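/- The recurrence coefficients aₙ in the three-term recurrence P_{n+1}(z) = (z - bₙ)Pₙ(z) - aₙ² P_{n-1}(z) (with aₙ > 0) for the monic orthogonal polynomials with respect to w_c satisfy, as n → ∞, aₙ = 1/2 − (log c/(2πn))·sin(θₙ) + O(1/n²). -/

import Mathlib

open Filter Set MeasureTheory Polynomial

section OperatorFamilies

open Asymptotics

variable {ι E : Type*} [NormedAddCommGroup E] [InnerProductSpace ℂ E]

lemma clm_apply_isBigO {l : Filter ι} {K : ι → E →L[ℂ] E} {a b : ι → ℝ} {x : ι → E} (hK : K =O[l] a) (hx : x =O[l] b) :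
    (fun i => K i (x i)) =O[l] (fun i => a i * b i) := by
  have h1 : (fun i => K i (x i)) =O[l] (fun i => ‖K i‖ * ‖x i‖) :=
    IsBigO.of_bound 1 (Eventually.of_forall fun i => by
      simpa using (K i).le_opNorm (x i))
  exact h1.trans (hK.norm_left.mul hx.norm_left)

lemma inner_isBigO {l : Filter ι} {a b : ι → ℝ} {x y : ι → E} (hx : x =O[l] a) (hy : y =O[l] b) :
    (fun i => inner ℂ (x i) (y i)) =O[l] (fun i => a i * b i) := by
  have h1 : (fun i => inner ℂ (x i) (y i)) =O[l] (fun i => ‖x i‖ * ‖y i‖) :=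
    IsBigO.of_bound 1 (Eventually.of_forall fun i => by
      simpa using norm_inner_le_norm (𝕜 := ℂ) (x i) (y i))
  exact h1.trans (hx.norm_left.mul hy.norm_left)

variable [CompleteSpace E]

/-- Bounded families of operators that are `O(δ)` on the vector `e`, together with their adjoints. -/
structure SmallFam (l : Filter ι) (δ : ι → ℝ) (e : E) (K : ι → E →L[ℂ] E) : Prop where
  bdd : K =O[l] (fun _ => (1 : ℝ))
  vec : (fun i => K i e) =O[l] δ
  star_vec : (fun i => star (K i) e) =O[l] δ

/-- Families of operators that are negligible with respect to `e`. -/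
structure NeglFam (l : Filter ι) (δ : ι → ℝ) (e : E) (J : ι → E →L[ℂ] E) : Prop where
  bdd : J =O[l] (fun i => δ i ^ 2)
  vec : (fun i => J i e) =O[l] (fun i => δ i ^ 3)
  star_vec : (fun i => star (J i) e) =O[l] (fun i => δ i ^ 3)
  diag : (fun i => inner ℂ e (J i e)) =O[l] (fun i => δ i ^ 4)

variable {l : Filter ι} {δ : ι → ℝ} {e : E} {K L J J' M S T : ι → E →L[ℂ] E}

lemma star_isBigO {a : ι → ℝ} (hK : K =O[l] a) : (fun i => star (K i)) =O[l] a := by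
  refine IsBigO.trans (IsBigO.of_bound 1 (Eventually.of_forall fun i => ?_)) hK
  simp [norm_star]

lemma inner_star_apply (A : E →L[ℂ] E) (x y : E) : inner ℂ (star A x) y = inner ℂ x (A y) := by
  rw [ContinuousLinearMap.star_eq_adjoint, ContinuousLinearMap.adjoint_inner_left]

namespace SmallFam

lemma star (h : SmallFam l δ e K) : SmallFam l δ e (fun i => star (K i)) :=
  ⟨star_isBigO h.bdd, h.star_vec, by simpa using h.vec⟩

lemma add (h : SmallFam l δ e K) (h' : SmallFam l δ e L) : SmallFam l δ e (fun i => K i + L i) :=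
  ⟨h.bdd.add h'.bdd, by simpa using h.vec.add h'.vec, by simpa using h.star_vec.add h'.star_vec⟩

lemma neg (h : SmallFam l δ e K) : SmallFam l δ e (fun i => - K i) :=
  ⟨h.bdd.neg_left, by simpa using h.vec.neg_left, by simpa using h.star_vec.neg_left⟩

lemma sub (h : SmallFam l δ e K) (h' : SmallFam l δ e L) : SmallFam l δ e (fun i => K i - L i) := by
  simpa [sub_eq_add_neg] using h.add h'.neg

lemma smul (c : ι → ℂ) (hc : c =O[l] (fun _ => (1:ℝ))) (h : SmallFam l δ e K) :
    SmallFam l δ e (fun i => c i • K i) := by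
  refine ⟨by simpa using hc.smul h.bdd, by simpa using hc.smul h.vec, ?_⟩
  have hc' : (fun i => (starRingEnd ℂ) (c i)) =O[l] (fun _ => (1:ℝ)) := by
    refine IsBigO.trans (IsBigO.of_bound 1 (Eventually.of_forall fun i => ?_)) hc
    simp
  have := hc'.smul h.star_vec
  simpa [star_smul] using this

lemma mul (h : SmallFam l δ e K) (h' : SmallFam l δ e L) : SmallFam l δ e (fun i => K i * L i) := by
  refine ⟨by simpa using h.bdd.mul h'.bdd, ?_, ?_⟩
  · simpa using clm_apply_isBigO h.bdd h'.vec
  · simpa using clm_apply_isBigO (star_isBigO h'.bdd) h.star_vec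

lemma congr' (h : SmallFam l δ e K) (hKL : K =ᶠ[l] L) : SmallFam l δ e L := by
  refine ⟨h.bdd.congr' hKL EventuallyEq.rfl, h.vec.congr' ?_ EventuallyEq.rfl,
    h.star_vec.congr' ?_ EventuallyEq.rfl⟩
  · filter_upwards [hKL] with i hi; rw [hi]
  · filter_upwards [hKL] with i hi; rw [hi]

lemma mono {κ : Type*} {l' : Filter κ} (h : SmallFam l δ e K) {f : κ → ι} (hf : Tendsto f l' l) :
    SmallFam l' (δ ∘ f) e (K ∘ f) :=
  ⟨h.bdd.comp_tendsto hf, h.vec.comp_tendsto hf, h.star_vec.comp_tendsto hf⟩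

end SmallFam

namespace NeglFam

lemma star (h : NeglFam l δ e K) : NeglFam l δ e (fun i => star (K i)) := by
  refine ⟨star_isBigO h.bdd, h.star_vec, by simpa using h.vec, ?_⟩
  refine IsBigO.trans (IsBigO.of_bound 1 (Eventually.of_forall fun i => ?_)) h.diag
  rw [← inner_conj_symm, inner_star_apply, RCLike.norm_conj, one_mul]

lemma add (h : NeglFam l δ e K) (h' : NeglFam l δ e L) : NeglFam l δ e (fun i => K i + L i) :=
  ⟨h.bdd.add h'.bdd, by simpa using h.vec.add h'.vec, by simpa using h.star_vec.add h'.star_vec,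
    by simpa [inner_add_right] using h.diag.add h'.diag⟩

lemma neg (h : NeglFam l δ e K) : NeglFam l δ e (fun i => - K i) :=
  ⟨h.bdd.neg_left, by simpa using h.vec.neg_left, by simpa using h.star_vec.neg_left,
    by simpa using h.diag.neg_left⟩

lemma sub (h : NeglFam l δ e K) (h' : NeglFam l δ e L) : NeglFam l δ e (fun i => K i - L i) := by
  simpa [sub_eq_add_neg] using h.add h'.neg

lemma smul (c : ι → ℂ) (hc : c =O[l] (fun _ => (1:ℝ))) (h : NeglFam l δ e K) :
    NeglFam l δ e (fun i => c i • K i) := by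
  refine ⟨by simpa using hc.smul h.bdd, by simpa using hc.smul h.vec, ?_, ?_⟩
  · have hc' : (fun i => (starRingEnd ℂ) (c i)) =O[l] (fun _ => (1:ℝ)) := by
      refine IsBigO.trans (IsBigO.of_bound 1 (Eventually.of_forall fun i => ?_)) hc
      simp
    have := hc'.smul h.star_vec
    simpa [star_smul] using this
  · simpa [inner_smul_right] using hc.mul h.diag

lemma mul_small (h : NeglFam l δ e J) (h' : SmallFam l δ e K) :
    NeglFam l δ e (fun i => J i * K i) := by
  refine ⟨by simpa using h.bdd.mul h'.bdd, ?_, ?_, ?_⟩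
  · refine (clm_apply_isBigO h.bdd h'.vec).congr (fun i => rfl) (fun i => by ring)
  · simpa using clm_apply_isBigO (star_isBigO h'.bdd) h.star_vec
  · refine (inner_isBigO h.star_vec h'.vec).congr (fun i => ?_) (fun i => by ring)
    rw [inner_star_apply]; rfl

lemma congr' (h : NeglFam l δ e K) (hKL : K =ᶠ[l] L) : NeglFam l δ e L := by
  refine ⟨h.bdd.congr' hKL EventuallyEq.rfl, h.vec.congr' ?_ EventuallyEq.rfl,
    h.star_vec.congr' ?_ EventuallyEq.rfl, h.diag.congr' ?_ EventuallyEq.rfl⟩ <;>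
  · filter_upwards [hKL] with i hi; rw [hi]

lemma small_mul (h' : SmallFam l δ e K) (h : NeglFam l δ e J) :
    NeglFam l δ e (fun i => K i * J i) := by
  have := (h.star.mul_small h'.star).star
  simpa using this

lemma mono {κ : Type*} {l' : Filter κ} (h : NeglFam l δ e K) {f : κ → ι} (hf : Tendsto f l' l) :
    NeglFam l' (δ ∘ f) e (K ∘ f) :=
  ⟨h.bdd.comp_tendsto hf, h.vec.comp_tendsto hf, h.star_vec.comp_tendsto hf,
    h.diag.comp_tendsto hf⟩

lemma small (h : NeglFam l δ e J) (hδ : Tendsto δ l (nhds 0)) : SmallFam l δ e J := by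
  have h1 : δ =O[l] (fun _ => (1:ℝ)) := hδ.isBigO_one ℝ
  have h2 : (fun i => δ i ^ 2) =O[l] (fun _ => (1:ℝ)) := by simpa using h1.pow 2
  have h3 : (fun i => δ i ^ 3) =O[l] δ := by
    simpa [pow_succ] using h2.mul (isBigO_refl δ l)
  exact ⟨h.bdd.trans h2, h.vec.trans h3, h.star_vec.trans h3⟩

/-- Multiplication by a family of the form `1 + small` preserves negligibility. -/
lemma reg_mul (h' : SmallFam l δ e (fun i => K i - 1)) (h : NeglFam l δ e J) :
    NeglFam l δ e (fun i => K i * J i) := by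
  simpa [sub_mul] using (small_mul h' h).add h

lemma mul_reg (h : NeglFam l δ e J) (h' : SmallFam l δ e (fun i => K i - 1)) :
    NeglFam l δ e (fun i => J i * K i) := by
  simpa [mul_sub] using (mul_small h h').add h

end NeglFam

/-- The inverse of a family `1 + small` is again of this form, if it is bounded. -/
lemma SmallFam.inverse (h : SmallFam l δ e K) {G : ι → E →L[ℂ] E}
    (hG : ∀ᶠ i in l, G i * (1 + K i) = 1 ∧ (1 + K i) * G i = 1) (hb : G =O[l] (fun _ => (1:ℝ))) :
    SmallFam l δ e (fun i => G i - 1) := by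
  have e1 : (fun i => G i - 1) =ᶠ[l] fun i => - (G i * K i) := by
    filter_upwards [hG] with i hi
    have := hi.1
    rw [mul_add, mul_one] at this
    rw [← this]; abel
  have e2 : (fun i => Star.star (G i - 1)) =ᶠ[l]
      fun i => - (Star.star (G i) * Star.star (K i)) := by
    filter_upwards [hG] with i hi
    have := hi.2
    rw [add_mul, one_mul] at this
    rw [← this]; simp
  refine ⟨?_, ?_, ?_⟩
  · exact ((by simpa using (hb.mul h.bdd).neg_left :
      (fun i => - (G i * K i)) =O[l] (fun _ => (1:ℝ)))).congr' e1.symm EventuallyEq.rfl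
  · have := (clm_apply_isBigO hb h.vec).neg_left
    refine this.congr' ?_ (by simp)
    filter_upwards [e1] with i hi
    rw [hi]; rfl
  · have := (clm_apply_isBigO (star_isBigO hb) h.star_vec).neg_left
    refine this.congr' ?_ (by simp)
    filter_upwards [e2] with i hi
    rw [hi]; rfl

/-- If `H ≈ M + M* + S` then `G (M - M M*) (1 + H) ≈ M`. -/
lemma NeglFam.mul_one_add {Ms H G : ι → E →L[ℂ] E}
    (hM : SmallFam l δ e M) (hMs : SmallFam l δ e Ms)
    (hMM : NeglFam l δ e (fun i => M i * M i)) (hMsMs : NeglFam l δ e (fun i => Ms i * Ms i))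
    (hMS : NeglFam l δ e (fun i => M i * S i)) (hMsS : NeglFam l δ e (fun i => Ms i * S i))
    (hG : ∀ᶠ i in l, G i * (1 - M i * Ms i) = 1 ∧ (1 - M i * Ms i) * G i = 1)
    (hGb : G =O[l] (fun _ => (1:ℝ)))
    (hH : NeglFam l δ e (fun i => H i - (M i + Ms i + S i)))
    : NeglFam l δ e (fun i => G i * (M i - M i * Ms i) * (1 + H i) - M i) := by
  have hGr : SmallFam l δ e (fun i => G i - 1) :=
    (hM.mul hMs).neg.inverse (by simpa [sub_eq_add_neg] using hG) hGb
  have h1 : NeglFam l δ e (fun i => G i * (M i * M i + M i * S i +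
      M i * (H i - (M i + Ms i + S i)) - M i * (Ms i * Ms i) - M i * (Ms i * S i)
      - M i * (Ms i * (H i - (M i + Ms i + S i))))) :=
    (((((hMM.add hMS).add (hH.small_mul hM)).sub (hMsMs.small_mul hM)).sub
      (hMsS.small_mul hM)).sub ((hH.small_mul hMs).small_mul hM)).reg_mul hGr
  refine h1.congr' ?_
  filter_upwards [hG] with i hGi
  have e1 : G i * (M i * M i + M i * S i +
      M i * (H i - (M i + Ms i + S i)) - M i * (Ms i * Ms i) - M i * (Ms i * S i)
      - M i * (Ms i * (H i - (M i + Ms i + S i)))) =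
      G i * (M i - M i * Ms i) * (1 + H i) - G i * (1 - M i * Ms i) * M i := by
    noncomm_ring
  rw [e1, hGi.1, one_mul]

lemma NeglFam.of_mul_one_add {B H A : ι → E →L[ℂ] E}
    (h : NeglFam l δ e (fun i => B i * (1 + H i) - M i))
    (hA : ∀ᶠ i in l, (1 + H i) * A i = 1) (hAr : SmallFam l δ e (fun i => A i - 1)) :
    NeglFam l δ e (fun i => M i * A i - B i) := by
  refine (h.mul_reg hAr).neg.congr' ?_
  filter_upwards [hA] with i hAi
  rw [sub_mul, mul_assoc _ (1 + H i), hAi]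
  noncomm_ring

/-- If `H ≈ M + M* + S` then `S' (1 + S)⁻¹ (1 + H) ≈ S'`. -/
lemma NeglFam.mul_one_add_of_orthogonal {Ms S' R H : ι → E →L[ℂ] E}
    (hS : SmallFam l δ e S) (hS' : SmallFam l δ e S') 
    (hS'M : NeglFam l δ e (fun i => S' i * M i)) (hS'Ms : NeglFam l δ e (fun i => S' i * Ms i))
    (hSM : NeglFam l δ e (fun i => S i * M i)) (hSMs : NeglFam l δ e (fun i => S i * Ms i))
    (hR : ∀ᶠ i in l, R i * (1 + S i) = 1 ∧ (1 + S i) * R i = 1)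
    (hRb : R =O[l] (fun _ => (1:ℝ)))
    (hH : NeglFam l δ e (fun i => H i - (M i + Ms i + S i)))
    : NeglFam l δ e (fun i => S' i * R i * (1 + H i) - S' i) := by
  have hRr : SmallFam l δ e (fun i => R i - 1) := hS.inverse hR hRb
  have h1 : NeglFam l δ e (fun i => S' i * M i + S' i * Ms i
      - S' i * (R i * (S i * M i)) - S' i * (R i * (S i * Ms i)) +
      S' i * (R i * (H i - (M i + Ms i + S i)))) :=
    (((hS'M.add hS'Ms).sub ((hSM.reg_mul hRr).small_mul hS')).sub
      ((hSMs.reg_mul hRr).small_mul hS')).add ((hH.reg_mul hRr).small_mul hS')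
  refine h1.congr' ?_
  filter_upwards [hR] with i hRi
  have e0 : R i * S i = 1 - R i := by
    rw [eq_sub_iff_add_eq, ← hRi.1, mul_add, mul_one, add_comm]
  show S' i * M i + S' i * Ms i
    - S' i * (R i * (S i * M i)) - S' i * (R i * (S i * Ms i)) +
    S' i * (R i * (H i - (M i + Ms i + S i))) = S' i * R i * (1 + H i) - S' i
  have : S' i * R i * (1 + H i) - S' i = S' i * (R i * H i) + S' i * R i - S' i := by noncomm_ring
  rw [this]
  have e2 : R i * (S i * M i) = M i - R i * M i := by rw [← mul_assoc, e0]; noncomm_ring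
  have e3 : R i * (S i * Ms i) = Ms i - R i * Ms i := by rw [← mul_assoc, e0]; noncomm_ring
  have e4 : R i * (H i - (M i + Ms i + S i)) =
      R i * H i - R i * M i - R i * Ms i - (1 - R i) := by rw [← e0]; noncomm_ring
  rw [e2, e3, e4]; noncomm_ring

/-- A self-adjoint family `1 + H` with `H ≈ M + M* + S` is eventually invertible. -/
lemma exists_resolvent {H G G' R : ι → E →L[ℂ] E} (hδ : Tendsto δ l (nhds 0))
    (hM : SmallFam l δ e M) (hS : SmallFam l δ e S) (hSs : ∀ i, star (S i) = S i)
    (hMM : NeglFam l δ e (fun i => M i * M i))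
    (hSM : NeglFam l δ e (fun i => S i * M i)) (hMS : NeglFam l δ e (fun i => M i * S i))
    (hG : ∀ᶠ i in l, G i * (1 - M i * star (M i)) = 1 ∧ (1 - M i * star (M i)) * G i = 1)
    (hGb : G =O[l] (fun _ => (1:ℝ)))
    (hG' : ∀ᶠ i in l, G' i * (1 - star (M i) * M i) = 1 ∧ (1 - star (M i) * M i) * G' i = 1)
    (hGb' : G' =O[l] (fun _ => (1:ℝ)))
    (hR : ∀ᶠ i in l, R i * (1 + S i) = 1 ∧ (1 + S i) * R i = 1)
    (hRb : R =O[l] (fun _ => (1:ℝ)))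
    (hHs : ∀ i, star (H i) = H i)
    (hH : NeglFam l δ e (fun i => H i - (M i + star (M i) + S i))) :
    ∃ A : ι → E →L[ℂ] E, (∀ᶠ i in l, A i * (1 + H i) = 1 ∧ (1 + H i) * A i = 1) ∧
      SmallFam l δ e (fun i => A i - 1) := by
  have hMs := hM.star
  have hMsMs : NeglFam l δ e (fun i => star (M i) * star (M i)) := by simpa using hMM.star
  have hMsS : NeglFam l δ e (fun i => star (M i) * S i) := by simpa [hSs] using hSM.star
  have hSMs : NeglFam l δ e (fun i => S i * star (M i)) := by simpa [hSs] using hMS.star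
  have hH' : NeglFam l δ e (fun i => H i - (star (M i) + M i + S i)) := by
    simpa [add_comm] using hH
  have n1 := NeglFam.mul_one_add hM hMs hMM hMsMs hMS hMsS hG hGb hH
  have n2 := NeglFam.mul_one_add hMs hM hMsMs hMM hMsS hMS hG' hGb' hH'
  have n3 := NeglFam.mul_one_add_of_orthogonal hS hS hSM hSMs hSM hSMs hR hRb hH
  set P : ι → E →L[ℂ] E := fun i => 1 - G i * (M i - M i * star (M i)) -
    G' i * (star (M i) - star (M i) * M i) - S i * R i with hP
  have hPb : P =O[l] (fun _ => (1:ℝ)) := by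
    have c1 : (fun _ : ι => (1 : E →L[ℂ] E)) =O[l] (fun _ => (1:ℝ)) :=
      isBigO_const_const _ one_ne_zero _
    have c2 := (hGb.mul (hM.sub (hM.mul hMs)).bdd)
    have c3 := (hGb'.mul (hMs.sub (hMs.mul hM)).bdd)
    have c4 := hS.bdd.mul hRb
    simp only [mul_one] at c2 c3 c4
    exact ((c1.sub c2).sub c3).sub c4
  have nJ : NeglFam l δ e (fun i => 1 - P i * (1 + H i)) := by
    refine ((n1.add n2).add (n3.sub hH)).congr' (Eventually.of_forall fun i => ?_)
    simp only [hP]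
    noncomm_ring
  have hJ0 : Tendsto (fun i => 1 - P i * (1 + H i)) l (nhds 0) :=
    nJ.bdd.trans_tendsto (by simpa using hδ.pow 2)
  have hU : ∀ᶠ i in l, IsUnit (P i * (1 + H i)) := by
    have : ∀ᶠ i in l, ‖1 - P i * (1 + H i)‖ < 1 := by
      have := hJ0.norm
      rw [norm_zero] at this
      exact this.eventually (gt_mem_nhds one_pos)
    filter_upwards [this] with i hi
    simpa using isUnit_one_sub_of_norm_lt_one hi
  set A : ι → E →L[ℂ] E := fun i => Ring.inverse (P i * (1 + H i)) * P i with hA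
  have hA1 : ∀ᶠ i in l, A i * (1 + H i) = 1 ∧ (1 + H i) * A i = 1 := by
    filter_upwards [hU] with i hi
    have a1 : A i * (1 + H i) = 1 := by
      simp only [hA]
      rw [mul_assoc, Ring.inverse_mul_cancel _ hi]
    have a2 : (1 + H i) * star (A i) = 1 := by
      have := congrArg star a1
      simpa [hHs] using this
    refine ⟨a1, ?_⟩
    have : A i = star (A i) := by
      calc A i = A i * ((1 + H i) * star (A i)) := by rw [a2, mul_one]
        _ = star (A i) := by rw [← mul_assoc, a1, one_mul]
    rw [← this] at a2
    exact a2
  have hAb : A =O[l] (fun _ => (1:ℝ)) := by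
    have := ((NormedRing.inverse_one_sub_norm (R := E →L[ℂ] E)).comp_tendsto hJ0).mul hPb
    refine this.congr (fun i => ?_) (fun i => by simp)
    simp [hA]
  have hHsm : SmallFam l δ e H := by
    have := (hH.small hδ).add ((hM.add hMs).add hS)
    simpa using this
  exact ⟨A, hA1, hHsm.inverse hA1 hAb⟩

theorem inner_resolvent_sub {S' H H2 Hd Hd2 G G' R A A2 : ι → E →L[ℂ] E} (x : ℂ)
    (hM : SmallFam l δ e M) (hS : SmallFam l δ e S) (hSs : ∀ i, star (S i) = S i)
    (hS' : SmallFam l δ e S')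
    (hMM : NeglFam l δ e (fun i => M i * M i))
    (hSM : NeglFam l δ e (fun i => S i * M i)) (hMS : NeglFam l δ e (fun i => M i * S i))
    (hSM' : NeglFam l δ e (fun i => S' i * M i))
    (hSMs' : NeglFam l δ e (fun i => S' i * star (M i)))
    (hG : ∀ᶠ i in l, G i * (1 - M i * star (M i)) = 1 ∧ (1 - M i * star (M i)) * G i = 1)
    (hGb : G =O[l] (fun _ => (1:ℝ)))
    (hG' : ∀ᶠ i in l, G' i * (1 - star (M i) * M i) = 1 ∧ (1 - star (M i) * M i) * G' i = 1)
    (hGb' : G' =O[l] (fun _ => (1:ℝ)))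
    (hR : ∀ᶠ i in l, R i * (1 + S i) = 1 ∧ (1 + S i) * R i = 1)
    (hRb : R =O[l] (fun _ => (1:ℝ)))
    (hH : NeglFam l δ e (fun i => H i - (M i + star (M i) + S i)))
    (hH2 : NeglFam l δ e (fun i => H2 i - (-M i + -star (M i) + S i)))
    (hHd : NeglFam l δ e (fun i => Hd i - (x • M i + star (x • M i) + S' i)))
    (hHd2 : NeglFam l δ e (fun i => Hd2 i - (-(x • M i) + -star (x • M i) + S' i)))
    (hA : ∀ᶠ i in l, (1 + H i) * A i = 1) (hAr : SmallFam l δ e (fun i => A i - 1))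
    (hA2 : ∀ᶠ i in l, (1 + H2 i) * A2 i = 1) (hAr2 : SmallFam l δ e (fun i => A2 i - 1)) :
    (fun i => inner ℂ e ((Hd i * A i) e) - inner ℂ e ((Hd2 i * A2 i) e)
      - 4 * ((x * inner ℂ e ((G i * M i) e)).re : ℂ)) =O[l] (fun i => δ i ^ 4) := by
  have hMs := hM.star
  have hMsMs : NeglFam l δ e (fun i => star (M i) * star (M i)) := by simpa using hMM.star
  have hMsS : NeglFam l δ e (fun i => star (M i) * S i) := by simpa [hSs] using hSM.star
  have hSMs : NeglFam l δ e (fun i => S i * star (M i)) := by simpa [hSs] using hMS.star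
  have hH' : NeglFam l δ e (fun i => H i - (star (M i) + M i + S i)) := by
    simpa [add_comm] using hH
  have hH2' : NeglFam l δ e (fun i => H2 i - (-star (M i) + -M i + S i)) :=
    hH2.congr' (Eventually.of_forall fun i => by simp only [add_comm (-M i)])
  have n1 := (NeglFam.mul_one_add hM hMs hMM hMsMs hMS hMsS hG hGb hH).of_mul_one_add hA hAr
  have n2 := (NeglFam.mul_one_add hMs hM hMsMs hMM hMsS hMS hG' hGb' hH').of_mul_one_add hA hAr
  have n3 := (NeglFam.mul_one_add_of_orthogonal hS hS' hSM' hSMs' hSM hSMs hR hRb hH).of_mul_one_add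
    hA hAr
  have m1 := (NeglFam.mul_one_add (G := G) hM.neg hMs.neg (by simpa using hMM) (by simpa using hMsMs)
    (by simpa using hMS.neg) (by simpa using hMsS.neg) (by simpa using hG) hGb hH2).of_mul_one_add
    hA2 hAr2
  have m2 := (NeglFam.mul_one_add (G := G') hMs.neg hM.neg (by simpa using hMsMs)
    (by simpa using hMM) (by simpa using hMsS.neg) (by simpa using hMS.neg) (by simpa using hG')
    hGb' hH2').of_mul_one_add hA2 hAr2
  have m3 := (NeglFam.mul_one_add_of_orthogonal (M := fun i => - M i) (Ms := fun i => - star (M i))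
    hS hS' (by simpa using hSM'.neg) (by simpa using hSMs'.neg) (by simpa using hSM.neg)
    (by simpa using hSMs.neg) hR hRb hH2).of_mul_one_add hA2 hAr2
  have cx : (fun _ : ι => x) =O[l] (fun _ => (1:ℝ)) := isBigO_const_const _ one_ne_zero _
  have cx' : (fun _ : ι => star x) =O[l] (fun _ => (1:ℝ)) := isBigO_const_const _ one_ne_zero _
  have tot := ((((n1.sub m1).smul _ cx).add ((n2.sub m2).smul _ cx')).add (n3.sub m3)).add
    ((hHd.mul_reg hAr).sub (hHd2.mul_reg hAr2))
  refine tot.diag.congr' ?_ EventuallyEq.rfl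
  filter_upwards [hG, hG'] with i hGi hGi'
  have k1 : x • (M i * A i - G i * (M i - M i * star (M i)) -
        (-M i * A2 i - G i * (-M i - -M i * -star (M i)))) +
      star x • (star (M i) * A i - G' i * (star (M i) - star (M i) * M i) -
        (-star (M i) * A2 i - G' i * (-star (M i) - -star (M i) * -M i))) +
      (S' i * A i - S' i * R i - (S' i * A2 i - S' i * R i)) +
      ((Hd i - (x • M i + star (x • M i) + S' i)) * A i -
        (Hd2 i - (-(x • M i) + -star (x • M i) + S' i)) * A2 i) =
      Hd i * A i - Hd2 i * A2 i - (2:ℂ) • (x • (G i * M i)) -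
        (2:ℂ) • (star x • (G' i * star (M i))) := by
    simp only [star_smul, two_smul, sub_mul, add_mul, mul_sub, smul_sub, neg_mul,
      mul_neg, neg_neg, smul_neg, smul_mul_assoc]
    abel
  have k2 : G' i * star (M i) = star (G i * M i) := by
    have hs : star (G i) * (1 - M i * star (M i)) = 1 := by
      have := congrArg star hGi.2
      simpa using this
    have hs2 : star (G i) = G i := by
      calc star (G i) = star (G i) * ((1 - M i * star (M i)) * G i) := by rw [hGi.2, mul_one]
        _ = G i := by rw [← mul_assoc, hs, one_mul]
    rw [star_mul, hs2]
    calc G' i * star (M i) = G' i * (star (M i) * ((1 - M i * star (M i)) * G i)) := by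
          rw [hGi.2, mul_one]
      _ = (G' i * (1 - star (M i) * M i)) * (star (M i) * G i) := by noncomm_ring
      _ = _ := by rw [hGi'.1, one_mul]
  rw [k1, k2]
  simp only [sub_apply, smul_apply, inner_sub_right,
    inner_smul_right]
  have k3 : inner ℂ e ((star (G i * M i)) e) = (starRingEnd ℂ) (inner ℂ e ((G i * M i) e)) := by
    rw [← inner_star_apply, star_star, inner_conj_symm]
  rw [k3]
  have k4 := Complex.add_conj (x * inner ℂ e ((G i * M i) e))
  rw [map_mul] at k4
  have : (star x) = (starRingEnd ℂ) x := rfl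
  rw [this]
  push_cast at k4 ⊢
  linear_combination (-2) * k4

end OperatorFamilies

section SequenceSpace

open Asymptotics

/-- The Hilbert space `ℓ²(ℕ)`. -/
abbrev Ell2 : Type := lp (fun _ : ℕ => ℂ) 2

/-- The standard unit vectors of `ℓ²(ℕ)`. -/
noncomputable def unitVec (k : ℕ) : Ell2 := lp.single 2 k (1 : ℂ)

lemma unitVec_apply (k j : ℕ) : unitVec k j = if j = k then 1 else 0 := by
  unfold unitVec
  rw [lp.single_apply]
  split_ifs with h
  · subst h; simp
  · simp [h]

lemma norm_unitVec (k : ℕ) : ‖unitVec k‖ = 1 := by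
  unfold unitVec
  rw [lp.norm_single (by norm_num)]; simp

lemma inner_unitVec (k : ℕ) (x : Ell2) : inner ℂ (unitVec k) x = x k := by
  unfold unitVec
  rw [lp.inner_single_left]; simp

lemma ell2_hasSum_norm_sq (x : Ell2) : HasSum (fun j => ‖x j‖ ^ 2) (‖x‖ ^ 2) := by
  have := lp.hasSum_norm (p := 2) (by norm_num) x
  simpa using this

lemma ell2_hasSum_inner (x y : Ell2) :
    HasSum (fun j => inner ℂ (x j) (y j)) (inner ℂ x y) := lp.hasSum_inner x y

lemma ell2_hasSum_unitVec (x : Ell2) : HasSum (fun j => x j • unitVec j) x := by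
  have := lp.hasSum_single (p := 2) (by norm_num) x
  convert this using 2 with j
  unfold unitVec
  rw [← lp.single_smul]; simp

/-- Matrix entries of an operator on `ℓ²(ℕ)`. -/
noncomputable def matEntry (J : Ell2 →L[ℂ] Ell2) (j k : ℕ) : ℂ := J (unitVec k) j

lemma ell2_norm_sq_le {x : Ell2} {p : ℕ → ℝ} {c s : ℝ} 
    (h : ∀ j, ‖x j‖ ≤ c * p j) (hs : HasSum (fun j => p j ^ 2) s) : ‖x‖ ^ 2 ≤ c ^ 2 * s := by
  refine hasSum_le (fun j => ?_) (ell2_hasSum_norm_sq x) (hs.mul_left (c ^ 2))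
  rw [← mul_pow]
  exact pow_le_pow_left₀ (norm_nonneg _) (h j) 2

lemma matEntry_star (J : Ell2 →L[ℂ] Ell2) (j k : ℕ) :
    matEntry (star J) j k = (starRingEnd ℂ) (matEntry J k j) := by
  unfold matEntry
  rw [← inner_unitVec, ← inner_unitVec, ← inner_conj_symm, inner_star_apply]

lemma matEntry_mul (J K : Ell2 →L[ℂ] Ell2) (j k : ℕ) :
    HasSum (fun m => matEntry J j m * matEntry K m k) (matEntry (J * K) j k) := by
  have h1 := ell2_hasSum_inner (star J (unitVec j)) (K (unitVec k))
  rw [inner_star_apply, inner_unitVec] at h1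
  change HasSum _ (J (K (unitVec k)) j)
  convert h1 using 2 with m
  have : inner ℂ ((star J) (unitVec j) m) (K (unitVec k) m) =
    K (unitVec k) m * (starRingEnd ℂ) ((star J) (unitVec j) m) := rfl
  rw [this, mul_comm]
  congr 1
  exact ((matEntry_star (star J) j m).symm.trans (by rw [star_star])).symm

lemma clm_ext_matEntry {J K : Ell2 →L[ℂ] Ell2} (h : ∀ j k, matEntry J j k = matEntry K j k) :
    J = K := by
  ext x : 1
  have h1 := (ell2_hasSum_unitVec x).mapL J
  have h2 := (ell2_hasSum_unitVec x).mapL K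
  refine h1.unique ?_
  convert h2 using 2 with j
  rw [map_smul, map_smul]
  congr 1
  ext m
  exact h m j

lemma hasSum_inv_sq {N : ℕ} (hN : 1 ≤ N) :
    ∃ s : ℝ, 0 ≤ s ∧ s ≤ 2 / N ∧ HasSum (fun j : ℕ => (1 / ((N:ℝ) + j)) ^ 2) s := by
  have hN' : (1:ℝ) ≤ N := by exact_mod_cast hN
  have hb : ∀ n : ℕ, ∑ j ∈ Finset.range n, (1 / ((N:ℝ) + j)) ^ 2 ≤ 2 / (N:ℝ) - 2 / ((N:ℝ) + n) := by
    intro n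
    induction n with
    | zero => simp
    | succ n ih =>
      rw [Finset.sum_range_succ]
      have h0 : (0:ℝ) ≤ n := Nat.cast_nonneg n
      have : (1 / ((N:ℝ) + n)) ^ 2 ≤ 2 / (N + n) - 2 / (N + (n + 1)) := by
        rw [div_sub_div _ _ (by positivity) (by positivity), div_pow, div_le_div_iff₀ (by positivity)
          (by positivity)]
        nlinarith [mul_nonneg (by linarith : (0:ℝ) ≤ N + n) (by linarith : (0:ℝ) ≤ N + n - 1)]
      push_cast
      linarith
  have hb' : ∀ n : ℕ, ∑ j ∈ Finset.range n, (1 / ((N:ℝ) + j)) ^ 2 ≤ 2 / (N:ℝ) := by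
    intro n
    have : (0:ℝ) ≤ 2 / (N + n) := by positivity
    linarith [hb n]
  have hs : Summable (fun j : ℕ => (1 / ((N:ℝ) + j)) ^ 2) :=
    summable_of_sum_range_le (fun _ => by positivity) hb'
  exact ⟨_, tsum_nonneg (fun _ => by positivity), hs.tsum_le_of_sum_range_le hb', hs.hasSum⟩

lemma ell2_norm_apply_le (J : Ell2 →L[ℂ] Ell2) (x : Ell2) (j : ℕ) :
    ‖J x j‖ ≤ ‖star J (unitVec j)‖ * ‖x‖ := by
  rw [← inner_unitVec, ← inner_star_apply]
  exact norm_inner_le_norm _ _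

/-- The scale `N ^ (-1/2)`. -/
noncomputable def invSqrt (N : ℕ) : ℝ := (Real.sqrt N)⁻¹

lemma invSqrt_sq (N : ℕ) : invSqrt N ^ 2 = 1 / N := by
  unfold invSqrt
  rw [inv_pow, Real.sq_sqrt (Nat.cast_nonneg N), one_div]

lemma invSqrt_nonneg (N : ℕ) : 0 ≤ invSqrt N := by unfold invSqrt; positivity

lemma tendsto_invSqrt : Tendsto invSqrt atTop (nhds 0) := by
  unfold invSqrt
  exact tendsto_inv_atTop_zero.comp (Real.tendsto_sqrt_atTop.comp tendsto_natCast_atTop_atTop)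

/-- Column bound from entry bounds. -/
lemma norm_column_le {J : Ell2 →L[ℂ] Ell2} {N k : ℕ} (hN : 1 ≤ N) {C : ℝ} (hC : 0 ≤ C)
    (h : ∀ j, ‖matEntry J j k‖ ≤ C * (1 / ((N:ℝ) + j))) :
    ‖J (unitVec k)‖ ≤ C * (2 * invSqrt N) := by
  obtain ⟨s, hs0, hs, hsum⟩ := hasSum_inv_sq hN
  have h1 : ‖J (unitVec k)‖ ^ 2 ≤ C ^ 2 * s := ell2_norm_sq_le h hsum
  refine le_of_sq_le_sq ?_ (by have := invSqrt_nonneg N; positivity)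
  calc _ ≤ C ^ 2 * s := h1
    _ ≤ C ^ 2 * (2 / N) := by gcongr
    _ ≤ _ := by
      rw [mul_pow, mul_pow, invSqrt_sq]
      have : (0:ℝ) ≤ C ^ 2 * (1 / N) := by positivity
      have e : C ^ 2 * (2 / N) = 2 * (C ^ 2 * (1 / (N:ℝ))) := by ring
      rw [e]; nlinarith

lemma SmallFam.of_matEntry {K : ℕ → Ell2 →L[ℂ] Ell2} (hK : K =O[atTop] (fun _ => (1:ℝ))) {C : ℝ}
    (hC : 0 ≤ C) (h : ∀ N : ℕ, 1 ≤ N → ∀ j, ‖matEntry (K N) j 0‖ ≤ C * (1 / ((N:ℝ) + j)))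
    (h' : ∀ N : ℕ, 1 ≤ N → ∀ j, ‖matEntry (K N) 0 j‖ ≤ C * (1 / ((N:ℝ) + j))) :
    SmallFam atTop invSqrt (unitVec 0) K := by
  refine ⟨hK, IsBigO.of_bound (C * 2) ?_, IsBigO.of_bound (C * 2) ?_⟩
  · filter_upwards [eventually_ge_atTop 1] with N hN
    rw [Real.norm_of_nonneg (invSqrt_nonneg N), mul_assoc]
    exact norm_column_le hN hC (h N hN)
  · filter_upwards [eventually_ge_atTop 1] with N hN
    rw [Real.norm_of_nonneg (invSqrt_nonneg N), mul_assoc]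
    refine norm_column_le hN hC (fun j => ?_)
    rw [matEntry_star, RCLike.norm_conj]
    exact h' N hN j

lemma NeglFam.of_matEntry {J : ℕ → Ell2 →L[ℂ] Ell2} {C : ℝ} (hC : 0 ≤ C)
    (h : ∀ N : ℕ, 1 ≤ N → ∀ j k,
      ‖matEntry (J N) j k‖ ≤ C * (1 / ((N:ℝ) + j)) * (1 / ((N:ℝ) + k))) :
    NeglFam atTop invSqrt (unitVec 0) J := by
  have key : ∀ J : Ell2 →L[ℂ] Ell2, ∀ N : ℕ, 1 ≤ N → (∀ j k,
      ‖matEntry J j k‖ ≤ C * (1 / ((N:ℝ) + j)) * (1 / ((N:ℝ) + k))) →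
      ∀ k, ‖J (unitVec k)‖ ≤ (C * (2 * invSqrt N)) * (1 / ((N:ℝ) + k)) := by
    intro J N hN h k
    have := norm_column_le (J := J) (k := k) hN (C := C * (1 / ((N:ℝ) + k))) (by positivity)
      (fun j => (h j k).trans_eq (by ring))
    exact this.trans_eq (by ring)
  have hstar : ∀ N : ℕ, 1 ≤ N → ∀ j k,
      ‖matEntry (Star.star (J N)) j k‖ ≤ C * (1 / ((N:ℝ) + j)) * (1 / ((N:ℝ) + k)) := by
    intro N hN j k
    rw [matEntry_star, RCLike.norm_conj]
    exact (h N hN k j).trans_eq (by ring)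
  have cube : ∀ N : ℕ, ‖invSqrt N ^ 3‖ = invSqrt N * (1 / N) := fun N => by
    rw [Real.norm_of_nonneg (pow_nonneg (invSqrt_nonneg N) 3), ← invSqrt_sq]; ring
  refine ⟨IsBigO.of_bound (4 * C) ?_, IsBigO.of_bound (2 * C) ?_, IsBigO.of_bound (2 * C) ?_,
    IsBigO.of_bound C ?_⟩ <;> filter_upwards [eventually_ge_atTop 1] with N hN
  · have h0 := invSqrt_nonneg N
    rw [Real.norm_of_nonneg (by positivity)]
    refine ContinuousLinearMap.opNorm_le_bound _ (by positivity) (fun x => ?_)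
    obtain ⟨s, hs0, hs, hsum⟩ := hasSum_inv_sq hN
    have h1 : ‖J N x‖ ^ 2 ≤ ((C * (2 * invSqrt N)) * ‖x‖) ^ 2 * s := by
      refine ell2_norm_sq_le (fun j => ?_) hsum
      refine (ell2_norm_apply_le _ _ _).trans ?_
      calc _ ≤ (C * (2 * invSqrt N)) * (1 / ((N:ℝ) + j)) * ‖x‖ := by
            gcongr; exact key _ N hN (hstar N hN) j
        _ = _ := by ring
    refine le_of_sq_le_sq ?_ (by positivity)
    calc _ ≤ _ := h1
      _ ≤ ((C * (2 * invSqrt N)) * ‖x‖) ^ 2 * (2 / N) := by gcongr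
      _ = 8 * (C * invSqrt N ^ 2 * ‖x‖) ^ 2 := by
        have : (2:ℝ) / N = 2 * invSqrt N ^ 2 := by rw [invSqrt_sq]; ring
        rw [this]; ring
      _ ≤ _ := by nlinarith [sq_nonneg (C * invSqrt N ^ 2 * ‖x‖)]
  · rw [cube]
    refine (key _ N hN (h N hN) 0).trans_eq ?_
    simp; ring
  · rw [cube]
    refine (key _ N hN (hstar N hN) 0).trans_eq ?_
    simp; ring
  · have : invSqrt N ^ 4 = (1 / N) * (1 / N) := by rw [← invSqrt_sq]; ring
    rw [this, Real.norm_of_nonneg (by positivity), inner_unitVec]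
    refine (h N hN 0 0).trans_eq ?_
    simp; ring

lemma norm_isBigO_of_hankel {N j k : ℕ} (hN : 1 ≤ N) {C : ℝ} (hC : 0 ≤ C) :
    C / ((N:ℝ) + j + k) ^ 2 ≤ C * (1 / ((N:ℝ) + j)) * (1 / ((N:ℝ) + k)) := by
  have hN' : (1:ℝ) ≤ N := by exact_mod_cast hN
  have hj : (0:ℝ) ≤ j := Nat.cast_nonneg j
  have hk : (0:ℝ) ≤ k := Nat.cast_nonneg k
  rw [mul_assoc, one_div_mul_one_div, mul_one_div]
  gcongr
  nlinarith [mul_nonneg hj hk]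

/-- A family of Hankel operators `(τ (N + j + k))` on `ℓ²(ℕ)`. -/
def IsHankelFam (τ : ℕ → ℂ) (K : ℕ → Ell2 →L[ℂ] Ell2) : Prop :=
  ∀ N j k, matEntry (K N) j k = τ (N + j + k)

lemma IsHankelFam.small {τ : ℕ → ℂ} {K : ℕ → Ell2 →L[ℂ] Ell2} (hK : IsHankelFam τ K)
    (hb : K =O[atTop] (fun _ => (1:ℝ))) {C : ℝ} (hC : 0 ≤ C)
    (hτ : ∀ m : ℕ, 1 ≤ m → ‖τ m‖ ≤ C / m) : SmallFam atTop invSqrt (unitVec 0) K := by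
  refine .of_matEntry hb hC (fun N hN j => ?_) (fun N hN j => ?_)
  · rw [hK]
    exact (hτ _ (by omega)).trans_eq (by push_cast; ring)
  · rw [hK]
    exact (hτ _ (by omega)).trans_eq (by push_cast; ring)

lemma IsHankelFam.negl {τ : ℕ → ℂ} {K : ℕ → Ell2 →L[ℂ] Ell2} (hK : IsHankelFam τ K)
    {C : ℝ} (hC : 0 ≤ C) (hτ : ∀ m : ℕ, 1 ≤ m → ‖τ m‖ ≤ C / (m:ℝ) ^ 2) :
    NeglFam atTop invSqrt (unitVec 0) K := by
  refine .of_matEntry hC (fun N hN j k => ?_)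
  rw [hK]
  refine (hτ _ (by omega)).trans (le_trans (le_of_eq ?_) (norm_isBigO_of_hankel hN hC))
  push_cast; ring

lemma IsHankelFam.shift {τ : ℕ → ℂ} {K : ℕ → Ell2 →L[ℂ] Ell2} (hK : IsHankelFam τ K) (d : ℕ) :
    IsHankelFam (fun m => τ (m + d)) (fun N => K (N + d)) := by
  intro N j k
  rw [hK]; congr 1; omega

lemma IsHankelFam.smul {τ : ℕ → ℂ} {K : ℕ → Ell2 →L[ℂ] Ell2} (hK : IsHankelFam τ K) (c : ℂ) :
    IsHankelFam (fun m => c * τ m) (fun N => c • K N) := by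
  intro N j k
  beta_reduce
  rw [← hK]; rfl

lemma IsHankelFam.add {τ σ : ℕ → ℂ} {K L : ℕ → Ell2 →L[ℂ] Ell2} (hK : IsHankelFam τ K)
    (hL : IsHankelFam σ L) : IsHankelFam (fun m => τ m + σ m) (fun N => K N + L N) := by
  intro N j k
  beta_reduce
  rw [← hK, ← hL]; rfl

lemma IsHankelFam.sub {τ σ : ℕ → ℂ} {K L : ℕ → Ell2 →L[ℂ] Ell2} (hK : IsHankelFam τ K)
    (hL : IsHankelFam σ L) : IsHankelFam (fun m => τ m - σ m) (fun N => K N - L N) := by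
  intro N j k
  beta_reduce
  rw [← hK, ← hL]; rfl

lemma IsHankelFam.star {τ : ℕ → ℂ} {K : ℕ → Ell2 →L[ℂ] Ell2} (hK : IsHankelFam τ K) :
    IsHankelFam (fun m => (starRingEnd ℂ) (τ m)) (fun N => Star.star (K N)) := by
  intro N j k
  rw [matEntry_star, hK, add_right_comm]

/-- A Hankel sequence of type `ω`: `τ m = O(1/m)` and `τ (m+1) - ω τ m = O(1/m²)`. -/
structure HankelType (ω : ℂ) (τ : ℕ → ℂ) : Prop where
  bound : ∃ C : ℝ, 0 ≤ C ∧ ∀ m : ℕ, 1 ≤ m → ‖τ m‖ ≤ C / m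
  diff : ∃ C : ℝ, 0 ≤ C ∧ ∀ m : ℕ, 1 ≤ m → ‖τ (m + 1) - ω * τ m‖ ≤ C / (m:ℝ) ^ 2

/-- Products of Hankel operators of non-conjugate types are negligible. -/
lemma IsHankelFam.mul_negl {τ τ' : ℕ → ℂ} {K K' : ℕ → Ell2 →L[ℂ] Ell2} (hK : IsHankelFam τ K)
    (hK' : IsHankelFam τ' K') (hb : K =O[atTop] (fun _ => (1:ℝ)))
    (hb' : K' =O[atTop] (fun _ => (1:ℝ))) {ω ω' : ℂ} (hτ : HankelType ω τ)
    (hτ' : HankelType ω' τ') (hω : ω * ω' ≠ 1) :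
    NeglFam atTop invSqrt (unitVec 0) (fun N => K N * K' N) := by
  obtain ⟨C, hC, hτb⟩ := hτ.bound
  obtain ⟨C', hC', hτb'⟩ := hτ'.bound
  obtain ⟨D, hD, hτd⟩ := hτ.diff
  obtain ⟨D', hD', hτd'⟩ := hτ'.diff
  have s1 := hK.small hb hC hτb
  have s2 := hK'.small hb' hC' hτb'
  have n1 : NeglFam atTop invSqrt (unitVec 0) (fun N => K (N + 1) - ω • K N) :=
    ((hK.shift 1).sub (hK.smul ω)).negl hD hτd
  have n2 : NeglFam atTop invSqrt (unitVec 0) (fun N => K' (N + 1) - ω' • K' N) :=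
    ((hK'.shift 1).sub (hK'.smul ω')).negl hD' hτd'
  have n3 : NeglFam atTop invSqrt (unitVec 0) (fun N => K N * K' N - K (N + 1) * K' (N + 1)) := by
    refine .of_matEntry (C := C * C') (by positivity) (fun N hN j k => ?_)
    have e : matEntry (K N * K' N - K (N + 1) * K' (N + 1)) j k = τ (N + j) * τ' (N + k) := by
      have a1 := matEntry_mul (K N) (K' N) j k
      have a2 := matEntry_mul (K (N + 1)) (K' (N + 1)) j k
      have a3 := (hasSum_nat_add_iff' (f := fun m => matEntry (K N) j m * matEntry (K' N) m k) 1).2 a1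
      have e0 : (fun m => matEntry (K N) j (m + 1) * matEntry (K' N) (m + 1) k) =
          fun m => matEntry (K (N + 1)) j m * matEntry (K' (N + 1)) m k := by
        funext m
        rw [hK, hK', hK, hK']
        congr 2 <;> omega
      rw [e0] at a3
      have a4 := a3.unique a2
      have : matEntry (K N * K' N - K (N + 1) * K' (N + 1)) j k =
        matEntry (K N * K' N) j k - matEntry (K (N + 1) * K' (N + 1)) j k := rfl
      rw [this, ← a4]
      simp [hK N, hK' N]
    rw [e, norm_mul]
    calc _ ≤ (C / (N + j : ℕ)) * (C' / (N + k : ℕ)) := by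
          gcongr
          · exact hτb _ (by omega)
          · exact hτb' _ (by omega)
      _ = _ := by push_cast; ring
  have c1 : ∀ z : ℂ, (fun _ : ℕ => z) =O[atTop] (fun _ => (1:ℝ)) := fun z =>
    isBigO_const_const _ one_ne_zero _
  have s2' : SmallFam atTop invSqrt (unitVec 0) (fun N => K' (N + 1)) := by
    simpa using (n2.small tendsto_invSqrt).add (s2.smul _ (c1 ω'))
  have tot := ((n3.add (n1.mul_small s2')).add ((n2.small_mul s1).smul _ (c1 ω))).smul _
    (c1 (1 - ω * ω')⁻¹)
  refine tot.congr' (Eventually.of_forall fun N => ?_)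
  have h1 : 1 - ω * ω' ≠ 0 := sub_ne_zero.2 hω.symm
  rw [inv_smul_eq_iff₀ h1]
  simp only [sub_mul, mul_sub, smul_mul_assoc, mul_smul_comm, smul_sub, smul_smul, sub_smul,
    one_smul]
  abel

end SequenceSpace

section CircleOperators

open scoped ENNReal InnerProductSpace ComplexConjugate

instance fact_two_pi_pos : Fact (0 < 2 * Real.pi) := ⟨Real.two_pi_pos⟩

/-- The circle `ℝ / 2πℤ`. -/
abbrev Tor : Type := AddCircle (2 * Real.pi)

/-- The normalised Haar measure on the circle. -/
noncomputable abbrev torMeasure : Measure Tor := AddCircle.haarAddCircle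

/-- The Hilbert space `L²` of the circle. -/
abbrev L2T : Type := Lp ℂ 2 torMeasure

/-- The coordinate `u = exp(iθ)` on the circle. -/
noncomputable def crd (t : Tor) : ℂ := (AddCircle.toCircle t : ℂ)

lemma crd_zpow (n : ℤ) (t : Tor) : crd t ^ n = fourier n t := by
  rw [fourier_apply, AddCircle.toCircle_zsmul]; simp [crd]

lemma crd_pow (n : ℕ) (t : Tor) : crd t ^ n = fourier (n : ℤ) t := by
  rw [← crd_zpow]; simp

lemma norm_crd (t : Tor) : ‖crd t‖ = 1 := Circle.norm_coe _

lemma crd_ne_zero (t : Tor) : crd t ≠ 0 := by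
  intro h; have := norm_crd t; rw [h] at this; simp at this

lemma conj_crd (t : Tor) : conj (crd t) = (crd t)⁻¹ := by
  rw [Complex.inv_def, Complex.normSq_eq_norm_sq, norm_crd]; simp

lemma continuous_crd : Continuous crd :=
  continuous_subtype_val.comp AddCircle.continuous_toCircle

lemma crd_coe (x : ℝ) : crd (x : Tor) = Complex.exp (x * Complex.I) := by
  have := fourier_coe_apply (T := 2 * Real.pi) (n := 1) (x := x)
  rw [← crd_zpow, zpow_one] at this
  rw [this]; congr 1
  have : (Real.pi : ℂ) ≠ 0 := by exact_mod_cast Real.pi_ne_zero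
  push_cast; field_simp

lemma continuous_crd_zpow (n : ℤ) : Continuous (fun t => crd t ^ n) := by
  simp_rw [crd_zpow]; exact (fourier n).continuous

/-- Multiplication operator on `L²` of the circle. -/
noncomputable def mulOp (φ : Tor → ℂ) (hφ : MemLp φ ∞ torMeasure) : L2T →L[ℂ] L2T :=
  (ContinuousLinearMap.mul ℂ ℂ).holderL torMeasure ∞ 2 2 (hφ.toLp φ)

lemma mulOp_ae {φ : Tor → ℂ} (hφ : MemLp φ ∞ torMeasure) (f : L2T) :
    mulOp φ hφ f =ᵐ[torMeasure] fun t => φ t * f t := by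
  have := (ContinuousLinearMap.mul ℂ ℂ).coeFn_holder (r := 2) (hφ.toLp φ) f
  filter_upwards [this, hφ.coeFn_toLp] with t h1 h2
  change ((ContinuousLinearMap.mul ℂ ℂ).holder 2 (hφ.toLp φ) f) t = _
  rw [h1, h2]; rfl

lemma norm_mulOp_le {φ : Tor → ℂ} (hφ : MemLp φ ∞ torMeasure) {C : ℝ} (hC : 0 ≤ C)
    (h : ∀ᵐ t ∂torMeasure, ‖φ t‖ ≤ C) : ‖mulOp φ hφ‖ ≤ C := by
  refine ContinuousLinearMap.opNorm_le_bound _ hC (fun f => ?_)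
  refine Lp.norm_le_mul_norm_of_ae_le_mul ?_
  filter_upwards [mulOp_ae hφ f, h] with t h1 h2
  rw [h1, norm_mul]
  gcongr

/-- The integral `∫ φ uᵐ` over the circle, i.e. the Fourier coefficient of index `-m`. -/
noncomputable def fco (φ : Tor → ℂ) (m : ℤ) : ℂ := ∫ t, φ t * crd t ^ m ∂torMeasure

/-- The orthonormal system `uᵏ`. -/
noncomputable def basisT (k : ℤ) : L2T := fourierLp 2 k

lemma basisT_ae (k : ℤ) : basisT k =ᵐ[torMeasure] fun t => crd t ^ k := by
  filter_upwards [coeFn_fourierLp (T := 2 * Real.pi) 2 k] with t ht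
  rw [crd_zpow]; exact ht

lemma orthonormal_basisT : Orthonormal ℂ basisT := orthonormal_fourier

lemma inner_basisT (f : L2T) (k : ℤ) : ⟪basisT k, f⟫_ℂ = fco f (-k) := by
  rw [MeasureTheory.L2.inner_def]
  refine integral_congr_ae ?_
  filter_upwards [basisT_ae k] with t ht
  rw [ht, zpow_neg]
  change f t * conj (crd t ^ k) = _
  rw [map_zpow₀, conj_crd, inv_zpow]

/-- The isometry of `ℓ²(ℕ)` onto the span of `u^(σ k)`. -/
noncomputable def embT (σ : ℕ → ℤ) (hσ : Function.Injective σ) : Ell2 →ₗᵢ[ℂ] L2T :=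
  (orthonormal_basisT.comp σ hσ).orthogonalFamily.linearIsometry

lemma embT_unitVec (σ : ℕ → ℤ) (hσ : Function.Injective σ) (k : ℕ) :
    embT σ hσ (unitVec k) = basisT (σ k) := by
  unfold embT unitVec
  have := (orthonormal_basisT.comp σ hσ).orthogonalFamily.linearIsometry_apply_single (i := k) (1:ℂ)
  rw [this]
  simp

/-- The isometry `ℓ²(ℕ) → L²`, `eₖ ↦ uᵏ`. -/
noncomputable def embPos : Ell2 →ₗᵢ[ℂ] L2T := embT (fun k => (k : ℤ)) (fun _ _ h => by simpa using h)

/-- The isometry `ℓ²(ℕ) → L²`, `eₖ ↦ u⁻ᵏ`. -/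
noncomputable def embNeg : Ell2 →ₗᵢ[ℂ] L2T := embT (fun k => -(k : ℤ)) (fun _ _ h => by simpa using h)

lemma embPos_unitVec (k : ℕ) : embPos (unitVec k) = basisT k := embT_unitVec _ _ k
lemma embNeg_unitVec (k : ℕ) : embNeg (unitVec k) = basisT (-k) := embT_unitVec _ _ k

lemma memLp_top_mul_zpow {φ : Tor → ℂ} (hφ : MemLp φ ∞ torMeasure) (n : ℤ) :
    MemLp (fun t => φ t * crd t ^ n) ∞ torMeasure := by
  have h2 : MemLp (fun t => crd t ^ n) ∞ torMeasure :=
    memLp_top_of_bound (continuous_crd_zpow n).aestronglyMeasurable 1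
      (by filter_upwards with t; rw [norm_zpow, norm_crd, one_zpow])
  exact h2.mul hφ

/-- The Hankel operator `(∫ φ u^(N+j+k))` on `ℓ²(ℕ)`. -/
noncomputable def hankelOp (φ : Tor → ℂ) (hφ : MemLp φ ∞ torMeasure) (N : ℕ) : Ell2 →L[ℂ] Ell2 :=
  (ContinuousLinearMap.adjoint embNeg.toContinuousLinearMap) ∘L
    (mulOp _ (memLp_top_mul_zpow hφ (N : ℤ))) ∘L embPos.toContinuousLinearMap

lemma hankelOp_apply {φ : Tor → ℂ} (hφ : MemLp φ ∞ torMeasure) (N : ℕ) (x : Ell2) (j : ℕ) :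
    hankelOp φ hφ N x j = fco (fun t => φ t * embPos x t) (N + j) := by
  rw [← inner_unitVec]
  unfold hankelOp
  rw [ContinuousLinearMap.comp_apply, ContinuousLinearMap.adjoint_inner_right]
  change ⟪embNeg (unitVec j), mulOp _ _ (embPos x)⟫_ℂ = _
  rw [embNeg_unitVec, inner_basisT, neg_neg]
  refine integral_congr_ae ?_
  filter_upwards [mulOp_ae (memLp_top_mul_zpow hφ (N : ℤ)) (embPos x)] with t ht
  rw [ht, zpow_add₀ (crd_ne_zero t)]; ring

lemma isHankelFam_hankelOp {φ : Tor → ℂ} (hφ : MemLp φ ∞ torMeasure) :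
    IsHankelFam (fun m => fco φ m) (hankelOp φ hφ) := by
  intro N j k
  unfold matEntry
  rw [hankelOp_apply, embPos_unitVec]
  refine integral_congr_ae ?_
  filter_upwards [basisT_ae k] with t ht
  rw [ht]
  push_cast
  rw [zpow_add₀ (crd_ne_zero t) (_ + _) (k : ℤ)]; ring

lemma norm_hankelOp_le {φ : Tor → ℂ} (hφ : MemLp φ ∞ torMeasure) {C : ℝ} (hC : 0 ≤ C)
    (h : ∀ᵐ t ∂torMeasure, ‖φ t‖ ≤ C) (N : ℕ) : ‖hankelOp φ hφ N‖ ≤ C := by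
  refine ContinuousLinearMap.opNorm_le_bound _ hC (fun x => ?_)
  unfold hankelOp
  rw [ContinuousLinearMap.comp_apply, ContinuousLinearMap.comp_apply]
  have h1 : ‖ContinuousLinearMap.adjoint embNeg.toContinuousLinearMap‖ ≤ 1 := by
    rw [LinearIsometryEquiv.norm_map]
    exact LinearIsometry.norm_toContinuousLinearMap_le embNeg
  refine (ContinuousLinearMap.le_of_opNorm_le _ h1 _).trans ?_
  rw [one_mul]
  refine (ContinuousLinearMap.le_of_opNorm_le _ (norm_mulOp_le _ hC (?_)) _).trans ?_
  · filter_upwards [h] with t ht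
    rw [norm_mul, norm_zpow, norm_crd, one_zpow, mul_one]; exact ht
  · simp

end CircleOperators

section CircleFunctions

open scoped ENNReal InnerProductSpace ComplexConjugate

lemma memLp_mul_top {p : ℝ≥0∞} {φ f : Tor → ℂ} (hφ : MemLp φ ∞ torMeasure)
    (hf : MemLp f p torMeasure) : MemLp (fun t => φ t * f t) p torMeasure :=
  hf.mul hφ

lemma memLp_conj {p : ℝ≥0∞} {f : Tor → ℂ} (hf : MemLp f p torMeasure) :
    MemLp (fun t => conj (f t)) p torMeasure := hf.star

lemma memLp_crd_zpow (p : ℝ≥0∞) (n : ℤ) : MemLp (fun t => crd t ^ n) p torMeasure :=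
  MemLp.of_bound (continuous_crd_zpow n).aestronglyMeasurable 1
      (by filter_upwards with t; rw [norm_zpow, norm_crd, one_zpow])

lemma memLp_mul_zpow {p : ℝ≥0∞} {f : Tor → ℂ} (hf : MemLp f p torMeasure) (n : ℤ) :
    MemLp (fun t => f t * crd t ^ n) p torMeasure := by
  have := memLp_mul_top (memLp_crd_zpow ∞ n) hf
  simpa only [mul_comm] using this

lemma fco_congr {f g : Tor → ℂ} (h : f =ᵐ[torMeasure] g) (m : ℤ) : fco f m = fco g m :=
  integral_congr_ae (by filter_upwards [h] with t ht; rw [ht])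

lemma integrable_mul_zpow {f : Tor → ℂ} (hf : Integrable f torMeasure) (m : ℤ) :
    Integrable (fun t => f t * crd t ^ m) torMeasure := by
  rw [← memLp_one_iff_integrable] at *
  exact memLp_mul_zpow hf m

lemma fco_add {f g : Tor → ℂ} (hf : Integrable f torMeasure) (hg : Integrable g torMeasure)
    (m : ℤ) : fco (fun t => f t + g t) m = fco f m + fco g m := by
  unfold fco
  rw [← integral_add (integrable_mul_zpow hf m) (integrable_mul_zpow hg m)]
  congr 1; ext t; ring

lemma fco_const_mul (c : ℂ) (f : Tor → ℂ) (m : ℤ) : fco (fun t => c * f t) m = c * fco f m := by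
  unfold fco
  rw [← integral_const_mul]
  congr 1; ext t; ring

lemma fco_mul_zpow (f : Tor → ℂ) (n m : ℤ) : fco (fun t => f t * crd t ^ n) m = fco f (n + m) := by
  unfold fco
  congr 1; ext t; rw [zpow_add₀ (crd_ne_zero t)]; ring

lemma fco_conj (f : Tor → ℂ) (m : ℤ) : fco (fun t => conj (f t)) m = conj (fco f (-m)) := by
  unfold fco
  rw [← integral_conj]
  congr 1; ext t
  rw [map_mul, map_zpow₀, conj_crd, inv_zpow, zpow_neg, inv_inv]

lemma fco_zpow (n m : ℤ) : fco (fun t => crd t ^ n) m = if n + m = 0 then 1 else 0 := by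
  have h := inner_basisT (basisT n) (-m)
  rw [neg_neg, fco_congr (basisT_ae n)] at h
  rw [← h]
  have := orthonormal_iff_ite.mp orthonormal_basisT (-m) n
  rw [this]
  congr 1
  simp only [eq_iff_iff]; omega

/-- Uniqueness of Fourier coefficients. -/
lemma ae_eq_of_fco {f g : Tor → ℂ} (hf : MemLp f 2 torMeasure) (hg : MemLp g 2 torMeasure)
    (h : ∀ m, fco f m = fco g m) : f =ᵐ[torMeasure] g := by
  have key : hf.toLp f = hg.toLp g := by
    apply (fourierBasis (T := 2 * Real.pi)).repr.injective
    ext k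
    have hb : ∀ F : L2T, (fourierBasis (T := 2 * Real.pi)).repr F k = fco F (-k) := by
      intro F
      rw [HilbertBasis.repr_apply_apply, coe_fourierBasis]
      exact inner_basisT F k
    rw [hb, hb, fco_congr hf.coeFn_toLp, fco_congr hg.coeFn_toLp, h]
  exact hf.coeFn_toLp.symm.trans ((Lp.ext_iff.mp key).trans hg.coeFn_toLp)

/-- Pairing with `φ uᵐ` as a continuous functional. -/
lemma fco_mul_eq_inner {φ : Tor → ℂ} (hφ : MemLp φ 2 torMeasure) (F : L2T) (m : ℤ) :
    fco (fun t => φ t * F t) m = ⟪((memLp_conj (memLp_mul_zpow hφ m)).toLp _ : L2T), F⟫_ℂ := by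
  rw [MeasureTheory.L2.inner_def]
  refine integral_congr_ae ?_
  filter_upwards [(memLp_conj (memLp_mul_zpow hφ m)).coeFn_toLp] with t ht
  rw [ht]
  change _ = F t * conj (conj (φ t * crd t ^ m))
  rw [Complex.conj_conj]; ring

lemma memLp_two_of_top {φ : Tor → ℂ} (hφ : MemLp φ ∞ torMeasure) : MemLp φ 2 torMeasure :=
  hφ.mono_exponent le_top

lemma hasSum_fco_mul_embPos {φ : Tor → ℂ} (hφ : MemLp φ 2 torMeasure) (x : Ell2) (m : ℤ) :
    HasSum (fun k : ℕ => x k * fco φ (m + k)) (fco (fun t => φ t * embPos x t) m) := by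
  rw [fco_mul_eq_inner hφ]
  have h1 := ((ell2_hasSum_unitVec x).mapL embPos.toContinuousLinearMap).mapL
    (innerSL ℂ ((memLp_conj (memLp_mul_zpow hφ m)).toLp _ : L2T))
  refine h1.congr_fun (fun k => ?_)
  rw [map_smul, map_smul, smul_eq_mul]
  congr 1
  change _ = ⟪_, embPos (unitVec k)⟫_ℂ
  rw [embPos_unitVec, ← fco_mul_eq_inner hφ]
  unfold fco
  refine integral_congr_ae ?_
  filter_upwards [basisT_ae k] with t ht
  rw [ht, zpow_add₀ (crd_ne_zero t)]; ring

lemma fco_embPos (x : Ell2) (m : ℤ) :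
    fco (embPos x) m = if m ≤ 0 then x m.natAbs else 0 := by
  have h := hasSum_fco_mul_embPos (φ := fun _ => 1) (memLp_const 1) x m
  simp only [one_mul] at h
  have h1 : ∀ k : ℕ, fco (fun _ => (1:ℂ)) (m + k) = if m + k = 0 then 1 else 0 := by
    intro k
    have := fco_zpow 0 (m + k)
    simpa using this
  simp_rw [h1] at h
  refine h.unique ?_
  split_ifs with hm
  · convert hasSum_ite_eq m.natAbs (x m.natAbs) using 2 with k
    by_cases hk : k = m.natAbs
    · rw [if_pos hk, if_pos (by omega), mul_one, hk]
    · rw [if_neg hk, if_neg (by omega), mul_zero]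
  · convert hasSum_zero using 2 with k
    rw [if_neg (by omega), mul_zero]

/-- A square integrable function with only nonnegative frequencies comes from `ℓ²(ℕ)`. -/
lemma exists_embPos {f : Tor → ℂ} (hf : MemLp f 2 torMeasure) (h : ∀ m : ℤ, 1 ≤ m → fco f m = 0) :
    ∃ x : Ell2, f =ᵐ[torMeasure] embPos x ∧ ∀ k : ℕ, x k = fco f (-k) := by
  set x : Ell2 := ContinuousLinearMap.adjoint embPos.toContinuousLinearMap (hf.toLp f) with hx
  have hxk : ∀ k : ℕ, x k = fco f (-k) := by
    intro k
    rw [← inner_unitVec, hx, ContinuousLinearMap.adjoint_inner_right]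
    change ⟪embPos (unitVec k), _⟫_ℂ = _
    rw [embPos_unitVec, inner_basisT, fco_congr hf.coeFn_toLp]
  refine ⟨x, ae_eq_of_fco hf (Lp.memLp _) (fun m => ?_), hxk⟩
  rw [fco_embPos]
  split_ifs with hm
  · rw [hxk]; congr 1; omega
  · exact h m (by omega)

lemma real_of_hasSum {f : ℕ → ℂ} {s : ℂ} (h : HasSum f s) (hf : ∀ k, conj (f k) = f k) :
    conj s = s := by
  have h1 : HasSum (fun k => conj (f k)) (conj s) := h.map (starRingEnd ℂ) Complex.continuous_conj
  simp_rw [hf] at h1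
  exact h1.unique h

lemma crd_re (t : Tor) : ((crd t).re : ℂ) = (crd t + (crd t)⁻¹) / 2 := by
  rw [← conj_crd, Complex.add_conj]; push_cast; ring

lemma chebyshevU_crd (j : ℕ) (t : Tor) :
    (((Polynomial.Chebyshev.U ℝ j).eval (crd t).re : ℝ) : ℂ) * ((crd t)⁻¹ - crd t) =
      (crd t) ^ (-((j:ℤ) + 1)) - (crd t) ^ ((j:ℤ) + 1) := by
  induction t using QuotientAddGroup.induction_on with
  | H x =>
  have hre : (crd (x : Tor)).re = Real.cos x := by
    rw [crd_coe, Complex.exp_ofReal_mul_I_re]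
  have hs : ∀ n : ℤ, (crd (x : Tor)) ^ (-n) - (crd (x : Tor)) ^ n =
      -(2 * Complex.I) * Complex.sin (n * x) := by
    intro n
    rw [crd_coe, ← Complex.exp_int_mul, ← Complex.exp_int_mul, Complex.sin]
    push_cast
    have e1 : (n:ℂ) * (x * Complex.I) = n * x * Complex.I := by ring
    have e2 : -(n:ℂ) * (x * Complex.I) = -(n * x) * Complex.I := by ring
    rw [e1, e2]
    linear_combination (Complex.exp (-(n * x) * Complex.I) - Complex.exp (n * x * Complex.I)) * Complex.I_sq
  have h1 := hs 1
  rw [zpow_neg, zpow_one] at h1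
  rw [hre, hs, h1]
  have h2 := congrArg (fun r : ℝ => (r : ℂ)) (Polynomial.Chebyshev.U_real_cos x j)
  generalize (Polynomial.Chebyshev.U ℝ j).eval (Real.cos x) = r at h2 ⊢
  push_cast at h2 ⊢
  rw [one_mul]
  linear_combination -(2 * Complex.I) * h2

lemma ae_crd_ne (z : ℂ) : ∀ᵐ t ∂torMeasure, crd t ≠ z := by
  have hsub : {t : Tor | crd t = z}.Subsingleton := by
    intro s hs t ht
    have : AddCircle.toCircle s = AddCircle.toCircle t := by
      apply Subtype.ext
      exact (show crd s = z from hs).trans (show crd t = z from ht).symm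
    exact AddCircle.injective_toCircle Real.two_pi_pos.ne' this
  have hv : (volume : Measure Tor) {t : Tor | crd t = z} = 0 := by
    rw [AddCircle.add_projection_respects_measure (2 * Real.pi) 0
      (measurableSet_eq_fun continuous_crd.measurable measurable_const)]
    refine Set.Subsingleton.measure_zero (fun x hx y hy => ?_) _
    exact (AddCircle.coe_eq_coe_iff_of_mem_Ioc hx.2 hy.2).mp (hsub hx.1 hy.1)
  rw [AddCircle.volume_eq_smul_haarAddCircle, Measure.smul_apply, smul_eq_mul, mul_eq_zero] at hv
  rw [ae_iff]
  simpa using hv.resolve_left (by simp [Real.pi_pos])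

/-- Integrals over the circle as integrals over a period. -/
lemma integral_tor {E : Type*} [NormedAddCommGroup E] [NormedSpace ℝ E] (f : Tor → E) (a : ℝ) :
    ∫ t, f t ∂torMeasure = (2 * Real.pi)⁻¹ • ∫ x in a..a + 2 * Real.pi, f (x : Tor) := by
  rw [AddCircle.integral_haarAddCircle, AddCircle.intervalIntegral_preimage]

end CircleFunctions

section OrthogonalPolynomials

/-- A family of monic orthogonal polynomials for a linear functional. -/
structure IsOPS (L : ℝ[X] →ₗ[ℝ] ℝ) (P : ℕ → ℝ[X]) : Prop where
  monic : ∀ n, (P n).Monic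
  deg : ∀ n, (P n).natDegree = n
  orth : ∀ n, ∀ k < n, L (P n * X ^ k) = 0

/-- Positive definiteness of a linear functional on polynomials. -/
def PosFun (L : ℝ[X] →ₗ[ℝ] ℝ) : Prop := ∀ q : ℝ[X], q ≠ 0 → 0 < L (q * q)

lemma functional_mul_eq_zero {L : ℝ[X] →ₗ[ℝ] ℝ} {Q : ℝ[X]} {n : ℕ}
    (h : ∀ k < n, L (Q * X ^ k) = 0) {q : ℝ[X]} (hq : q.degree < n) : L (Q * q) = 0 := by
  rcases eq_or_ne q 0 with rfl | hq0
  · simp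
  rw [q.as_sum_range' n ((natDegree_lt_iff_degree_lt hq0).mpr hq), Finset.mul_sum, map_sum]
  refine Finset.sum_eq_zero (fun k hk => ?_)
  have h1 := h k (Finset.mem_range.mp hk)
  rw [← C_mul_X_pow_eq_monomial, ← mul_assoc, mul_comm Q (C _), mul_assoc, ← smul_eq_C_mul, map_smul,
    h1, smul_zero]

lemma PosFun.eq_zero {L : ℝ[X] →ₗ[ℝ] ℝ} (hL : PosFun L) {Q : ℝ[X]} {n : ℕ}
    (h : ∀ k < n, L (Q * X ^ k) = 0) (hq : Q.degree < n) : Q = 0 := by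
  by_contra hne
  have := hL Q hne
  rw [functional_mul_eq_zero h hq] at this
  exact this.ne rfl

lemma IsOPS.eq_smul {L : ℝ[X] →ₗ[ℝ] ℝ} (hL : PosFun L) {P : ℕ → ℝ[X]} (hP : IsOPS L P) {Q : ℝ[X]}
    {n : ℕ} (h : ∀ k < n, L (Q * X ^ k) = 0) (hq : Q.natDegree ≤ n) : Q = C (Q.coeff n) * P n := by
  rw [← sub_eq_zero]
  refine hL.eq_zero (n := n) (fun k hk => ?_) ?_
  · rw [sub_mul, map_sub, h k hk, mul_assoc, ← smul_eq_C_mul, map_smul, hP.orth n k hk]; simp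
  · rw [degree_lt_iff_coeff_zero]
    intro m hm
    rcases hm.eq_or_lt with rfl | hm
    · have := hP.monic n
      rw [Monic, leadingCoeff, hP.deg] at this
      rw [coeff_sub, coeff_C_mul, this]; simp
    · rw [coeff_sub, coeff_C_mul, coeff_eq_zero_of_natDegree_lt (hq.trans_lt hm),
        coeff_eq_zero_of_natDegree_lt ((hP.deg n).trans_lt hm)]; simp

end OrthogonalPolynomials

section SzegoIdentity

open scoped ENNReal InnerProductSpace ComplexConjugate

lemma fco_re_mul {g : Tor → ℂ} (hg : Integrable g torMeasure) (m : ℤ) :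
    fco (fun t => g t * ((crd t).re : ℂ)) m = (fco g (m + 1) + fco g (m - 1)) / 2 := by
  have h1 : (fun t => g t * ((crd t).re : ℂ)) =
      fun t => (1 / 2 : ℂ) * ((g t * crd t ^ (1:ℤ)) + (g t * crd t ^ (-1:ℤ))) := by
    ext t; rw [crd_re, zpow_one, zpow_neg_one]; ring
  rw [h1, fco_const_mul, fco_add (integrable_mul_zpow hg _) (integrable_mul_zpow hg _),
    fco_mul_zpow, fco_mul_zpow, add_comm 1 m, add_comm (-1) m, ← sub_eq_add_neg]
  ring

lemma integrable_mul_re_pow {g : Tor → ℂ} (hg : Integrable g torMeasure) (k : ℕ) :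
    Integrable (fun t => g t * ((crd t).re : ℂ) ^ k) torMeasure := by
  have h2 : MemLp (fun t => ((crd t).re : ℂ) ^ k) ∞ torMeasure := by
    refine MemLp.of_bound ?_ 1 ?_
    · exact (Complex.continuous_ofReal.comp
        (Complex.continuous_re.comp continuous_crd)).pow k |>.aestronglyMeasurable
    · filter_upwards with t
      rw [norm_pow, Complex.norm_real]
      refine pow_le_one₀ (norm_nonneg _) ?_
      exact (Complex.abs_re_le_norm _).trans_eq (norm_crd t)
  have := memLp_mul_top h2 (memLp_one_iff_integrable.mpr hg)
  rw [← memLp_one_iff_integrable]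
  simpa only [mul_comm] using this

lemma fco_re_pow_succ {g : Tor → ℂ} (hg : Integrable g torMeasure) (k : ℕ) (m : ℤ) :
    fco (fun t => g t * ((crd t).re : ℂ) ^ (k + 1)) m =
      (fco (fun t => g t * ((crd t).re : ℂ) ^ k) (m + 1) +
        fco (fun t => g t * ((crd t).re : ℂ) ^ k) (m - 1)) / 2 := by
  rw [← fco_re_mul (integrable_mul_re_pow hg k)]
  congr 1; ext t; ring

lemma fco_re_pow_eq_zero {g : Tor → ℂ} (hg : Integrable g torMeasure) {n : ℕ}
    (h : ∀ m : ℤ, |m| < n → fco g m = 0) (k : ℕ) :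
    ∀ m : ℤ, |m| + k < n → fco (fun t => g t * ((crd t).re : ℂ) ^ k) m = 0 := by
  induction k with
  | zero => intro m hm; simpa using h m (by simpa using hm)
  | succ k ih =>
    intro m hm
    rw [fco_re_pow_succ hg, ih, ih]
    · simp
    · push_cast at hm; have := abs_sub m 1; simp at this; omega
    · push_cast at hm; have := abs_add_le m 1; simp at this; omega

lemma fco_re_pow_boundary {g : Tor → ℂ} (hg : Integrable g torMeasure) {n : ℕ}
    (h : ∀ m : ℤ, |m| < n → fco g m = 0) (k : ℕ) (hk : k < n) :
    fco (fun t => g t * ((crd t).re : ℂ) ^ k) (n - k) = (1 / 2) ^ k * fco g n ∧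
    fco (fun t => g t * ((crd t).re : ℂ) ^ k) (k - n) = (1 / 2) ^ k * fco g (-n) := by
  induction k with
  | zero => simp
  | succ k ih =>
    obtain ⟨h1, h2⟩ := ih (by omega)
    rw [fco_re_pow_succ hg, fco_re_pow_succ hg]
    push_cast
    rw [show (n:ℤ) - (k + 1) + 1 = n - k by ring, show (k:ℤ) + 1 - n - 1 = k - n by ring, h1, h2,
      fco_re_pow_eq_zero hg h k _ (by rw [abs_of_nonneg (by omega)]; omega),
      fco_re_pow_eq_zero hg h k _ (by rw [abs_of_nonpos (by omega)]; omega)]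
    constructor <;> ring

lemma fco_re_pow_top {g : Tor → ℂ} (hg : Integrable g torMeasure) {n : ℕ} (hn : 1 ≤ n)
    (h : ∀ m : ℤ, |m| < n → fco g m = 0) :
    fco (fun t => g t * ((crd t).re : ℂ) ^ n) 0 = (1 / 2) ^ n * (fco g n + fco g (-n)) := by
  obtain ⟨k, rfl⟩ : ∃ k, n = k + 1 := ⟨n - 1, by omega⟩
  obtain ⟨h1, h2⟩ := fco_re_pow_boundary hg h k (by omega)
  rw [fco_re_pow_succ hg]
  have e1 : ((k + 1 : ℕ) : ℤ) - k = 0 + 1 := by push_cast; ring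
  have e2 : (k : ℤ) - ((k + 1 : ℕ) : ℤ) = 0 - 1 := by push_cast; ring
  rw [e1] at h1; rw [e2] at h2
  rw [h1, h2]; ring

lemma chebyshevU_coeff_self (n : ℕ) : (Polynomial.Chebyshev.U ℝ n).coeff n = 2 ^ n := by
  have h := Polynomial.Chebyshev.leadingCoeff_U_natCast ℝ n
  rwa [leadingCoeff, Polynomial.Chebyshev.natDegree_U_natCast] at h

lemma chebyshevU_coeff_pred (n : ℕ) : (Polynomial.Chebyshev.U ℝ (n + 1 : ℕ)).coeff n = 0 := by
  induction n with
  | zero => simp [Polynomial.Chebyshev.U_one]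
  | succ n ih =>
    have := Polynomial.Chebyshev.U_add_two ℝ n
    have e : (((n + 1 + 1 : ℕ)) : ℤ) = n + 2 := by push_cast; ring
    push_cast at ih
    rw [e, this, coeff_sub, mul_assoc, ← C_ofNat, coeff_C_mul, coeff_X_mul, ih,
      coeff_eq_zero_of_natDegree_lt (by rw [Polynomial.Chebyshev.natDegree_U_natCast]; omega)]
    simp

/-- Szegő factorisation data on the circle. -/
structure SzegoData (D V b : Tor → ℂ) : Prop where
  memD : MemLp D ∞ torMeasure
  memV : MemLp V ∞ torMeasure
  memb : MemLp b ∞ torMeasure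
  fcoD : ∀ m : ℤ, 1 ≤ m → fco D m = 0
  fcoV : ∀ m : ℤ, 1 ≤ m → fco V m = 0
  realV : ∀ m : ℤ, conj (fco V m) = fco V m
  realb : ∀ m : ℤ, conj (fco b m) = fco b m
  realD : conj (fco D 0) = fco D 0
  prod_ae : ∀ᵐ t ∂torMeasure, V t * D t = 1 - crd t ^ 2
  quot_ae : ∀ᵐ t ∂torMeasure, b t * conj (D t) = D t
  value_mul : fco D 0 * fco V 0 = 1

end SzegoIdentity

section SzegoIdentityMain

open scoped ENNReal InnerProductSpace ComplexConjugate

lemma integrable_of_memLp_two {f : Tor → ℂ} (hf : MemLp f 2 torMeasure) : Integrable f torMeasure :=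
  hf.integrable (by norm_num)

/-- The function `conj Y + u^N b Y` with `Y = embPos v`. -/
noncomputable def reflFun (b : Tor → ℂ) (N : ℕ) (v : Ell2) (t : Tor) : ℂ :=
  conj (embPos v t) + b t * embPos v t * crd t ^ (N : ℤ)

lemma memLp_reflFun {b : Tor → ℂ} (hb : MemLp b ∞ torMeasure) (N : ℕ) (v : Ell2) :
    MemLp (reflFun b N v) 2 torMeasure :=
  (memLp_conj (Lp.memLp _)).add (memLp_mul_zpow (memLp_mul_top hb (Lp.memLp _)) _)

lemma fco_reflFun {b : Tor → ℂ} (hb : MemLp b ∞ torMeasure) (N : ℕ) (v : Ell2) (m : ℤ) :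
    fco (reflFun b N v) m =
      conj (fco (embPos v) (-m)) + fco (fun t => b t * embPos v t) (N + m) := by
  unfold reflFun
  rw [fco_add (integrable_of_memLp_two (memLp_conj (Lp.memLp _)))
    (integrable_of_memLp_two (memLp_mul_zpow (memLp_mul_top hb (Lp.memLp _)) _)), fco_conj,
    fco_mul_zpow (fun t => b t * embPos v t)]

lemma fco_reflFun_nonneg {b : Tor → ℂ} (hb : MemLp b ∞ torMeasure) (N : ℕ) (v : Ell2) (j : ℕ) :
    fco (reflFun b N v) j = conj (v j) + hankelOp b hb N v j := by
  rw [fco_reflFun hb, hankelOp_apply, fco_embPos, if_pos (by omega)]; simp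

lemma fco_reflFun_neg_one {b : Tor → ℂ} (hb : MemLp b ∞ torMeasure) (N : ℕ) (v : Ell2) :
    fco (reflFun b (N + 1) v) (-1) = hankelOp b hb N v 0 := by
  rw [fco_reflFun hb, hankelOp_apply, fco_embPos, if_neg (by omega)]; simp

lemma real_fco_reflFun {b : Tor → ℂ} (hb : MemLp b ∞ torMeasure)
    (hbr : ∀ m : ℤ, conj (fco b m) = fco b m) (N : ℕ) {v : Ell2} (hv : ∀ k, conj (v k) = v k)
    (m : ℤ) : conj (fco (reflFun b N v) m) = fco (reflFun b N v) m := by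
  rw [fco_reflFun hb, map_add, Complex.conj_conj, fco_embPos]
  congr 1
  · split_ifs
    · exact (hv _).symm
    · simp
  · refine real_of_hasSum (hasSum_fco_mul_embPos (memLp_two_of_top hb) v _) (fun k => ?_)
    rw [map_mul, hv, hbr]

section Solution

variable {D V b : Tor → ℂ} (S : SzegoData D V b) {n : ℕ} {v : Ell2}

lemma SzegoData.fco_refl
    (hv : v + hankelOp b S.memb (2 * n) v = unitVec 0) (hvr : ∀ k, conj (v k) = v k) (j : ℕ) :
    fco (reflFun b (2 * n) v) j = if j = 0 then 1 else 0 := by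
  rw [fco_reflFun_nonneg S.memb, hvr, ← unitVec_apply, ← hv]; rfl

lemma SzegoData.exists_seq
    (hv : v + hankelOp b S.memb (2 * n) v = unitVec 0) (hvr : ∀ k, conj (v k) = v k) :
    ∃ x : Ell2, reflFun b (2 * n) v =ᵐ[torMeasure] embPos x ∧
    x 0 = 1 ∧ x 1 = fco (reflFun b (2 * n) v) (-1) ∧ ∀ k, conj (x k) = x k := by
  obtain ⟨x, hx, hxk⟩ := exists_embPos (memLp_reflFun S.memb (2 * n) v) (fun m hm => by
    obtain ⟨j, rfl⟩ : ∃ j : ℕ, m = j := ⟨m.toNat, by omega⟩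
    rw [S.fco_refl hv hvr, if_neg (by omega)])
  refine ⟨x, hx, ?_, ?_, fun k => ?_⟩
  · rw [hxk]; simpa using S.fco_refl hv hvr 0
  · rw [hxk]; simp
  · rw [hxk]; exact real_fco_reflFun S.memb S.realb _ hvr _

/-- The product `V X` has real coefficients, antisymmetric about `n + 1`. -/
lemma SzegoData.fco_prod
    (hv : v + hankelOp b S.memb (2 * n) v = unitVec 0) (hvr : ∀ k, conj (v k) = v k) :
    ∃ z : ℕ → ℝ, z (n + 1) = 0 ∧ (∀ k ≤ 2 * n + 2, z (2 * n + 2 - k) = - z k) ∧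
    (∀ m : ℤ, fco (fun t => V t * reflFun b (2 * n) v t) m =
      if m ≤ 0 ∧ -(2 * n + 2 : ℤ) ≤ m then (z m.natAbs : ℂ) else 0) ∧
    (z 0 : ℂ) = fco V 0 ∧
    (z 1 : ℂ) = fco V 0 * fco (reflFun b (2 * n) v) (-1) + fco V (-1) := by
  obtain ⟨x, hx, hx0, hx1, hxr⟩ := S.exists_seq hv hvr
  set Z : Tor → ℂ := fun t => V t * reflFun b (2 * n) v t with hZ
  have hZx : Z =ᵐ[torMeasure] fun t => V t * embPos x t := by
    filter_upwards [hx] with t ht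
    rw [hZ]; simp only [ht]
  have hsum : ∀ m : ℤ, HasSum (fun k : ℕ => x k * fco V (m + k)) (fco Z m) := by
    intro m
    rw [fco_congr hZx]
    exact hasSum_fco_mul_embPos (memLp_two_of_top S.memV) x m
  have hreal : ∀ m, conj (fco Z m) = fco Z m := fun m =>
    real_of_hasSum (hsum m) (fun k => by rw [map_mul, hxr, S.realV])
  have hpos : ∀ m : ℤ, 1 ≤ m → fco Z m = 0 := fun m hm => by
    refine (hsum m).unique ?_
    convert hasSum_zero using 2 with k
    rw [S.fcoV _ (by omega), mul_zero]
  have hsymm : ∀ m : ℤ, fco Z (-m) = - fco Z (m - (2 * n + 2)) := by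
    intro m
    rw [← hreal (-m), ← fco_conj]
    have : (fun t => conj (Z t)) =ᵐ[torMeasure]
        fun t => (-1 : ℂ) * (Z t * crd t ^ (-(2 * n + 2 : ℤ))) := by
      filter_upwards [S.prod_ae, S.quot_ae, ae_crd_ne 1, ae_crd_ne (-1)] with t h1 h2 h3 h4
      have hu := crd_ne_zero t
      have hne : 1 - crd t ^ 2 ≠ 0 := by
        rw [show 1 - crd t ^ 2 = (1 - crd t) * (1 + crd t) by ring]
        refine mul_ne_zero (sub_ne_zero.mpr (Ne.symm h3)) (fun h => h4 ?_)
        linear_combination h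
      have hD : D t ≠ 0 := fun h => hne (by rw [← h1, h, mul_zero])
      have hDc : conj (D t) ≠ 0 := by simpa using hD
      have hVc : conj (V t) * conj (D t) = 1 - (crd t)⁻¹ ^ 2 := by
        rw [← map_mul, h1, map_sub, map_pow, conj_crd, map_one]
      have hbc : conj (b t) * D t = conj (D t) := by
        have := congrArg conj h2
        rwa [map_mul, Complex.conj_conj] at this
      have hV : V t = (1 - crd t ^ 2) / D t := by rw [← h1]; field_simp
      have hb : b t = D t / conj (D t) := by rw [eq_div_iff hDc]; exact h2
      rw [hZ]
      simp only [reflFun, map_mul, map_add, Complex.conj_conj, map_zpow₀, conj_crd, hV, hb,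
        map_div₀, map_sub, map_pow, map_one]
      have e1 : ((crd t)⁻¹) ^ (((2 * n : ℕ)) : ℤ) = (crd t ^ (2 * n))⁻¹ := by
        rw [zpow_natCast, inv_pow]
      have e2 : crd t ^ (-(2 * n + 2 : ℤ)) = (crd t ^ (2 * n))⁻¹ * (crd t ^ 2)⁻¹ := by
        rw [neg_add, zpow_add₀ hu, zpow_neg, zpow_neg]; norm_cast
      rw [e1, e2, zpow_natCast]
      have hu2 : crd t ^ (2 * n) ≠ 0 := pow_ne_zero _ hu
      generalize crd t ^ (2 * n) = U at *
      field_simp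
      ring
    rw [fco_congr this, fco_const_mul, fco_mul_zpow]
    rw [neg_one_mul]; congr 2; ring
  have hz : ∀ k : ℕ, ((fco Z (-k)).re : ℂ) = fco Z (-k) := fun k =>
    Complex.conj_eq_iff_re.mp (hreal _)
  have hanti : ∀ k ≤ 2 * n + 2, (fco Z (-((2 * n + 2 - k : ℕ) : ℤ))).re = -(fco Z (-k)).re := by
    intro k hk
    have := hsymm k
    rw [this, Complex.neg_re, neg_neg]
    congr 2; push_cast [hk]; ring
  refine ⟨fun k => (fco Z (-k)).re, ?_, hanti, ?_, ?_, ?_⟩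
  · have := hanti (n + 1) (by omega)
    rw [show 2 * n + 2 - (n + 1) = n + 1 by omega] at this
    linarith
  · intro m
    split_ifs with hm
    · simp only
      rw [hz]; congr 1; omega
    · by_cases h1 : 1 ≤ m
      · exact hpos m h1
      · have := hsymm (-m)
        rw [neg_neg] at this
        rw [this, hpos _ (by omega), neg_zero]
  · simp only
    rw [hz]
    refine (hsum _).unique ?_
    convert hasSum_ite_eq 0 (fco V 0) using 2 with k
    by_cases hk : k = 0
    · subst hk; simp [hx0]
    · rw [if_neg hk, S.fcoV _ (by push_cast; omega), mul_zero]
  · simp only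
    rw [hz]
    refine (hsum _).unique ?_
    have h2 : ∀ k ∉ ({0, 1} : Finset ℕ), x k * fco V (-((1:ℕ):ℤ) + k) = 0 := by
      intro k hk
      simp only [Finset.mem_insert, Finset.mem_singleton, not_or] at hk
      rw [S.fcoV _ (by push_cast; omega), mul_zero]
    have h3 : HasSum (fun k => x k * fco V (-((1:ℕ):ℤ) + k)) _ :=
      hasSum_sum_of_ne_finset_zero h2
    rw [Finset.sum_pair (by norm_num), hx0, hx1] at h3
    convert h3 using 1
    push_cast
    ring

end Solution

/-- The polynomial `∑ z_{n-j} U_j`. -/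
noncomputable def chebSum (z : ℕ → ℝ) (n : ℕ) : ℝ[X] :=
  ∑ j ∈ Finset.range (n + 1), C (z (n - j)) * Polynomial.Chebyshev.U ℝ (j : ℕ)

lemma chebSum_natDegree (z : ℕ → ℝ) (n : ℕ) : (chebSum z n).natDegree ≤ n := by
  refine natDegree_sum_le_of_forall_le _ _ (fun j hj => ?_)
  refine (natDegree_C_mul_le _ _).trans ?_
  rw [Polynomial.Chebyshev.natDegree_U_natCast]
  have := Finset.mem_range.mp hj; omega


lemma chebSum_coeff_self (z : ℕ → ℝ) (n : ℕ) : (chebSum z n).coeff n = z 0 * 2 ^ n := by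
  unfold chebSum
  rw [finsetSum_coeff, Finset.sum_eq_single_of_mem n (by simp)]
  · rw [coeff_C_mul, chebyshevU_coeff_self]; simp
  · intro j hj hne
    have := Finset.mem_range.mp hj
    rw [coeff_C_mul, coeff_eq_zero_of_natDegree_lt, mul_zero]
    rw [Polynomial.Chebyshev.natDegree_U_natCast]; omega

lemma chebSum_coeff_pred (z : ℕ → ℝ) (n : ℕ) : (chebSum z (n + 1)).coeff n = z 1 * 2 ^ n := by
  unfold chebSum
  rw [finsetSum_coeff, Finset.sum_eq_single_of_mem n (by simp)]
  · rw [coeff_C_mul, chebyshevU_coeff_self]; simp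
  · intro j hj hne
    have := Finset.mem_range.mp hj
    rw [coeff_C_mul]
    by_cases h : j = n + 1
    · subst h; rw [chebyshevU_coeff_pred, mul_zero]
    rw [coeff_eq_zero_of_natDegree_lt, mul_zero]
    rw [Polynomial.Chebyshev.natDegree_U_natCast]; omega

lemma chebSum_crd (z : ℕ → ℝ) (n : ℕ) (t : Tor) :
    (((chebSum z n).eval (crd t).re : ℝ) : ℂ) * ((crd t)⁻¹ - crd t) =
      ∑ j ∈ Finset.range (n + 1), (z (n - j) : ℂ) *
        (crd t ^ (-((j:ℤ) + 1)) - crd t ^ ((j:ℤ) + 1)) := by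
  unfold chebSum
  rw [eval_finsetSum]
  push_cast
  rw [Finset.sum_mul]
  refine Finset.sum_congr rfl (fun j _ => ?_)
  rw [eval_mul, eval_C, ← chebyshevU_crd]; push_cast; ring

lemma fco_finset_sum {ι : Type*} (s : Finset ι) (f : ι → Tor → ℂ)
    (hf : ∀ i ∈ s, Integrable (f i) torMeasure) (m : ℤ) :
    fco (fun t => ∑ i ∈ s, f i t) m = ∑ i ∈ s, fco (f i) m := by
  unfold fco
  rw [← integral_finsetSum _ (fun i hi => integrable_mul_zpow (hf i hi) m)]
  congr 1; ext t; rw [Finset.sum_mul]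

lemma memLp_trig (z : ℕ → ℝ) (n : ℕ) : MemLp (fun t => ∑ j ∈ Finset.range (n + 1),
    (z (n - j) : ℂ) * (crd t ^ ((n:ℤ) - j) - crd t ^ ((n:ℤ) + j + 2))) 2 torMeasure :=
  memLp_finsetSum _ (fun _ _ =>
    ((memLp_crd_zpow 2 _).sub (memLp_crd_zpow 2 _)).const_mul _)

lemma fco_trig (z : ℕ → ℝ) (n : ℕ) (m : ℤ) : fco (fun t => ∑ j ∈ Finset.range (n + 1),
    (z (n - j) : ℂ) * (crd t ^ ((n:ℤ) - j) - crd t ^ ((n:ℤ) + j + 2))) m =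
    ∑ j ∈ Finset.range (n + 1), (z (n - j) : ℂ) *
      ((if (n:ℤ) - j + m = 0 then 1 else 0) - (if (n:ℤ) + j + 2 + m = 0 then 1 else 0)) := by
  have hi : ∀ k : ℤ, Integrable (fun t => crd t ^ k) torMeasure := fun k =>
    integrable_of_memLp_two (memLp_crd_zpow 2 k)
  rw [fco_finset_sum _ (fun j t => (z (n - j) : ℂ) *
    (crd t ^ ((n:ℤ) - j) - crd t ^ ((n:ℤ) + j + 2)))
    (fun j _ => ((hi _).sub (hi _)).const_mul _)]
  refine Finset.sum_congr rfl (fun j _ => ?_)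
  rw [fco_const_mul, ← fco_zpow, ← fco_zpow]
  congr 1
  unfold fco
  rw [← integral_sub (integrable_mul_zpow (hi _) _) (integrable_mul_zpow (hi _) _)]
  congr 1; ext t; ring

lemma sum_trig_coeff {z : ℕ → ℝ} {n : ℕ} (h0 : z (n + 1) = 0)
    (hz : ∀ k ≤ 2 * n + 2, z (2 * n + 2 - k) = - z k) (m : ℤ) :
    ∑ j ∈ Finset.range (n + 1), (z (n - j) : ℂ) *
      ((if (n:ℤ) - j + m = 0 then 1 else 0) - (if (n:ℤ) + j + 2 + m = 0 then 1 else 0)) =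
      if m ≤ 0 ∧ -(2 * n + 2 : ℤ) ≤ m then (z m.natAbs : ℂ) else 0 := by
  by_cases hm : m ≤ 0 ∧ -(2 * n + 2 : ℤ) ≤ m
  · rw [if_pos hm]
    obtain ⟨k, rfl⟩ : ∃ k : ℕ, m = -k := ⟨m.natAbs, by omega⟩
    rw [Int.natAbs_neg, Int.natAbs_natCast]
    rcases lt_trichotomy k (n + 1) with hk | hk | hk
    · rw [Finset.sum_eq_single_of_mem (n - k) (Finset.mem_range.mpr (by omega))]
      · rw [if_pos (by omega), if_neg (by omega), show n - (n - k) = k by omega]; simp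
      · intro j hj hne
        have := Finset.mem_range.mp hj
        rw [if_neg (by omega), if_neg (by omega)]; simp
    · subst hk
      rw [h0, Finset.sum_eq_zero]
      · simp
      · intro j hj
        have := Finset.mem_range.mp hj
        rw [if_neg (by omega), if_neg (by omega)]; simp
    · rw [Finset.sum_eq_single_of_mem (k - n - 2) (Finset.mem_range.mpr (by omega))]
      · rw [if_neg (by omega), if_pos (by omega)]
        have := hz k (by omega)
        rw [show n - (k - n - 2) = 2 * n + 2 - k by omega, this]; simp
      · intro j hj hne
        have := Finset.mem_range.mp hj
        rw [if_neg (by omega), if_neg (by omega)]; simp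
  · rw [if_neg hm]
    refine Finset.sum_eq_zero (fun j hj => ?_)
    have := Finset.mem_range.mp hj
    rw [if_neg (by omega), if_neg (by omega)]; simp

/-- The polynomial built from the solution of the Hankel system has trivial low-order moments. -/
lemma SzegoData.exists_poly {D V b : Tor → ℂ} (S : SzegoData D V b) {n : ℕ} {v : Ell2}
    (hv : v + hankelOp b S.memb (2 * n) v = unitVec 0) (hvr : ∀ k, conj (v k) = v k) :
    ∃ z : ℕ → ℝ, (z 0 : ℂ) = fco V 0 ∧
      (z 1 : ℂ) = fco V 0 * fco (reflFun b (2 * n) v) (-1) + fco V (-1) ∧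
      (fun t => (((chebSum z n).eval (crd t).re : ℝ) : ℂ) * (D t * conj (D t))) =ᵐ[torMeasure]
        fun t => conj (D t * embPos v t * crd t ^ (n : ℤ)) + D t * embPos v t * crd t ^ (n : ℤ) := by
  obtain ⟨z, hz0, hz, hfc, h0, h1⟩ := S.fco_prod hv hvr
  refine ⟨z, h0, h1, ?_⟩
  have hZ : (fun t => V t * reflFun b (2 * n) v t) =ᵐ[torMeasure] fun t =>
      ∑ j ∈ Finset.range (n + 1),
        (z (n - j) : ℂ) * (crd t ^ ((n:ℤ) - j) - crd t ^ ((n:ℤ) + j + 2)) := by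
    refine ae_eq_of_fco (memLp_mul_top S.memV (memLp_reflFun S.memb _ _)) (memLp_trig z n)
      (fun m => ?_)
    rw [hfc, fco_trig, sum_trig_coeff hz0 hz]
  filter_upwards [hZ, S.prod_ae, S.quot_ae, ae_crd_ne 1, ae_crd_ne (-1)] with t hZ h1 h2 h3 h4
  have hu := crd_ne_zero t
  have hne : 1 - crd t ^ 2 ≠ 0 := by
    rw [show 1 - crd t ^ 2 = (1 - crd t) * (1 + crd t) by ring]
    refine mul_ne_zero (sub_ne_zero.mpr (Ne.symm h3)) (fun h => h4 ?_)
    linear_combination h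
  have hD : D t ≠ 0 := fun h => hne (by rw [← h1, h, mul_zero])
  have hZ2 : V t * reflFun b (2 * n) v t = crd t ^ (n + 1) *
      ((((chebSum z n).eval (crd t).re : ℝ) : ℂ) * ((crd t)⁻¹ - crd t)) := by
    rw [hZ, chebSum_crd, Finset.mul_sum]
    refine Finset.sum_congr rfl (fun j _ => ?_)
    have e5 : crd t ^ (n + 1) * (crd t ^ (-((j:ℤ) + 1)) - crd t ^ ((j:ℤ) + 1)) =
        crd t ^ ((n:ℤ) - j) - crd t ^ ((n:ℤ) + j + 2) := by
      rw [mul_sub, ← zpow_natCast, ← zpow_add₀ hu, ← zpow_add₀ hu]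
      congr 2 <;> push_cast <;> ring
    rw [mul_left_comm, e5]
  have hX : reflFun b (2 * n) v t = crd t ^ n *
      (((chebSum z n).eval (crd t).re : ℝ) : ℂ) * D t := by
    have e : (1 - crd t ^ 2) * reflFun b (2 * n) v t = (1 - crd t ^ 2) * (crd t ^ n *
      (((chebSum z n).eval (crd t).re : ℝ) : ℂ) * D t) := by
      have e3 : crd t ^ (n + 1) * ((crd t)⁻¹ - crd t) = crd t ^ n * (1 - crd t ^ 2) := by
        field_simp
        ring
      calc _ = D t * (V t * reflFun b (2 * n) v t) := by rw [← h1]; ring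
        _ = (crd t ^ (n + 1) * ((crd t)⁻¹ - crd t)) *
            (((chebSum z n).eval (crd t).re : ℝ) : ℂ) * D t := by rw [hZ2]; ring
        _ = _ := by rw [e3]; ring
    exact mul_left_cancel₀ hne e
  have hX2 : (((chebSum z n).eval (crd t).re : ℝ) : ℂ) * (D t * conj (D t)) =
      (crd t ^ n)⁻¹ * (reflFun b (2 * n) v t * conj (D t)) := by
    rw [hX]; field_simp
  rw [hX2, reflFun, map_mul, map_mul, map_zpow₀, conj_crd]
  have e4 : b t * embPos v t * crd t ^ ((2 * n : ℕ) : ℤ) * conj (D t) =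
      D t * embPos v t * crd t ^ n * crd t ^ n := by
    rw [zpow_natCast]
    linear_combination embPos v t * crd t ^ (2 * n) * h2
  rw [add_mul, e4, zpow_natCast, zpow_natCast, inv_pow]
  have : crd t ^ n ≠ 0 := pow_ne_zero _ hu
  field_simp

theorem szego_identity {D V b : Tor → ℂ} (S : SzegoData D V b) {L : ℝ[X] →ₗ[ℝ] ℝ}
    (hL : ∀ q : ℝ[X], ((L q : ℝ) : ℂ) =
      Real.pi * fco (fun t => ((q.eval (crd t).re : ℝ) : ℂ) * (D t * conj (D t))) 0)
    (hpos : PosFun L) {P : ℕ → ℝ[X]} (hP : IsOPS L P) {n : ℕ} (hn : 1 ≤ n) {v : Ell2}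
    (hv : v + hankelOp b S.memb (2 * n) v = unitVec 0) (hvr : ∀ k, conj (v k) = v k) :
    ((L (P n * X ^ n) : ℝ) : ℂ) = 2 * Real.pi * (1 / 4) ^ n * fco D 0 ^ 2 * v 0 ∧
    (((P n).coeff (n - 1) : ℝ) : ℂ) =
      (hankelOp b S.memb (2 * n - 1) v 0 + fco V (-1) * fco D 0) / 2 := by
  obtain ⟨z, hz0, hz1, hg⟩ := S.exists_poly hv hvr
  set F : Tor → ℂ := fun t => D t * embPos v t with hF
  have hFm : MemLp F 2 torMeasure := memLp_mul_top S.memD (Lp.memLp _)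
  have hFsum := fun m => hasSum_fco_mul_embPos (memLp_two_of_top S.memD) v m
  have hFpos : ∀ m : ℤ, 1 ≤ m → fco F m = 0 := fun m hm => by
    refine (hFsum m).unique ?_
    convert hasSum_zero with k
    rw [S.fcoD _ (by omega), mul_zero]
  have hF0 : fco F 0 = v 0 * fco D 0 := by
    refine (hFsum 0).unique ?_
    convert hasSum_ite_eq 0 (v 0 * fco D 0) using 2 with k
    by_cases hk : k = 0
    · subst hk; simp
    · rw [if_neg hk, S.fcoD _ (by omega), mul_zero]
  have hF0r : conj (fco F 0) = fco F 0 := by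
    rw [hF0, map_mul, hvr, S.realD]
  set g : Tor → ℂ := fun t => conj (F t * crd t ^ (n : ℤ)) + F t * crd t ^ (n : ℤ) with hgdef
  have hFn : MemLp (fun t => F t * crd t ^ (n : ℤ)) 2 torMeasure := memLp_mul_zpow hFm _
  have hgi : Integrable g torMeasure :=
    (integrable_of_memLp_two (memLp_conj hFn)).add (integrable_of_memLp_two hFn)
  have hgm : ∀ m : ℤ, fco g m = conj (fco F (n - m)) + fco F (n + m) := fun m => by
    rw [hgdef, fco_add (integrable_of_memLp_two (memLp_conj hFn)) (integrable_of_memLp_two hFn),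
      fco_conj, fco_mul_zpow, fco_mul_zpow, sub_eq_add_neg]
  have hgsmall : ∀ m : ℤ, |m| < n → fco g m = 0 := fun m hm => by
    obtain ⟨h1, h2⟩ := abs_lt.mp hm
    rw [hgm, hFpos _ (by omega), hFpos _ (by omega)]; simp
  have hLQ : ∀ k : ℕ, ((L (chebSum z n * X ^ k) : ℝ) : ℂ) =
      Real.pi * fco (fun t => g t * ((crd t).re : ℂ) ^ k) 0 := fun k => by
    rw [hL]
    congr 1
    refine fco_congr ?_ 0
    filter_upwards [hg] with t ht
    have ht' : _ = g t := ht
    rw [← ht', eval_mul, eval_pow, eval_X]; push_cast; ring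
  have horth : ∀ k < n, L (chebSum z n * X ^ k) = 0 := fun k hk => by
    have := hLQ k
    rw [fco_re_pow_eq_zero hgi hgsmall k 0 (by simpa using hk), mul_zero] at this
    exact_mod_cast this
  have htop : ((L (chebSum z n * X ^ n) : ℝ) : ℂ) =
      Real.pi * ((1 / 2) ^ n * (2 * (v 0 * fco D 0))) := by
    have h2n := hFpos ((n:ℤ) + n) (by omega)
    rw [hLQ, fco_re_pow_top hgi hn hgsmall, hgm, hgm, sub_self, sub_neg_eq_add, add_neg_cancel,
      h2n, hF0r, hF0, map_zero]
    ring
  have hQ := hP.eq_smul hpos horth (chebSum_natDegree z n)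
  rw [chebSum_coeff_self] at hQ
  have hDV := S.value_mul
  have hD0 : fco D 0 ≠ 0 := left_ne_zero_of_mul (hDV ▸ one_ne_zero)
  have hV0 : fco V 0 = (fco D 0)⁻¹ := by field_simp; rw [mul_comm]; exact hDV
  constructor
  · rw [hQ, mul_assoc, ← smul_eq_C_mul, map_smul, smul_eq_mul] at htop
    push_cast at htop
    rw [hz0, hV0] at htop
    have h2 : (2:ℂ) ^ n ≠ 0 := pow_ne_zero _ two_ne_zero
    rw [show (1 / 4 : ℂ) = (1 / 2) * (1 / 2) by norm_num, mul_pow]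
    have h3 : (1 / 2 : ℂ) ^ n * 2 ^ n = 1 := by rw [← mul_pow]; norm_num
    have h4 : (L (P n * X ^ n) : ℂ) = fco D 0 * (1 / 2) ^ n *
        ((fco D 0)⁻¹ * 2 ^ n * (L (P n * X ^ n) : ℂ)) := by
      linear_combination -(L (P n * X ^ n) : ℂ) * h3 +
        -(L (P n * X ^ n) : ℂ) * (1 / 2) ^ n * 2 ^ n * (mul_inv_cancel₀ hD0)
    rw [h4, htop]; ring
  · obtain ⟨k, rfl⟩ : ∃ k, n = k + 1 := ⟨n - 1, by omega⟩
    have h1 := congrArg (fun q => ((q.coeff k : ℝ) : ℂ)) hQ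
    simp only [chebSum_coeff_pred, coeff_C_mul] at h1
    push_cast at h1
    rw [hz0, hz1, hV0] at h1
    have h2 : fco (reflFun b (2 * (k + 1)) v) (-1) = hankelOp b S.memb (2 * k + 1) v 0 :=
      fco_reflFun_neg_one S.memb (2 * k + 1) v
    rw [h2, pow_succ] at h1
    simp only [Nat.add_sub_cancel]
    rw [show 2 * (k + 1) - 1 = 2 * k + 1 by omega]
    have h3 : (2:ℂ) ^ k ≠ 0 := pow_ne_zero _ two_ne_zero
    field_simp at h1 ⊢
    linear_combination -h1

end SzegoIdentityMain

section Hardy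

open scoped ENNReal InnerProductSpace ComplexConjugate

lemma circleMap_eq_crd (r x : ℝ) : circleMap 0 r x = r * crd (x : Tor) := by
  rw [crd_coe, circleMap]; simp

lemma integral_analytic_circle {G : ℂ → ℂ} (hG : DifferentiableOn ℂ G (Metric.ball 0 1))
    {r : ℝ} (hr : r ∈ Ioo (0:ℝ) 1) : ∫ t, G (r * crd t) ∂torMeasure = G 0 := by
  have h1 : DiffContOnCl ℂ G (Metric.ball 0 |r|) := by
    refine (hG.mono ?_).diffContOnCl
    rw [abs_of_pos hr.1]
    refine (closure_minimal Metric.ball_subset_closedBall Metric.isClosed_closedBall).trans ?_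
    exact Metric.closedBall_subset_ball hr.2
  have h2 := h1.circleAverage
  rw [Real.circleAverage] at h2
  rw [integral_tor _ 0, zero_add, ← h2]
  simp only [circleMap_eq_crd]

lemma hardy_of_analytic {G : ℂ → ℂ} {φ : Tor → ℂ} (hG : DifferentiableOn ℂ G (Metric.ball 0 1))
    {C : ℝ} (hC : ∀ z ∈ Metric.ball (0:ℂ) 1, ‖G z‖ ≤ C)
    (hlim : ∀ᵐ t ∂torMeasure,
      Tendsto (fun r : ℝ => G (r * crd t)) (nhdsWithin 1 (Iio 1)) (nhds (φ t))) :
    MemLp φ ∞ torMeasure ∧ (∀ m : ℤ, 1 ≤ m → fco φ m = 0) ∧ fco φ 0 = G 0 := by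
  have hev : ∀ᶠ r in nhdsWithin (1:ℝ) (Iio 1), r ∈ Ioo (0:ℝ) 1 := Ioo_mem_nhdsLT (by norm_num)
  have hmem : ∀ (t : Tor) (r : ℝ), r ∈ Ioo (0:ℝ) 1 → (r * crd t : ℂ) ∈ Metric.ball (0:ℂ) 1 := by
    intro t r hr
    rw [mem_ball_zero_iff, norm_mul, norm_crd, mul_one, Complex.norm_real, Real.norm_eq_abs,
      abs_of_pos hr.1]
    exact hr.2
  have hmeas : ∀ r ∈ Ioo (0:ℝ) 1, Continuous (fun t => G (r * crd t)) := by
    intro r hr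
    exact hG.continuousOn.comp_continuous (continuous_const.mul continuous_crd)
      (fun t => hmem t r hr)
  have hφm : AEStronglyMeasurable φ torMeasure := by
    obtain ⟨ρ, hρ, hρm⟩ := (frequently_iff_seq_forall.mp hev.frequently)
    exact aestronglyMeasurable_of_tendsto_ae atTop
      (fun n => (hmeas _ (hρm n)).aestronglyMeasurable)
      (by filter_upwards [hlim] with t ht using ht.comp hρ)
  have hb : ∀ᵐ t ∂torMeasure, ‖φ t‖ ≤ C := by
    filter_upwards [hlim] with t ht
    refine le_of_tendsto ht.norm ?_
    filter_upwards [hev] with r hr using hC _ (hmem t r hr)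
  have hmain : ∀ m : ℕ, fco φ m = G 0 * 0 ^ m := by
    intro m
    have hlim2 : Tendsto (fun r : ℝ => ∫ t, G (r * crd t) * (r * crd t) ^ m ∂torMeasure)
        (nhdsWithin 1 (Iio 1)) (nhds (∫ t, φ t * crd t ^ (m:ℤ) ∂torMeasure)) := by
      refine tendsto_integral_filter_of_dominated_convergence (fun _ => C) ?_ ?_
        (integrable_const _) ?_
      · filter_upwards [hev] with r hr
        exact ((hmeas r hr).mul
          ((continuous_const.mul continuous_crd).pow m)).aestronglyMeasurable
      · filter_upwards [hev] with r hr
        filter_upwards with t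
        rw [norm_mul, norm_pow]
        refine (mul_le_of_le_one_right (norm_nonneg _) ?_).trans (hC _ (hmem t r hr))
        exact pow_le_one₀ (norm_nonneg _) (mem_ball_zero_iff.mp (hmem t r hr)).le
      · filter_upwards [hlim] with t ht
        refine ht.mul ?_
        rw [zpow_natCast]
        refine Tendsto.pow ?_ m
        have h1 : Tendsto (fun r : ℝ => (r : ℂ)) (nhdsWithin 1 (Iio 1)) (nhds ((1:ℝ):ℂ)) :=
          (Complex.continuous_ofReal.tendsto 1).mono_left nhdsWithin_le_nhds
        simpa using h1.mul_const (crd t)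
    refine tendsto_nhds_unique hlim2 (tendsto_const_nhds.congr' ?_)
    filter_upwards [hev] with r hr
    have := integral_analytic_circle (G := fun z => G z * z ^ m)
      (hG.mul (differentiableOn_id.pow m)) hr
    exact this.symm
  refine ⟨MemLp.of_bound hφm C hb, fun m hm => ?_, by simpa using hmain 0⟩
  obtain ⟨k, rfl⟩ : ∃ k : ℕ, m = k := ⟨m.toNat, by omega⟩
  rw [hmain, zero_pow (by omega), mul_zero]

/-- Functions on the disc whose exponential is a bounded outer function. -/
structure LogLike (F : ℂ → ℂ) : Prop where
  diff : DifferentiableOn ℂ F (Metric.ball 0 1)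
  cont : ∀ᵐ t ∂torMeasure, ContinuousWithinAt F (Metric.closedBall 0 1) (crd t)
  bdd : ∃ C : ℝ, ∀ z ∈ Metric.ball (0:ℂ) 1, (F z).re ≤ C

lemma LogLike.add {F G : ℂ → ℂ} (hF : LogLike F) (hG : LogLike G) :
    LogLike (fun z => F z + G z) := by
  refine ⟨hF.diff.add hG.diff, ?_, ?_⟩
  · filter_upwards [hF.cont, hG.cont] with t h1 h2 using h1.add h2
  · obtain ⟨C, hC⟩ := hF.bdd
    obtain ⟨C', hC'⟩ := hG.bdd
    exact ⟨C + C', fun z hz => by simpa using add_le_add (hC z hz) (hC' z hz)⟩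

lemma LogLike.hardy {F : ℂ → ℂ} (hF : LogLike F) :
    MemLp (fun t => Complex.exp (F (crd t))) ∞ torMeasure ∧
    (∀ m : ℤ, 1 ≤ m → fco (fun t => Complex.exp (F (crd t))) m = 0) ∧
    fco (fun t => Complex.exp (F (crd t))) 0 = Complex.exp (F 0) := by
  obtain ⟨C, hC⟩ := hF.bdd
  refine hardy_of_analytic (G := fun z => Complex.exp (F z)) hF.diff.cexp (C := Real.exp C)
    (fun z hz => ?_) ?_
  · rw [Complex.norm_exp]; exact Real.exp_le_exp.mpr (hC z hz)
  · filter_upwards [hF.cont] with t ht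
    refine (Complex.continuous_exp.tendsto _).comp (ht.tendsto.comp ?_)
    refine tendsto_nhdsWithin_iff.mpr ⟨?_, ?_⟩
    · have h1 : Tendsto (fun r : ℝ => (r : ℂ)) (nhdsWithin 1 (Iio 1)) (nhds ((1:ℝ):ℂ)) :=
        (Complex.continuous_ofReal.tendsto 1).mono_left nhdsWithin_le_nhds
      simpa using h1.mul_const (crd t)
    · filter_upwards [Ioo_mem_nhdsLT (show (0:ℝ) < 1 by norm_num)] with r hr
      rw [mem_closedBall_zero_iff, norm_mul, norm_crd, mul_one, Complex.norm_real,
        Real.norm_eq_abs, abs_of_pos hr.1]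
      exact hr.2.le

/-- `log (1 - ω z)`. -/
noncomputable def lg (ω z : ℂ) : ℂ := Complex.log (1 - ω * z)

lemma one_sub_mem_slitPlane {w : ℂ} (hw : ‖w‖ ≤ 1) (h : w ≠ 1) : 1 - w ∈ Complex.slitPlane := by
  left
  simp only [Complex.sub_re, Complex.one_re, sub_pos]
  refine lt_of_le_of_ne ((Complex.re_le_norm w).trans hw) (fun hre => h ?_)
  have h1 := Complex.sq_norm w
  rw [Complex.normSq_apply, hre] at h1
  have h2 : w.im = 0 := by nlinarith [norm_nonneg w, mul_self_nonneg w.im]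
  exact Complex.ext hre h2

lemma lg_zero (ω : ℂ) : lg ω 0 = 0 := by simp [lg]

lemma exp_lg {ω z : ℂ} (h : ω * z ≠ 1) : Complex.exp (lg ω z) = 1 - ω * z :=
  Complex.exp_log (sub_ne_zero.mpr (Ne.symm h))

lemma differentiableAt_lg {ω z : ℂ} (hω : ‖ω‖ = 1) (hz : ‖z‖ ≤ 1) (h : ω * z ≠ 1) :
    DifferentiableAt ℂ (lg ω) z := by
  refine DifferentiableAt.clog (by fun_prop) (one_sub_mem_slitPlane ?_ h)
  rwa [norm_mul, hω, one_mul]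

lemma abs_im_lg_le (ω z : ℂ) : |(lg ω z).im| ≤ Real.pi := by
  rw [lg, Complex.log_im]; exact Complex.abs_arg_le_pi _

lemma logLike_lg {ω : ℂ} (hω : ‖ω‖ = 1) {c : ℂ} (hc : 0 ≤ c.re) :
    LogLike (fun z => c * lg ω z) := by
  have hω0 : ω ≠ 0 := by rw [← norm_pos_iff, hω]; norm_num
  refine ⟨fun z hz => ?_, ?_, c.re * Real.log 2 + |c.im| * Real.pi, fun z hz => ?_⟩
  · have hz1 : ‖z‖ < 1 := mem_ball_zero_iff.mp hz
    refine ((differentiableAt_lg hω hz1.le (fun h => ?_)).const_mul c).differentiableWithinAt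
    have := congrArg norm h
    rw [norm_mul, hω, one_mul, norm_one] at this
    exact hz1.ne this
  · filter_upwards [ae_crd_ne ω⁻¹] with t ht
    refine ((differentiableAt_lg hω (norm_crd t).le (fun h => ht ?_)).continuousAt.const_mul
      c).continuousWithinAt
    exact eq_inv_of_mul_eq_one_right h
  · have hz1 : ‖z‖ < 1 := mem_ball_zero_iff.mp hz
    rw [Complex.mul_re]
    have h1 : (lg ω z).re ≤ Real.log 2 := by
      rw [lg, Complex.log_re]
      have h0 : 1 - ω * z ≠ 0 := by
        intro h
        have := congrArg norm (sub_eq_zero.mp h)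
        rw [norm_mul, hω, one_mul, norm_one] at this
        exact hz1.ne this.symm
      refine Real.log_le_log (norm_pos_iff.mpr h0) ((norm_sub_le _ _).trans ?_)
      rw [norm_one, norm_mul, hω]; linarith
    have h2 := abs_im_lg_le ω z
    have h3 : -(c.im * (lg ω z).im) ≤ |c.im| * Real.pi :=
      (neg_le_abs _).trans (by rw [abs_mul]; gcongr)
    have h4 := mul_le_mul_of_nonneg_left h1 hc
    linarith

lemma logLike_const (c : ℂ) : LogLike (fun _ => c) :=
  ⟨differentiableOn_const c, by filter_upwards with t using continuousWithinAt_const,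
    c.re, fun _ _ => le_rfl⟩

lemma crd_neg (t : Tor) : crd (-t) = (crd t)⁻¹ := by
  rw [crd, crd, AddCircle.toCircle_neg]; simp

lemma conj_fco_of_symm {φ : Tor → ℂ} (h : ∀ᵐ t ∂torMeasure, φ (-t) = conj (φ t)) (m : ℤ) :
    conj (fco φ m) = fco φ m := by
  have h1 := fco_conj φ (-m)
  rw [neg_neg] at h1
  rw [← h1, ← fco_congr h]
  unfold fco
  rw [← integral_neg_eq_self]
  congr 1; ext t
  beta_reduce
  rw [crd_neg, neg_neg, inv_zpow, zpow_neg, inv_inv]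

lemma fco_add_right (φ : Tor → ℂ) (s : Tor) (m : ℤ) :
    fco (fun t => φ (t + s)) m = crd s ^ (-m) * fco φ m := by
  unfold fco
  rw [← integral_add_right_eq_self (fun t => φ t * crd t ^ m) s, ← integral_const_mul]
  congr 1; ext t
  have : crd (t + s) = crd t * crd s := by rw [crd, crd, crd, AddCircle.toCircle_add]; simp
  rw [this, mul_zpow, zpow_neg]
  have := zpow_ne_zero m (crd_ne_zero s)
  field_simp

lemma crd_add (s t : Tor) : crd (s + t) = crd s * crd t := by
  rw [crd, crd, crd, AddCircle.toCircle_add]; simp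

/-- `log (1 - u)` on the circle. -/
lemma lg_one_crd {x : ℝ} (hx : x ∈ Ioo 0 (2 * Real.pi)) :
    lg 1 (crd (x : Tor)) = Real.log (2 * Real.sin (x / 2)) + Complex.I * ((x - Real.pi) / 2 : ℝ) := by
  have hs : 0 < Real.sin (x / 2) :=
    Real.sin_pos_of_pos_of_lt_pi (by linarith [hx.1]) (by linarith [hx.2])
  have h1 : 1 - 1 * crd (x : Tor) = ((2 * Real.sin (x / 2) : ℝ) : ℂ) *
      Complex.exp (((x - Real.pi) / 2 : ℝ) * Complex.I) := by
    rw [crd_coe]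
    have e1 : Complex.exp (x * Complex.I) = Complex.exp ((x / 2 : ℝ) * Complex.I) ^ 2 := by
      rw [← Complex.exp_nat_mul]; congr 1; push_cast; ring
    have e2 : Complex.exp (((x - Real.pi) / 2 : ℝ) * Complex.I) =
        Complex.exp ((x / 2 : ℝ) * Complex.I) * (-Complex.I) := by
      rw [← Complex.exp_neg_pi_div_two_mul_I, ← Complex.exp_add]
      congr 1; push_cast; ring
    rw [e1, e2, Complex.exp_mul_I]
    push_cast
    have := Complex.sin_sq_add_cos_sq ((x:ℂ) / 2)
    have hI := Complex.I_sq
    linear_combination -this + Complex.sin ((x:ℂ) / 2) ^ 2 * hI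
  rw [lg, h1, Complex.log_ofReal_mul (by positivity) (Complex.exp_ne_zero _), Complex.log_exp]
  · ring
  · simp; linarith [hx.1, Real.pi_pos]
  · simp; linarith [hx.2, Real.pi_pos]

end Hardy

section Model

open scoped ENNReal InnerProductSpace ComplexConjugate

/-- The function `(1 - u)^{iν}`. -/
noncomputable def outer1 (ν : ℝ) (t : Tor) : ℂ := Complex.exp (Complex.I * ν * lg 1 (crd t))

/-- The function `|1 - u|^{2 i ν}`. -/
noncomputable def quot1 (ν : ℝ) (t : Tor) : ℂ :=
  Complex.exp (Complex.I * ν * (lg 1 (crd t) + conj (lg 1 (crd t))))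

/-- The function `((1 - u) / (1 - ū))^a`. -/
noncomputable def jump1 (a : ℂ) (t : Tor) : ℂ :=
  Complex.exp (a * (lg 1 (crd t) - conj (lg 1 (crd t))))

lemma conj_outer1 (ν : ℝ) (t : Tor) :
    conj (outer1 ν t) = Complex.exp (-(Complex.I * ν * conj (lg 1 (crd t)))) := by
  rw [outer1, ← Complex.exp_conj]; simp

lemma quot1_mul_conj_outer1 (ν : ℝ) (t : Tor) : quot1 ν t * conj (outer1 ν t) = outer1 ν t := by
  rw [conj_outer1, quot1, outer1, ← Complex.exp_add]; congr 1; ring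

lemma outer1_mul_conj (ν : ℝ) (t : Tor) :
    outer1 ν t * conj (outer1 ν t) = jump1 (Complex.I * ν) t := by
  rw [conj_outer1, jump1, outer1, ← Complex.exp_add]; congr 1; ring

lemma outer1_mul_neg (ν : ℝ) (t : Tor) : outer1 ν t * outer1 (-ν) t = 1 := by
  rw [outer1, outer1, ← Complex.exp_add, ← Complex.exp_zero]; congr 1; push_cast; ring

lemma outer1_hardy (ν : ℝ) : MemLp (outer1 ν) ∞ torMeasure ∧
    (∀ m : ℤ, 1 ≤ m → fco (outer1 ν) m = 0) ∧ fco (outer1 ν) 0 = 1 := by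
  have := (logLike_lg (ω := 1) (by simp) (c := Complex.I * ν) (by simp)).hardy
  simp only [lg_zero, mul_zero, Complex.exp_zero] at this
  exact this

lemma norm_quot1 (ν : ℝ) (t : Tor) : ‖quot1 ν t‖ = 1 := by
  rw [quot1, Complex.norm_exp, Complex.add_conj, mul_comm Complex.I, mul_assoc]
  simp

lemma norm_jump1_ofReal (a : ℝ) (t : Tor) : ‖jump1 a t‖ = 1 := by
  rw [jump1, Complex.norm_exp, Complex.sub_conj]
  simp

lemma memLp_quot1 (ν : ℝ) : MemLp (quot1 ν) ∞ torMeasure := by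
  have h : quot1 ν = fun t => outer1 ν t * conj (outer1 (-ν) t) := by
    ext t; rw [conj_outer1, quot1, outer1, ← Complex.exp_add]; congr 1; push_cast; ring
  rw [h]
  exact memLp_mul_top (outer1_hardy ν).1 (memLp_conj (outer1_hardy (-ν)).1)

lemma conj_quot1 (ν : ℝ) (t : Tor) : conj (quot1 ν t) * quot1 ν t = 1 := by
  rw [mul_comm, Complex.mul_conj, Complex.normSq_eq_norm_sq, norm_quot1]; simp

/-- Fourier coefficients of the pure jump. -/
lemma fco_jump1 (a : ℂ) (m : ℤ) (h : a + m ≠ 0) :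
    fco (jump1 a) m = Complex.sin (Real.pi * a) / (Real.pi * (a + m)) := by
  unfold fco
  rw [integral_tor _ 0, zero_add]
  have h1 : ∫ x in (0:ℝ)..2 * Real.pi, jump1 a (x : Tor) * crd (x : Tor) ^ m =
      ∫ x in (0:ℝ)..2 * Real.pi, Complex.exp (-(a * Real.pi * Complex.I)) *
        Complex.exp ((a + m) * Complex.I * x) := by
    refine intervalIntegral.integral_congr_ae ?_
    rw [uIoc_of_le (by positivity)]
    have : ∀ᵐ x : ℝ, x ≠ 2 * Real.pi := by simp [ae_iff]
    filter_upwards [this] with x hx hx2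
    have hx3 : x ∈ Ioo 0 (2 * Real.pi) := ⟨hx2.1, lt_of_le_of_ne hx2.2 hx⟩
    rw [jump1, lg_one_crd hx3, crd_coe, ← Complex.exp_int_mul, ← Complex.exp_add,
      ← Complex.exp_add]
    congr 1
    simp only [map_add, map_mul, Complex.conj_ofReal, Complex.conj_I]
    push_cast; ring
  have h2 : (a + m) * Complex.I ≠ 0 := mul_ne_zero h Complex.I_ne_zero
  have hpi : (Real.pi : ℂ) ≠ 0 := by exact_mod_cast Real.pi_ne_zero
  rw [h1, intervalIntegral.integral_const_mul, integral_exp_mul_complex h2]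
  have h3 : Complex.exp ((a + m) * Complex.I * ((2 * Real.pi : ℝ) : ℂ)) =
      Complex.exp (a * Real.pi * Complex.I) * Complex.exp (a * Real.pi * Complex.I) := by
    rw [← Complex.exp_add, show (a + m) * Complex.I * ((2 * Real.pi : ℝ) : ℂ) =
      (a * Real.pi * Complex.I + a * Real.pi * Complex.I) + m * (2 * Real.pi * Complex.I) by
        push_cast; ring]
    rw [Complex.exp_add _ (m * (2 * Real.pi * Complex.I)), Complex.exp_int_mul_two_pi_mul_I,
      mul_one]
  rw [h3, Complex.sin, Complex.real_smul]
  have h4 : Complex.exp (-(a * Real.pi * Complex.I)) * Complex.exp (a * Real.pi * Complex.I) = 1 := by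
    rw [← Complex.exp_add]; simp
  rw [show -(Real.pi * a) * Complex.I = -(a * Real.pi * Complex.I) by ring,
    show Real.pi * a * Complex.I = a * Real.pi * Complex.I by ring]
  push_cast
  rw [mul_zero, Complex.exp_zero]
  generalize Complex.exp (-(a * Real.pi * Complex.I)) = A at *
  generalize Complex.exp (a * Real.pi * Complex.I) = B at *
  have hI := Complex.I_sq
  field_simp
  linear_combination B * h4 + (B - A) * hI

/-- Recursion for the Fourier coefficients of `|1 - u|^{2 i ν}`. -/
lemma fco_quot1_succ (ν : ℝ) (k : ℤ) :
    (k + 1 + Complex.I * ν) * fco (quot1 ν) (k + 1) = (k - Complex.I * ν) * fco (quot1 ν) k := by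
  set f : ℝ → ℂ := fun x => (1 - Complex.exp (x * Complex.I)) * Complex.exp (k * (x * Complex.I)) *
    Complex.exp (2 * Complex.I * ν * Real.log (2 * Real.sin (x / 2))) with hf
  set f' : ℝ → ℂ := fun x => (Complex.I * k + ν) * (quot1 ν (x:Tor) * crd (x:Tor) ^ k) -
    (Complex.I * (k + 1) - ν) * (quot1 ν (x:Tor) * crd (x:Tor) ^ (k + 1)) with hf'
  have hq : ∀ x ∈ Ioo 0 (2 * Real.pi), quot1 ν (x : Tor) =
      Complex.exp (2 * Complex.I * ν * Real.log (2 * Real.sin (x / 2))) := by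
    intro x hx
    rw [quot1, lg_one_crd hx]
    congr 1
    simp only [map_add, map_mul, Complex.conj_ofReal, Complex.conj_I]
    ring
  have hderiv : ∀ x ∈ Ioo 0 (2 * Real.pi), HasDerivAt f (f' x) x := by
    intro x hx
    have hs : 0 < Real.sin (x / 2) :=
      Real.sin_pos_of_pos_of_lt_pi (by linarith [hx.1]) (by linarith [hx.2])
    have d1 : HasDerivAt (fun x : ℝ => (x : ℂ) * Complex.I) Complex.I x := by
      simpa using (Complex.ofRealCLM.hasDerivAt (x := x)).mul_const Complex.I
    have d2 : HasDerivAt (fun x : ℝ => Real.log (2 * Real.sin (x / 2)))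
        ((2 * (Real.cos (x / 2) * (1 / 2))) / (2 * Real.sin (x / 2))) x := by
      refine HasDerivAt.log ?_ (by positivity)
      exact (((hasDerivAt_id x).div_const 2).sin).const_mul 2
    have d3 := ((d2.ofReal_comp.const_mul (2 * Complex.I * ν)).cexp)
    have d4 := (((hasDerivAt_const x (1:ℂ)).sub d1.cexp).mul (d1.const_mul (k:ℂ)).cexp).mul d3
    refine d4.congr_deriv ?_
    simp only [hf', hq x hx, crd_coe, Pi.mul_apply, Pi.sub_apply]
    rw [zpow_add_one₀ (Complex.exp_ne_zero _), ← Complex.exp_int_mul]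
    generalize Complex.exp (2 * Complex.I * ν * Real.log (2 * Real.sin (x / 2))) = E
    generalize Complex.exp (k * (x * Complex.I)) = U
    have e1 : Complex.exp (x * Complex.I) = (Complex.cos (x / 2) + Complex.sin (x / 2) * Complex.I) ^ 2 := by
      rw [← Complex.exp_mul_I, ← Complex.exp_nat_mul]; congr 1; push_cast; ring
    have hs' : Complex.sin (x / 2) ≠ 0 := by
      have : ((Real.sin (x / 2) : ℝ) : ℂ) ≠ 0 := by exact_mod_cast hs.ne'
      simpa using this
    rw [e1]
    push_cast
    have e2 := Complex.sin_sq_add_cos_sq ((x:ℂ) / 2)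
    generalize Complex.sin ((x:ℂ) / 2) = s at *
    generalize Complex.cos ((x:ℂ) / 2) = c at *
    have hI := Complex.I_sq
    field_simp
    linear_combination E * U * ν * ((s - Complex.I * c) * e2 +
      (-2 * c ^ 2 * s - s ^ 2 * c * Complex.I - s ^ 3) * hI)
  have hnorm : ∀ x, ‖f x‖ = ‖1 - Complex.exp (x * Complex.I)‖ := by
    intro x
    rw [hf, norm_mul, norm_mul, Complex.norm_exp, Complex.norm_exp]
    simp
  have hlim : ∀ a : ℝ, Complex.exp (a * Complex.I) = 1 → Tendsto f (nhds a) (nhds 0) := by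
    intro a ha
    rw [tendsto_zero_iff_norm_tendsto_zero]
    simp_rw [hnorm]
    have : Continuous fun x : ℝ => ‖1 - Complex.exp (x * Complex.I)‖ := by fun_prop
    have h2 := this.tendsto a
    simpa [ha] using h2
  have hmeas : Measurable fun x : ℝ => quot1 ν (x : Tor) := by
    have hc : Measurable fun x : ℝ => crd (x : Tor) :=
      (continuous_crd.comp (AddCircle.continuous_mk' _)).measurable
    unfold quot1 lg
    refine Complex.measurable_exp.comp (Measurable.const_mul (Measurable.add ?_ ?_) _)
    · exact Complex.measurable_log.comp ((hc.const_mul 1).const_sub 1)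
    · exact Complex.continuous_conj.measurable.comp
        (Complex.measurable_log.comp ((hc.const_mul 1).const_sub 1))
  have h_integ : ∀ m : ℤ, IntervalIntegrable (fun x : ℝ => quot1 ν (x:Tor) * crd (x:Tor) ^ m)
      volume 0 (2 * Real.pi) := by
    intro m
    refine (intervalIntegrable_const (c := (1:ℝ))).mono_fun' ?_ ?_
    · exact (hmeas.mul ((continuous_crd_zpow m).comp
        (AddCircle.continuous_mk' _)).measurable).aestronglyMeasurable
    · filter_upwards with x
      rw [norm_mul, norm_quot1, norm_zpow, norm_crd, one_zpow, one_mul]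
  have hftc := intervalIntegral.integral_eq_sub_of_hasDerivAt_of_tendsto (a := 0)
    (b := 2 * Real.pi) (by positivity) hderiv
    (((h_integ k).const_mul _).sub ((h_integ (k + 1)).const_mul _))
    ((hlim 0 (by simp)).mono_left nhdsWithin_le_nhds)
    ((hlim (2 * Real.pi) (by push_cast; exact Complex.exp_two_pi_mul_I)).mono_left
      nhdsWithin_le_nhds)
  rw [sub_zero, intervalIntegral.integral_sub ((h_integ k).const_mul _) ((h_integ (k + 1)).const_mul _),
    intervalIntegral.integral_const_mul, intervalIntegral.integral_const_mul] at hftc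
  have hk : ∀ m : ℤ, ∫ x in (0:ℝ)..2 * Real.pi, quot1 ν (x:Tor) * crd (x:Tor) ^ m =
      2 * Real.pi * fco (quot1 ν) m := by
    intro m
    have hpi : (Real.pi : ℂ) ≠ 0 := by exact_mod_cast Real.pi_ne_zero
    rw [fco, integral_tor _ 0, zero_add, Complex.real_smul]
    push_cast
    field_simp
  rw [hk, hk] at hftc
  have hpi : (Real.pi : ℂ) ≠ 0 := by exact_mod_cast Real.pi_ne_zero
  have h2 : (Complex.I * k + ν) * fco (quot1 ν) k =
      (Complex.I * (k + 1) - ν) * fco (quot1 ν) (k + 1) := by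
    refine mul_left_cancel₀ (mul_ne_zero two_ne_zero hpi) ?_
    linear_combination hftc
  have hI := Complex.I_sq
  linear_combination Complex.I * h2 + (-(k:ℂ) * fco (quot1 ν) k +
    (k + 1) * fco (quot1 ν) (k + 1)) * hI

end Model

section ModelBounds

open scoped ENNReal InnerProductSpace ComplexConjugate

lemma norm_sq_nat_add_I_mul (x y : ℝ) : ‖(x + Complex.I * y : ℂ)‖ ^ 2 = x ^ 2 + y ^ 2 := by
  rw [Complex.sq_norm, Complex.normSq_apply]; simp; ring

lemma norm_fco_le {φ : Tor → ℂ} {C : ℝ} (h : ∀ t, ‖φ t‖ ≤ C) (m : ℤ) : ‖fco φ m‖ ≤ C := by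
  refine (norm_integral_le_of_norm_le_const (C := C) ?_).trans (by simp)
  filter_upwards with t
  rw [norm_mul, norm_zpow, norm_crd, one_zpow, mul_one]
  exact h t

lemma norm_fco_quot1 (ν : ℝ) (m : ℕ) :
    ‖fco (quot1 ν) m‖ ^ 2 * (m ^ 2 + ν ^ 2) = ‖fco (quot1 ν) 0‖ ^ 2 * ν ^ 2 := by
  induction m with
  | zero => simp
  | succ m ih =>
    have h := congrArg (fun z => ‖z‖ ^ 2) (fco_quot1_succ ν m)
    simp only [norm_mul, mul_pow] at h
    have e1 := norm_sq_nat_add_I_mul (m + 1) ν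
    have e2 := norm_sq_nat_add_I_mul m (-ν)
    push_cast at e1 e2 h ⊢
    rw [e1, show (m:ℂ) - Complex.I * ν = m + Complex.I * -ν by ring, e2] at h
    rw [← ih]; linarith

lemma norm_fco_quot1_le (ν : ℝ) {m : ℕ} (hm : 1 ≤ m) : ‖fco (quot1 ν) m‖ ≤ |ν| / m := by
  have hm' : (0:ℝ) < m := by exact_mod_cast hm
  have h := norm_fco_quot1 ν m
  have h0 : ‖fco (quot1 ν) 0‖ ≤ 1 := norm_fco_le (fun t => (norm_quot1 ν t).le) 0
  rw [le_div_iff₀ hm']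
  refine abs_le_of_sq_le_sq' ?_ (abs_nonneg ν) |>.2
  rw [sq_abs, mul_pow]
  have h1 : ‖fco (quot1 ν) 0‖ ^ 2 ≤ 1 := pow_le_one₀ (norm_nonneg _) h0
  nlinarith [mul_nonneg (sq_nonneg ‖fco (quot1 ν) m‖) (sq_nonneg ν),
    mul_le_mul_of_nonneg_right h1 (sq_nonneg ν)]

lemma hankelType_quot1 (ν : ℝ) : HankelType 1 (fun m => fco (quot1 ν) m) := by
  refine ⟨⟨|ν|, abs_nonneg _, fun m hm => norm_fco_quot1_le ν hm⟩,
    |ν| * (1 + 2 * |ν|), by positivity, fun m hm => ?_⟩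
  have hm' : (0:ℝ) < m := by exact_mod_cast hm
  have h := fco_quot1_succ ν m
  have hne : (m + 1 + Complex.I * ν : ℂ) ≠ 0 := by
    intro h0
    have := congrArg Complex.re h0
    simp at this
    linarith
  have h1 : (m + 1 + Complex.I * ν : ℂ) * (fco (quot1 ν) (m + 1) - fco (quot1 ν) m) =
      -(1 + 2 * Complex.I * ν) * fco (quot1 ν) m := by
    push_cast at h; linear_combination h
  have h2 : (m:ℝ) ≤ ‖(m + 1 + Complex.I * ν : ℂ)‖ := by
    refine le_trans ?_ (Complex.re_le_norm _)
    simp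
  have h3 : ‖(-(1 + 2 * Complex.I * ν) : ℂ)‖ ≤ 1 + 2 * |ν| := by
    rw [norm_neg]; refine (norm_add_le _ _).trans ?_
    simp
  have h4 := congrArg norm h1
  rw [norm_mul, norm_mul] at h4
  push_cast
  rw [one_mul, le_div_iff₀ (by positivity)]
  have h5 := norm_fco_quot1_le ν hm
  rw [le_div_iff₀ hm'] at h5
  set d := ‖fco (quot1 ν) (m + 1) - fco (quot1 ν) m‖
  calc d * (m:ℝ) ^ 2 = (m * d) * m := by ring
    _ ≤ (‖(m + 1 + Complex.I * ν : ℂ)‖ * d) * m := by gcongr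
    _ = ‖(-(1 + 2 * Complex.I * ν) : ℂ)‖ * (‖fco (quot1 ν) m‖ * m) := by rw [h4]; ring
    _ ≤ (1 + 2 * |ν|) * |ν| := by gcongr
    _ = _ := by ring

lemma jump1_I (ν : ℝ) (t : Tor) : jump1 (Complex.I * ν) t =
    ((Real.exp (-2 * ν * (lg 1 (crd t)).im) : ℝ) : ℂ) := by
  rw [jump1, Complex.sub_conj]
  push_cast; congr 1
  linear_combination 2 * ν * ((lg 1 (crd t)).im : ℂ) * Complex.I_sq

lemma norm_hankelOp_quot1_lt (ν : ℝ) :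
    ∃ k : ℝ, 0 ≤ k ∧ k < 1 ∧ ∀ N : ℕ, 1 ≤ N → ‖hankelOp (quot1 ν) (memLp_quot1 ν) N‖ ≤ k := by
  set A := Real.exp (2 * |ν| * Real.pi) with hA
  have hA0 : 0 < A := Real.exp_pos _
  have hA1 : 1 ≤ A := Real.one_le_exp (by positivity)
  set ρ : ℝ := 2 / (A + A⁻¹) with hρ
  have h2 : MemLp (fun t => (-ρ : ℂ) * (outer1 (ν + ν) t)) ∞ torMeasure :=
    (outer1_hardy _).1.const_mul _
  set φ : Tor → ℂ := fun t => quot1 ν t + (-ρ : ℂ) * (outer1 (ν + ν) t) with hφdef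
  have hφ : MemLp φ ∞ torMeasure := (memLp_quot1 ν).add h2
  have hAi : 0 < A⁻¹ := inv_pos.mpr hA0
  have hAi1 : A⁻¹ ≤ 1 := inv_le_one_of_one_le₀ hA1
  refine ⟨(A - A⁻¹) / (A + A⁻¹), div_nonneg (by linarith) (by linarith), ?_, fun N hN => ?_⟩
  · rw [div_lt_one (by linarith)]; linarith
  have heq : hankelOp (quot1 ν) (memLp_quot1 ν) N = hankelOp φ hφ N := by
    refine clm_ext_matEntry (fun j k => ?_)
    rw [isHankelFam_hankelOp, isHankelFam_hankelOp]
    simp only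
    rw [hφdef, fco_add ((memLp_quot1 ν).integrable le_top) (h2.integrable le_top), fco_const_mul,
      (outer1_hardy _).2.1 _ (by push_cast; omega), mul_zero, add_zero]
  rw [heq]
  refine norm_hankelOp_le hφ (div_nonneg (by linarith) (by linarith)) ?_ N
  filter_upwards with t
  set w := Real.exp (-2 * ν * (lg 1 (crd t)).im) with hw
  have hw0 : 0 < w := Real.exp_pos _
  have him := abs_im_lg_le 1 (crd t)
  have habs : |2 * ν * (lg 1 (crd t)).im| ≤ 2 * |ν| * Real.pi := by
    rw [abs_mul, abs_mul, abs_two]; gcongr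
  obtain ⟨hb1, hb2⟩ := abs_le.mp habs
  have hwA : w ≤ A := Real.exp_le_exp.mpr (by linarith)
  have hwA' : A⁻¹ ≤ w := by
    rw [hA, ← Real.exp_neg]; exact Real.exp_le_exp.mpr (by linarith)
  have hmul : φ t * jump1 (Complex.I * ν) t =
      (outer1 (ν + ν) t) * (1 - ρ * jump1 (Complex.I * ν) t) := by
    have h3 : quot1 ν t * jump1 (Complex.I * ν) t = outer1 (ν + ν) t := by
      rw [quot1, jump1, outer1, ← Complex.exp_add]; congr 1; push_cast; ring
    rw [hφdef]; simp only; rw [add_mul, h3]; ring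
  have hn : ‖outer1 (ν + ν) t‖ = w := by
    rw [outer1, Complex.norm_exp, hw]; congr 1
    simp only [Complex.mul_re, Complex.mul_im, Complex.I_re, Complex.I_im, Complex.ofReal_re,
      Complex.ofReal_im]
    ring
  have h4 := congrArg norm hmul
  rw [norm_mul, norm_mul, jump1_I, hn, ← hw] at h4
  rw [Complex.norm_real, Real.norm_of_nonneg hw0.le, mul_comm] at h4
  have h5 := mul_left_cancel₀ hw0.ne' h4
  rw [h5, show (1 - ρ * w : ℂ) = ((1 - ρ * w : ℝ) : ℂ) by push_cast; ring, Complex.norm_real,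
    Real.norm_eq_abs, hρ, abs_le]
  have hs : 0 < A + A⁻¹ := by linarith
  have e : 1 - 2 / (A + A⁻¹) * w = (A + A⁻¹ - 2 * w) / (A + A⁻¹) := by field_simp
  rw [e]
  constructor
  · rw [← neg_div]; exact div_le_div_of_nonneg_right (by linarith) hs.le
  · exact div_le_div_of_nonneg_right (by linarith) hs.le

end ModelBounds

section CauchySystem

lemma cauchy_system_ratio (n : ℕ) (s : ℂ) (hs : ∀ m : ℤ, (m : ℂ) + s ≠ 0) (p : ℕ → ℂ)
    (h : ∀ k : ℕ, 1 ≤ k → k ≤ n →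
      ∑ l ∈ Finset.range (n + 1), p l / ((l : ℂ) - k + s) = 0) :
    p n * ∏ j ∈ Finset.range n, ((j : ℂ) + 1 - s) = p 0 * ∏ j ∈ Finset.range n, ((j : ℂ) + s) := by
  classical
  set P : ℂ[X] := ∑ l ∈ Finset.range (n + 1), C (p l) *
    ∏ l' ∈ (Finset.range (n + 1)).erase l, (C ((l' : ℂ) + s) - X) with hP
  set Q : ℂ[X] := ∏ j ∈ Finset.range n, (C ((j : ℂ) + 1) - X) with hQ
  have hlin : ∀ a : ℂ, (C a - X : ℂ[X]).degree ≤ 1 := fun a =>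
    (degree_sub_le _ _).trans (max_le (degree_C_le.trans (by norm_num)) degree_X_le)
  have hprod : ∀ (t : Finset ℕ) (f : ℕ → ℂ), (∏ l ∈ t, (C (f l) - X : ℂ[X])).degree ≤ t.card := by
    intro t f
    refine (degree_prod_le _ _).trans ((Finset.sum_le_sum fun l _ => hlin (f l)).trans ?_)
    simp
  have hCm : ∀ (a : ℂ) (q : ℂ[X]), (C a * q).degree ≤ q.degree := fun a q => by
    rw [C_mul']; exact degree_smul_le a q
  have hPd : P.degree ≤ n := by
    refine (degree_sum_le _ _).trans (Finset.sup_le fun l hl => ?_)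
    refine (hCm _ _).trans ((hprod _ _).trans ?_)
    rw [Finset.card_erase_of_mem hl]; simp
  have hQd : Q.degree ≤ n := by
    exact (hprod (Finset.range n) (fun j => (j:ℂ) + 1)).trans_eq (by simp)
  have hPk : ∀ k : ℕ, 1 ≤ k → k ≤ n → P.eval (k : ℂ) = 0 := by
    intro k hk1 hk2
    have : P.eval (k : ℂ) = (∏ l ∈ Finset.range (n + 1), ((l : ℂ) + s - k)) *
        ∑ l ∈ Finset.range (n + 1), p l / ((l : ℂ) - k + s) := by
      rw [hP, eval_finsetSum, Finset.mul_sum]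
      refine Finset.sum_congr rfl fun l hl => ?_
      rw [← Finset.mul_prod_erase _ _ hl, eval_mul, eval_prod]
      simp only [eval_C, eval_sub, eval_X]
      have h0 : (l : ℂ) - k + s ≠ 0 := by have := hs (l - k); push_cast at this; exact this
      rw [show (l : ℂ) + s - k = l - k + s by ring]
      field_simp
    rw [this, h k hk1 hk2, mul_zero]
  have hPl : ∀ l ∈ Finset.range (n + 1), P.eval ((l : ℂ) + s) =
      p l * ∏ l' ∈ (Finset.range (n + 1)).erase l, ((l' : ℂ) - l) := by
    intro l hl
    rw [hP, eval_finsetSum, Finset.sum_eq_single l]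
    · rw [eval_mul, eval_prod]; simp
    · intro b hb hbl
      rw [eval_mul, eval_prod, Finset.prod_eq_zero (i := l)]
      · simp
      · exact Finset.mem_erase.mpr ⟨hbl.symm, hl⟩
      · simp
    · intro h'; exact absurd hl h'
  have hQk : ∀ k : ℕ, 1 ≤ k → k ≤ n → Q.eval (k : ℂ) = 0 := by
    intro k hk1 hk2
    rw [hQ, eval_prod]
    refine Finset.prod_eq_zero (i := k - 1) (Finset.mem_range.mpr (by omega)) ?_
    simp [Nat.cast_sub hk1]
  have hne : ∀ k : ℕ, (k : ℂ) ≠ s := by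
    intro k hk; apply hs (-k); push_cast; rw [hk]; ring
  have hzero : C (P.eval s) * Q - C (Q.eval s) * P = 0 := by
    refine eq_zero_of_degree_lt_of_eval_finset_eq_zero
      (insert s ((Finset.Icc 1 n).image (fun k : ℕ => (k : ℂ)))) ?_ ?_
    · rw [Finset.card_insert_of_notMem, Finset.card_image_of_injective _ Nat.cast_injective]
      · refine lt_of_le_of_lt (degree_sub_le _ _) (max_lt ?_ ?_)
        · exact lt_of_le_of_lt ((hCm _ _).trans hQd) (by simp only [Nat.card_Icc]; exact_mod_cast n.lt_succ_self)
        · exact lt_of_le_of_lt ((hCm _ _).trans hPd) (by simp only [Nat.card_Icc]; exact_mod_cast n.lt_succ_self)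
      · simp only [Finset.mem_image, not_exists, not_and]
        exact fun k _ => hne k
    · intro x hx
      rw [Finset.mem_insert, Finset.mem_image] at hx
      rcases hx with rfl | ⟨k, hk, rfl⟩
      · simp; ring
      · rw [Finset.mem_Icc] at hk
        simp [hPk k hk.1 hk.2, hQk k hk.1 hk.2]
  have hev := congrArg (eval ((n : ℂ) + s)) hzero
  have h0 := hPl 0 (by simp)
  rw [Nat.cast_zero, zero_add] at h0
  simp only [eval_sub, eval_mul, eval_C, eval_zero] at hev
  rw [hPl n (by simp), h0] at hev
  have e1 : ∏ l' ∈ (Finset.range (n + 1)).erase 0, ((l' : ℂ) - 0) = ∏ j ∈ Finset.range n, ((j : ℂ) + 1) := by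
    have h1 := Finset.prod_range_succ' (fun j => if j = 0 then (1:ℂ) else (j:ℂ)) n
    have h2 := Finset.mul_prod_erase (Finset.range (n + 1))
      (fun j => if j = 0 then (1:ℂ) else (j:ℂ)) (a := 0) (by simp)
    simp only [if_true, one_mul, mul_one] at h1 h2
    rw [← h2] at h1
    rw [Finset.prod_congr rfl (g := fun j : ℕ => if j = 0 then (1:ℂ) else (j:ℂ)), h1]
    · exact Finset.prod_congr rfl fun j _ => by simp
    · intro j hj
      rw [if_neg (Finset.ne_of_mem_erase hj), sub_zero]
  have e2 : ∏ l' ∈ (Finset.range (n + 1)).erase n, ((l' : ℂ) - n) =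
      (-1) ^ n * ∏ j ∈ Finset.range n, ((j : ℂ) + 1) := by
    rw [Finset.range_add_one, Finset.erase_insert (by simp), ← Finset.prod_range_reflect,
      ← Finset.card_range n, ← Finset.prod_const, Finset.card_range, ← Finset.prod_mul_distrib]
    refine Finset.prod_congr rfl fun j hj => ?_
    have := Finset.mem_range.mp hj
    rw [Nat.cast_sub (by omega), Nat.cast_sub (by omega)]; push_cast; ring
  have e3 : Q.eval ((n:ℂ) + s) = (-1) ^ n * ∏ j ∈ Finset.range n, ((j : ℂ) + s) := by
    rw [hQ, eval_prod, ← Finset.prod_range_reflect,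
      ← Finset.card_range n, ← Finset.prod_const, Finset.card_range, ← Finset.prod_mul_distrib]
    refine Finset.prod_congr rfl fun j hj => ?_
    have := Finset.mem_range.mp hj
    rw [Nat.cast_sub (by omega), Nat.cast_sub (by omega)]; simp; ring
  have e4 : Q.eval s = ∏ j ∈ Finset.range n, ((j : ℂ) + 1 - s) := by
    rw [hQ, eval_prod]; simp
  have e5 : ∏ j ∈ Finset.range n, ((j : ℂ) + 1) ≠ 0 :=
    Finset.prod_ne_zero_iff.mpr fun j _ => by exact_mod_cast j.succ_ne_zero
  rw [e1, e2, e3, e4] at hev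
  have e6 : ((-1 : ℂ) ^ n * ∏ j ∈ Finset.range n, ((j : ℂ) + 1)) ≠ 0 :=
    mul_ne_zero (pow_ne_zero _ (by norm_num)) e5
  apply mul_left_cancel₀ e6
  linear_combination -hev

end CauchySystem

section ModelIdentity

open scoped ENNReal InnerProductSpace ComplexConjugate

lemma star_hankelOp_apply {φ : Tor → ℂ} (hφ : MemLp φ ∞ torMeasure) (N : ℕ) (x : Ell2) (j : ℕ) :
    (star (hankelOp φ hφ N)) x j = conj (hankelOp φ hφ N (star x) j) := by
  rw [hankelOp_apply]
  have h1 := hasSum_fco_mul_embPos (memLp_two_of_top hφ) (star x) (N + j)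
  have h2 : HasSum (fun k => conj ((star x : Ell2) k * fco φ (N + j + k)))
      (conj (fco (fun t => φ t * embPos (star x) t) (N + j))) :=
    h1.map (starRingEnd ℂ) Complex.continuous_conj
  rw [← inner_unitVec, ← inner_star_apply, star_star]
  refine (ell2_hasSum_inner (hankelOp φ hφ N (unitVec j)) x).unique ?_
  refine h2.congr_fun fun k => ?_
  have h3 := isHankelFam_hankelOp hφ N k j
  unfold matEntry at h3
  rw [h3, lp.star_apply, map_mul, RCLike.inner_apply]
  simp only [RCLike.star_def, Complex.conj_conj]
  rw [show ((N + k + j : ℕ) : ℤ) = N + j + k by push_cast; ring]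

lemma fco_mul_hardy_pos {φ f : Tor → ℂ} (hφ : MemLp φ ∞ torMeasure) (hf : MemLp f 2 torMeasure)
    (hφ0 : ∀ m : ℤ, 1 ≤ m → fco φ m = 0) (hf0 : ∀ m : ℤ, 1 ≤ m → fco f m = 0) :
    (∀ m : ℤ, 1 ≤ m → fco (fun t => φ t * f t) m = 0) ∧
      fco (fun t => φ t * f t) 0 = fco φ 0 * fco f 0 := by
  obtain ⟨x, hx, hxk⟩ := exists_embPos hf hf0
  have hc : ∀ m, fco (fun t => φ t * f t) m = fco (fun t => φ t * embPos x t) m := fun m =>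
    fco_congr (by filter_upwards [hx] with t ht; rw [ht]) m
  constructor
  · intro m hm
    rw [hc]
    refine (hasSum_fco_mul_embPos (memLp_two_of_top hφ) x m).unique ?_
    refine hasSum_zero.congr_fun fun k => ?_
    rw [hφ0 _ (by omega), mul_zero]
  · rw [hc]
    refine (hasSum_fco_mul_embPos (memLp_two_of_top hφ) x 0).unique ?_
    convert hasSum_single (f := fun k : ℕ => x k * fco φ (0 + k)) 0 ?_ using 1
    · have := hxk 0
      simp only [Nat.cast_zero, neg_zero] at this
      simp [this, mul_comm]
    · intro k hk
      rw [hφ0 _ (by omega), mul_zero]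

lemma model_ratio {ν : ℝ} (hν : ν ≠ 0) (n : ℕ) (c' : Ell2)
    (hc : c' - hankelOp (quot1 ν) (memLp_quot1 ν) (n + 1)
      ((star (hankelOp (quot1 ν) (memLp_quot1 ν) (n + 1))) c') = unitVec 0) :
    (star (hankelOp (quot1 ν) (memLp_quot1 ν) n)) c' 0 *
      ∏ j ∈ Finset.range n, ((j : ℂ) + 1 - Complex.I * ν) =
      ∏ j ∈ Finset.range n, ((j : ℂ) + Complex.I * ν) := by
  have hq := memLp_quot1 ν
  set K := hankelOp (quot1 ν) hq (n + 1) with hK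
  set c : Ell2 := star c' with hcdef
  have hcc : ∀ j, c' j = conj (c j) := fun j => by rw [hcdef, lp.star_apply]; simp
  set y : Ell2 := -((star K) c') with hy
  have hKy : ∀ j, K y j = unitVec 0 j - c' j := by
    intro j
    rw [hy, map_neg, ← hc]
    simp only [lp.coeFn_neg, lp.coeFn_sub, Pi.neg_apply, Pi.sub_apply]; ring
  have hKc : ∀ (N : ℕ) j, (star (hankelOp (quot1 ν) hq N)) c' j = conj (hankelOp (quot1 ν) hq N c j) :=
    fun N j => star_hankelOp_apply hq N c' j
  have hemb : ∀ x : Ell2, MemLp (embPos x) 2 torMeasure := fun x => Lp.memLp _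
  have hqe : ∀ x : Ell2, MemLp (fun t => quot1 ν t * embPos x t) 2 torMeasure := fun x =>
    memLp_mul_top hq (hemb x)
  set X : Tor → ℂ := fun t => conj (embPos c t) + (quot1 ν t * embPos y t) * crd t ^ ((n:ℤ) + 1)
    with hX
  have hX1 := memLp_conj (hemb c)
  have hX2 := memLp_mul_zpow (hqe y) ((n:ℤ) + 1)
  have hXm : MemLp X 2 torMeasure := hX1.add hX2
  have hXj : ∀ j : ℕ, fco X j = unitVec 0 j := by
    intro j
    rw [hX, fco_add (hX1.integrable (by norm_num)) (hX2.integrable (by norm_num)), fco_conj,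
      fco_embPos, if_pos (by omega), fco_mul_zpow]
    have := hankelOp_apply hq (n + 1) y j
    push_cast at this
    rw [← this, ← hK, hKy, hcc]; simp
  have hX0 : fco X 0 = 1 := by have := hXj 0; simpa [unitVec_apply] using this
  have hXp : ∀ m : ℤ, 1 ≤ m → fco X m = 0 := by
    intro m hm
    obtain ⟨j, rfl⟩ := Int.eq_ofNat_of_zero_le (by omega : 0 ≤ m)
    rw [hXj, unitVec_apply, if_neg (by omega)]
  -- the function `W̄ u⁻¹`
  set H : Tor → ℂ := fun t => conj (embPos y t) * crd t ^ (-1 : ℤ) +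
    (quot1 ν t * embPos c t) * crd t ^ (n : ℤ) with hH
  have hH1 := memLp_mul_zpow (memLp_conj (hemb y)) (-1)
  have hH2 := memLp_mul_zpow (hqe c) (n:ℤ)
  have hHm : MemLp H 2 torMeasure := hH1.add hH2
  have hHj : ∀ m : ℤ, 0 ≤ m → fco H m = if m = 0 then
      hankelOp (quot1 ν) hq n c 0 else 0 := by
    intro m hm
    rw [hH, fco_add (hH1.integrable (by norm_num)) (hH2.integrable (by norm_num)), fco_mul_zpow,
      fco_conj, fco_embPos, fco_mul_zpow]
    rcases hm.eq_or_lt with rfl | hm'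
    · rw [if_neg (by norm_num), if_pos rfl, hankelOp_apply]; simp
    · obtain ⟨j, rfl⟩ : ∃ j : ℕ, m = j + 1 := ⟨(m - 1).toNat, by omega⟩
      rw [if_pos (by omega), if_neg (by omega)]
      have := hankelOp_apply hq (n + 1) c j
      push_cast at this
      rw [show (n:ℤ) + (j + 1) = n + 1 + j by ring, ← this, ← hK,
        show (-(-1 + ((j:ℤ) + 1))).natAbs = j by omega, hy]
      simp only [lp.coeFn_neg, Pi.neg_apply]
      rw [hKc (n + 1) j]; simp [hK]
  obtain ⟨hoL, ho0, ho1⟩ := outer1_hardy (-ν)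
  obtain ⟨hoL', ho0', ho1'⟩ := outer1_hardy ν
  set p : Tor → ℂ := fun t => outer1 (-ν) t * X t with hp
  have hpm : MemLp p 2 torMeasure := memLp_mul_top hoL hXm
  have hp1 := fco_mul_hardy_pos hoL hXm ho0 hXp
  have hpH : ∀ t, p t = conj (outer1 (-ν) t * H t) * crd t ^ (n : ℤ) := by
    intro t
    have e1 := outer1_mul_neg ν t
    have e2 := quot1_mul_conj_outer1 ν t
    have e3 := congrArg conj e1
    rw [map_mul, map_one] at e3
    have e4 := conj_quot1 ν t
    have e5 : outer1 (-ν) t * quot1 ν t = conj (outer1 (-ν) t) := by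
      linear_combination (outer1 (-ν) t * conj (outer1 (-ν) t)) * e2 -
        (outer1 (-ν) t * quot1 ν t) * e3 + conj (outer1 (-ν) t) * e1
    have e6 : crd t ^ (-(n : ℤ)) * crd t ^ (n : ℤ) = 1 := by
      rw [← zpow_add₀ (crd_ne_zero t)]; simp
    have e7 : crd t ^ (n : ℤ) * crd t = crd t ^ ((n : ℤ) + 1) := by
      rw [zpow_add_one₀ (crd_ne_zero t)]
    have e8 : conj (H t) = embPos y t * crd t +
        conj (quot1 ν t) * conj (embPos c t) * crd t ^ (-(n : ℤ)) := by
      rw [hH]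
      simp only [map_add, map_mul, Complex.conj_conj, map_zpow₀, conj_crd, inv_zpow', neg_neg, zpow_one]
    rw [map_mul, e8, ← e5, hp, hX]
    simp only
    rw [← e7]
    linear_combination (-(outer1 (-ν) t * conj (embPos c t))) * e4 -
      (outer1 (-ν) t * quot1 ν t * conj (quot1 ν t) * conj (embPos c t)) * e6
  have hoH := fco_mul_hardy_pos hoL hHm ho0 (fun m hm => by rw [hHj m (by omega), if_neg (by omega)])
  have hpk : ∀ k : ℤ, fco p (-k) = conj (fco (fun t => outer1 (-ν) t * H t) (k - n)) := by
    intro k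
    rw [fco_congr (Eventually.of_forall hpH), fco_mul_zpow, fco_conj]
    congr 2; ring
  have hp0 : fco p 0 = 1 := by rw [hp, hp1.2, ho1, hX0, mul_one]
  have hpn : fco p (-(n:ℤ)) = (star (hankelOp (quot1 ν) hq n)) c' 0 := by
    rw [hpk, sub_self, hoH.2, ho1, one_mul, hHj 0 le_rfl, if_pos rfl, hKc]
  have hpsum : p =ᵐ[torMeasure] fun t => ∑ l ∈ Finset.range (n + 1), fco p (-(l:ℤ)) * crd t ^ (l:ℤ) := by
    have hterm : ∀ l : ℕ, MemLp (fun t => fco p (-(l:ℤ)) * crd t ^ (l:ℤ)) 2 torMeasure := fun l =>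
      (memLp_crd_zpow 2 l).const_mul _
    refine ae_eq_of_fco hpm (memLp_finsetSum _ fun l _ => hterm l) fun m => ?_
    rw [fco_finset_sum _ _ (fun l _ => (hterm l).integrable (by norm_num))]
    simp_rw [fco_const_mul, fco_zpow]
    by_cases hm : m ∈ (Finset.range (n + 1)).image (fun l : ℕ => -(l : ℤ))
    · obtain ⟨l, hl, rfl⟩ := Finset.mem_image.mp hm
      rw [Finset.sum_eq_single_of_mem l hl]
      · simp
      · intro b _ hb
        rw [if_neg (by omega), mul_zero]
    · rw [Finset.sum_eq_zero]
      · rcases le_or_gt 1 m with h | h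
        · exact hp1.1 m h
        · have h2 : ¬ (-m ≤ n) := fun h3 => hm (Finset.mem_image.mpr
            ⟨(-m).toNat, Finset.mem_range.mpr (by omega), by omega⟩)
          have := hpk (-m)
          rw [neg_neg] at this
          rw [this, hoH.1 _ (by omega), map_zero]
      · intro l hl
        rw [if_neg, mul_zero]
        intro h3
        exact hm (Finset.mem_image.mpr ⟨l, hl, by omega⟩)
  have hjump : ∀ t, p t * jump1 (Complex.I * ν) t = conj (outer1 ν t * embPos c t) +
      (outer1 ν t * embPos y t) * crd t ^ ((n:ℤ) + 1) := by
    intro t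
    have e1 := outer1_mul_neg ν t
    have e2 := quot1_mul_conj_outer1 ν t
    rw [← outer1_mul_conj, hp, hX, map_mul]
    simp only
    linear_combination (conj (outer1 ν t) * (conj (embPos c t) +
      quot1 ν t * embPos y t * crd t ^ ((n:ℤ) + 1))) * e1 + embPos y t * crd t ^ ((n:ℤ) + 1) * e2
  have hj1 : ∀ x : Ell2, MemLp (fun t => outer1 ν t * embPos x t) 2 torMeasure := fun x =>
    memLp_mul_top hoL' (hemb x)
  have hj2 : ∀ x : Ell2, ∀ m : ℤ, 1 ≤ m → fco (fun t => outer1 ν t * embPos x t) m = 0 := fun x =>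
    (fco_mul_hardy_pos hoL' (hemb x) ho0' (fun m hm => by rw [fco_embPos, if_neg (by omega)])).1
  have hsz : ∀ m : ℤ, (m : ℂ) + Complex.I * ν ≠ 0 := by
    intro m h
    have := congrArg Complex.im h
    simp at this
    exact hν this
  have hsin : Complex.sin (Real.pi * (Complex.I * ν)) ≠ 0 := by
    rw [show (Real.pi * (Complex.I * ν) : ℂ) = ((Real.pi * ν : ℝ) : ℂ) * Complex.I by push_cast; ring,
      Complex.sin_mul_I, ← Complex.ofReal_sinh]
    refine mul_ne_zero ?_ Complex.I_ne_zero
    rw [Complex.ofReal_ne_zero, Ne, Real.sinh_eq_zero]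
    exact mul_ne_zero Real.pi_ne_zero hν
  have hj3 : ∀ m : ℤ, fco (jump1 (Complex.I * ν)) m =
      Complex.sin (Real.pi * (Complex.I * ν)) / Real.pi / (m + Complex.I * ν) := by
    intro m
    rw [fco_jump1 _ _ (by rw [add_comm]; exact hsz m), div_div, add_comm (m:ℂ)]
  have hfin := cauchy_system_ratio n (Complex.I * ν) hsz (fun l => fco p (-(l:ℤ))) ?_
  · simp only [Nat.cast_zero, neg_zero, hp0, hpn, one_mul] at hfin
    exact hfin
  intro k hk1 hkn
  have e1 : fco (fun t => p t * jump1 (Complex.I * ν) t) (-(k:ℤ)) = 0 := by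
    have hm1 := memLp_conj (hj1 c)
    have hm2 := memLp_mul_zpow (hj1 y) ((n:ℤ) + 1)
    rw [fco_congr (Eventually.of_forall hjump), fco_add (hm1.integrable (by norm_num))
      (hm2.integrable (by norm_num)), fco_conj, fco_mul_zpow, hj2 c _ (by omega),
      hj2 y _ (by omega)]
    simp
  have hjL : MemLp (jump1 (Complex.I * ν)) ∞ torMeasure := by
    have : jump1 (Complex.I * ν) = fun t => outer1 ν t * conj (outer1 ν t) :=
      funext fun t => (outer1_mul_conj ν t).symm
    rw [this]; exact memLp_mul_top hoL' (memLp_conj hoL')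
  have e2 : fco (fun t => p t * jump1 (Complex.I * ν) t) (-(k:ℤ)) =
      ∑ l ∈ Finset.range (n + 1), fco p (-(l:ℤ)) * fco (jump1 (Complex.I * ν)) (l - k) := by
    rw [fco_congr (g := fun t => ∑ l ∈ Finset.range (n + 1),
      fco p (-(l:ℤ)) * (jump1 (Complex.I * ν) t * crd t ^ (l:ℤ)))]
    · rw [fco_finset_sum]
      · refine Finset.sum_congr rfl fun l _ => ?_
        rw [fco_const_mul, fco_mul_zpow]; rfl
      · intro l _
        exact ((memLp_mul_zpow hjL l).integrable le_top).const_mul _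
    · filter_upwards [hpsum] with t ht
      rw [ht, Finset.sum_mul]
      exact Finset.sum_congr rfl fun l _ => by ring
  rw [e1] at e2
  have e3 : (Complex.sin (Real.pi * (Complex.I * ν)) / Real.pi) *
      ∑ l ∈ Finset.range (n + 1), fco p (-(l:ℤ)) / ((l : ℂ) - k + Complex.I * ν) = 0 := by
    rw [e2, Finset.mul_sum]
    refine Finset.sum_congr rfl fun l _ => ?_
    rw [hj3]; push_cast; ring
  refine (mul_eq_zero.mp e3).resolve_left (div_ne_zero hsin ?_)
  exact_mod_cast Real.pi_ne_zero

end ModelIdentity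

section ModelAsymptotics

open scoped ENNReal InnerProductSpace ComplexConjugate
open Asymptotics

lemma norm_sub_lim_le {a : ℕ → ℂ} {L : ℂ} (h : Tendsto a atTop (nhds L)) {C : ℝ} {n₀ : ℕ}
    (hn₀ : 1 ≤ n₀) (hC : 0 ≤ C) (hd : ∀ n, n₀ ≤ n → ‖a (n + 1) - a n‖ ≤ C / (n : ℝ) ^ 2) {n : ℕ} (hn : n₀ ≤ n) :
    ‖a n - L‖ ≤ 2 * C / n := by
  have h1 : ∀ k : ℕ, ‖a (n + k) - a n‖ ≤ 2 * C / n - 2 * C / ((n + k : ℕ) : ℝ) := by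
    intro k
    induction k with
    | zero => simp
    | succ k ih =>
      have hp : (1:ℝ) ≤ ((n + k : ℕ) : ℝ) := by exact_mod_cast (by omega)
      have e := hd (n + k) (by omega)
      have e2 : C / ((n + k : ℕ) : ℝ) ^ 2 ≤ 2 * C / ((n + k : ℕ) : ℝ) - 2 * C / (((n + k : ℕ) : ℝ) + 1) := by
        generalize ((n + k : ℕ) : ℝ) = x at hp
        rw [div_sub_div _ _ (by positivity) (by positivity), div_le_div_iff₀ (by positivity) (by positivity)]
        nlinarith [mul_nonneg hC (mul_nonneg (by positivity : 0 ≤ x) (sub_nonneg.mpr hp))]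
      have e3 : a (n + (k + 1)) - a n = (a (n + k + 1) - a (n + k)) + (a (n + k) - a n) := by
        rw [← add_assoc]; ring
      rw [e3]
      refine (norm_add_le _ _).trans ?_
      rw [← add_assoc]; push_cast at *
      linarith
  have h2 : Tendsto (fun k => ‖a (n + k) - a n‖) atTop (nhds ‖L - a n‖) := by
    have := (h.comp (tendsto_add_atTop_nat n))
    refine ((this.sub_const (a n)).norm).congr fun k => ?_
    simp [add_comm]
  rw [norm_sub_rev]
  refine le_of_tendsto h2 (Eventually.of_forall fun k => (h1 k).trans ?_)
  have : 0 ≤ 2 * C / ((n + k : ℕ) : ℝ) := by positivity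
  linarith

/-- The ratio of the extreme coefficients in the model problem. -/
noncomputable def modelRatio (s : ℂ) (n : ℕ) : ℂ :=
  ∏ j ∈ Finset.range n, (((j : ℂ) + s) / ((j : ℂ) + 1 - s))

noncomputable def modelRatioNorm (s : ℂ) (n : ℕ) : ℂ :=
  modelRatio s n * (n + s) * Complex.exp (-(2 * s * Real.log n))

lemma modelRatioNorm_succ {s : ℂ} (hs : ∀ m : ℤ, (m : ℂ) + s ≠ 0) (hs' : ∀ m : ℤ, (m : ℂ) - s ≠ 0) {n : ℕ} (hn : 1 ≤ n) :
    modelRatioNorm s (n + 1) = modelRatioNorm s n *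
      ((n + 1 + s) / (n + 1 - s) * Complex.exp (-(2 * s * Real.log (1 + 1 / n)))) := by
  have hn0 : (n:ℝ) ≠ 0 := by positivity
  have e1 : Real.log ((n + 1 : ℕ) : ℝ) = Real.log n + Real.log (1 + 1 / n) := by
    rw [← Real.log_mul hn0 (by positivity)]; congr 1; push_cast; field_simp
  have h1 : (n : ℂ) + s ≠ 0 := by have := hs n; simpa using this
  have h2 : (n : ℂ) + 1 - s ≠ 0 := by have := hs' (n + 1); push_cast at this; exact this
  unfold modelRatioNorm modelRatio
  rw [Finset.prod_range_succ, e1]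
  generalize Real.log n = x
  generalize Real.log (1 + 1 / n) = y
  push_cast
  rw [show -(2 * s * ((x : ℂ) + y)) = -(2 * s * x) + -(2 * s * y) by ring, Complex.exp_add]
  field_simp

lemma tendsto_modelRatioNorm {s : ℂ} (hs : ∀ m : ℤ, (m : ℂ) + s ≠ 0) (hs' : ∀ m : ℤ, (m : ℂ) - s ≠ 0) :
    Tendsto (modelRatioNorm s) atTop (nhds (s * Complex.Gamma (1 - s) / Complex.Gamma (1 + s))) := by
  have hs0 : s ≠ 0 := by have := hs 0; simpa using this
  have h1 := Complex.GammaSeq_tendsto_Gamma s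
  have h2 := Complex.GammaSeq_tendsto_Gamma (-s)
  have hG : Complex.Gamma s ≠ 0 := Complex.Gamma_ne_zero fun m h => hs m (by rw [h]; simp)
  have h3 := (h2.div h1 hG).const_mul (-s)
  have e1 : Complex.Gamma (1 - s) = -s * Complex.Gamma (-s) := by
    rw [← Complex.Gamma_add_one _ (neg_ne_zero.mpr hs0)]; congr 1; ring
  have e2 : Complex.Gamma (1 + s) = s * Complex.Gamma s := by
    rw [← Complex.Gamma_add_one _ hs0]; congr 1; ring
  rw [e1, e2, show s * (-s * Complex.Gamma (-s)) / (s * Complex.Gamma s) =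
    -s * (Complex.Gamma (-s) / Complex.Gamma s) by field_simp]
  refine h3.congr' ?_
  filter_upwards [eventually_ge_atTop 1] with n hn
  have hnC : (n : ℂ) ≠ 0 := by exact_mod_cast (by omega : n ≠ 0)
  have hr : (n : ℂ) ^ s = Complex.exp (s * Real.log n) := by
    rw [Complex.cpow_def_of_ne_zero hnC, ← Complex.natCast_log, mul_comm]
  have hr' : (n : ℂ) ^ (-s) = Complex.exp (-(s * Real.log n)) := by
    rw [Complex.cpow_def_of_ne_zero hnC, ← Complex.natCast_log, mul_comm, neg_mul]
  have ea : ∏ j ∈ Finset.range n, ((j : ℂ) + s) ≠ 0 :=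
    Finset.prod_ne_zero_iff.mpr fun j _ => by have := hs j; simpa using this
  have eb : ∏ j ∈ Finset.range n, ((j : ℂ) + 1 - s) ≠ 0 :=
    Finset.prod_ne_zero_iff.mpr fun j _ => by have := hs' (j + 1); push_cast at this; exact this
  have ec : (n : ℂ) + s ≠ 0 := by have := hs n; simpa using this
  have p1 : ∏ j ∈ Finset.range (n + 1), (s + (j:ℂ)) = (∏ j ∈ Finset.range n, ((j : ℂ) + s)) * (n + s) := by
    rw [Finset.prod_range_succ]; simp_rw [add_comm s]
  have p2 : ∏ j ∈ Finset.range (n + 1), (-s + (j:ℂ)) = (∏ j ∈ Finset.range n, ((j : ℂ) + 1 - s)) * (-s) := by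
    rw [Finset.prod_range_succ']; congr 1
    · refine Finset.prod_congr rfl fun j _ => ?_
      push_cast; ring
    · simp
  have hf : ((n.factorial : ℕ) : ℂ) ≠ 0 := by exact_mod_cast n.factorial_ne_zero
  change -s * (Complex.GammaSeq (-s) n / Complex.GammaSeq s n) = _
  unfold Complex.GammaSeq modelRatioNorm modelRatio
  rw [p1, p2, hr, hr', Finset.prod_div_distrib,
    show -(2 * s * (Real.log n : ℂ)) = -(s * Real.log n) - (s * Real.log n) by ring, Complex.exp_sub]
  have := Complex.exp_ne_zero (s * Real.log n)
  field_simp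

lemma isBigO_inv_add (s : ℂ) :
    (fun n : ℕ => ((n : ℂ) + s)⁻¹) =O[atTop] fun n : ℕ => (1 / (n:ℝ)) := by
  refine IsBigO.of_bound 2 ?_
  filter_upwards [eventually_ge_atTop (⌈2 * ‖s‖⌉₊ + 1)] with n hn
  have h1 : 2 * ‖s‖ ≤ n := (Nat.le_ceil _).trans (by exact_mod_cast (by omega))
  have h2 : (0:ℝ) < n := by exact_mod_cast (by omega)
  have h3 : (n:ℝ) - ‖s‖ ≤ ‖(n : ℂ) + s‖ := by
    have := norm_sub_le_norm_add (n : ℂ) s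
    simpa using this
  rw [norm_inv, Real.norm_of_nonneg (by positivity), ← div_eq_mul_one_div, ← one_div,
    div_le_div_iff₀ (by linarith) h2]
  linarith

lemma isBigO_log_one_add_inv :
    (fun n : ℕ => ((Real.log (1 + 1 / n) : ℝ) : ℂ) - 1 / n) =O[atTop] fun n : ℕ => (1 / (n:ℝ) ^ 2) := by
  refine IsBigO.of_bound 1 ?_
  filter_upwards [eventually_ge_atTop 1] with n hn
  have h2 : (0:ℝ) < n := by exact_mod_cast (by omega)
  have h3 : (0:ℝ) < 1 / n := by positivity
  have e : ((Real.log (1 + 1 / n) : ℝ) : ℂ) - 1 / n = ((Real.log (1 + 1 / n) - 1 / n : ℝ) : ℂ) := by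
    push_cast; ring
  rw [e, Complex.norm_real, Real.norm_eq_abs, Real.norm_of_nonneg (by positivity), one_mul,
    show 1 / (n:ℝ) ^ 2 = (1 / n) ^ 2 by ring]
  generalize (1 / (n:ℝ)) = x at h3
  have a1 := Real.log_le_sub_one_of_pos (by linarith : 0 < 1 + x)
  have a2 := Real.one_sub_inv_le_log_of_pos (by linarith : 0 < 1 + x)
  have a3 : 1 - (1 + x)⁻¹ ≥ x - x ^ 2 := by
    have : 1 - (1 + x)⁻¹ - (x - x ^ 2) = x ^ 3 / (1 + x) := by field_simp; ring
    have h5 : 0 ≤ x ^ 3 / (1 + x) := by positivity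
    linarith
  rw [abs_le]; constructor <;> nlinarith

lemma modelRatioNorm_step (s : ℂ) :
    (fun n : ℕ => ((n + 1 + s) / (n + 1 - s) * Complex.exp (-(2 * s * Real.log (1 + 1 / n))) - 1 : ℂ))
      =O[atTop] fun n : ℕ => (1 / (n:ℝ) ^ 2) := by
  have hsq : (fun n : ℕ => 1 / (n:ℝ) * (1 / (n:ℝ))) = fun n : ℕ => (1 / (n:ℝ) ^ 2) := by
    ext n; ring
  have h21 : (fun n : ℕ => (1 / (n:ℝ) ^ 2)) =O[atTop] fun n : ℕ => (1 / (n:ℝ)) := by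
    refine IsBigO.of_bound 1 ?_
    filter_upwards [eventually_ge_atTop 1] with n hn
    have h2 : (1:ℝ) ≤ n := by exact_mod_cast hn
    rw [Real.norm_of_nonneg (by positivity), Real.norm_of_nonneg (by positivity), one_mul]
    exact one_div_le_one_div_of_le (by linarith) (by nlinarith)
  have h10 : (fun n : ℕ => (1 / (n:ℝ))) =O[atTop] fun _ : ℕ => (1:ℝ) :=
    tendsto_one_div_atTop_nhds_zero_nat.isBigO_one ℝ
  have hinv : (fun n : ℕ => (1 / (n:ℂ))) =O[atTop] fun n : ℕ => (1 / (n:ℝ)) := by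
    simpa using isBigO_inv_add 0
  set A : ℕ → ℂ := fun n => (n + 1 + s) / (n + 1 - s) with hA
  set w : ℕ → ℂ := fun n => -(2 * s * Real.log (1 + 1 / n)) with hw
  have hlog : (fun n : ℕ => ((Real.log (1 + 1 / n) : ℝ) : ℂ)) =O[atTop] fun n : ℕ => (1 / (n:ℝ)) :=
    ((isBigO_log_one_add_inv.trans h21).add hinv).congr_left fun n => by ring
  have hwO : w =O[atTop] fun n : ℕ => (1 / (n:ℝ)) :=
    (hlog.const_mul_left (-(2 * s))).congr_left fun n => by simp [hw]
  have hi := isBigO_inv_add (1 - s)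
  have hne : ∀ᶠ n : ℕ in atTop, (n : ℂ) + 1 - s ≠ 0 ∧ (n : ℂ) ≠ 0 := by
    filter_upwards [eventually_ge_atTop (⌈‖s‖⌉₊ + 1)] with n hn
    have h1 : ‖s‖ ≤ n := (Nat.le_ceil _).trans (by exact_mod_cast (by omega))
    refine ⟨fun h => ?_, by exact_mod_cast (by omega)⟩
    have h2 : s = ((n + 1 : ℝ) : ℂ) := by push_cast; linear_combination -h
    rw [h2, Complex.norm_real, Real.norm_of_nonneg (by positivity)] at h1
    linarith
  have hA1 : (fun n => A n - 1) =O[atTop] fun n : ℕ => (1 / (n:ℝ)) := by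
    refine (hi.const_mul_left (2 * s)).congr' ?_ EventuallyEq.rfl
    filter_upwards [hne] with n hn
    have h := hn.1
    rw [hA]; simp only
    rw [show (n:ℂ) + (1 - s) = n + 1 - s by ring]
    field_simp; ring
  have hA0 : A =O[atTop] fun _ => (1:ℝ) := by
    have := (hA1.trans h10).add (isBigO_const_const (1:ℂ) (one_ne_zero (α := ℝ)) atTop)
    exact this.congr_left fun n => by ring
  have hw0 : Tendsto w atTop (nhds 0) := hwO.trans_tendsto tendsto_one_div_atTop_nhds_zero_nat
  have hr : (fun n => Complex.exp (w n) - 1 - w n) =O[atTop] fun n : ℕ => (1 / (n:ℝ) ^ 2) := by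
    have h1 : (fun n => Complex.exp (w n) - 1 - w n) =O[atTop] fun n => w n * w n := by
      refine IsBigO.of_bound 1 ?_
      filter_upwards [hw0.norm.eventually_le_const (u := 1) (by simp)] with n hn
      refine (Complex.norm_exp_sub_one_sub_id_le hn).trans_eq ?_
      rw [norm_mul]; ring
    exact (h1.trans (hwO.mul hwO)).congr_right (congrFun hsq)
  have hwA : (fun n => w n + (A n - 1)) =O[atTop] fun n : ℕ => (1 / (n:ℝ) ^ 2) := by
    have h1 := (isBigO_log_one_add_inv.const_mul_left (-(2 * s))).add
      (((hinv.mul hi).congr_right (congrFun hsq)).const_mul_left (2 * s * (s - 1)))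
    refine h1.congr' ?_ EventuallyEq.rfl
    filter_upwards [hne] with n hn
    have h := hn.1
    have h' := hn.2
    rw [hA, hw]; simp only
    rw [show (n:ℂ) + (1 - s) = n + 1 - s by ring]
    generalize ((Real.log (1 + 1 / n) : ℝ) : ℂ) = y
    field_simp; ring
  have t1 := (hA0.mul hr).congr_right (g₂ := fun n : ℕ => (1 / (n:ℝ) ^ 2)) (fun n => one_mul _)
  have t2 := (hA1.mul hwO).congr_right (congrFun hsq)
  refine ((t1.add t2).add hwA).congr_left fun n => ?_
  simp only [hA, hw]; ring

lemma norm_exp_I_mul (x y : ℝ) : ‖Complex.exp (2 * (Complex.I * x) * y)‖ = 1 := by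
  rw [show (2 * (Complex.I * x) * y : ℂ) = ((2 * x * y : ℝ) : ℂ) * Complex.I by push_cast; ring,
    Complex.norm_exp_ofReal_mul_I]

lemma isBigO_modelRatio {ν : ℝ} (hν : ν ≠ 0) :
    (fun n : ℕ => modelRatio (Complex.I * ν) n - (Complex.I * ν) / n *
      Complex.exp (2 * (Complex.I * ν) * Real.log n) *
      (Complex.Gamma (1 - Complex.I * ν) / Complex.Gamma (1 + Complex.I * ν)))
      =O[atTop] fun n : ℕ => (1 / (n:ℝ) ^ 2) := by
  set s : ℂ := Complex.I * ν with hsdef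
  have hs : ∀ m : ℤ, (m : ℂ) + s ≠ 0 := by
    intro m h
    have := congrArg Complex.im h
    simp [hsdef] at this
    exact hν this
  have hs' : ∀ m : ℤ, (m : ℂ) - s ≠ 0 := by
    intro m h
    have := congrArg Complex.im h
    simp [hsdef] at this
    exact hν this
  set L := s * Complex.Gamma (1 - s) / Complex.Gamma (1 + s) with hL
  have hlim := tendsto_modelRatioNorm hs hs'
  have hb : modelRatioNorm s =O[atTop] fun _ => (1:ℝ) := hlim.isBigO_one ℝ
  have hstep : (fun n => modelRatioNorm s (n + 1) - modelRatioNorm s n) =O[atTop]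
      fun n : ℕ => (1 / (n:ℝ) ^ 2) := by
    refine (hb.mul (modelRatioNorm_step s)).congr' ?_ (Eventually.of_forall fun n => one_mul _)
    filter_upwards [eventually_ge_atTop 1] with n hn
    rw [modelRatioNorm_succ hs hs' hn]; ring
  have hrate : (fun n => modelRatioNorm s n - L) =O[atTop] fun n : ℕ => (1 / (n:ℝ)) := by
    obtain ⟨C, hC0, hC⟩ := hstep.exists_nonneg
    obtain ⟨n₀, hn₀⟩ := eventually_atTop.mp hC.bound
    refine IsBigO.of_bound (2 * C) ?_
    filter_upwards [eventually_ge_atTop (max n₀ 1)] with n hn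
    have := norm_sub_lim_le hlim (n₀ := max n₀ 1) (le_max_right _ _) hC0 (fun m hm => by
      have := hn₀ m ((le_max_left _ _).trans hm)
      rw [Real.norm_of_nonneg (by positivity), ← div_eq_mul_one_div] at this
      exact this) hn
    rw [Real.norm_of_nonneg (by positivity), ← div_eq_mul_one_div]
    exact this
  have hE : (fun n : ℕ => Complex.exp (2 * s * Real.log n)) =O[atTop] fun _ => (1:ℝ) :=
    IsBigO.of_bound 1 (Eventually.of_forall fun n => by rw [hsdef, norm_exp_I_mul]; simp)
  have hi := isBigO_inv_add s
  have hinv : (fun n : ℕ => ((n:ℂ) + 0)⁻¹) =O[atTop] fun n : ℕ => (1 / (n:ℝ)) := isBigO_inv_add 0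
  have t1 := hE.mul (hrate.mul hi)
  have t2 := hE.mul ((hi.mul hinv).const_mul_left (-(s * L)))
  refine (t1.add t2).congr' ?_ (Eventually.of_forall fun n => by ring)
  filter_upwards [eventually_ge_atTop 1] with n hn
  have h1 : (n : ℂ) + s ≠ 0 := by have := hs n; simpa using this
  have h2 : (n : ℂ) ≠ 0 := by exact_mod_cast (by omega : n ≠ 0)
  have h3 : modelRatio s n = Complex.exp (2 * s * Real.log n) * modelRatioNorm s n * ((n:ℂ) + s)⁻¹ := by
    unfold modelRatioNorm
    rw [Complex.exp_neg]
    have := Complex.exp_ne_zero (2 * s * Real.log n)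
    field_simp
  rw [h3, show s / n * Complex.exp (2 * s * Real.log n) * (Complex.Gamma (1 - s) / Complex.Gamma (1 + s)) =
    Complex.exp (2 * s * Real.log n) * (L * (n:ℂ)⁻¹) by rw [hL]; ring, add_zero]
  field_simp
  ring

end ModelAsymptotics

section ModelResolvent
open scoped ENNReal InnerProductSpace ComplexConjugate
open Asymptotics

/-- Neumann inverse of `1 - T` for `‖T‖ ≤ k < 1`. -/
lemma exists_inverse_one_sub {T : Ell2 →L[ℂ] Ell2} {k : ℝ} (hk : k < 1) (hT : ‖T‖ ≤ k) :
    ∃ G : Ell2 →L[ℂ] Ell2, G * (1 - T) = 1 ∧ (1 - T) * G = 1 ∧ ‖G‖ ≤ (1 - k)⁻¹ := by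
  let u := Units.oneSub T (hT.trans_lt hk)
  have hu : (u : Ell2 →L[ℂ] Ell2) = 1 - T := rfl
  refine ⟨((u⁻¹ : (Ell2 →L[ℂ] Ell2)ˣ) : Ell2 →L[ℂ] Ell2), ?_, ?_, ?_⟩
  · rw [← hu]; exact u.inv_mul
  · rw [← hu]; exact u.mul_inv
  · set G : Ell2 →L[ℂ] Ell2 := ((u⁻¹ : (Ell2 →L[ℂ] Ell2)ˣ) : Ell2 →L[ℂ] Ell2)
    have h1 : G = 1 + T * G := by
      have : (1 - T) * G = 1 := by rw [← hu]; exact u.mul_inv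
      rw [sub_mul, one_mul] at this
      rw [← this]; abel
    have h2 : ‖G‖ ≤ 1 + k * ‖G‖ := by
      calc ‖G‖ = ‖1 + T * G‖ := by rw [← h1]
        _ ≤ ‖(1 : Ell2 →L[ℂ] Ell2)‖ + ‖T * G‖ := norm_add_le _ _
        _ ≤ 1 + k * ‖G‖ := by
          gcongr
          · exact ContinuousLinearMap.norm_id_le
          · exact (norm_mul_le _ _).trans (by gcongr)
    rw [← one_div, le_div_iff₀ (by linarith)]
    nlinarith

/-- The diagonal operator with entries `z ^ j`, `|z| = 1`. -/
noncomputable def diagOp (z : ℂ) (hz : ‖z‖ = 1) : Ell2 →L[ℂ] Ell2 :=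
  LinearMap.mkContinuous
    { toFun := fun x => ⟨fun j => z ^ j * x j, by
        have := lp.memℓp x
        rw [memℓp_gen_iff (by simp)] at this
        refine (memℓp_gen_iff (by simp)).mpr ?_
        simpa [norm_mul, norm_pow, hz] using this⟩
      map_add' := fun x y => by ext j; exact mul_add _ _ _
      map_smul' := fun c x => by ext j; simp; ring } 1 (fun x => by
        rw [one_mul]
        refine le_of_eq ?_
        rw [lp.norm_eq_tsum_rpow (by simp), lp.norm_eq_tsum_rpow (by simp)]
        simp [norm_pow, hz])

lemma diagOp_apply (z : ℂ) (hz : ‖z‖ = 1) (x : Ell2) (j : ℕ) : diagOp z hz x j = z ^ j * x j := rfl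

lemma diagOp_mul {z w : ℂ} (hz : ‖z‖ = 1) (hw : ‖w‖ = 1) (h : z * w = 1) :
    diagOp z hz * diagOp w hw = 1 := by
  ext x j
  change diagOp z hz (diagOp w hw x) j = x j
  rw [diagOp_apply, diagOp_apply, ← mul_assoc, ← mul_pow, h, one_pow, one_mul]

lemma diagOp_unitVec (z : ℂ) (hz : ‖z‖ = 1) (k : ℕ) :
    diagOp z hz (unitVec k) = z ^ k • unitVec k := by
  ext j
  rw [diagOp_apply, unitVec_apply, lp.coeFn_smul, Pi.smul_apply, unitVec_apply]
  split_ifs with h <;> simp [h]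

lemma star_diagOp {z : ℂ} (hz : ‖z‖ = 1) :
    star (diagOp z hz) = diagOp (conj z) (by simpa using hz) := by
  refine clm_ext_matEntry fun j k => ?_
  rw [matEntry_star, matEntry, matEntry, diagOp_apply, diagOp_apply, unitVec_apply, unitVec_apply]
  by_cases h : j = k
  · simp [h]
  · simp [h, Ne.symm h]

lemma star_eq_of_inverse {G T : Ell2 →L[ℂ] Ell2} (hT : star T = T) (h : G * T = 1) :
    star G = G := by
  have h1 : T * star G = 1 := by simpa [hT] using congrArg star h
  calc star G = (G * T) * star G := by rw [h, one_mul]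
    _ = G := by rw [mul_assoc, h1, mul_one]

/-- Resolvents of the model Hankel operators and the asymptotics of the corner entry. -/
theorem exists_quot1_resolvent (ν : ℝ) :
    ∃ G G' : ℕ → Ell2 →L[ℂ] Ell2, ∃ C : ℝ,
      (∀ N : ℕ, 1 ≤ N → ∀ K, K = hankelOp (quot1 ν) (memLp_quot1 ν) N →
        (G N * (1 - K * star K) = 1 ∧ (1 - K * star K) * G N = 1) ∧
        (G' N * (1 - star K * K) = 1 ∧ (1 - star K * K) * G' N = 1) ∧
        ‖K‖ ≤ C ∧ ‖G N‖ ≤ C ∧ ‖G' N‖ ≤ C) ∧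
      (fun N : ℕ => inner ℂ (unitVec 0)
          ((G N * hankelOp (quot1 ν) (memLp_quot1 ν) N) (unitVec 0)) -
        (-(Complex.I * ν)) / N * Complex.exp (-(2 * (Complex.I * ν) * Real.log N)) *
          (Complex.Gamma (1 + Complex.I * ν) / Complex.Gamma (1 - Complex.I * ν)))
        =O[atTop] fun N : ℕ => 1 / (N:ℝ) ^ 2 := by
  set K := hankelOp (quot1 ν) (memLp_quot1 ν) with hKdef
  obtain ⟨k, hk0, hk1, hk⟩ := norm_hankelOp_quot1_lt ν
  have hkk : k * k < 1 := by nlinarith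
  have hns : ∀ A : Ell2 →L[ℂ] Ell2, ‖star A‖ = ‖A‖ := fun A =>
    LinearIsometryEquiv.norm_map ContinuousLinearMap.adjoint A
  have ex : ∀ N : ℕ, ∃ G G' : Ell2 →L[ℂ] Ell2, 1 ≤ N →
      (G * (1 - K N * star (K N)) = 1 ∧ (1 - K N * star (K N)) * G = 1 ∧ ‖G‖ ≤ (1 - k * k)⁻¹) ∧
      (G' * (1 - star (K N) * K N) = 1 ∧ (1 - star (K N) * K N) * G' = 1 ∧ ‖G'‖ ≤ (1 - k * k)⁻¹) := by
    intro N
    by_cases hN : 1 ≤ N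
    · have b1 : ‖K N * star (K N)‖ ≤ k * k :=
        (norm_mul_le _ _).trans (by rw [hns]; gcongr <;> exact hk N hN)
      have b2 : ‖star (K N) * K N‖ ≤ k * k :=
        (norm_mul_le _ _).trans (by rw [hns]; gcongr <;> exact hk N hN)
      obtain ⟨G, hG⟩ := exists_inverse_one_sub hkk b1
      obtain ⟨G', hG'⟩ := exists_inverse_one_sub hkk b2
      exact ⟨G, G', fun _ => ⟨hG, hG'⟩⟩
    · exact ⟨1, 1, fun h => absurd h hN⟩
  choose G G' hGG using ex
  refine ⟨G, G', max k (1 - k * k)⁻¹, fun N hN K' hK' => ?_, ?_⟩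
  · obtain ⟨⟨a1, a2, a3⟩, b1, b2, b3⟩ := hGG N hN
    subst hK'
    exact ⟨⟨a1, a2⟩, ⟨b1, b2⟩, (hk N hN).trans (le_max_left _ _), a3.trans (le_max_right _ _),
      b3.trans (le_max_right _ _)⟩
  rcases eq_or_ne ν 0 with rfl | hν
  · refine IsBigO.of_bound 0 ?_
    filter_upwards [eventually_ge_atTop 1] with N hN
    have hK0 : K N = 0 := by
      refine clm_ext_matEntry fun i j => ?_
      rw [isHankelFam_hankelOp]
      have := norm_fco_quot1_le 0 (m := N + i + j) (by omega)
      simp only [abs_zero, zero_div, norm_le_zero_iff] at this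
      exact this
    simp [hK0]
  have hKh : IsHankelFam (fun m => fco (quot1 ν) m) K := isHankelFam_hankelOp _
  have hKb : K =O[atTop] (fun _ => (1:ℝ)) := by
    refine IsBigO.of_bound k ?_
    filter_upwards [eventually_ge_atTop 1] with N hN
    simpa using hk N hN
  have hKs : SmallFam atTop invSqrt (unitVec 0) K :=
    hKh.small hKb (abs_nonneg ν) fun m hm => norm_fco_quot1_le ν hm
  have hGb : G =O[atTop] (fun _ => (1:ℝ)) := by
    refine IsBigO.of_bound (1 - k * k)⁻¹ ?_
    filter_upwards [eventually_ge_atTop 1] with N hN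
    simpa using (hGG N hN).1.2.2
  have hGs : SmallFam atTop invSqrt (unitVec 0) (fun N => G N - 1) := by
    refine SmallFam.inverse (hKs.mul hKs.star).neg ?_ hGb
    filter_upwards [eventually_ge_atTop 1] with N hN
    obtain ⟨⟨a1, a2, -⟩, -⟩ := hGG N hN
    simpa [sub_eq_add_neg] using And.intro a1 a2
  have hsh : Tendsto (fun N : ℕ => N + 1) atTop atTop := tendsto_add_atTop_nat 1
  have hδ1 : (invSqrt ∘ fun N : ℕ => N + 1) =O[atTop] invSqrt := by
    refine IsBigO.of_bound 1 ?_
    filter_upwards [eventually_ge_atTop 1] with N hN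
    have h0 : (0:ℝ) < N := by exact_mod_cast hN
    rw [one_mul, Function.comp, Real.norm_of_nonneg (invSqrt_nonneg _),
      Real.norm_of_nonneg (invSqrt_nonneg _)]
    unfold invSqrt
    gcongr
    linarith
  have up : ∀ {J : ℕ → Ell2 →L[ℂ] Ell2}, SmallFam atTop invSqrt (unitVec 0) J →
      SmallFam atTop invSqrt (unitVec 0) (fun N => J (N + 1)) := fun {J} h => by
    have := h.mono hsh
    exact ⟨this.bdd, this.vec.trans hδ1, this.star_vec.trans hδ1⟩
  obtain ⟨D, hD, hτd⟩ := (hankelType_quot1 ν).diff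
  have hdiff : NeglFam atTop invSqrt (unitVec 0) (fun N => K (N + 1) - K N) :=
    ((hKh.shift 1).sub hKh).negl hD fun m hm => by
      have := hτd m hm
      rw [one_mul] at this
      exact_mod_cast this
  have hJ : NeglFam atTop invSqrt (unitVec 0)
      (fun N => K (N + 1) * star (K (N + 1)) - K N * star (K N)) := by
    refine ((hdiff.mul_small (up hKs).star).add (NeglFam.small_mul hKs hdiff.star)).congr'
      (Eventually.of_forall fun N => ?_)
    simp only [star_sub]
    noncomm_ring
  have hGd : NeglFam atTop invSqrt (unitVec 0) (fun N => G (N + 1) - G N) := by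
    refine ((NeglFam.reg_mul (up hGs) hJ).mul_reg hGs).congr' ?_
    filter_upwards [eventually_ge_atTop 1] with N hN
    obtain ⟨⟨-, a2, -⟩, -⟩ := hGG N hN
    obtain ⟨⟨b1, -, -⟩, -⟩ := hGG (N + 1) (by omega)
    have : K (N + 1) * star (K (N + 1)) - K N * star (K N) =
      (1 - K N * star (K N)) - (1 - K (N + 1) * star (K (N + 1))) := by abel
    rw [this, mul_sub, sub_mul, b1, mul_assoc, a2, mul_one, one_mul]
  have h4 : ∀ N : ℕ, invSqrt N ^ 4 = 1 / (N:ℝ) ^ 2 := fun N => by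
    rw [show (4:ℕ) = 2 * 2 by norm_num, pow_mul, invSqrt_sq, one_div_pow]
  have key : (fun N : ℕ => inner ℂ (K N (unitVec 0)) ((G (N + 1) - G N) (unitVec 0))) =O[atTop]
      fun N : ℕ => 1 / (N:ℝ) ^ 2 := by
    refine (inner_isBigO hKs.vec hGd.vec).congr_right fun N => ?_
    rw [← h4]; ring
  have hρ : ∀ N : ℕ, 1 ≤ N →
      inner ℂ (K N (unitVec 0)) (G (N + 1) (unitVec 0)) = modelRatio (Complex.I * ν) N := by
    intro N hN
    obtain ⟨⟨-, b2, -⟩, -⟩ := hGG (N + 1) (by omega)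
    have h1 := model_ratio hν N (G (N + 1) (unitVec 0)) (by
      have := congrArg (fun A : Ell2 →L[ℂ] Ell2 => A (unitVec 0)) b2
      simpa [sub_mul] using this)
    have h2 : inner ℂ (K N (unitVec 0)) (G (N + 1) (unitVec 0)) =
        star (K N) (G (N + 1) (unitVec 0)) 0 := by
      rw [← inner_unitVec, ← inner_star_apply (star (K N)), star_star]
    rw [h2, modelRatio, Finset.prod_div_distrib, eq_div_iff]
    · exact h1
    · refine Finset.prod_ne_zero_iff.mpr fun j _ h => ?_
      have := congrArg Complex.im h
      simp at this
      exact hν this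
  have hconj : ∀ N : ℕ, 1 ≤ N →
      inner ℂ (K N (unitVec 0)) (G N (unitVec 0)) =
        conj (inner ℂ (unitVec 0) ((G N * K N) (unitVec 0))) := by
    intro N hN
    obtain ⟨⟨b1, b2, -⟩, -⟩ := hGG N hN
    have hs : star (G N) = G N := star_eq_of_inverse (by simp) b1
    rw [inner_conj_symm]
    conv_lhs => rw [← inner_star_apply]
    rw [hs]; rfl
  have tot := (key.neg_left.add (isBigO_modelRatio hν))
  have tot2 : (fun N : ℕ => conj (inner ℂ (unitVec 0) ((G N * K N) (unitVec 0)) -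
        (-(Complex.I * ν)) / N * Complex.exp (-(2 * (Complex.I * ν) * Real.log N)) *
          (Complex.Gamma (1 + Complex.I * ν) / Complex.Gamma (1 - Complex.I * ν)))) =O[atTop]
      fun N : ℕ => 1 / (N:ℝ) ^ 2 := by
    refine tot.congr' ?_ EventuallyEq.rfl
    filter_upwards [eventually_ge_atTop 1] with N hN
    have e1 := hρ N hN
    have e2 := hconj N hN
    have g1 : conj (Complex.Gamma (1 + Complex.I * ν)) = Complex.Gamma (1 - Complex.I * ν) := by
      rw [← Complex.Gamma_conj]; simp [sub_eq_add_neg]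
    have g2 : conj (Complex.Gamma (1 - Complex.I * ν)) = Complex.Gamma (1 + Complex.I * ν) := by
      rw [← Complex.Gamma_conj]; simp
    rw [_root_.sub_apply, inner_sub_right, e1, e2, map_sub, map_mul, map_mul, map_div₀,
      map_div₀, g1, g2, ← Complex.exp_conj]
    simp only [map_neg, map_mul, Complex.conj_I, Complex.conj_ofReal, map_natCast, neg_mul, neg_neg,
      mul_neg, map_ofNat]
    ring
  refine IsBigO.trans (IsBigO.of_bound 1 (Eventually.of_forall fun N => ?_)) tot2
  rw [RCLike.norm_conj, one_mul]

/-- Model operators with an arbitrary unimodular type. -/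
theorem exists_model_resolvent (ν : ℝ) (κ z : ℂ) (hκ : ‖κ‖ = 1) (hz : ‖z‖ = 1) :
    ∃ M G G' : ℕ → Ell2 →L[ℂ] Ell2,
      IsHankelFam (fun m => κ * z ^ m * fco (quot1 ν) m) M ∧
      M =O[atTop] (fun _ => (1:ℝ)) ∧
      (∀ᶠ N in atTop, G N * (1 - M N * star (M N)) = 1 ∧ (1 - M N * star (M N)) * G N = 1) ∧
      G =O[atTop] (fun _ => (1:ℝ)) ∧
      (∀ᶠ N in atTop, G' N * (1 - star (M N) * M N) = 1 ∧ (1 - star (M N) * M N) * G' N = 1) ∧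
      G' =O[atTop] (fun _ => (1:ℝ)) ∧
      (fun N : ℕ => inner ℂ (unitVec 0) ((G N * M N) (unitVec 0)) -
        κ * z ^ N * ((-(Complex.I * ν)) / N * Complex.exp (-(2 * (Complex.I * ν) * Real.log N)) *
          (Complex.Gamma (1 + Complex.I * ν) / Complex.Gamma (1 - Complex.I * ν))))
        =O[atTop] fun N : ℕ => 1 / (N:ℝ) ^ 2 := by
  obtain ⟨G, G', C, h, hF⟩ := exists_quot1_resolvent ν
  set K := hankelOp (quot1 ν) (memLp_quot1 ν) with hKdef
  have hzc : ‖conj z‖ = 1 := by simpa using hz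
  set U := diagOp z hz with hU
  set V := diagOp (conj z) hzc with hV
  have hzz : z * conj z = 1 := by rw [Complex.mul_conj, Complex.normSq_eq_norm_sq, hz]; simp
  have hUV : U * V = 1 := diagOp_mul _ _ hzz
  have hVU : V * U = 1 := diagOp_mul _ _ (by rw [mul_comm, hzz])
  have hsU : star U = V := star_diagOp hz
  have hsV : star V = U := by rw [← hsU, star_star]
  have hUe : U (unitVec 0) = unitVec 0 := by rw [hU, diagOp_unitVec]; simp
  have hVe : V (unitVec 0) = unitVec 0 := by rw [hV, diagOp_unitVec]; simp
  have hnU : ‖U‖ ≤ 1 := LinearMap.mkContinuous_norm_le _ zero_le_one _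
  have hnV : ‖V‖ ≤ 1 := LinearMap.mkContinuous_norm_le _ zero_le_one _
  have hw : ∀ N, ‖κ * z ^ N‖ = 1 := fun N => by rw [norm_mul, norm_pow, hκ, hz]; simp
  have hww : ∀ N, (κ * z ^ N) * conj (κ * z ^ N) = 1 := fun N => by
    rw [Complex.mul_conj, Complex.normSq_eq_norm_sq, hw]; simp
  have hUVx : ∀ X, U * (V * X) = X := fun X => by rw [← mul_assoc, hUV, one_mul]
  have hVUx : ∀ X, V * (U * X) = X := fun X => by rw [← mul_assoc, hVU, one_mul]
  have tri : ∀ A X B : Ell2 →L[ℂ] Ell2, ‖A‖ ≤ 1 → ‖B‖ ≤ 1 → ‖A * X * B‖ ≤ ‖X‖ := by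
    intro A X B hA hB
    calc ‖A * X * B‖ ≤ ‖A‖ * ‖X‖ * ‖B‖ := (norm_mul_le _ _).trans (by gcongr; exact norm_mul_le _ _)
      _ ≤ 1 * ‖X‖ * 1 := by gcongr
      _ = ‖X‖ := by ring
  set M : ℕ → Ell2 →L[ℂ] Ell2 := fun N => (κ * z ^ N) • (U * K N * U) with hM
  have hMM : ∀ N, 1 - M N * star (M N) = U * (1 - K N * star (K N)) * V := by
    intro N
    have : M N * star (M N) = ((κ * z ^ N) * conj (κ * z ^ N)) • (U * (K N * star (K N)) * V) := by
      have : star (M N) = conj (κ * z ^ N) • star (U * K N * U) := star_smul _ _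
      rw [this, star_mul, star_mul, hsU]
      simp only [hM]
      rw [smul_mul_smul_comm]
      simp only [mul_assoc, hUVx]
    rw [this, hww, one_smul, mul_sub, sub_mul, mul_one, hUV]
  have hMM' : ∀ N, 1 - star (M N) * M N = V * (1 - star (K N) * K N) * U := by
    intro N
    have : star (M N) * M N = (conj (κ * z ^ N) * (κ * z ^ N)) • (V * (star (K N) * K N) * U) := by
      have : star (M N) = conj (κ * z ^ N) • star (U * K N * U) := star_smul _ _
      rw [this, star_mul, star_mul, hsU]
      simp only [hM]
      rw [smul_mul_smul_comm]
      simp only [mul_assoc, hVUx]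
    rw [this, mul_comm (conj _), hww, one_smul, mul_sub, sub_mul, mul_one, hVU]
  refine ⟨M, fun N => U * G N * V, fun N => V * G' N * U, ?_, ?_, ?_, ?_, ?_, ?_, ?_⟩
  · intro N j k
    have h1 := isHankelFam_hankelOp (memLp_quot1 ν) N j k
    rw [matEntry] at h1 ⊢
    change (κ * z ^ N) * (U (K N (U (unitVec k)))) j = _
    rw [hU, diagOp_apply, diagOp_unitVec, map_smul, lp.coeFn_smul, Pi.smul_apply, smul_eq_mul, h1]
    ring
  · refine IsBigO.of_bound C ?_
    filter_upwards [eventually_ge_atTop 1] with N hN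
    rw [norm_smul, hw, one_mul, norm_one, mul_one]
    exact (tri _ _ _ hnU hnU).trans (h N hN _ rfl).2.2.1
  · filter_upwards [eventually_ge_atTop 1] with N hN
    obtain ⟨⟨b1, b2⟩, -⟩ := h N hN _ rfl
    rw [hMM]
    constructor
    · calc _ = U * (G N * (V * (U * ((1 - K N * star (K N)) * V)))) := by simp only [mul_assoc]
        _ = U * ((G N * (1 - K N * star (K N))) * V) := by rw [hVUx]; simp only [mul_assoc]
        _ = 1 := by rw [b1, one_mul, hUV]
    · calc _ = U * ((1 - K N * star (K N)) * (V * (U * (G N * V)))) := by simp only [mul_assoc]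
        _ = U * (((1 - K N * star (K N)) * G N) * V) := by rw [hVUx]; simp only [mul_assoc]
        _ = 1 := by rw [b2, one_mul, hUV]
  · refine IsBigO.of_bound C ?_
    filter_upwards [eventually_ge_atTop 1] with N hN
    rw [norm_one, mul_one]
    exact (tri _ _ _ hnU hnV).trans (h N hN _ rfl).2.2.2.1
  · filter_upwards [eventually_ge_atTop 1] with N hN
    obtain ⟨-, ⟨b1, b2⟩, -⟩ := h N hN _ rfl
    rw [hMM']
    constructor
    · calc _ = V * (G' N * (U * (V * ((1 - star (K N) * K N) * U)))) := by simp only [mul_assoc]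
        _ = V * ((G' N * (1 - star (K N) * K N)) * U) := by rw [hUVx]; simp only [mul_assoc]
        _ = 1 := by rw [b1, one_mul, hVU]
    · calc _ = V * ((1 - star (K N) * K N) * (U * (V * (G' N * U)))) := by simp only [mul_assoc]
        _ = V * (((1 - star (K N) * K N) * G' N) * U) := by rw [hUVx]; simp only [mul_assoc]
        _ = 1 := by rw [b2, one_mul, hVU]
  · refine IsBigO.of_bound C ?_
    filter_upwards [eventually_ge_atTop 1] with N hN
    rw [norm_one, mul_one]
    exact (tri _ _ _ hnV hnU).trans (h N hN _ rfl).2.2.2.2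
  · have hc : (fun N : ℕ => κ * z ^ N) =O[atTop] (fun _ => (1:ℝ)) :=
      IsBigO.of_bound 1 (Eventually.of_forall fun N => by rw [hw]; simp)
    refine (hc.mul hF).congr (fun N => ?_) (fun N => one_mul _)
    have e1 : ((U * G N * V) * M N) (unitVec 0) =
        (κ * z ^ N) • U ((G N * K N) (unitVec 0)) := by
      have : (U * G N * V) * M N = (κ * z ^ N) • (U * (G N * K N) * U) := by
        simp only [hM, mul_smul_comm, mul_assoc, hVUx]
      rw [this]
      change (κ * z ^ N) • (U ((G N * K N) (U (unitVec 0)))) = _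
      rw [hUe]
    have e2 : inner ℂ (unitVec 0) (U ((G N * K N) (unitVec 0))) =
        inner ℂ (unitVec 0) ((G N * K N) (unitVec 0)) := by
      rw [← inner_star_apply, hsU, hVe]
    rw [e1, inner_smul_right, e2]
    ring

end ModelResolvent

section SmoothFourier
open scoped ENNReal InnerProductSpace ComplexConjugate ContDiff
open Asymptotics

lemma periodic_deriv {f : ℝ → ℂ} {T : ℝ} (hf : Function.Periodic f T) : Function.Periodic (deriv f) T := by
  intro x
  have : (fun y => f (y + T)) = f := funext hf
  rw [← deriv_comp_add_const, this]

lemma exists_norm_integral_exp_le (p : ℕ) : ∀ f : ℝ → ℂ, ContDiff ℝ ∞ f → Function.Periodic f (2 * Real.pi) →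
    ∃ C : ℝ, 0 ≤ C ∧ ∀ m : ℤ, m ≠ 0 →
      ‖∫ x in (0:ℝ)..2 * Real.pi, f x * Complex.exp (m * (x * Complex.I))‖ ≤ C / |(m:ℝ)| ^ p := by
  induction p with
  | zero =>
    intro f hf _
    have hc := hf.continuous
    obtain ⟨C, hC⟩ := (isCompact_Icc (a := (0:ℝ)) (b := 2 * Real.pi)).exists_bound_of_continuousOn hc.continuousOn
    refine ⟨|C| * (2 * Real.pi), by positivity, fun m _ => ?_⟩
    rw [pow_zero, div_one]
    refine (intervalIntegral.norm_integral_le_of_norm_le_const (C := |C|) fun x hx => ?_).trans ?_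
    · rw [uIoc_of_le (by positivity)] at hx
      rw [norm_mul, show (m:ℂ) * (x * Complex.I) = ((m * x : ℝ) : ℂ) * Complex.I by push_cast; ring,
        Complex.norm_exp_ofReal_mul_I, mul_one]
      exact (hC x ⟨hx.1.le, hx.2⟩).trans (le_abs_self C)
    · rw [sub_zero, abs_of_pos Real.two_pi_pos]
  | succ p ih =>
    intro f hf hper
    have hf' : ContDiff ℝ ∞ (deriv f) := (contDiff_infty_iff_deriv.mp hf).2
    obtain ⟨C, hC0, hC⟩ := ih _ hf' (periodic_deriv hper)
    refine ⟨C, hC0, fun m hm => ?_⟩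
    have hmc : (m : ℂ) * Complex.I ≠ 0 := mul_ne_zero (by exact_mod_cast hm) Complex.I_ne_zero
    have hv : ∀ x : ℝ, HasDerivAt (fun x : ℝ => Complex.exp (m * (x * Complex.I)) / (m * Complex.I))
        (Complex.exp (m * (x * Complex.I))) x := by
      intro x
      have h1 : HasDerivAt (fun x : ℝ => (m:ℂ) * (x * Complex.I)) (m * Complex.I) x := by
        simpa using ((Complex.ofRealCLM.hasDerivAt (x := x)).mul_const Complex.I).const_mul (m:ℂ)
      convert! (h1.cexp).div_const (m * Complex.I) using 1
      field_simp
    have hu : ∀ x : ℝ, HasDerivAt f (deriv f x) x := fun x =>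
      (hf.differentiable (by simp) x).hasDerivAt
    have ibp := intervalIntegral.integral_mul_deriv_eq_deriv_mul (a := 0) (b := 2 * Real.pi)
      (fun x _ => hu x) (fun x _ => hv x) (hf'.continuous.intervalIntegrable _ _)
      (by apply Continuous.intervalIntegrable; fun_prop)
    have e0 : f (2 * Real.pi) = f 0 := by simpa using hper 0
    have e1 : Complex.exp (m * ((2 * Real.pi : ℝ) * Complex.I)) = 1 := by
      rw [show (m:ℂ) * ((2 * Real.pi : ℝ) * Complex.I) = m * (2 * Real.pi * Complex.I) by push_cast; ring]
      exact Complex.exp_int_mul_two_pi_mul_I m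
    rw [ibp, e0, e1]
    simp only [Complex.ofReal_zero, zero_mul, mul_zero, Complex.exp_zero, sub_self, zero_sub, norm_neg]
    simp_rw [← mul_div_assoc]
    rw [intervalIntegral.integral_div, norm_div, norm_mul, Complex.norm_I, mul_one, Complex.norm_intCast,
      pow_succ, ← div_div]
    gcongr
    exact hC m hm

/-- Smooth functions on the circle. -/
def SmoothT (s : Tor → ℂ) : Prop := ContDiff ℝ ∞ (fun x : ℝ => s (x : Tor))

lemma fco_eq_intervalIntegral (s : Tor → ℂ) (m : ℤ) :
    fco s m = (2 * Real.pi)⁻¹ • ∫ x in (0:ℝ)..2 * Real.pi, s (x : Tor) * Complex.exp (m * (x * Complex.I)) := by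
  unfold fco
  rw [integral_tor _ 0, zero_add]
  congr 2
  ext x
  rw [crd_coe, ← Complex.exp_int_mul]

namespace SmoothT

lemma continuous {s : Tor → ℂ} (hs : SmoothT s) : Continuous s :=
  (QuotientAddGroup.isQuotientMap_mk _).continuous_iff.mpr (ContDiff.continuous hs)

lemma exists_norm_fco_le {s : Tor → ℂ} (hs : SmoothT s) (p : ℕ) :
    ∃ C : ℝ, 0 ≤ C ∧ ∀ m : ℤ, ‖fco s m‖ ≤ C / (1 + |(m:ℝ)|) ^ p := by
  obtain ⟨C, hC0, hC⟩ := exists_norm_integral_exp_le p _ hs (fun x => by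
    congr 1; exact AddCircle.coe_add_period _ _)
  refine ⟨max ‖fco s 0‖ (C * 2 ^ p), le_max_of_le_left (norm_nonneg _), fun m => ?_⟩
  rcases eq_or_ne m 0 with rfl | hm
  · simp
  have hm1 : (1:ℝ) ≤ |(m:ℝ)| := by exact_mod_cast Int.one_le_abs hm
  have hpi : (2 * Real.pi)⁻¹ ≤ 1 := inv_le_one_of_one_le₀ (by linarith [Real.pi_gt_three])
  calc ‖fco s m‖ ≤ 1 * (C / |(m:ℝ)| ^ p) := by
        rw [fco_eq_intervalIntegral, norm_smul, Real.norm_of_nonneg (by positivity)]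
        gcongr
        exact hC m hm
    _ ≤ C * 2 ^ p / (1 + |(m:ℝ)|) ^ p := by
        rw [one_mul, div_le_div_iff₀ (by positivity) (by positivity), mul_assoc, ← mul_pow]
        gcongr
        linarith
    _ ≤ _ := by gcongr; exact le_max_right _ _

lemma summable_one_add_abs :
    Summable (fun k : ℤ => 1 / (1 + |(k:ℝ)|) ^ 2) := by
  refine Summable.of_norm_bounded_eventually (g := fun k : ℤ => 1 / (k:ℝ) ^ 2)
    (Real.summable_one_div_int_pow.mpr one_lt_two) ?_
  have : {x : ℤ | ¬ ‖(1:ℝ) / (1 + |(x:ℝ)|) ^ 2‖ ≤ 1 / (x:ℝ) ^ 2} ⊆ {0} := by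
    intro x hx
    by_contra h0
    refine hx ?_
    have h1 : (x:ℝ) ≠ 0 := by exact_mod_cast h0
    rw [Real.norm_of_nonneg (by positivity), ← sq_abs (x:ℝ)]
    have := abs_pos.mpr h1
    gcongr
    linarith
  exact (Set.finite_singleton 0).subset this

lemma summable_weighted {s : Tor → ℂ} (hs : SmoothT s) (p : ℕ) :
    Summable (fun k : ℤ => (1 + |(k:ℝ)|) ^ p * ‖fco s (-k)‖) := by
  obtain ⟨C, hC0, hC⟩ := hs.exists_norm_fco_le (p + 2)
  refine Summable.of_nonneg_of_le (fun k => by positivity) (fun k => ?_)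
    (summable_one_add_abs.mul_left C)
  have := hC (-k)
  rw [Int.cast_neg, abs_neg] at this
  calc _ ≤ (1 + |(k:ℝ)|) ^ p * (C / (1 + |(k:ℝ)|) ^ (p + 2)) := by gcongr
    _ = _ := by
      rw [pow_add]
      have : (1 + |(k:ℝ)|) ≠ 0 := by positivity
      field_simp

lemma hasSum {s : Tor → ℂ} (hs : SmoothT s) (t : Tor) :
    HasSum (fun k : ℤ => fco s (-k) * crd t ^ k) (s t) := by
  let f : C(Tor, ℂ) := ⟨s, hs.continuous⟩
  have hc : ∀ k : ℤ, fourierCoeff f k = fco s (-k) := by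
    intro k
    unfold fourierCoeff fco torMeasure
    congr 1; ext t
    rw [smul_eq_mul, mul_comm, crd_zpow]; rfl
  have hsum : Summable (fourierCoeff f) := by
    refine Summable.of_norm ?_
    refine (hs.summable_weighted 0).congr fun k => ?_
    rw [hc, pow_zero, one_mul]
  refine (has_pointwise_sum_fourier_series_of_summable hsum t).congr_fun fun k => ?_
  rw [hc, crd_zpow, smul_eq_mul]

lemma mul {s r : Tor → ℂ} (hs : SmoothT s) (hr : SmoothT r) : SmoothT (fun t => s t * r t) :=
  ContDiff.mul hs hr

end SmoothT

lemma norm_sub_pow_mul_le {τ : ℕ → ℂ} {z : ℂ} (hz : ‖z‖ = 1) {C : ℝ} (hC : 0 ≤ C)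
    (h : ∀ m : ℕ, 1 ≤ m → ‖τ (m + 1) - z * τ m‖ ≤ C / (m:ℝ) ^ 2) {n : ℕ} (hn : 1 ≤ n) (j : ℕ) :
    ‖τ (n + j) - z ^ j * τ n‖ ≤ j * (C / (n:ℝ) ^ 2) := by
  induction j with
  | zero => simp
  | succ j ih =>
    have hn' : (1:ℝ) ≤ n := by exact_mod_cast hn
    have e : τ (n + (j + 1)) - z ^ (j + 1) * τ n =
        (τ (n + j + 1) - z * τ (n + j)) + z * (τ (n + j) - z ^ j * τ n) := by
      rw [← add_assoc]; ring
    rw [e]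
    refine (norm_add_le _ _).trans ?_
    rw [norm_mul, hz, one_mul]
    have h1 := h (n + j) (by omega)
    have h2 : C / ((n + j : ℕ):ℝ) ^ 2 ≤ C / (n:ℝ) ^ 2 := by
      gcongr
      linarith [Nat.cast_nonneg (α := ℝ) j]
    have h3 := h1.trans h2
    push_cast
    linarith

/-- Multiplying a function by a smooth one only changes its Fourier coefficients by the
value at the singular point, up to `O(1/m²)`. -/
lemma fco_smooth_mul {s φ : Tor → ℂ} (hs : SmoothT s) (hφ : MemLp φ ∞ torMeasure)
    (hb : ∀ t, ‖φ t‖ ≤ 1) (t₀ : Tor) {C : ℝ} (hC : 0 ≤ C)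
    (h : ∀ m : ℕ, 1 ≤ m → ‖fco φ (m + 1 : ℕ) - crd t₀ * fco φ m‖ ≤ C / (m:ℝ) ^ 2) :
    ∃ C' : ℝ, 0 ≤ C' ∧ ∀ m : ℕ, 1 ≤ m →
      ‖fco (fun t => s t * φ t) m - s t₀ * fco φ m‖ ≤ C' / (m:ℝ) ^ 2 := by
  have hsum := hs.summable_weighted 2
  have hsum0 : Summable (fun k : ℤ => ‖fco s (-k)‖) := by simpa using hs.summable_weighted 0
  have hφ1 : Integrable φ torMeasure := (memLp_one_iff_integrable.mp (hφ.mono_exponent le_top))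
  have hexp : ∀ m : ℕ, HasSum (fun k : ℤ => fco s (-k) * fco φ (m + k)) (fco (fun t => s t * φ t) m) := by
    intro m
    have h_integ : ∀ k : ℤ, Integrable (fun t => fco s (-k) * (φ t * crd t ^ ((m:ℤ) + k))) torMeasure :=
      fun k => (integrable_mul_zpow hφ1 _).const_mul _
    have hs1 : Summable (fun k : ℤ => ∫ t, ‖fco s (-k) * (φ t * crd t ^ ((m:ℤ) + k))‖ ∂torMeasure) := by
      refine Summable.of_nonneg_of_le (fun k => integral_nonneg fun t => norm_nonneg _) (fun k => ?_) hsum0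
      calc _ ≤ ∫ t, ‖fco s (-k)‖ ∂torMeasure := by
            refine integral_mono (h_integ k).norm (integrable_const _) fun t => ?_
            rw [norm_mul, norm_mul, norm_zpow, norm_crd, one_zpow, mul_one]
            exact mul_le_of_le_one_right (norm_nonneg _) (hb t)
        _ = ‖fco s (-k)‖ := by simp
    have := hasSum_integral_of_summable_integral_norm h_integ hs1
    have e : ∫ t, ∑' k : ℤ, fco s (-k) * (φ t * crd t ^ ((m:ℤ) + k)) ∂torMeasure =
        fco (fun t => s t * φ t) m := by
      unfold fco
      congr 1; ext t
      rw [mul_assoc, ← (hs.hasSum t).tsum_eq, ← tsum_mul_right]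
      congr 1; ext k
      rw [zpow_add₀ (crd_ne_zero t)]; unfold fco; ring
    rw [e] at this
    refine this.congr_fun fun k => ?_
    rw [integral_const_mul]; rfl
  have hb' : ∀ m : ℤ, ‖fco φ m‖ ≤ 1 := norm_fco_le hb
  refine ⟨∑' k : ℤ, (4 * C + 8) * ((1 + |(k:ℝ)|) ^ 2 * ‖fco s (-k)‖),
    tsum_nonneg fun k => by positivity, fun m hm => ?_⟩
  have hm' : (1:ℝ) ≤ m := by exact_mod_cast hm
  have h2 := (hexp m).sub ((hs.hasSum t₀).mul_right (fco φ m))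
  rw [← h2.tsum_eq, ← tsum_div_const]
  refine tsum_of_norm_bounded ((hsum.mul_left (4 * C + 8)).div_const ((m:ℝ) ^ 2)).hasSum fun k => ?_
  have e : fco s (-k) * fco φ (m + k) - fco s (-k) * crd t₀ ^ k * fco φ m =
      fco s (-k) * (fco φ (m + k) - crd t₀ ^ k * fco φ m) := by ring
  rw [e, norm_mul]
  suffices hk : ‖fco φ (m + k) - crd t₀ ^ k * fco φ m‖ ≤ (4 * C + 8) * (1 + |(k:ℝ)|) ^ 2 / (m:ℝ) ^ 2 by
    calc _ ≤ ‖fco s (-k)‖ * ((4 * C + 8) * (1 + |(k:ℝ)|) ^ 2 / (m:ℝ) ^ 2) := by gcongr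
      _ = _ := by ring
  have hjj : ∀ j : ℕ, (j:ℝ) ≤ (1 + j) ^ 2 := fun j => by nlinarith [Nat.cast_nonneg (α := ℝ) j]
  rcases le_or_gt 0 k with hk0 | hk0
  · obtain ⟨j, rfl⟩ := Int.eq_ofNat_of_zero_le hk0
    have := norm_sub_pow_mul_le (norm_crd t₀) hC (τ := fun m => fco φ m) h hm j
    push_cast at this ⊢
    rw [zpow_natCast]
    refine this.trans ?_
    rw [← mul_div_assoc, Nat.abs_cast]
    have h3 : (j:ℝ) * C ≤ (4 * C + 8) * (1 + (j:ℝ)) ^ 2 := by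
      nlinarith [hjj j, Nat.cast_nonneg (α := ℝ) j, mul_le_mul_of_nonneg_right (hjj j) hC,
        mul_nonneg hC (sq_nonneg (1 + (j:ℝ)))]
    gcongr
  · obtain ⟨j, hj⟩ := Int.eq_ofNat_of_zero_le (a := -k) (by omega)
    obtain rfl : k = -(j:ℤ) := by omega
    have habs : |((-(j:ℤ) : ℤ) : ℝ)| = j := by push_cast; rw [abs_neg, Nat.abs_cast]
    rw [habs]
    rcases le_or_gt (2 * j) m with hjm | hjm
    · have hn : 1 ≤ m - j := by omega
      have := norm_sub_pow_mul_le (norm_crd t₀) hC (τ := fun m => fco φ m) h hn j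
      rw [Nat.sub_add_cancel (by omega)] at this
      have e2 : fco φ ((m:ℤ) + -(j:ℤ)) - crd t₀ ^ (-(j:ℤ)) * fco φ m =
          -(crd t₀ ^ (-(j:ℤ)) * (fco φ m - crd t₀ ^ j * fco φ ((m - j : ℕ) : ℤ))) := by
        have h1 : crd t₀ ^ (-(j:ℤ)) * crd t₀ ^ j = 1 := by
          rw [zpow_neg, zpow_natCast, inv_mul_cancel₀ (pow_ne_zero _ (crd_ne_zero _))]
        rw [mul_sub, ← mul_assoc, h1, Nat.cast_sub (by omega), ← sub_eq_add_neg]; ring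
      rw [e2, norm_neg, norm_mul, norm_zpow, norm_crd, one_zpow, one_mul]
      refine this.trans ?_
      have hge : (m:ℝ) / 2 ≤ ((m - j : ℕ) : ℝ) := by
        rw [Nat.cast_sub (by omega)]
        have : (2:ℝ) * j ≤ m := by exact_mod_cast hjm
        linarith
      calc (j:ℝ) * (C / ((m - j : ℕ) : ℝ) ^ 2) ≤ j * (C / ((m:ℝ) / 2) ^ 2) := by gcongr
        _ = (4 * C) * j / (m:ℝ) ^ 2 := by field_simp; ring
        _ ≤ _ := by
          gcongr
          · linarith
          · exact hjj j
    · have : (m:ℝ) ≤ 2 * (1 + j) := by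
        have : (m:ℝ) < 2 * j := by exact_mod_cast hjm
        linarith
      calc _ ≤ (1:ℝ) + 1 := by
            refine (norm_sub_le _ _).trans ?_
            rw [norm_mul, norm_zpow, norm_crd, one_zpow, one_mul]
            exact add_le_add (hb' _) (hb' _)
        _ ≤ _ := by
          rw [le_div_iff₀ (by positivity)]
          nlinarith [sq_nonneg (2 * (1 + (j:ℝ)) - m), mul_nonneg hC (sq_nonneg (1 + (j:ℝ)))]

end SmoothFourier

section OuterLog
open scoped ENNReal InnerProductSpace ComplexConjugate ContDiff

lemma logLike_of_continuousOn {g : ℂ → ℂ} (hd : DifferentiableOn ℂ g (Metric.ball 0 1))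
    (hc : ContinuousOn g (Metric.closedBall 0 1)) : LogLike g := by
  refine ⟨hd, ?_, ?_⟩
  · filter_upwards with t
    exact hc _ (by rw [mem_closedBall_zero_iff, norm_crd])
  · obtain ⟨C, hC⟩ := (isCompact_closedBall (0:ℂ) 1).exists_bound_of_continuousOn hc
    exact ⟨C, fun z hz => (Complex.re_le_norm _).trans (hC z (Metric.ball_subset_closedBall hz))⟩

/-- The power series with real coefficients `c`. -/
noncomputable def gser (c : ℕ → ℝ) (z : ℂ) : ℂ := ∑' k : ℕ, (c k : ℂ) * z ^ k

lemma norm_gser_term_le (c : ℕ → ℝ) (k : ℕ) {z : ℂ} (hz : ‖z‖ ≤ 1) : ‖(c k : ℂ) * z ^ k‖ ≤ |c k| := by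
  rw [norm_mul, norm_pow, Complex.norm_real, Real.norm_eq_abs]
  exact mul_le_of_le_one_right (abs_nonneg _) (pow_le_one₀ (norm_nonneg _) hz)

lemma differentiableOn_gser {c : ℕ → ℝ} (hc : Summable (fun k => |c k|)) :
    DifferentiableOn ℂ (gser c) (Metric.ball 0 1) :=
  Complex.differentiableOn_tsum_of_summable_norm hc (fun k => by fun_prop) Metric.isOpen_ball
    fun k _ hz => norm_gser_term_le c k (mem_ball_zero_iff.mp hz).le

lemma continuousOn_gser {c : ℕ → ℝ} (hc : Summable (fun k => |c k|)) :
    ContinuousOn (gser c) (Metric.closedBall 0 1) :=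
  continuousOn_tsum (fun k => by fun_prop) hc
    fun k _ hz => norm_gser_term_le c k (mem_closedBall_zero_iff.mp hz)

lemma gser_conj (c : ℕ → ℝ) (z : ℂ) : gser c (conj z) = conj (gser c z) := by
  rw [gser, gser, Complex.conj_tsum]
  congr 1; ext k
  rw [map_mul, map_pow, Complex.conj_ofReal]

lemma iteratedDeriv_exp_mul_I (c : ℂ) (a : ℂ) (n : ℕ) :
    iteratedDeriv n (fun x : ℝ => c * Complex.exp (a * x)) = fun x : ℝ => c * a ^ n * Complex.exp (a * x) := by
  induction n with
  | zero => simp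
  | succ n ih =>
    rw [iteratedDeriv_succ, ih]
    ext x
    have h1 : HasDerivAt (fun x : ℝ => a * (x : ℂ)) a x := by
      simpa using (Complex.ofRealCLM.hasDerivAt (x := x)).const_mul a
    rw [((h1.cexp).const_mul (c * a ^ n)).deriv]
    ring

lemma smoothT_gser {c : ℕ → ℝ} (hc : ∀ p : ℕ, Summable (fun k : ℕ => (k:ℝ) ^ p * |c k|)) :
    SmoothT (fun t => gser c (crd t)) := by
  have e : (fun x : ℝ => gser c (crd (x : Tor))) =
      fun x : ℝ => ∑' k : ℕ, (c k : ℂ) * Complex.exp ((k * Complex.I) * x) := by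
    ext x
    rw [gser]
    congr 1; ext k
    rw [crd_coe, ← Complex.exp_nat_mul]; congr 2; ring
  unfold SmoothT
  rw [e]
  refine contDiff_tsum (N := ⊤) (v := fun p (k : ℕ) => (k:ℝ) ^ p * |c k|) (fun k => ?_) (fun p _ => hc p) ?_
  · have := Complex.ofRealCLM.contDiff (n := ∞)
    exact contDiff_const.mul (contDiff_const.mul this).cexp
  · intro p k x _
    rw [norm_iteratedFDeriv_eq_norm_iteratedDeriv, iteratedDeriv_exp_mul_I, norm_mul, norm_mul, norm_pow,
      norm_mul, Complex.norm_I, mul_one, Complex.norm_natCast, Complex.norm_real, Real.norm_eq_abs,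
      show (k:ℂ) * Complex.I * x = ((k * x : ℝ) : ℂ) * Complex.I by push_cast; ring,
      Complex.norm_exp_ofReal_mul_I, mul_one, mul_comm]

/-- `(1 - (-1)ⁿ) cos(nθ) / cos θ`. -/
noncomputable def oddRatio (n : ℕ) (θ : ℝ) : ℝ := (1 - (-1) ^ n) * Real.cos (n * θ) / Real.cos θ

lemma oddRatio_add_two (n : ℕ) {θ : ℝ} (h : Real.cos θ ≠ 0) :
    oddRatio (n + 2) θ = 2 * (1 - (-1) ^ n) * Real.cos ((n + 1 : ℕ) * θ) - oddRatio n θ := by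
  unfold oddRatio
  have e : Real.cos ((n + 2 : ℕ) * θ) = 2 * Real.cos ((n + 1 : ℕ) * θ) * Real.cos θ - Real.cos (n * θ) := by
    have e1 : ((n + 2 : ℕ):ℝ) * θ = ((n + 1 : ℕ):ℝ) * θ + θ := by push_cast; ring
    have e2 : (n:ℝ) * θ = ((n + 1 : ℕ):ℝ) * θ - θ := by push_cast; ring
    rw [e1, e2, Real.cos_add, Real.cos_sub]; ring
  rw [e, pow_add]
  field_simp

lemma abs_oddRatio_le (n : ℕ) {θ : ℝ} (h : Real.cos θ ≠ 0) : |oddRatio n θ| ≤ 2 * n := by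
  induction n using Nat.twoStepInduction with
  | zero => simp [oddRatio]
  | one => rw [oddRatio]; norm_num [h]
  | more n ih _ =>
    rw [oddRatio_add_two n h]
    refine (abs_sub _ _).trans ?_
    have h1 : |(1:ℝ) - (-1) ^ n| ≤ 2 := by
      rcases neg_one_pow_eq_or ℝ n with h | h <;> rw [h] <;> norm_num
    have h2 := Real.abs_cos_le_one ((n + 1 : ℕ) * θ)
    rw [abs_mul, abs_mul, abs_two]
    have := mul_le_mul h1 h2 (abs_nonneg _) zero_le_two
    push_cast at *
    nlinarith

lemma ae_cos_ne_zero : ∀ᵐ θ : ℝ, θ ∈ uIoc 0 Real.pi → Real.cos θ ≠ 0 := by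
  have h : ∀ᵐ θ : ℝ, θ ≠ Real.pi / 2 := by
    simp [ae_iff]
  filter_upwards [h] with θ h hθ h0
  rw [uIoc_of_le Real.pi_pos.le] at hθ
  refine h ?_
  rcases lt_trichotomy θ (Real.pi / 2) with h1 | h1 | h1
  · exact absurd h0 (Real.cos_pos_of_mem_Ioo ⟨by linarith [hθ.1, Real.pi_pos], h1⟩).ne'
  · exact h1
  · exact absurd h0 (Real.cos_neg_of_pi_div_two_lt_of_lt h1 (by linarith [hθ.2, Real.pi_pos])).ne

lemma measurable_oddRatio (n : ℕ) : Measurable (oddRatio n) := by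
  unfold oddRatio; fun_prop

lemma intervalIntegrable_oddRatio (n : ℕ) : IntervalIntegrable (oddRatio n) volume 0 Real.pi := by
  refine (intervalIntegrable_const (c := 2 * (n:ℝ))).mono_fun
    (measurable_oddRatio n).aestronglyMeasurable ?_
  refine (ae_restrict_iff' measurableSet_uIoc).mpr ?_
  filter_upwards [ae_cos_ne_zero] with θ h hθ
  rw [Real.norm_eq_abs, Real.norm_of_nonneg (by positivity)]
  exact abs_oddRatio_le n (h hθ)

lemma integral_oddRatio (n : ℕ) : ∫ θ in (0:ℝ)..Real.pi, oddRatio n θ = 2 * Real.pi * (Complex.I ^ n).im := by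
  induction n using Nat.twoStepInduction with
  | zero => simp [oddRatio]
  | one =>
    have : ∫ θ in (0:ℝ)..Real.pi, oddRatio 1 θ = ∫ θ in (0:ℝ)..Real.pi, (2:ℝ) := by
      refine intervalIntegral.integral_congr_ae ?_
      filter_upwards [ae_cos_ne_zero] with θ h hθ
      rw [oddRatio]; have := h hθ; norm_num [this]
    rw [this]; simp; ring
  | more n ih _ =>
    have : ∫ θ in (0:ℝ)..Real.pi, oddRatio (n + 2) θ =
        ∫ θ in (0:ℝ)..Real.pi, (2 * (1 - (-1) ^ n) * Real.cos ((n + 1 : ℕ) * θ) - oddRatio n θ) := by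
      refine intervalIntegral.integral_congr_ae ?_
      filter_upwards [ae_cos_ne_zero] with θ h hθ
      exact oddRatio_add_two n (h hθ)
    rw [this, intervalIntegral.integral_sub (by apply Continuous.intervalIntegrable; fun_prop)
      (intervalIntegrable_oddRatio n), ih, intervalIntegral.integral_const_mul,
      intervalIntegral.integral_comp_mul_left (fun x => Real.cos x) (by positivity), integral_cos,
      Real.sin_nat_mul_pi, mul_zero, Real.sin_zero, pow_add, Complex.I_sq]
    simp

lemma tendsto_pv_integral {c : ℕ → ℝ} {F : ℝ → ℝ} (hF : ContinuousOn F (Icc (-1) 1))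
    (hc : Summable (fun k : ℕ => (k:ℝ) * |c k|)) (hc0 : Summable (fun k : ℕ => |c k|))
    (hsum : ∀ θ : ℝ, HasSum (fun n : ℕ => 2 * c n * Real.cos (n * θ)) (F (Real.cos θ) + c 0)) :
    Tendsto (fun ε : ℝ => ∫ t in (Ioo (-1 : ℝ) 1 \ Ioo (0 - ε) (0 + ε)),
      F t / Real.sqrt (1 - t ^ 2) / (t - 0)) (nhdsWithin 0 (Ioi 0))
      (nhds (2 * Real.pi * (gser c Complex.I).im)) := by
  have hFc : Continuous (fun θ => F (Real.cos θ)) :=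
    hF.comp_continuous Real.continuous_cos fun θ => ⟨Real.neg_one_le_cos θ, Real.cos_le_one θ⟩
  have hFc' : Continuous (fun θ => F (-Real.cos θ)) :=
    hF.comp_continuous Real.continuous_cos.neg fun θ =>
      ⟨by linarith [Real.cos_le_one θ], by linarith [Real.neg_one_le_cos θ]⟩
  let Ψ : ℝ → ℝ := fun θ => (F (Real.cos θ) - F (-Real.cos θ)) / Real.cos θ
  have hΨ : ∀ θ, Real.cos θ ≠ 0 → HasSum (fun n : ℕ => 2 * c n * oddRatio n θ) (Ψ θ) := by
    intro θ hθ
    have h2 := hsum (θ + Real.pi)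
    rw [Real.cos_add_pi] at h2
    have h3 := ((hsum θ).sub h2).div_const (Real.cos θ)
    rw [add_sub_add_right_eq_sub] at h3
    refine h3.congr_fun fun n => ?_
    rw [oddRatio, mul_add, Real.cos_add_nat_mul_pi]
    ring
  have hbd : ∀ n θ, Real.cos θ ≠ 0 → ‖2 * c n * oddRatio n θ‖ ≤ 4 * (n * |c n|) := by
    intro n θ hθ
    rw [Real.norm_eq_abs, abs_mul, abs_mul, abs_two]
    nlinarith [abs_oddRatio_le n hθ, abs_nonneg (c n)]
  have hs4 := hc.mul_left 4
  have hΨb : ∀ θ, Real.cos θ ≠ 0 → ‖Ψ θ‖ ≤ ∑' n : ℕ, 4 * (n * |c n|) := fun θ hθ => by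
    rw [← (hΨ θ hθ).tsum_eq]
    exact tsum_of_norm_bounded hs4.hasSum fun n => hbd n θ hθ
  have h_integ : ∫ θ in (0:ℝ)..Real.pi, Ψ θ = 4 * Real.pi * (gser c Complex.I).im := by
    have h1 := intervalIntegral.hasSum_integral_of_dominated_convergence (μ := volume) (a := 0) (b := Real.pi)
      (F := fun n θ => 2 * c n * oddRatio n θ) (f := Ψ) (fun n _ => 4 * (n * |c n|))
      (fun n => ((measurable_oddRatio n).const_mul _).aestronglyMeasurable)
      (fun n => by filter_upwards [ae_cos_ne_zero] with θ h hθ using hbd n θ (h hθ))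
      (by filter_upwards with θ _ using hs4) intervalIntegrable_const
      (by filter_upwards [ae_cos_ne_zero] with θ h hθ using hΨ θ (h hθ))
    have h2 : HasSum (fun n : ℕ => (c n : ℂ) * Complex.I ^ n) (gser c Complex.I) :=
      (Summable.of_norm_bounded hc0 fun n => norm_gser_term_le c n (by simp)).hasSum
    have h3 := (Complex.imCLM.hasSum h2).mul_left (4 * Real.pi)
    refine h1.unique (h3.congr_fun fun n => ?_)
    rw [intervalIntegral.integral_const_mul, integral_oddRatio, Complex.imCLM_apply,
      Complex.im_ofReal_mul]
    ring
  have hlim : Tendsto (fun ε : ℝ => ∫ θ in (0:ℝ)..Real.pi, if |Real.cos θ| < ε then 0 else Ψ θ)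
      (nhdsWithin 0 (Ioi 0)) (nhds (∫ θ in (0:ℝ)..Real.pi, Ψ θ)) := by
    refine intervalIntegral.tendsto_integral_filter_of_dominated_convergence
      (fun _ => ∑' n : ℕ, 4 * (n * |c n|)) ?_ ?_ intervalIntegrable_const ?_
    · filter_upwards with ε
      refine Measurable.aestronglyMeasurable ?_
      refine Measurable.ite (measurableSet_lt (by fun_prop) (by fun_prop)) measurable_const ?_
      exact (hFc.measurable.sub hFc'.measurable).div (by fun_prop)
    · filter_upwards with ε
      filter_upwards [ae_cos_ne_zero] with θ h hθ
      split_ifs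
      · rw [norm_zero]; exact tsum_nonneg fun n => by positivity
      · exact hΨb θ (h hθ)
    · filter_upwards [ae_cos_ne_zero] with θ h hθ
      refine tendsto_const_nhds.congr' ?_
      filter_upwards [Ioo_mem_nhdsGT (abs_pos.mpr (h hθ))] with ε hε
      rw [if_neg (not_lt.mpr hε.2.le)]
  have hlim2 := hlim.const_mul (1/2)
  rw [h_integ, show 1 / 2 * (4 * Real.pi * (gser c Complex.I).im) = 2 * Real.pi * (gser c Complex.I).im by ring]
    at hlim2
  refine hlim2.congr' ?_
  filter_upwards [self_mem_nhdsWithin] with ε hε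
  have hε : 0 < ε := hε
  let K : ℝ → ℝ := fun x => if |x| < ε then 0 else F x / x
  have e1 : ∫ t in (Ioo (-1 : ℝ) 1 \ Ioo (0 - ε) (0 + ε)), F t / Real.sqrt (1 - t ^ 2) / (t - 0) =
      ∫ θ in (0:ℝ)..Real.pi, K (Real.cos θ) := by
    rw [← Polynomial.Chebyshev.integral_measureT_eq_integral_cos (f := K),
      Polynomial.Chebyshev.integral_measureT, intervalIntegral.integral_of_le (by norm_num),
      integral_Ioc_eq_integral_Ioo, sdiff_eq, ← setIntegral_indicator measurableSet_Ioo.compl]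
    refine setIntegral_congr_fun measurableSet_Ioo fun t _ => ?_
    have : t ∈ (Ioo (0 - ε) (0 + ε))ᶜ ↔ ¬ |t| < ε := by
      rw [mem_compl_iff, mem_Ioo, abs_lt, zero_sub, zero_add]
    by_cases ht : |t| < ε
    · rw [indicator_of_notMem (by rw [this]; exact not_not.mpr ht)]
      simp [K, ht]
    · rw [indicator_of_mem (this.mpr ht)]
      simp only [K, if_neg ht, sub_zero, Real.sqrt_inv]
      ring
  obtain ⟨C, hC⟩ := isCompact_Icc.exists_bound_of_continuousOn hF
  have hKb : ∀ x ∈ Icc (-1:ℝ) 1, ‖K x‖ ≤ |C| / ε := by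
    intro x hx
    simp only [K]
    split_ifs with h
    · rw [norm_zero]; positivity
    · rw [norm_div]
      exact div_le_div₀ (abs_nonneg _) ((hC x hx).trans (le_abs_self _)) hε (not_lt.mp h)
  have hK1 : IntervalIntegrable (fun θ => K (Real.cos θ)) volume 0 Real.pi := by
    refine (intervalIntegrable_const (c := |C| / ε)).mono_fun (Measurable.aestronglyMeasurable ?_) ?_
    · refine Measurable.ite (measurableSet_lt (by fun_prop) (by fun_prop)) measurable_const ?_
      exact hFc.measurable.div (by fun_prop)
    · filter_upwards with θ
      rw [Real.norm_of_nonneg (by positivity : 0 ≤ |C| / ε)]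
      exact hKb _ ⟨Real.neg_one_le_cos θ, Real.cos_le_one θ⟩
  have hK2 : IntervalIntegrable (fun θ => K (-Real.cos θ)) volume 0 Real.pi := by
    refine (intervalIntegrable_const (c := |C| / ε)).mono_fun (Measurable.aestronglyMeasurable ?_) ?_
    · refine Measurable.ite (measurableSet_lt (by fun_prop) (by fun_prop)) measurable_const ?_
      exact hFc'.measurable.div (by fun_prop)
    · filter_upwards with θ
      rw [Real.norm_of_nonneg (by positivity : 0 ≤ |C| / ε)]
      exact hKb _ ⟨by linarith [Real.cos_le_one θ], by linarith [Real.neg_one_le_cos θ]⟩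
  have e2 : ∫ θ in (0:ℝ)..Real.pi, K (-Real.cos θ) = ∫ θ in (0:ℝ)..Real.pi, K (Real.cos θ) := by
    have := intervalIntegral.integral_comp_sub_left (a := 0) (b := Real.pi)
      (fun θ => K (Real.cos θ)) Real.pi
    simpa [Real.cos_pi_sub] using this
  have e3 : ∫ θ in (0:ℝ)..Real.pi, (if |Real.cos θ| < ε then 0 else Ψ θ) =
      ∫ θ in (0:ℝ)..Real.pi, (K (Real.cos θ) + K (-Real.cos θ)) := by
    congr 1; ext θ
    simp only [K, abs_neg, Ψ]
    split_ifs
    · simp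
    · ring
  rw [e1, e3, intervalIntegral.integral_add hK1 hK2, e2]
  ring

lemma crd_coe_re (x : ℝ) : (crd (x : Tor)).re = Real.cos x := by
  rw [crd_coe, Complex.exp_ofReal_mul_I_re]

/-- Analytic functions positive on `[-1, 1]` factor as `exp g * conj (exp g)` on the circle, with `g`
holomorphic in the disc. -/
lemma exists_outer_log {h : ℝ → ℝ} (h_an : AnalyticOnNhd ℝ h (Icc (-1) 1))
    (h_pos : ∀ x ∈ Icc (-1 : ℝ) 1, 0 < h x) {v : ℝ}
    (hv : Tendsto (fun ε : ℝ => ∫ t in (Ioo (-1 : ℝ) 1 \ Ioo (0 - ε) (0 + ε)),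
      Real.log (h t) / Real.sqrt (1 - t ^ 2) / (t - 0)) (nhdsWithin 0 (Ioi 0))
      (nhds (2 * Real.pi * v))) :
    ∃ g : ℂ → ℂ, DifferentiableOn ℂ g (Metric.ball 0 1) ∧ ContinuousOn g (Metric.closedBall 0 1) ∧
      SmoothT (fun t => g (crd t)) ∧ (∀ z, g (conj z) = conj (g z)) ∧
      (∀ t, g (crd t) + conj (g (crd t)) = (Real.log (h (crd t).re) : ℝ)) ∧
      (g Complex.I).im = v := by
  let s : Tor → ℂ := fun t => ((Real.log (h (crd t).re) : ℝ) : ℂ)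
  have hcos : ∀ x : ℝ, Real.cos x ∈ Icc (-1:ℝ) 1 := fun x => ⟨Real.neg_one_le_cos x, Real.cos_le_one x⟩
  have hs : SmoothT s := by
    have : (fun x : ℝ => s (x : Tor)) = fun x : ℝ => ((Real.log (h (Real.cos x)) : ℝ) : ℂ) := by
      ext x; simp only [s, crd_coe_re]
    unfold SmoothT
    rw [this]
    refine Complex.ofRealCLM.contDiff.comp (contDiff_iff_contDiffAt.mpr fun x => ?_)
    refine ContDiffAt.log ?_ (h_pos _ (hcos x)).ne'
    exact ((h_an _ (hcos x)).contDiffAt (n := ∞)).comp x Real.contDiff_cos.contDiffAt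
  have hsneg : ∀ t, s (-t) = s t := by
    intro t
    simp only [s]
    rw [crd_neg, ← conj_crd, Complex.conj_re]
  have hsconj : ∀ t, conj (s t) = s t := fun t => Complex.conj_ofReal _
  have hreal : ∀ m, conj (fco s m) = fco s m := conj_fco_of_symm (by
    filter_upwards with t; rw [hsneg, hsconj])
  have heven : ∀ m, fco s (-m) = fco s m := by
    intro m
    have h1 := fco_conj s m
    rw [show (fun t => conj (s t)) = s from funext hsconj] at h1
    rw [← hreal (-m), ← h1]
  let c : ℕ → ℝ := fun k => (fco s k).re
  have hcf : ∀ k : ℕ, (c k : ℂ) = fco s k := fun k => Complex.conj_eq_iff_re.mp (hreal k)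
  have hcs : ∀ p : ℕ, Summable (fun k : ℕ => (k:ℝ) ^ p * |c k|) := by
    intro p
    refine Summable.of_nonneg_of_le (fun k => by positivity) (fun k => ?_)
      ((hs.summable_weighted p).comp_injective Nat.cast_injective)
    simp only [Function.comp_apply]
    rw [heven, ← hcf, Complex.norm_real, Real.norm_eq_abs, Int.cast_natCast, Nat.abs_cast]
    gcongr
    linarith
  have hcs0 : Summable (fun k : ℕ => |c k|) := by simpa using hcs 0
  have hcs1 : Summable (fun k : ℕ => (k:ℝ) * |c k|) := by simpa using hcs 1
  have hsumC : ∀ t, HasSum (fun n : ℕ => (c n : ℂ) * (crd t ^ n + (crd t ^ n)⁻¹)) (s t + c 0) := by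
    intro t
    have h1 := (hs.hasSum t).nat_add_neg
    rw [neg_zero, zpow_zero, mul_one] at h1
    rw [hcf 0]
    refine h1.congr_fun fun n => ?_
    rw [neg_neg, heven, hcf, zpow_neg, zpow_natCast]
    ring
  have hre : ∀ t, gser c (crd t) + conj (gser c (crd t)) = s t + c 0 := by
    intro t
    have h2 : HasSum (fun n : ℕ => (c n : ℂ) * crd t ^ n) (gser c (crd t)) :=
      (Summable.of_norm_bounded hcs0 fun n => norm_gser_term_le c n (norm_crd t).le).hasSum
    refine (h2.add (Complex.hasSum_conj'.mpr h2)).unique ((hsumC t).congr_fun fun n => ?_)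
    rw [map_mul, map_pow, Complex.conj_ofReal, conj_crd, inv_pow]; ring
  refine ⟨fun z => gser c z - ((c 0 / 2 : ℝ) : ℂ), (differentiableOn_gser hcs0).sub_const _,
    (continuousOn_gser hcs0).sub continuousOn_const, ?_, fun z => ?_, fun t => ?_, ?_⟩
  · exact ContDiff.sub (smoothT_gser hcs) contDiff_const
  · beta_reduce
    rw [gser_conj, map_sub, Complex.conj_ofReal]
  · have := hre t
    rw [map_sub, Complex.conj_ofReal]
    push_cast
    linear_combination this
  · rw [Complex.sub_im, Complex.ofReal_im, sub_zero]
    have hFc : ContinuousOn (fun x => Real.log (h x)) (Icc (-1) 1) :=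
      ContinuousOn.log (fun x hx => (h_an x hx).continuousAt.continuousWithinAt)
        fun x hx => (h_pos x hx).ne'
    have h3 := tendsto_pv_integral hFc hcs1 hcs0 (fun θ => by
      have h4 := Complex.reCLM.hasSum (hsumC (θ : Tor))
      simp only [s, crd_coe_re, Complex.reCLM_apply, Complex.add_re, Complex.ofReal_re] at h4
      refine h4.congr_fun fun n => ?_
      rw [crd_coe, ← Complex.exp_nat_mul, ← Complex.exp_neg,
        show (n:ℂ) * (θ * Complex.I) = ((n * θ : ℝ) : ℂ) * Complex.I by push_cast; ring,
        ← neg_mul, ← Complex.ofReal_neg, Complex.re_ofReal_mul, Complex.add_re,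
        Complex.exp_ofReal_mul_I_re, Complex.exp_ofReal_mul_I_re, Real.cos_neg]
      ring)
    have h5 := tendsto_nhds_unique h3 hv
    have := Real.pi_pos
    nlinarith

end OuterLog

section SzegoWeight
open scoped ENNReal InnerProductSpace ComplexConjugate ContDiff

/-- Logarithms of holomorphic functions in the disc, continuous and smooth up to the boundary and
real on the real axis. -/
structure DiscLog (g : ℂ → ℂ) : Prop where
  diff : DifferentiableOn ℂ g (Metric.ball 0 1)
  cont : ContinuousOn g (Metric.closedBall 0 1)
  smooth : SmoothT (fun t => g (crd t))
  symm : ∀ z, g (conj z) = conj (g z)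

lemma DiscLog.neg {g : ℂ → ℂ} (hg : DiscLog g) : DiscLog (fun z => -g z) :=
  ⟨hg.diff.neg, hg.cont.neg, ContDiff.neg hg.smooth, fun z => by rw [hg.symm, map_neg]⟩

lemma DiscLog.add_real {g : ℂ → ℂ} (hg : DiscLog g) (r : ℝ) : DiscLog (fun z => g z + r) :=
  ⟨hg.diff.add_const _, hg.cont.add continuousOn_const, ContDiff.add hg.smooth contDiff_const,
    fun z => by rw [hg.symm, map_add, Complex.conj_ofReal]⟩

/-- Logarithm of the Szegő function. -/
noncomputable def szegoLog (a a' l : ℝ) (g : ℂ → ℂ) (z : ℂ) : ℂ :=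
  (a : ℂ) * lg 1 z + ((a' : ℂ) * lg (-1) z + (Complex.I * l * lg Complex.I z +
    (-(Complex.I * l) * lg (-Complex.I) z + g z)))

lemma logLike_szegoLog {a a' : ℝ} (ha : 0 ≤ a) (ha' : 0 ≤ a') (l : ℝ) {g : ℂ → ℂ} (hg : DiscLog g) :
    LogLike (szegoLog a a' l g) := by
  refine (logLike_lg (by simp) (by simpa)).add ((logLike_lg (by simp) (by simpa)).add
    ((logLike_lg (by simp) (by simp)).add ((logLike_lg (by simp) (by simp)).add
    (logLike_of_continuousOn hg.diff hg.cont))))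

lemma szegoLog_zero (a a' l : ℝ) (g : ℂ → ℂ) : szegoLog a a' l g 0 = g 0 := by
  simp [szegoLog, lg_zero]

lemma lg_conj {w z : ℂ} (hw : ‖w‖ = 1) (hz : ‖z‖ ≤ 1) : lg (conj w) (conj z) = conj (lg w z) := by
  by_cases h : w * z = 1
  · rw [lg, lg, ← map_mul, h]; simp
  have h1 := one_sub_mem_slitPlane (w := w * z) (by rwa [norm_mul, hw, one_mul]) h
  rw [lg, lg, ← Complex.log_conj _ (Complex.mem_slitPlane_iff_arg.mp h1).1]
  simp

lemma ae_crd_mul_ne (w : ℂ) : ∀ᵐ t ∂torMeasure, w * crd t ≠ 1 := by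
  filter_upwards [ae_crd_ne w⁻¹] with t ht h
  exact ht (eq_inv_of_mul_eq_one_right h)

lemma szegoLog_crd_neg (a a' l : ℝ) {g : ℂ → ℂ} (hg : DiscLog g)
    (t : Tor) : szegoLog a a' l g (crd (-t)) = conj (szegoLog a a' l g (crd t)) := by
  have e1 := lg_conj (w := 1) (by simp) (norm_crd t).le
  have e2 := lg_conj (w := -1) (by simp) (norm_crd t).le
  have e3 := lg_conj (w := Complex.I) (by simp) (norm_crd t).le
  have e4 := lg_conj (w := -Complex.I) (by simp) (norm_crd t).le
  rw [map_one] at e1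
  rw [map_neg, map_one] at e2
  rw [Complex.conj_I] at e3
  rw [map_neg, Complex.conj_I, neg_neg] at e4
  rw [crd_neg, ← conj_crd]
  unfold szegoLog
  rw [e1, e2, e3, e4, hg.symm]
  simp only [map_add, map_mul, map_neg, Complex.conj_ofReal, Complex.conj_I]
  ring

/-- The Szegő function on the circle. -/
noncomputable def szegoFun (a a' l : ℝ) (g : ℂ → ℂ) (t : Tor) : ℂ :=
  Complex.exp (szegoLog a a' l g (crd t))

/-- The phase of the Szegő function. -/
noncomputable def szegoPhase (a a' l : ℝ) (g : ℂ → ℂ) (t : Tor) : ℂ :=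
  szegoFun a a' l g t / conj (szegoFun a a' l g t)

lemma szegoFun_neg (a a' l : ℝ) {g : ℂ → ℂ} (hg : DiscLog g) (t : Tor) :
    szegoFun a a' l g (-t) = conj (szegoFun a a' l g t) := by
  rw [szegoFun, szegoFun, szegoLog_crd_neg a a' l hg, Complex.exp_conj]

lemma norm_szegoPhase (a a' l : ℝ) (g : ℂ → ℂ) (t : Tor) : ‖szegoPhase a a' l g t‖ = 1 := by
  rw [szegoPhase, norm_div, RCLike.norm_conj, div_self]
  exact norm_ne_zero_iff.mpr (Complex.exp_ne_zero _)

lemma szegoData_szegoFun {a a' : ℝ} (ha : a ∈ Icc (0:ℝ) 1) (ha' : a' ∈ Icc (0:ℝ) 1) (l : ℝ) {g : ℂ → ℂ}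
    (hg : DiscLog g) :
    SzegoData (szegoFun a a' l g) (szegoFun (1 - a) (1 - a') (-l) (fun z => -g z)) (szegoPhase a a' l g) := by
  have hD := (logLike_szegoLog ha.1 ha'.1 l hg).hardy
  have hV := (logLike_szegoLog (sub_nonneg.mpr ha.2) (sub_nonneg.mpr ha'.2) (-l) hg.neg).hardy
  rw [szegoLog_zero] at hD hV
  refine ⟨hD.1, hV.1, ?_, hD.2.1, hV.2.1, conj_fco_of_symm (.of_forall (szegoFun_neg _ _ _ hg.neg)),
    conj_fco_of_symm ?_, conj_fco_of_symm (.of_forall (szegoFun_neg _ _ _ hg)) 0, ?_, ?_, ?_⟩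
  · refine MemLp.of_bound ?_ 1 (by filter_upwards with t using (norm_szegoPhase _ _ _ _ t).le)
    have h1 := hD.1.1.aemeasurable
    exact (h1.div (Complex.continuous_conj.measurable.comp_aemeasurable h1)).aestronglyMeasurable
  · filter_upwards with t
    rw [szegoPhase, szegoPhase, szegoFun_neg a a' l hg, map_div₀, Complex.conj_conj]
  · filter_upwards [ae_crd_mul_ne 1, ae_crd_mul_ne (-1)] with t h1 h2
    rw [szegoFun, szegoFun, ← Complex.exp_add]
    have : szegoLog (1 - a) (1 - a') (-l) (fun z => -g z) (crd t) + szegoLog a a' l g (crd t) =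
        lg 1 (crd t) + lg (-1) (crd t) := by
      unfold szegoLog; push_cast; ring
    rw [this, Complex.exp_add, exp_lg h1, exp_lg h2]; ring
  · filter_upwards with t
    exact div_mul_cancel₀ _ ((_root_.map_ne_zero _).mpr (Complex.exp_ne_zero _))
  · have e1 : fco (szegoFun a a' l g) 0 = Complex.exp (g 0) := hD.2.2
    have e2 : fco (szegoFun (1 - a) (1 - a') (-l) fun z => -g z) 0 = Complex.exp (-g 0) := hV.2.2
    rw [e1, e2, ← Complex.exp_add, add_neg_cancel, Complex.exp_zero]

lemma arg_add_sub_arg {w : ℂ} (h1 : 0 < (1 + w).re) (h2 : 0 < (1 - w).re) (hn : ‖w‖ = 1) :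
    (0 < w.im → Complex.arg (1 + w) - Complex.arg (1 - w) = Real.pi / 2) ∧
    (w.im < 0 → Complex.arg (1 + w) - Complex.arg (1 - w) = -(Real.pi / 2)) := by
  have a1 := abs_lt.mp (Complex.abs_arg_lt_pi_div_two_iff.mpr (Or.inl h1))
  have a2 := abs_lt.mp (Complex.abs_arg_lt_pi_div_two_iff.mpr (Or.inl h2))
  have e1 : Complex.arg (conj (1 - w)) = -Complex.arg (1 - w) := by
    rw [Complex.arg_conj, if_neg]
    intro h; rw [h] at a2; linarith [Real.pi_pos]
  have n1 : 1 + w ≠ 0 := fun h => by rw [h] at h1; simp at h1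
  have n2 : conj (1 - w) ≠ 0 := by
    rw [Ne, map_eq_zero]; intro h; rw [h] at h2; simp at h2
  have e2 := Complex.arg_mul n1 n2 (by rw [e1]; constructor <;> linarith)
  have e3 : (1 + w) * conj (1 - w) = ((2 * w.im : ℝ) : ℂ) * Complex.I := by
    have hw : w * conj w = 1 := by rw [Complex.mul_conj, Complex.normSq_eq_norm_sq, hn]; simp
    have := Complex.sub_conj w
    rw [map_sub, map_one]
    push_cast at this ⊢
    linear_combination -hw + this
  rw [e3, e1, ← sub_eq_add_neg] at e2
  refine ⟨fun h => ?_, fun h => ?_⟩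
  · rw [← e2, Complex.arg_real_mul _ (by linarith), Complex.arg_I]
  · rw [← e2, show ((2 * w.im : ℝ) : ℂ) * Complex.I = ((-(2 * w.im) : ℝ) : ℂ) * (-Complex.I) by
      push_cast; ring, Complex.arg_real_mul _ (by linarith), Complex.arg_neg_I]

lemma norm_one_sub_crd_sq (x : ℝ) : ‖1 - 1 * crd (x : Tor)‖ ^ 2 = 2 * (1 - Real.cos x) := by
  rw [← Complex.normSq_eq_norm_sq, one_mul, crd_coe, Complex.normSq_apply]
  simp only [Complex.sub_re, Complex.sub_im, Complex.exp_ofReal_mul_I_re, Complex.exp_ofReal_mul_I_im,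
    Complex.one_re, Complex.one_im]
  nlinarith [Real.sin_sq_add_cos_sq x]

lemma norm_one_add_crd_sq (x : ℝ) : ‖1 - (-1) * crd (x : Tor)‖ ^ 2 = 2 * (1 + Real.cos x) := by
  rw [← Complex.normSq_eq_norm_sq, neg_one_mul, sub_neg_eq_add, crd_coe, Complex.normSq_apply]
  simp only [Complex.add_re, Complex.add_im, Complex.exp_ofReal_mul_I_re, Complex.exp_ofReal_mul_I_im,
    Complex.one_re, Complex.one_im]
  nlinarith [Real.sin_sq_add_cos_sq x]

/-- The boundary values of the Szegő function reproduce the weight. -/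
lemma normSq_szegoFun {α β c : ℝ} (hc : 0 < c) {h : ℝ → ℝ} {g : ℂ → ℂ}
    (h_pos : ∀ x ∈ Icc (-1 : ℝ) 1, 0 < h x)
    (hg : ∀ t, g (crd t) + conj (g (crd t)) = (Real.log (h (crd t).re) : ℝ)) {x : ℝ}
    (hx : x ∈ Ioo 0 Real.pi) (hx0 : Real.cos x ≠ 0) :
    Complex.normSq (szegoFun (α + 1 / 2) (β + 1 / 2) (Real.log c / Real.pi)
      (fun z => g z + ((Real.log c - (α + β + 1) * Real.log 2) / 2 : ℝ)) (x : Tor)) =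
      h (Real.cos x) * (1 - Real.cos x) ^ α * (1 + Real.cos x) ^ β * (if Real.cos x < 0 then 1 else c ^ 2) *
        Real.sin x := by
  have hs : 0 < Real.sin x := Real.sin_pos_of_pos_of_lt_pi hx.1 hx.2
  have hsq := Real.sin_sq_add_cos_sq x
  have hc1 : 0 < 1 - Real.cos x := by nlinarith [Real.cos_le_one x]
  have hc2 : 0 < 1 + Real.cos x := by nlinarith [Real.neg_one_le_cos x]
  have hh := h_pos (Real.cos x) ⟨Real.neg_one_le_cos x, Real.cos_le_one x⟩
  have hlog1 : Real.log ‖1 - 1 * crd (x : Tor)‖ = (Real.log 2 + Real.log (1 - Real.cos x)) / 2 := by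
    rw [← Real.log_mul two_ne_zero hc1.ne', ← norm_one_sub_crd_sq, Real.log_pow]; push_cast; ring
  have hlog2 : Real.log ‖1 - (-1) * crd (x : Tor)‖ = (Real.log 2 + Real.log (1 + Real.cos x)) / 2 := by
    rw [← Real.log_mul two_ne_zero hc2.ne', ← norm_one_add_crd_sq, Real.log_pow]; push_cast; ring
  have hre1 : (lg 1 (crd (x : Tor))).re = (Real.log 2 + Real.log (1 - Real.cos x)) / 2 := by
    rw [lg, Complex.log_re, hlog1]
  have hre2 : (lg (-1) (crd (x : Tor))).re = (Real.log 2 + Real.log (1 + Real.cos x)) / 2 := by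
    rw [lg, Complex.log_re, hlog2]
  have hreg : 2 * (g (crd (x : Tor))).re = Real.log (h (Real.cos x)) := by
    have := congrArg Complex.re (hg (x : Tor))
    rw [Complex.add_re, Complex.conj_re, Complex.ofReal_re, crd_coe_re] at this
    linarith
  have hw : (Complex.I * crd (x : Tor)).re = -Real.sin x := by
    rw [crd_coe, Complex.I_mul_re, Complex.exp_ofReal_mul_I_im]
  have hw' : (Complex.I * crd (x : Tor)).im = Real.cos x := by
    rw [crd_coe, Complex.I_mul_im, Complex.exp_ofReal_mul_I_re]
  have hs1 : Real.sin x < 1 := by nlinarith [sq_pos_of_ne_zero hx0]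
  have harg := arg_add_sub_arg (w := Complex.I * crd (x : Tor))
    (by rw [Complex.add_re, hw, Complex.one_re]; linarith)
    (by rw [Complex.sub_re, hw, Complex.one_re]; linarith) (by rw [norm_mul, norm_crd]; simp)
  rw [hw'] at harg
  have himI : (lg Complex.I (crd (x : Tor))).im = Complex.arg (1 - Complex.I * crd (x : Tor)) := by
    rw [lg, Complex.log_im]
  have himI' : (lg (-Complex.I) (crd (x : Tor))).im = Complex.arg (1 + Complex.I * crd (x : Tor)) := by
    rw [lg, Complex.log_im, neg_mul, sub_neg_eq_add]
  rw [Complex.normSq_eq_norm_sq, szegoFun, Complex.norm_exp, ← Real.exp_nat_mul]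
  have hL : (2:ℕ) * (szegoLog (α + 1 / 2) (β + 1 / 2) (Real.log c / Real.pi)
      (fun z => g z + ((Real.log c - (α + β + 1) * Real.log 2) / 2 : ℝ)) (crd (x : Tor))).re =
      Real.log (h (Real.cos x)) + Real.log (1 - Real.cos x) * α + Real.log (1 + Real.cos x) * β +
      (Real.log c + 2 * (Real.log c / Real.pi) * (Complex.arg (1 + Complex.I * crd (x : Tor)) -
        Complex.arg (1 - Complex.I * crd (x : Tor)))) + Real.log (Real.sin x) := by
    have e1 : Real.log (1 - Real.cos x) + Real.log (1 + Real.cos x) = 2 * Real.log (Real.sin x) := by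
      rw [← Real.log_mul hc1.ne' hc2.ne', show (1 - Real.cos x) * (1 + Real.cos x) = Real.sin x ^ 2 by
        linarith, Real.log_pow]; push_cast; ring
    unfold szegoLog
    simp only [Complex.add_re, Complex.mul_re, Complex.mul_im, Complex.I_re, Complex.I_im, Complex.ofReal_re,
      Complex.ofReal_im, Complex.neg_re, Complex.neg_im, hre1, hre2, himI, himI']
    push_cast
    linear_combination hreg + (1/2) * e1
  have hp1 : Real.exp (Real.log (1 - Real.cos x) * α) = (1 - Real.cos x) ^ α :=
    (Real.rpow_def_of_pos hc1 α).symm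
  have hp2 : Real.exp (Real.log (1 + Real.cos x) * β) = (1 + Real.cos x) ^ β :=
    (Real.rpow_def_of_pos hc2 β).symm
  rw [hL, Real.exp_add, Real.exp_add, Real.exp_add, Real.exp_add, Real.exp_log hh, Real.exp_log hs, hp1, hp2]
  congr 2
  have hpi := Real.pi_ne_zero
  rcases lt_or_gt_of_ne hx0 with h0 | h0
  · rw [if_pos h0, harg.2 h0, ← Real.exp_zero]
    congr 1; field_simp; ring
  · rw [if_neg (not_lt.mpr h0.le), harg.1 h0, show Real.log c + 2 * (Real.log c / Real.pi) * (Real.pi / 2) =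
      (2:ℕ) * Real.log c by push_cast; field_simp; ring, Real.exp_nat_mul, Real.exp_log hc]

lemma integral_even_abs {k : ℝ → ℝ} {f : ℝ → ℝ} (hk : ∀ x, f x = k |x|) {a : ℝ} (ha : 0 ≤ a) :
    ∫ x in -a..a, f x = 2 * ∫ x in (0:ℝ)..a, k x := by
  have h1 := integral_comp_abs (f := (Iic a).indicator k)
  have h2 : ∫ x, (Iic a).indicator k |x| = ∫ x in -a..a, f x := by
    rw [intervalIntegral.integral_of_le (by linarith), integral_Ioc_eq_integral_Ioo,
      ← integral_Icc_eq_integral_Ioo, ← integral_indicator measurableSet_Icc]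
    congr 1; ext x
    by_cases h : |x| ≤ a
    · rw [indicator_of_mem (show |x| ∈ Iic a from h), indicator_of_mem (show x ∈ Icc (-a) a from abs_le.mp h), hk]
    · rw [indicator_of_notMem (show |x| ∉ Iic a from h), indicator_of_notMem (fun h' : x ∈ Icc (-a) a => h (abs_le.mpr h'))]
  have h3 : ∫ x in Ioi (0:ℝ), (Iic a).indicator k x = ∫ x in (0:ℝ)..a, k x := by
    rw [intervalIntegral.integral_of_le ha, setIntegral_indicator measurableSet_Iic, Ioi_inter_Iic]
  rw [← h2, h1, h3]

/-- Integrals over `[-1, 1]` as circle averages. -/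
lemma integral_weight_eq_fco {w : ℝ → ℝ} {D : Tor → ℂ} (hD : ∀ t, D (-t) = conj (D t))
    (hw : ∀ x ∈ Ioo 0 Real.pi, Real.cos x ≠ 0 → Complex.normSq (D (x : Tor)) = w (Real.cos x) * Real.sin x)
    (q : ℝ → ℝ) :
    ((∫ x in (-1:ℝ)..1, q x * w x : ℝ) : ℂ) =
      Real.pi * fco (fun t => ((q (crd t).re : ℝ) : ℂ) * (D t * conj (D t))) 0 := by
  have hae : ∀ᵐ x : ℝ, x ∈ uIoc 0 Real.pi → x ∈ Ioo 0 Real.pi ∧ Real.cos x ≠ 0 := by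
    have h : ∀ᵐ θ : ℝ, θ ≠ Real.pi := by simp [ae_iff]
    filter_upwards [ae_cos_ne_zero, h] with x h1 h2 hx
    refine ⟨?_, h1 hx⟩
    rw [uIoc_of_le Real.pi_pos.le] at hx
    exact ⟨hx.1, lt_of_le_of_ne hx.2 h2⟩
  have e1 : ∫ x in (-1:ℝ)..1, q x * w x = ∫ x in (0:ℝ)..Real.pi, q (Real.cos x) * Complex.normSq (D (x : Tor)) := by
    have h1 : ∫ x in (-1:ℝ)..1, q x * w x =
        ∫ x in (-1:ℝ)..1, (q x * w x * Real.sqrt (1 - x ^ 2)) * √(1 - x ^ 2)⁻¹ := by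
      rw [intervalIntegral.integral_of_le (by norm_num), intervalIntegral.integral_of_le (by norm_num),
        integral_Ioc_eq_integral_Ioo, integral_Ioc_eq_integral_Ioo]
      refine setIntegral_congr_fun measurableSet_Ioo fun x hx => ?_
      have : 0 < 1 - x ^ 2 := by nlinarith [hx.1, hx.2]
      rw [Real.sqrt_inv, mul_assoc (q x * w x), mul_inv_cancel₀ (Real.sqrt_ne_zero'.mpr this), mul_one]
    rw [h1, ← Polynomial.Chebyshev.integral_measureT (fun x => q x * w x * Real.sqrt (1 - x ^ 2)),
      Polynomial.Chebyshev.integral_measureT_eq_integral_cos]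
    refine intervalIntegral.integral_congr_ae ?_
    filter_upwards [hae] with x h hx
    obtain ⟨h1, h2⟩ := h hx
    rw [hw x h1 h2, ← Real.abs_sin_eq_sqrt_one_sub_cos_sq,
      abs_of_pos (Real.sin_pos_of_pos_of_lt_pi h1.1 h1.2)]
    ring
  have e2 : fco (fun t => ((q (crd t).re : ℝ) : ℂ) * (D t * conj (D t))) 0 =
      (((2 * Real.pi)⁻¹ * ∫ x in (-Real.pi)..Real.pi, q (Real.cos x) * Complex.normSq (D (x : Tor)) : ℝ) : ℂ) := by
    unfold fco
    rw [integral_tor _ (-Real.pi), show -Real.pi + 2 * Real.pi = Real.pi by ring]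
    push_cast
    rw [← intervalIntegral.integral_ofReal, Complex.real_smul]
    push_cast
    congr 2; ext x
    rw [zpow_zero, mul_one, crd_coe_re, Complex.mul_conj]
  have hk : ∀ x : ℝ, q (Real.cos x) * Complex.normSq (D (x : Tor)) =
      q (Real.cos |x|) * Complex.normSq (D ((|x| : ℝ) : Tor)) := by
    intro x
    rw [Real.cos_abs]
    rcases abs_choice x with h | h <;> rw [h]
    rw [AddCircle.coe_neg, hD, Complex.normSq_conj]
  have hpi := Real.pi_ne_zero
  rw [e2, e1, integral_even_abs (k := fun x => q (Real.cos x) * Complex.normSq (D (x : Tor))) hk Real.pi_pos.le, ← Complex.ofReal_mul]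
  congr 1
  field_simp

end SzegoWeight

section PhaseAsymptotics
open scoped ENNReal InnerProductSpace ComplexConjugate ContDiff

/-- Cutoff function at the point `1` of the circle. -/
noncomputable def cutoff (t : Tor) : ℂ := ((Real.smoothTransition (4 * (crd t).re - 2) : ℝ) : ℂ)

lemma contDiff_crd_re : ContDiff ℝ ∞ (fun x : ℝ => (crd (x : Tor)).re) := by
  simp_rw [crd_coe_re]; exact Real.contDiff_cos

lemma smoothT_cutoff (s : ℝ) : SmoothT (fun t => cutoff (t - (s : Tor))) := by
  have h : ContDiff ℝ ∞ (fun x : ℝ => cutoff (x : Tor)) :=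
    Complex.ofRealCLM.contDiff.comp (Real.smoothTransition.contDiff.comp
      ((contDiff_const.mul contDiff_crd_re).sub contDiff_const))
  have h2 := h.comp (contDiff_id.sub (contDiff_const (c := s)))
  unfold SmoothT
  convert! h2 using 2

lemma cutoff_eventually_zero {s x : ℝ} (h : (crd ((x : Tor) - (s : Tor))).re ≤ 0) :
    ∀ᶠ y : ℝ in nhds x, cutoff ((y : Tor) - (s : Tor)) = 0 := by
  have hc : ContinuousAt (fun y : ℝ => (crd ((y : Tor) - (s : Tor))).re) x := by
    have := (Complex.continuous_re.comp (continuous_crd.comp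
      ((AddCircle.continuous_mk' (2 * Real.pi)).sub continuous_const : Continuous
        fun y : ℝ => (y : Tor) - (s : Tor)))).continuousAt (x := x)
    exact this
  filter_upwards [hc.eventually (gt_mem_nhds (show _ < (1:ℝ) / 2 by linarith))] with y hy
  rw [cutoff, Real.smoothTransition.zero_of_nonpos (by linarith), Complex.ofReal_zero]

lemma cutoff_eventually_one {s x : ℝ} (h : crd ((x : Tor) - (s : Tor)) = 1) :
    ∀ᶠ y : ℝ in nhds x, cutoff ((y : Tor) - (s : Tor)) = 1 := by
  have hc : ContinuousAt (fun y : ℝ => (crd ((y : Tor) - (s : Tor))).re) x := by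
    have := (Complex.continuous_re.comp (continuous_crd.comp
      ((AddCircle.continuous_mk' (2 * Real.pi)).sub continuous_const : Continuous
        fun y : ℝ => (y : Tor) - (s : Tor)))).continuousAt (x := x)
    exact this
  filter_upwards [hc.eventually (lt_mem_nhds (show (3:ℝ) / 4 < _ by
    beta_reduce; rw [h]; norm_num))] with y hy
  rw [cutoff, Real.smoothTransition.one_of_one_le (by linarith), Complex.ofReal_one]

lemma crd_sub_eq_one {s t : Tor} (h : crd (s - t) = 1) : s = t := by
  rw [crd, ← Circle.coe_one, Circle.coe_inj] at h
  have := AddCircle.injective_toCircle Real.two_pi_pos.ne' (h.trans AddCircle.toCircle_zero.symm)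
  exact sub_eq_zero.mp this

/-- Unimodular functions on the circle with a single singularity at `1`, whose Fourier coefficients
vary slowly. -/
structure SingularPhase (ρ : Tor → ℂ) : Prop where
  mem : MemLp ρ ∞ torMeasure
  norm_le : ∀ t, ‖ρ t‖ ≤ 1
  smooth : ∀ x : ℝ, crd (x : Tor) ≠ 1 → ContDiffAt ℝ ∞ (fun y : ℝ => ρ (y : Tor)) x
  diff : ∃ C : ℝ, 0 ≤ C ∧ ∀ m : ℕ, 1 ≤ m → ‖fco ρ (m + 1 : ℕ) - fco ρ m‖ ≤ C / (m:ℝ) ^ 2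

lemma SingularPhase.contDiffAt_sub {ρ : Tor → ℂ} (h : SingularPhase ρ) {s x : ℝ}
    (hx : crd ((x : Tor) - (s : Tor)) ≠ 1) :
    ContDiffAt ℝ ∞ (fun y : ℝ => ρ ((y : Tor) - (s : Tor))) x := by
  have h1 : ContDiffAt ℝ ∞ (fun y : ℝ => ρ (y : Tor)) (x - s) := h.smooth _ (by rwa [AddCircle.coe_sub])
  have h2 := h1.comp x (contDiffAt_id.sub (contDiffAt_const (c := s)))
  convert! h2 using 2

lemma fco_sub_right (φ : Tor → ℂ) (s : Tor) (m : ℤ) :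
    fco (fun t => φ (t - s)) m = crd s ^ m * fco φ m := by
  have := fco_add_right φ (-s) m
  simp_rw [← sub_eq_add_neg] at this
  rw [this, crd_neg, inv_zpow, zpow_neg, inv_inv]

/-- Fourier coefficients of a product of functions with separated singularities. -/
lemma fco_prod_singularPhase {ι : Type*} [Fintype ι] [DecidableEq ι] {s : ι → ℝ}
    (hsep : ∀ i j, i ≠ j → (crd ((s i : Tor) - (s j : Tor))).re ≤ 0) {ρ : ι → Tor → ℂ}
    (hρ : ∀ i, SingularPhase (ρ i)) {G : Tor → ℂ} (hG : SmoothT G) :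
    ∃ C : ℝ, 0 ≤ C ∧ ∀ m : ℕ, 1 ≤ m →
      ‖fco (fun t => G t * ∏ i, ρ i (t - (s i : Tor))) m -
        ∑ j, (G (s j : Tor) * ∏ i ∈ Finset.univ.erase j, ρ i ((s j : Tor) - (s i : Tor))) *
          (crd (s j : Tor) ^ m * fco (ρ j) m)‖ ≤ C / (m:ℝ) ^ 2 := by
  let χ : ι → Tor → ℂ := fun j t => cutoff (t - (s j : Tor))
  let r : ι → Tor → ℂ := fun j t => χ j t * (G t * ∏ i ∈ Finset.univ.erase j, ρ i (t - (s i : Tor)))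
  let q : Tor → ℂ := fun t => (1 - ∑ j, χ j t) * (G t * ∏ i, ρ i (t - (s i : Tor)))
  have hsame : ∀ {x : ℝ} {i : ι}, crd ((x : Tor) - (s i : Tor)) = 1 → ∀ j, i ≠ j →
      (crd ((x : Tor) - (s j : Tor))).re ≤ 0 := by
    intro x i h j hij
    rw [crd_sub_eq_one h]; exact hsep i j hij
  have hr : ∀ j, SmoothT (r j) := by
    intro j
    refine contDiff_iff_contDiffAt.mpr fun x => ?_
    by_cases h : ∃ i, i ≠ j ∧ crd ((x : Tor) - (s i : Tor)) = 1
    · obtain ⟨i, hij, hi⟩ := h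
      refine (contDiffAt_const (c := (0:ℂ))).congr_of_eventuallyEq ?_
      filter_upwards [cutoff_eventually_zero (hsame hi j hij)] with y hy
      simp only [r, χ, hy, zero_mul]
    · push Not at h
      refine (smoothT_cutoff (s j)).contDiffAt.mul (hG.contDiffAt.mul ?_)
      exact contDiffAt_prod fun i hi => (hρ i).contDiffAt_sub (h i (Finset.ne_of_mem_erase hi))
  have hq : SmoothT q := by
    refine contDiff_iff_contDiffAt.mpr fun x => ?_
    by_cases h : ∃ i, crd ((x : Tor) - (s i : Tor)) = 1
    · obtain ⟨i, hi⟩ := h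
      refine (contDiffAt_const (c := (0:ℂ))).congr_of_eventuallyEq ?_
      have h1 : ∀ᶠ y : ℝ in nhds x, ∀ j, i ≠ j → χ j (y : Tor) = 0 := by
        refine eventually_all.mpr fun j => ?_
        by_cases hij : i = j
        · exact .of_forall fun y hy => absurd hij hy
        · filter_upwards [cutoff_eventually_zero (hsame hi j hij)] with y hy _ using hy
      filter_upwards [h1, cutoff_eventually_one hi] with y h1 h2
      have : ∑ j, χ j (y : Tor) = 1 := by
        rw [Finset.sum_eq_single i (fun j _ hj => h1 j hj.symm) (by simp)]; exact h2
      simp only [q, this, sub_self, zero_mul]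
    · push Not at h
      refine (contDiffAt_const.sub (ContDiffAt.sum fun j _ => (smoothT_cutoff (s j)).contDiffAt)).mul
        (hG.contDiffAt.mul ?_)
      exact contDiffAt_prod fun i _ => (hρ i).contDiffAt_sub (h i)
  have hmem : ∀ j, MemLp (fun t => ρ j (t - (s j : Tor))) ∞ torMeasure := fun j =>
    (hρ j).mem.comp_measurePreserving (measurePreserving_sub_right torMeasure _)
  have hdec : (fun t => G t * ∏ i, ρ i (t - (s i : Tor))) =
      fun t => q t + ∑ j, r j t * ρ j (t - (s j : Tor)) := by
    ext t
    have : ∀ j, r j t * ρ j (t - (s j : Tor)) = χ j t * (G t * ∏ i, ρ i (t - (s i : Tor))) := by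
      intro j
      rw [← Finset.mul_prod_erase _ _ (Finset.mem_univ j)]
      simp only [r]; ring
    simp_rw [this]
    rw [← Finset.sum_mul]
    simp only [q]; ring
  have hval : ∀ j, r j (s j : Tor) = G (s j : Tor) *
      ∏ i ∈ Finset.univ.erase j, ρ i ((s j : Tor) - (s i : Tor)) := by
    intro j
    have h1 : χ j (s j : Tor) = 1 := (cutoff_eventually_one (s := s j) (x := s j) (by
      rw [sub_self]; simpa using crd_coe 0)).self_of_nhds
    simp only [r, h1, one_mul]
  have hterm : ∀ j, ∃ C : ℝ, 0 ≤ C ∧ ∀ m : ℕ, 1 ≤ m →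
      ‖fco (fun t => r j t * ρ j (t - (s j : Tor))) m - r j (s j : Tor) *
        (crd (s j : Tor) ^ m * fco (ρ j) m)‖ ≤ C / (m:ℝ) ^ 2 := by
    intro j
    obtain ⟨C, hC, h⟩ := (hρ j).diff
    obtain ⟨C', hC', h'⟩ := fco_smooth_mul (hr j) (hmem j) (fun t => (hρ j).norm_le _) (s j : Tor) hC
      (fun m hm => by
        rw [fco_sub_right, fco_sub_right, zpow_natCast, zpow_natCast, pow_succ', mul_assoc,
          ← mul_sub, ← mul_sub, norm_mul, norm_mul, norm_pow, norm_crd, one_pow, one_mul, one_mul]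
        exact h m hm)
    refine ⟨C', hC', fun m hm => ?_⟩
    have := h' m hm
    rwa [fco_sub_right, zpow_natCast] at this
  choose C hC hCm using hterm
  obtain ⟨C0, hC0, hq0⟩ := hq.exists_norm_fco_le 2
  refine ⟨C0 + ∑ j, C j, add_nonneg hC0 (Finset.sum_nonneg fun j _ => hC j), fun m hm => ?_⟩
  have hm' : (1:ℝ) ≤ m := by exact_mod_cast hm
  have hrm : ∀ j, MemLp (fun t => r j t * ρ j (t - (s j : Tor))) ∞ torMeasure := fun j =>
    (hmem j).mul' (p := ∞) (q := ∞) (r := ∞) ((hr j).continuous.memLp_top_of_hasCompactSupport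
      (.of_compactSpace _) _)
  have h_integ : ∀ j, Integrable (fun t => r j t * ρ j (t - (s j : Tor))) torMeasure := fun j =>
    memLp_one_iff_integrable.mp ((hrm j).mono_exponent le_top)
  have hqi : Integrable q torMeasure := hq.continuous.integrable_of_hasCompactSupport (.of_compactSpace _)
  have e : fco (fun t => G t * ∏ i, ρ i (t - (s i : Tor))) m =
      fco q m + ∑ j, fco (fun t => r j t * ρ j (t - (s j : Tor))) m := by
    rw [hdec, fco_add hqi (integrable_finsetSum _ fun j _ => h_integ j), fco_finset_sum]
    exact fun j _ => h_integ j
  rw [e, add_sub_assoc, ← Finset.sum_sub_distrib, add_div, Finset.sum_div]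
  refine (norm_add_le _ _).trans (add_le_add ?_ ((norm_sum_le _ _).trans (Finset.sum_le_sum fun j _ => ?_)))
  · refine (hq0 m).trans ?_
    rw [Int.cast_natCast, Nat.abs_cast]
    gcongr
    linarith
  · rw [← hval]; exact hCm j m hm

end PhaseAsymptotics

section SzegoPhaseAsymptotics
open scoped ENNReal InnerProductSpace ComplexConjugate ContDiff

lemma contDiffAt_crd (x : ℝ) : ContDiffAt ℝ ∞ (fun y : ℝ => crd (y : Tor)) x := by
  simp_rw [crd_coe]
  exact (Complex.contDiff_exp (𝕜 := ℝ)).contDiffAt.comp x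
    (Complex.ofRealCLM.contDiff.contDiffAt.mul contDiffAt_const)

lemma contDiffAt_lg_one_crd {x : ℝ} (hx : crd (x : Tor) ≠ 1) :
    ContDiffAt ℝ ∞ (fun y : ℝ => lg 1 (crd (y : Tor))) x := by
  have h1 : 1 - 1 * crd (x : Tor) ∈ Complex.slitPlane := by
    rw [one_mul]; exact one_sub_mem_slitPlane (norm_crd _).le hx
  exact ((Complex.contDiffAt_log h1).restrict_scalars ℝ).comp x
    (contDiffAt_const.sub (contDiffAt_const.mul (contDiffAt_crd x)))

lemma contDiffAt_conj_lg_one_crd {x : ℝ} (hx : crd (x : Tor) ≠ 1) :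
    ContDiffAt ℝ ∞ (fun y : ℝ => conj (lg 1 (crd (y : Tor)))) x :=
  Complex.conjCLE.contDiff.contDiffAt.comp x (contDiffAt_lg_one_crd hx)

lemma measurable_jump1 (a : ℂ) : Measurable (jump1 a) := by
  have h : Measurable fun t : Tor => lg 1 (crd t) :=
    Complex.measurable_log.comp (measurable_const.sub (measurable_const.mul continuous_crd.measurable))
  exact Complex.measurable_exp.comp
    (measurable_const.mul (h.sub (Complex.continuous_conj.measurable.comp h)))

lemma singularPhase_jump1 {a : ℝ} (ha : 0 ≤ a) : SingularPhase (jump1 a) where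
  mem := memLp_top_of_bound (measurable_jump1 a).aestronglyMeasurable 1
    (.of_forall fun t => (norm_jump1_ofReal a t).le)
  norm_le t := (norm_jump1_ofReal a t).le
  smooth x hx := (Complex.contDiff_exp (𝕜 := ℝ)).contDiffAt.comp x
    (contDiffAt_const.mul ((contDiffAt_lg_one_crd hx).sub (contDiffAt_conj_lg_one_crd hx)))
  diff := by
    refine ⟨1, zero_le_one, fun m hm => ?_⟩
    have hm' : (1:ℝ) ≤ m := by exact_mod_cast hm
    have h1 : (a:ℂ) + m ≠ 0 := by
      have : a + m ≠ 0 := by positivity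
      exact_mod_cast this
    have h2 : (a:ℂ) + (m + 1) ≠ 0 := by
      have : a + (m + 1) ≠ 0 := by positivity
      exact_mod_cast this
    have hpi : (Real.pi : ℂ) ≠ 0 := by exact_mod_cast Real.pi_ne_zero
    rw [fco_jump1 a _ (by push_cast; exact h2), fco_jump1 a _ (by push_cast; exact h1)]
    push_cast
    have : Complex.sin (Real.pi * a) / (Real.pi * (a + (m + 1))) -
        Complex.sin (Real.pi * a) / (Real.pi * (a + m)) =
        ((-(Real.sin (Real.pi * a) / (Real.pi * ((a + (m + 1)) * (a + m)))) : ℝ) : ℂ) := by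
      push_cast
      field_simp
      ring
    rw [this, Complex.norm_real, Real.norm_eq_abs, abs_neg, abs_div]
    rw [abs_of_pos (show 0 < Real.pi * ((a + (m + 1)) * (a + m)) by positivity)]
    refine div_le_div₀ zero_le_one (Real.abs_sin_le_one _) (by positivity) ?_
    have h3 : (m:ℝ) ^ 2 ≤ (a + (m + 1)) * (a + m) := by nlinarith
    nlinarith [Real.pi_gt_three, sq_nonneg (m:ℝ)]

lemma singularPhase_quot1 (ν : ℝ) : SingularPhase (quot1 ν) where
  mem := memLp_quot1 ν
  norm_le t := (norm_quot1 ν t).le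
  smooth x hx := (Complex.contDiff_exp (𝕜 := ℝ)).contDiffAt.comp x
    (contDiffAt_const.mul ((contDiffAt_lg_one_crd hx).add (contDiffAt_conj_lg_one_crd hx)))
  diff := by
    obtain ⟨C, hC, h⟩ := (hankelType_quot1 ν).diff
    exact ⟨C, hC, fun m hm => by simpa using h m hm⟩

lemma crd_pi : crd ((Real.pi : ℝ) : Tor) = -1 := by rw [crd_coe, Complex.exp_pi_mul_I]

lemma crd_neg_pi : crd ((-Real.pi : ℝ) : Tor) = -1 := by
  rw [AddCircle.coe_neg, crd_neg, crd_pi]; norm_num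

lemma crd_half_pi : crd ((Real.pi / 2 : ℝ) : Tor) = Complex.I := by
  rw [crd_coe]; push_cast; exact Complex.exp_pi_div_two_mul_I

lemma crd_neg_half_pi : crd ((-(Real.pi / 2) : ℝ) : Tor) = -Complex.I := by
  rw [AddCircle.coe_neg, crd_neg, crd_half_pi, Complex.inv_I]

lemma lg_one_neg_one : lg 1 (-1) = Real.log 2 := by
  rw [lg, Complex.ofReal_log (by norm_num)]; norm_num

lemma lg_one_I : lg 1 Complex.I = ((Real.log 2 / 2 : ℝ) : ℂ) + Complex.I * ((-(Real.pi / 4) : ℝ) : ℂ) := by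
  have := lg_one_crd (x := Real.pi / 2) ⟨by positivity, by linarith [Real.pi_pos]⟩
  rw [crd_half_pi] at this
  rw [this, show Real.pi / 2 / 2 = Real.pi / 4 by ring, Real.sin_pi_div_four,
    show 2 * (√2 / 2) = √2 by ring, Real.log_sqrt (by norm_num)]
  congr 3
  ring

lemma lg_one_neg_I : lg 1 (-Complex.I) =
    ((Real.log 2 / 2 : ℝ) : ℂ) + Complex.I * ((Real.pi / 4 : ℝ) : ℂ) := by
  have := lg_conj (w := 1) (z := Complex.I) (by simp) (by simp)
  rw [map_one, Complex.conj_I, lg_one_I] at this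
  rw [this, map_add, map_mul, Complex.conj_ofReal, Complex.conj_ofReal, Complex.conj_I]
  push_cast; ring

/-- Asymptotics of the Fourier coefficients of the phase. -/
lemma exists_fco_szegoPhase {a a' : ℝ} (ha : 0 ≤ a) (ha' : 0 ≤ a') (l : ℝ) {g : ℂ → ℂ} (hg : DiscLog g) :
    ∃ C : ℝ, 0 ≤ C ∧ ∀ m : ℕ, 1 ≤ m →
      ‖fco (szegoPhase a a' l g) m - ((fco (jump1 a) m + (-1) ^ m * fco (jump1 a') m) +
        (Complex.exp (Complex.I * ((a - a') * Real.pi / 2 - 2 * l * Real.log 2 - 2 * (g Complex.I).im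
          : ℝ)) * (-Complex.I) ^ m * fco (quot1 l) m +
        conj (Complex.exp (Complex.I * ((a - a') * Real.pi / 2 - 2 * l * Real.log 2 -
          2 * (g Complex.I).im : ℝ)) * (-Complex.I) ^ m * fco (quot1 l) m)))‖ ≤ C / (m:ℝ) ^ 2 := by
  set s : Fin 4 → ℝ := ![0, Real.pi, -(Real.pi / 2), Real.pi / 2] with hs
  set ρ : Fin 4 → Tor → ℂ := ![jump1 a, jump1 a', quot1 l, quot1 (-l)] with hρd
  set G : Tor → ℂ := fun t => Complex.exp (g (crd t) - conj (g (crd t))) with hGd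
  have hG : SmoothT G := by
    have h1 : ContDiff ℝ ∞ (fun x : ℝ => g (crd (x : Tor))) := hg.smooth
    exact (Complex.contDiff_exp (𝕜 := ℝ)).comp
      (h1.sub (Complex.conjCLE.contDiff.comp h1))
  have hρ : ∀ i, SingularPhase (ρ i) := by
    intro i
    fin_cases i
    · exact singularPhase_jump1 ha
    · exact singularPhase_jump1 ha'
    · exact singularPhase_quot1 l
    · exact singularPhase_quot1 (-l)
  have hcos : Real.cos (-(Real.pi / 2) - Real.pi) = 0 := by
    rw [Real.cos_sub_pi, Real.cos_neg, Real.cos_pi_div_two, neg_zero]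
  have hcos2 : Real.cos (Real.pi - -(Real.pi / 2)) = 0 := by
    rw [← Real.cos_neg, ← hcos]; congr 1; ring
  have hsep : ∀ i j, i ≠ j → (crd ((s i : Tor) - (s j : Tor))).re ≤ 0 := by
    intro i j hij
    rw [← AddCircle.coe_sub, crd_coe_re]
    fin_cases i <;> fin_cases j <;> first | exact absurd rfl hij | skip
    all_goals simp only [hs, Fin.zero_eta, Fin.mk_one, Fin.reduceFinMk, Matrix.cons_val, zero_sub, sub_zero,
      neg_neg, Real.cos_neg, Real.cos_pi, Real.cos_pi_div_two, hcos, hcos2]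
    all_goals first | norm_num; done | skip
    all_goals ring_nf
    all_goals simp
  have hprod : ∀ t, szegoPhase a a' l g t = G t * ∏ i, ρ i (t - (s i : Tor)) := by
    intro t
    have e0 : crd (t - ((0:ℝ) : Tor)) = crd t := by simp
    have e1 : crd (t - (Real.pi : Tor)) = -1 * crd t := by
      rw [sub_eq_add_neg, ← AddCircle.coe_neg, crd_add, crd_neg_pi, mul_comm]
    have e2 : crd (t - ((-(Real.pi / 2) : ℝ) : Tor)) = Complex.I * crd t := by
      rw [sub_eq_add_neg, ← AddCircle.coe_neg, neg_neg, crd_add, crd_half_pi, mul_comm]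
    have e3 : crd (t - ((Real.pi / 2 : ℝ) : Tor)) = -Complex.I * crd t := by
      rw [sub_eq_add_neg, ← AddCircle.coe_neg, crd_add, crd_neg_half_pi, mul_comm]
    simp only [Fin.prod_univ_four, hs, hρd, hGd, Matrix.cons_val, jump1, quot1, e0, e1, e2, e3,
      szegoPhase, szegoFun]
    rw [← Complex.exp_conj, ← Complex.exp_sub, ← Complex.exp_add, ← Complex.exp_add, ← Complex.exp_add,
      ← Complex.exp_add]
    congr 1
    simp only [szegoLog, map_add, map_mul, map_neg, Complex.conj_ofReal, Complex.conj_I, lg, one_mul]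
    push_cast
    ring
  have hreal1 : conj (g 1) = g 1 := by rw [← hg.symm, map_one]
  have hreal2 : conj (g (-1)) = g (-1) := by rw [← hg.symm, map_neg, map_one]
  have hgI : g (-Complex.I) = conj (g Complex.I) := by rw [← hg.symm, Complex.conj_I]
  have hgsub : g Complex.I - conj (g Complex.I) = 2 * Complex.I * ((g Complex.I).im : ℂ) := by
    rw [Complex.sub_conj]; push_cast; ring
  have crd0 : crd ((0:ℝ) : Tor) = 1 := by rw [crd_coe]; simp
  have c1 : crd (((0:ℝ) : Tor) - (Real.pi : Tor)) = -1 := by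
    rw [sub_eq_add_neg, ← AddCircle.coe_neg, crd_add, crd_neg_pi, crd0]; simp
  have c2 : crd (((0:ℝ) : Tor) - ((-(Real.pi / 2) : ℝ) : Tor)) = Complex.I := by
    rw [sub_eq_add_neg, ← AddCircle.coe_neg, neg_neg, crd_add, crd_half_pi, crd0]; simp
  have c3 : crd (((0:ℝ) : Tor) - ((Real.pi / 2 : ℝ) : Tor)) = -Complex.I := by
    rw [sub_eq_add_neg, ← AddCircle.coe_neg, crd_add, crd_neg_half_pi, crd0]; simp
  have sub0 : ∀ t : Tor, crd (t - ((0:ℝ) : Tor)) = crd t := by intro t; simp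
  have d2 : crd ((Real.pi : Tor) - ((-(Real.pi / 2) : ℝ) : Tor)) = -Complex.I := by
    rw [sub_eq_add_neg, ← AddCircle.coe_neg, neg_neg, crd_add, crd_half_pi, crd_pi]; simp
  have d3 : crd ((Real.pi : Tor) - ((Real.pi / 2 : ℝ) : Tor)) = Complex.I := by
    rw [sub_eq_add_neg, ← AddCircle.coe_neg, crd_add, crd_neg_half_pi, crd_pi]; simp
  have f1 : crd (((-(Real.pi / 2) : ℝ) : Tor) - (Real.pi : Tor)) = Complex.I := by
    rw [sub_eq_add_neg, ← AddCircle.coe_neg, crd_add, crd_neg_pi, crd_neg_half_pi]; simp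
  have f3 : crd (((-(Real.pi / 2) : ℝ) : Tor) - ((Real.pi / 2 : ℝ) : Tor)) = -1 := by
    rw [sub_eq_add_neg, ← AddCircle.coe_neg, crd_add, crd_neg_half_pi]; simp
  have k1 : crd (((Real.pi / 2 : ℝ) : Tor) - (Real.pi : Tor)) = -Complex.I := by
    rw [sub_eq_add_neg, ← AddCircle.coe_neg, crd_add, crd_neg_pi, crd_half_pi]; simp
  have k2 : crd (((Real.pi / 2 : ℝ) : Tor) - ((-(Real.pi / 2) : ℝ) : Tor)) = -1 := by
    rw [sub_eq_add_neg, ← AddCircle.coe_neg, neg_neg, crd_add, crd_half_pi]; simp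
  have hconjq : ∀ m : ℕ, fco (quot1 (-l)) m = conj (fco (quot1 l) m) := by
    intro m
    have h1 := fco_conj (quot1 l) (-(m:ℤ))
    have h2 : ∀ t, conj (quot1 l t) = quot1 (-l) (-t) := by
      intro t
      have e1 := lg_conj (w := 1) (by simp) (norm_crd t).le
      rw [map_one] at e1
      rw [quot1, quot1, ← Complex.exp_conj, crd_neg, ← conj_crd, e1]
      congr 1
      simp only [map_add, map_mul, Complex.conj_I, Complex.conj_ofReal, Complex.conj_conj]
      push_cast; ring
    rw [neg_neg] at h1
    rw [← h1]
    unfold fco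
    rw [← integral_neg_eq_self]
    congr 1; ext t
    beta_reduce
    rw [h2, crd_neg, inv_zpow, zpow_neg]
  obtain ⟨C, hC, h⟩ := fco_prod_singularPhase hsep hρ hG
  refine ⟨C, hC, fun m hm => ?_⟩
  have := h m hm
  rw [← funext hprod] at this
  convert this using 3
  have u0 : Finset.univ.erase (0 : Fin 4) = {1, 2, 3} := rfl
  have u1 : Finset.univ.erase (1 : Fin 4) = {0, 2, 3} := rfl
  have u2 : Finset.univ.erase (2 : Fin 4) = {0, 1, 3} := rfl
  have u3 : Finset.univ.erase (3 : Fin 4) = {0, 1, 2} := rfl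
  have v0 : G (s 0 : Tor) * ∏ i ∈ Finset.univ.erase 0, ρ i ((s 0 : Tor) - (s i : Tor)) = 1 := by
    rw [u0, Finset.prod_insert (by decide), Finset.prod_insert (by decide), Finset.prod_singleton]
    simp only [hs, hρd, hGd, Matrix.cons_val, jump1, quot1, c1, c2, c3, crd0, hreal1, lg_one_neg_one,
      lg_one_I, lg_one_neg_I, map_add, map_mul, Complex.conj_ofReal, Complex.conj_I]
    rw [← Complex.exp_add, ← Complex.exp_add, ← Complex.exp_add, Complex.exp_eq_one_iff]
    exact ⟨0, by push_cast; ring⟩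
  have v1 : G (s 1 : Tor) * ∏ i ∈ Finset.univ.erase 1, ρ i ((s 1 : Tor) - (s i : Tor)) = 1 := by
    rw [u1, Finset.prod_insert (by decide), Finset.prod_insert (by decide), Finset.prod_singleton]
    simp only [hs, hρd, hGd, Matrix.cons_val, jump1, quot1, sub0, crd_pi, d2, d3, hreal2, lg_one_neg_one,
      lg_one_I, lg_one_neg_I, map_add, map_mul, Complex.conj_ofReal, Complex.conj_I]
    rw [← Complex.exp_add, ← Complex.exp_add, ← Complex.exp_add, Complex.exp_eq_one_iff]
    exact ⟨0, by push_cast; ring⟩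
  have v2 : G (s 2 : Tor) * ∏ i ∈ Finset.univ.erase 2, ρ i ((s 2 : Tor) - (s i : Tor)) =
      Complex.exp (Complex.I * ((a - a') * Real.pi / 2 - 2 * l * Real.log 2 -
        2 * (g Complex.I).im : ℝ)) := by
    rw [u2, Finset.prod_insert (by decide), Finset.prod_insert (by decide), Finset.prod_singleton]
    simp only [hs, hρd, hGd, Matrix.cons_val, jump1, quot1, sub0, crd_neg_half_pi, f1, f3, hgI,
      Complex.conj_conj, lg_one_neg_one,
      lg_one_I, lg_one_neg_I, map_add, map_mul, Complex.conj_ofReal, Complex.conj_I]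
    rw [← Complex.exp_add, ← Complex.exp_add, ← Complex.exp_add, ← neg_sub, hgsub]
    congr 1
    push_cast; ring
  have v3 : G (s 3 : Tor) * ∏ i ∈ Finset.univ.erase 3, ρ i ((s 3 : Tor) - (s i : Tor)) =
      conj (Complex.exp (Complex.I * ((a - a') * Real.pi / 2 - 2 * l * Real.log 2 -
        2 * (g Complex.I).im : ℝ))) := by
    rw [u3, Finset.prod_insert (by decide), Finset.prod_insert (by decide), Finset.prod_singleton]
    simp only [hs, hρd, hGd, Matrix.cons_val, jump1, quot1, sub0, crd_half_pi, k1, k2, 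
      lg_one_neg_one,
      lg_one_I, lg_one_neg_I, map_add, map_mul, Complex.conj_ofReal, Complex.conj_I]
    rw [← Complex.exp_add, ← Complex.exp_add, ← Complex.exp_add, hgsub, ← Complex.exp_conj, map_mul,
      Complex.conj_I, Complex.conj_ofReal]
    congr 1
    push_cast; ring
  rw [Fin.sum_univ_four, v0, v1, v2, v3]
  simp only [hs, hρd, Matrix.cons_val, crd0, crd_pi, crd_half_pi, crd_neg_half_pi, hconjq, map_mul,
    map_pow, map_neg, Complex.conj_I, neg_neg, one_pow, one_mul]
  ring
end SzegoPhaseAsymptotics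

section PositiveHankel
open scoped ENNReal InnerProductSpace ComplexConjugate ContDiff

lemma hankel_form_nonneg {s : ℝ} (hs : -1 < s) (y : ℕ → ℂ) (n : ℕ) :
    0 ≤ (∑ j ∈ Finset.range n, ∑ k ∈ Finset.range n,
      conj (y j) * y k * ((1 / (s + j + k + 1) : ℝ) : ℂ)).re := by
  have h_integ : ∀ j k : ℕ, IntervalIntegrable (fun x : ℝ => (conj (y j) * y k).re * x ^ (s + j + k)) volume 0 1 :=
    fun j k => (intervalIntegral.intervalIntegrable_rpow' (by
      have : (0:ℝ) ≤ j + k := by positivity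
      linarith)).const_mul _
  have key : (∑ j ∈ Finset.range n, ∑ k ∈ Finset.range n,
      conj (y j) * y k * ((1 / (s + j + k + 1) : ℝ) : ℂ)).re =
      ∫ x in (0:ℝ)..1, ∑ j ∈ Finset.range n, ∑ k ∈ Finset.range n,
        (conj (y j) * y k).re * x ^ (s + j + k) := by
    have hi2 : ∀ j : ℕ, IntervalIntegrable (fun x : ℝ => ∑ k ∈ Finset.range n,
        (conj (y j) * y k).re * x ^ (s + j + k)) volume 0 1 := by
      intro j
      have := IntervalIntegrable.sum (μ := volume) (a := (0:ℝ)) (b := 1) (Finset.range n)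
        (f := fun k x => (conj (y j) * y k).re * x ^ (s + j + k)) (fun k _ => h_integ j k)
      simpa [Finset.sum_apply, ← Finset.sum_fn] using this
    rw [intervalIntegral.integral_finsetSum fun j _ => hi2 j, Complex.re_sum]
    refine Finset.sum_congr rfl fun j _ => ?_
    rw [intervalIntegral.integral_finsetSum fun k _ => h_integ j k, Complex.re_sum]
    refine Finset.sum_congr rfl fun k _ => ?_
    have hjk : (0:ℝ) ≤ j + k := by positivity
    rw [intervalIntegral.integral_const_mul, integral_rpow (Or.inl (by linarith)), Complex.re_mul_ofReal,
      Real.one_rpow, Real.zero_rpow (by linarith)]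
    ring
  rw [key]
  rw [intervalIntegral.integral_of_le zero_le_one]
  refine setIntegral_nonneg measurableSet_Ioc fun x hx => ?_
  have h1 : ∑ j ∈ Finset.range n, ∑ k ∈ Finset.range n, (conj (y j) * y k).re * x ^ (s + j + k) =
      x ^ s * (conj (∑ j ∈ Finset.range n, y j * ((x ^ j : ℝ) : ℂ)) *
        ∑ k ∈ Finset.range n, y k * ((x ^ k : ℝ) : ℂ)).re := by
    rw [map_sum, Finset.sum_mul_sum, Complex.re_sum, Finset.mul_sum]
    refine Finset.sum_congr rfl fun j _ => ?_
    rw [Complex.re_sum, Finset.mul_sum]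
    refine Finset.sum_congr rfl fun k _ => ?_
    rw [Real.rpow_add hx.1, Real.rpow_add hx.1, Real.rpow_natCast, Real.rpow_natCast, map_mul,
      Complex.conj_ofReal, mul_mul_mul_comm, ← Complex.ofReal_mul, Complex.re_mul_ofReal]
    ring
  rw [h1, mul_comm (conj _), Complex.mul_conj, Complex.ofReal_re]
  exact mul_nonneg (Real.rpow_nonneg hx.1.le _) (Complex.normSq_nonneg _)

lemma re_inner_nonneg_of_matEntry {K : Ell2 →L[ℂ] Ell2}
    (h : ∀ (y : ℕ → ℂ) (n : ℕ), 0 ≤ (∑ j ∈ Finset.range n, ∑ k ∈ Finset.range n,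
      conj (y j) * y k * matEntry K j k).re) (x : Ell2) : 0 ≤ (inner ℂ x (K x)).re := by
  have h1 := (ell2_hasSum_unitVec x).tendsto_sum_nat
  have h2 := (h1.inner (𝕜 := ℂ) ((K.continuous.tendsto _).comp h1))
  refine ge_of_tendsto' ((Complex.continuous_re.tendsto _).comp h2) fun n => ?_
  refine (h x n).trans_eq ?_
  simp only [Function.comp_def]
  rw [map_sum, sum_inner]
  congr 1
  refine Finset.sum_congr rfl fun j _ => ?_
  rw [inner_sum]
  refine Finset.sum_congr rfl fun k _ => ?_
  rw [map_smul, inner_smul_left, inner_smul_right, inner_unitVec, matEntry]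
  ring

lemma exists_inverse_one_add {E : Type*} [NormedAddCommGroup E] [InnerProductSpace ℂ E] [CompleteSpace E]
    {S : E →L[ℂ] E} (h : ∀ x, 0 ≤ (inner ℂ x (S x)).re) :
    ∃ R : E →L[ℂ] E, R * (1 + S) = 1 ∧ (1 + S) * R = 1 ∧ ‖R‖ ≤ 1 := by
  have h1 : ∀ x, ‖x‖ ^ 2 ≤ ‖inner ℂ ((1 + S) x) x‖ := by
    intro x
    rw [← inner_conj_symm, RCLike.norm_conj]
    refine le_trans ?_ (Complex.re_le_norm _)
    rw [_root_.add_apply, inner_add_right, one_apply_eq_self, Complex.add_re,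
      inner_self_eq_norm_sq_to_K]
    have : ((((‖x‖:ℝ):ℂ)) ^ 2).re = ‖x‖ ^ 2 := by rw [← Complex.ofReal_pow, Complex.ofReal_re]
    have h2 := h x
    simp only [Complex.coe_algebraMap] at *
    linarith
  obtain ⟨U, hU⟩ := ContinuousLinearMap.isUnit_of_forall_le_norm_inner_map (1 + S) (c := 1) one_pos
    (fun x => by rw [NNReal.coe_one, mul_one]; exact h1 x)
  refine ⟨(U⁻¹ : (E →L[ℂ] E)ˣ), by rw [← hU, Units.inv_mul], by rw [← hU, Units.mul_inv], ?_⟩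
  refine ContinuousLinearMap.opNorm_le_bound _ zero_le_one fun y => ?_
  rw [one_mul]
  set x := (U⁻¹ : (E →L[ℂ] E)ˣ).1 y with hx
  have hy : (1 + S) x = y := by
    rw [hx, ← hU, ← mul_apply_eq_comp, Units.mul_inv, one_apply_eq_self]
  have h3 := (h1 x).trans (norm_inner_le_norm _ _)
  rw [hy, sq] at h3
  by_cases h0 : ‖x‖ = 0
  · rw [h0]; positivity
  · exact le_of_mul_le_mul_right h3 (lt_of_le_of_ne (norm_nonneg _) (Ne.symm h0))

end PositiveHankel

section HankelResolvent
open scoped ENNReal InnerProductSpace ComplexConjugate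
open Asymptotics

lemma HankelType.twist {w : ℂ} {τ : ℕ → ℂ} (h : HankelType w τ) {κ z : ℂ} (hκ : ‖κ‖ = 1) (hz : ‖z‖ = 1) :
    HankelType (z * w) (fun m => κ * z ^ m * τ m) := by
  obtain ⟨⟨C, hC, h1⟩, D, hD, h2⟩ := h
  refine ⟨⟨C, hC, fun m hm => ?_⟩, D, hD, fun m hm => ?_⟩
  · simpa [norm_mul, hκ, hz] using h1 m hm
  · rw [show κ * z ^ (m + 1) * τ (m + 1) - z * w * (κ * z ^ m * τ m) =
      κ * z ^ (m + 1) * (τ (m + 1) - w * τ m) by ring]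
    simpa [norm_mul, hκ, hz] using h2 m hm

lemma HankelType.conj {w : ℂ} {τ : ℕ → ℂ} (h : HankelType w τ) :
    HankelType (conj w) (fun m => conj (τ m)) := by
  obtain ⟨⟨C, hC, h1⟩, D, hD, h2⟩ := h
  refine ⟨⟨C, hC, fun m hm => ?_⟩, D, hD, fun m hm => ?_⟩
  · rw [RCLike.norm_conj]; exact h1 m hm
  · rw [← map_mul, ← map_sub, RCLike.norm_conj]; exact h2 m hm

lemma HankelType.shift_one {w : ℂ} {τ : ℕ → ℂ} (h : HankelType w τ) :
    HankelType w (fun m => τ (m + 1)) := by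
  obtain ⟨⟨C, hC, h1⟩, D, hD, h2⟩ := h
  refine ⟨⟨C, hC, fun m hm => (h1 _ (by omega)).trans ?_⟩, D, hD, fun m hm =>
    (h2 _ (by omega)).trans ?_⟩
  all_goals
    have hm' : (1:ℝ) ≤ m := by exact_mod_cast hm
    gcongr; linarith

lemma HankelType.norm_shift_sub_le {w : ℂ} {τ : ℕ → ℂ} (h : HankelType w τ) (d : ℕ) :
    ∃ C : ℝ, 0 ≤ C ∧ ∀ m : ℕ, 1 ≤ m → ‖τ (m + d) - w ^ d * τ m‖ ≤ C / (m:ℝ) ^ 2 := by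
  induction d with
  | zero => exact ⟨0, le_rfl, fun m _ => by simp⟩
  | succ d ih =>
    obtain ⟨C, hC, h1⟩ := ih
    obtain ⟨D, hD, h2⟩ := h.diff
    refine ⟨D + ‖w‖ * C, by positivity, fun m hm => ?_⟩
    have hm' : (1:ℝ) ≤ m := by exact_mod_cast hm
    have e : τ (m + (d + 1)) - w ^ (d + 1) * τ m =
        (τ (m + d + 1) - w * τ (m + d)) + w * (τ (m + d) - w ^ d * τ m) := by
      rw [← add_assoc]; ring
    rw [e, add_div, mul_div_assoc]
    refine (norm_add_le _ _).trans (add_le_add ((h2 _ (by omega)).trans ?_) ?_)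
    · gcongr; linarith
    · rw [norm_mul]; gcongr; exact h1 m hm

lemma HankelType.norm_shift_sub_le' {w : ℂ} {τ : ℕ → ℂ} (h : HankelType w τ) (hw : ‖w‖ = 1) (d : ℕ) :
    ∃ C : ℝ, 0 ≤ C ∧ ∀ m : ℕ, 1 ≤ m → ‖τ (m + d) - w ^ d * w⁻¹ * τ (m + 1)‖ ≤ C / (m:ℝ) ^ 2 := by
  obtain ⟨C, hC, h1⟩ := h.norm_shift_sub_le d
  obtain ⟨D, hD, h2⟩ := h.diff
  have hw0 : w ≠ 0 := norm_ne_zero_iff.mp (by rw [hw]; exact one_ne_zero)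
  refine ⟨C + D, by positivity, fun m hm => ?_⟩
  have e : τ (m + d) - w ^ d * w⁻¹ * τ (m + 1) =
      (τ (m + d) - w ^ d * τ m) - w ^ d * w⁻¹ * (τ (m + 1) - w * τ m) := by
    field_simp; ring
  rw [e, add_div]
  refine (norm_sub_le _ _).trans (add_le_add (h1 m hm) ?_)
  rw [norm_mul, norm_mul, norm_pow, norm_inv, hw]
  simpa using h2 m hm

/-- Comparison of a Hankel family with the shifts of its leading terms. -/
lemma negl_shift_sub {τ₁ τ₂ μ β : ℕ → ℂ} (h₁ : HankelType 1 τ₁) (h₂ : HankelType (-1) τ₂)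
    (hμ : HankelType (-Complex.I) μ)
    (hβ : ∃ C : ℝ, 0 ≤ C ∧ ∀ m : ℕ, 1 ≤ m →
      ‖β m - ((τ₁ m + τ₂ m) + (μ m + conj (μ m)))‖ ≤ C / (m:ℝ) ^ 2)
    {S₁ S₂ M H : ℕ → Ell2 →L[ℂ] Ell2} (hS₁ : IsHankelFam τ₁ S₁) (hS₂ : IsHankelFam τ₂ S₂)
    (hM : IsHankelFam μ M) (hH : IsHankelFam β H) (d : ℕ) :
    NeglFam atTop invSqrt (unitVec 0) (fun p => H (p + d) -
      (((-Complex.I) ^ d * Complex.I) • M (p + 1) +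
        Star.star (((-Complex.I) ^ d * Complex.I) • M (p + 1)) +
        (S₁ (p + 1) + (-(-1) ^ d : ℂ) • S₂ (p + 1)))) := by
  have hX := ((hH.shift d).sub (((((hM.shift 1).smul ((-Complex.I) ^ d * Complex.I))).add
    ((hM.shift 1).smul ((-Complex.I) ^ d * Complex.I)).star).add
      ((hS₁.shift 1).add ((hS₂.shift 1).smul (-(-1) ^ d : ℂ)))))
  obtain ⟨C, hC, hb⟩ := hβ
  obtain ⟨C1, hC1, hb1⟩ := h₁.norm_shift_sub_le' (by simp) d
  obtain ⟨C2, hC2, hb2⟩ := h₂.norm_shift_sub_le' (by simp) d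
  obtain ⟨C3, hC3, hb3⟩ := hμ.norm_shift_sub_le' (by simp) d
  refine hX.negl (C := C + (C1 + C2 + (C3 + C3))) (by positivity) fun m hm => ?_
  have hm' : (1:ℝ) ≤ m := by exact_mod_cast hm
  have h3 := hb3 m hm
  rw [inv_neg, Complex.inv_I, neg_neg] at h3
  have h4 := h3
  rw [← RCLike.norm_conj] at h4
  have h1 := hb1 m hm
  rw [one_pow, inv_one, one_mul, one_mul] at h1
  have h2 := hb2 m hm
  rw [inv_neg, inv_one, mul_neg, mul_one] at h2
  have h0 := (hb (m + d) (by omega)).trans (show C / ((m + d : ℕ):ℝ) ^ 2 ≤ C / (m:ℝ) ^ 2 by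
    gcongr; omega)
  rw [add_div, add_div, add_div, add_div]
  refine le_trans (le_of_eq ?_) ((norm_add_le _ _).trans (add_le_add h0
    ((norm_add_le _ _).trans (add_le_add ((norm_add_le _ _).trans (add_le_add h1 h2))
      ((norm_add_le _ _).trans (add_le_add h3 h4))))))
  congr 1
  rw [map_sub]
  ring

lemma inverse_eq_of_mul_eq_one {A : Type*} [Ring A] {x y : A} (h : y * x = 1) (h' : x * y = 1) :
    Ring.inverse x = y :=
  Ring.inverse_unit ⟨x, y, h', h⟩

theorem hankel_resolvent_asymptotics {τ₁ τ₂ μ β : ℕ → ℂ} (h₁ : HankelType 1 τ₁) (h₂ : HankelType (-1) τ₂)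
    (hμ : HankelType (-Complex.I) μ)
    (hβ : ∃ C : ℝ, 0 ≤ C ∧ ∀ m : ℕ, 1 ≤ m →
      ‖β m - ((τ₁ m + τ₂ m) + (μ m + conj (μ m)))‖ ≤ C / (m:ℝ) ^ 2)
    (hr₁ : ∀ m, conj (τ₁ m) = τ₁ m) (hr₂ : ∀ m, conj (τ₂ m) = τ₂ m) (hrβ : ∀ m, conj (β m) = β m)
    {S₁ S₂ M H G G' R : ℕ → Ell2 →L[ℂ] Ell2} (hS₁ : IsHankelFam τ₁ S₁) (hS₂ : IsHankelFam τ₂ S₂)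
    (hM : IsHankelFam μ M) (hH : IsHankelFam β H)
    (hS₁b : S₁ =O[atTop] (fun _ => (1:ℝ))) (hS₂b : S₂ =O[atTop] (fun _ => (1:ℝ)))
    (hMb : M =O[atTop] (fun _ => (1:ℝ)))
    (hG : ∀ᶠ N in atTop, G N * (1 - M N * star (M N)) = 1 ∧ (1 - M N * star (M N)) * G N = 1)
    (hGb : G =O[atTop] (fun _ => (1:ℝ)))
    (hG' : ∀ᶠ N in atTop, G' N * (1 - star (M N) * M N) = 1 ∧ (1 - star (M N) * M N) * G' N = 1)
    (hGb' : G' =O[atTop] (fun _ => (1:ℝ)))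
    (hR : ∀ n, R n * (1 + (S₁ (2 * n + 2) + S₂ (2 * n + 2))) = 1 ∧
      (1 + (S₁ (2 * n + 2) + S₂ (2 * n + 2))) * R n = 1)
    (hRb : ∀ n, ‖R n‖ ≤ 1) :
    (∀ᶠ n in atTop, IsUnit (1 + H (2 * n + 2))) ∧
    (fun n : ℕ => inner ℂ (unitVec 0) ((H (2 * n + 2) * Ring.inverse (1 + H (2 * n + 2))) (unitVec 0)))
      =O[atTop] (fun n => 1 / (n:ℝ)) ∧
    (fun n : ℕ =>
      inner ℂ (unitVec 0) ((H (2 * n + 2) * Ring.inverse (1 + H (2 * n + 2))) (unitVec 0)) -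
      inner ℂ (unitVec 0) ((H (2 * n + 4) * Ring.inverse (1 + H (2 * n + 4))) (unitVec 0)) -
      4 * ((inner ℂ (unitVec 0) ((G (2 * n + 2) * M (2 * n + 2)) (unitVec 0))).re : ℂ))
      =O[atTop] (fun n => 1 / (n:ℝ) ^ 2) ∧
    (fun n : ℕ =>
      inner ℂ (unitVec 0) ((H (2 * n + 1) * Ring.inverse (1 + H (2 * n + 2))) (unitVec 0)) -
      inner ℂ (unitVec 0) ((H (2 * n + 3) * Ring.inverse (1 + H (2 * n + 4))) (unitVec 0)) -
      4 * ((Complex.I * inner ℂ (unitVec 0) ((G (2 * n + 2) * M (2 * n + 2)) (unitVec 0))).re : ℂ))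
      =O[atTop] (fun n => 1 / (n:ℝ) ^ 2) := by
  have hneg := negl_shift_sub h₁ h₂ hμ hβ hS₁ hS₂ hM hH
  have ht1 : Tendsto (fun N : ℕ => N + 1) atTop atTop := tendsto_add_atTop_nat 1
  have hf : Tendsto (fun n : ℕ => 2 * n + 1) atTop atTop :=
    tendsto_atTop_mono (fun n => by simp only [id]; omega) tendsto_id
  have hf2 : Tendsto (fun n : ℕ => 2 * n + 2) atTop atTop :=
    tendsto_atTop_mono (fun n => by simp only [id]; omega) tendsto_id
  -- the shifted families
  have hM1 := hM.shift 1
  have hS11 := hS₁.shift 1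
  have hS21 := hS₂.shift 1
  have hμ1 := hμ.shift_one
  have h₁1 := h₁.shift_one
  have h₂1 := h₂.shift_one
  have hM1b : (fun N => M (N + 1)) =O[atTop] (fun _ => (1:ℝ)) := hMb.comp_tendsto ht1
  have hS11b : (fun N => S₁ (N + 1)) =O[atTop] (fun _ => (1:ℝ)) := hS₁b.comp_tendsto ht1
  have hS21b : (fun N => S₂ (N + 1)) =O[atTop] (fun _ => (1:ℝ)) := hS₂b.comp_tendsto ht1
  have hMs := hM1.star
  have hMsb : (fun N => Star.star (M (N + 1))) =O[atTop] (fun _ => (1:ℝ)) := star_isBigO hM1b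
  have hμs := hμ1.conj
  rw [map_neg, Complex.conj_I, neg_neg] at hμs
  have hsmall : ∀ {w : ℂ} {τ : ℕ → ℂ} {K : ℕ → Ell2 →L[ℂ] Ell2}, IsHankelFam τ K → HankelType w τ →
      K =O[atTop] (fun _ => (1:ℝ)) → SmallFam atTop invSqrt (unitVec 0) K := by
    intro w τ K hK hτ hb
    obtain ⟨C, hC, h⟩ := hτ.bound
    exact hK.small hb hC h
  have hne1 : (1:ℂ) * Complex.I ≠ 1 := by
    rw [one_mul]; intro h; simpa using congrArg Complex.im h
  have hne2 : (-1:ℂ) * Complex.I ≠ 1 := by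
    intro h; simpa using congrArg Complex.im h
  have hMM := hM1.mul_negl hM1 hM1b hM1b hμ1 hμ1 (by
    rw [neg_mul_neg, Complex.I_mul_I]; norm_num)
  have hS1M := hS11.mul_negl hM1 hS11b hM1b h₁1 hμ1 (by rwa [mul_neg, ← neg_mul])
  have hS2M := hS21.mul_negl hM1 hS21b hM1b h₂1 hμ1 (by rwa [neg_mul_neg])
  have hMS1 := hM1.mul_negl hS11 hM1b hS11b hμ1 h₁1 (by rwa [mul_comm, mul_neg, ← neg_mul])
  have hMS2 := hM1.mul_negl hS21 hM1b hS21b hμ1 h₂1 (by rwa [mul_comm, neg_mul_neg])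
  have hS1Ms := hS11.mul_negl hMs hS11b hMsb h₁1 hμs hne1
  have hS2Ms := hS21.mul_negl hMs hS21b hMsb h₂1 hμs hne2
  have hMsm := hsmall hM1 hμ1 hM1b
  have hS1sm := hsmall hS11 h₁1 hS11b
  have hS2sm := hsmall hS21 h₂1 hS21b
  have hSM : NeglFam atTop invSqrt (unitVec 0) (fun p => (S₁ (p + 1) + S₂ (p + 1)) * M (p + 1)) := by
    simpa only [add_mul] using hS1M.add hS2M
  have hMS : NeglFam atTop invSqrt (unitVec 0) (fun p => M (p + 1) * (S₁ (p + 1) + S₂ (p + 1))) := by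
    simpa only [mul_add] using hMS1.add hMS2
  have hSMs : NeglFam atTop invSqrt (unitVec 0)
      (fun p => (S₁ (p + 1) + S₂ (p + 1)) * star (M (p + 1))) := by
    simpa only [add_mul] using hS1Ms.add hS2Ms
  have hS'M : NeglFam atTop invSqrt (unitVec 0) (fun p => (S₁ (p + 1) - S₂ (p + 1)) * M (p + 1)) := by
    simpa only [sub_mul] using hS1M.sub hS2M
  have hS'Ms : NeglFam atTop invSqrt (unitVec 0)
      (fun p => (S₁ (p + 1) - S₂ (p + 1)) * star (M (p + 1))) := by
    simpa only [sub_mul] using hS1Ms.sub hS2Ms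
  have hn0 : NeglFam atTop invSqrt (unitVec 0) (fun p => H p -
      (Complex.I • M (p + 1) + star (Complex.I • M (p + 1)) + (S₁ (p + 1) - S₂ (p + 1)))) := by
    simpa only [pow_zero, one_mul, neg_one_smul, ← sub_eq_add_neg, add_zero] using hneg 0
  have hn1 : NeglFam atTop invSqrt (unitVec 0) (fun p => H (p + 1) -
      (M (p + 1) + star (M (p + 1)) + (S₁ (p + 1) + S₂ (p + 1)))) := by
    have e : (-Complex.I) ^ 1 * Complex.I = 1 := by simp
    have e2 : (-(-1) ^ 1 : ℂ) = 1 := by norm_num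
    simpa only [e, e2, one_smul] using hneg 1
  have hn2 : NeglFam atTop invSqrt (unitVec 0) (fun p => H (p + 2) -
      (-(Complex.I • M (p + 1)) + -star (Complex.I • M (p + 1)) + (S₁ (p + 1) - S₂ (p + 1)))) := by
    have e : (-Complex.I) ^ 2 * Complex.I = -Complex.I := by simp
    simpa only [e, even_two.neg_one_pow, neg_smul, one_smul, star_neg, ← sub_eq_add_neg] using hneg 2
  have hn3 : NeglFam atTop invSqrt (unitVec 0) (fun p => H (p + 3) -
      (-M (p + 1) + -star (M (p + 1)) + (S₁ (p + 1) + S₂ (p + 1)))) := by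
    have e : (-Complex.I) ^ 3 * Complex.I = -1 := by
      rw [show (-Complex.I) ^ 3 * Complex.I = -(Complex.I ^ 2) ^ 2 by ring, Complex.I_sq]; norm_num
    have e2 : (-(-1) ^ 3 : ℂ) = 1 := by norm_num
    simpa only [e, e2, neg_smul, one_smul, star_neg] using hneg 3
  have hstar : ∀ {τ : ℕ → ℂ} {K : ℕ → Ell2 →L[ℂ] Ell2}, IsHankelFam τ K → (∀ m, conj (τ m) = τ m) →
      ∀ N, star (K N) = K N := by
    intro τ K hK hr N
    refine clm_ext_matEntry fun j k => ?_
    rw [matEntry_star, hK, hK, hr, add_right_comm]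
  have hSs : ∀ p, star (S₁ (p + 1) + S₂ (p + 1)) = S₁ (p + 1) + S₂ (p + 1) := by
    intro p; rw [star_add, hstar hS₁ hr₁, hstar hS₂ hr₂]
  have hδ : Tendsto (invSqrt ∘ fun n : ℕ => 2 * n + 1) atTop (nhds 0) := tendsto_invSqrt.comp hf
  have hGf := hf2.eventually hG
  have hG'f := hf2.eventually hG'
  have hGbf : (fun n : ℕ => G (2 * n + 2)) =O[atTop] (fun _ => (1:ℝ)) := hGb.comp_tendsto hf2
  have hGbf' : (fun n : ℕ => G' (2 * n + 2)) =O[atTop] (fun _ => (1:ℝ)) := hGb'.comp_tendsto hf2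
  have hRb' : R =O[atTop] (fun _ => (1:ℝ)) :=
    IsBigO.of_bound 1 (.of_forall fun n => by simpa using hRb n)
  obtain ⟨A, hA, hAsm⟩ := exists_resolvent hδ (hMsm.mono hf) ((hS1sm.add hS2sm).mono hf)
    (fun n => hSs _) (hMM.mono hf) (hSM.mono hf) (hMS.mono hf) hGf hGbf hG'f hGbf'
    (.of_forall hR) hRb' (H := fun n => H (2 * n + 2)) (fun n => hstar hH hrβ _) (hn1.mono hf)
  obtain ⟨A2, hA2, hA2sm⟩ := exists_resolvent hδ (hMsm.neg.mono hf) ((hS1sm.add hS2sm).mono hf)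
    (fun n => hSs _)
    (NeglFam.congr' (hMM.mono hf) (.of_forall fun n => (neg_mul_neg _ _).symm))
    (NeglFam.congr' (hSM.neg.mono hf) (.of_forall fun n => (mul_neg _ _).symm))
    (NeglFam.congr' (hMS.neg.mono hf) (.of_forall fun n => (neg_mul _ _).symm))
    (G := fun n => G (2 * n + 2)) (G' := fun n => G' (2 * n + 2))
    (hGf.mono fun n hn => by
      simp only [Function.comp_apply, star_neg, neg_mul_neg]; exact hn) hGbf
    (hG'f.mono fun n hn => by
      simp only [Function.comp_apply, star_neg, neg_mul_neg]; exact hn) hGbf'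
    (.of_forall hR) hRb' (H := fun n => H (2 * n + 4)) (fun n => hstar hH hrβ _)
    (NeglFam.congr' (hn3.mono hf) (.of_forall fun n => by
      simp only [Function.comp_apply, star_neg]))
  have hAi : ∀ᶠ n in atTop, Ring.inverse (1 + H (2 * n + 2)) = A n :=
    hA.mono fun n hn => inverse_eq_of_mul_eq_one hn.1 hn.2
  have hA2i : ∀ᶠ n in atTop, Ring.inverse (1 + H (2 * n + 4)) = A2 n :=
    hA2.mono fun n hn => inverse_eq_of_mul_eq_one hn.1 hn.2
  have hδ2 : (fun n => (invSqrt ∘ fun n : ℕ => 2 * n + 1) n ^ 2) =O[atTop] (fun n : ℕ => 1 / (n:ℝ)) := by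
    refine IsBigO.of_bound 1 ?_
    filter_upwards [eventually_ge_atTop 1] with n hn
    have : (0:ℝ) < n := by exact_mod_cast hn
    rw [Function.comp_apply, invSqrt_sq, one_mul, Real.norm_of_nonneg (by positivity),
      Real.norm_of_nonneg (by positivity)]
    push_cast
    gcongr
    linarith
  have hδ4 : (fun n => (invSqrt ∘ fun n : ℕ => 2 * n + 1) n ^ 4) =O[atTop] (fun n : ℕ => 1 / (n:ℝ) ^ 2) := by
    refine (hδ2.pow 2).congr (fun n => by ring) (fun n => by ring)
  refine ⟨hA.mono fun n hn => ⟨⟨1 + H (2 * n + 2), A n, hn.2, hn.1⟩, rfl⟩, ?_, ?_, ?_⟩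
  · have hHsm := ((hn1.mono hf).small hδ).add (((hMsm.mono hf).add (hMsm.mono hf).star).add
      ((hS1sm.add hS2sm).mono hf))
    have hβb : (fun n : ℕ => β (2 * n + 2)) =O[atTop] (fun n : ℕ => 1 / (n:ℝ)) := by
      obtain ⟨C₁, -, h1⟩ := h₁.bound
      obtain ⟨C₂, -, h2⟩ := h₂.bound
      obtain ⟨C₃, -, h3⟩ := hμ.bound
      obtain ⟨C₄, -, h4⟩ := hβ
      have hb : ∀ m : ℕ, 1 ≤ m → ‖β m‖ ≤ (C₁ + C₂ + 2 * C₃ + |C₄|) / m := by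
        intro m hm
        have hm' : (1:ℝ) ≤ m := by exact_mod_cast hm
        have e4 : C₄ / (m:ℝ) ^ 2 ≤ |C₄| / m := by
          gcongr
          · exact le_abs_self _
          · nlinarith
        have key : ‖β m‖ ≤ C₁ / m + C₂ / m + (C₃ / m + C₃ / m) + |C₄| / m := by
          have e5 : β m = (τ₁ m + τ₂ m) + (μ m + conj (μ m)) +
            (β m - ((τ₁ m + τ₂ m) + (μ m + conj (μ m)))) := by ring
          rw [e5]
          refine (norm_add_le _ _).trans (add_le_add ((norm_add_le _ _).trans (add_le_add
            ((norm_add_le _ _).trans (add_le_add (h1 m hm) (h2 m hm)))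
            ((norm_add_le _ _).trans (add_le_add (h3 m hm) ?_)))) ((h4 m hm).trans e4))
          rw [RCLike.norm_conj]; exact h3 m hm
        refine key.trans_eq (by ring)
      refine IsBigO.trans ?_ hδ2
      refine IsBigO.of_bound (C₁ + C₂ + 2 * C₃ + |C₄|) (.of_forall fun n => ?_)
      refine (hb _ (by omega)).trans ?_
      have h0 : 0 ≤ (C₁ + C₂ + 2 * C₃ + |C₄|) := by
        have := (norm_nonneg _).trans (hb 1 le_rfl)
        simpa using this
      rw [Function.comp_apply, invSqrt_sq, Real.norm_of_nonneg (by positivity), ← mul_one_div]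
      push_cast
      gcongr
      linarith
    have h2 := inner_isBigO hHsm.star_vec hAsm.vec
    have h3 := hβb.add ((h2.congr_right (fun n => (sq _).symm)).trans hδ2)
    refine h3.congr' ?_ .rfl
    filter_upwards [hAi] with n h1
    rw [h1, inner_star_apply]
    have e1 : inner ℂ (unitVec 0) (H (2 * n + 2) (unitVec 0)) = β (2 * n + 2) := by
      rw [inner_unitVec]; exact hH _ 0 0
    rw [← e1, ← inner_add_right]
    congr 1
    simp only [Function.comp_apply, _root_.add_apply, _root_.sub_apply, mul_apply_eq_comp, one_apply_eq_self, map_sub]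
    abel
  · have := inner_resolvent_sub (1:ℂ) (hMsm.mono hf) ((hS1sm.add hS2sm).mono hf) (fun n => hSs _)
      ((hS1sm.add hS2sm).mono hf) (hMM.mono hf) (hSM.mono hf) (hMS.mono hf) (hSM.mono hf) (hSMs.mono hf)
      hGf hGbf hG'f hGbf' (.of_forall hR) hRb' (H := fun n => H (2 * n + 2)) (H2 := fun n => H (2 * n + 4))
      (Hd := fun n => H (2 * n + 2)) (Hd2 := fun n => H (2 * n + 4))
      (hn1.mono hf) (hn3.mono hf) (by simpa only [one_smul, Function.comp_def] using hn1.mono hf)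
      (by simpa only [one_smul, Function.comp_def] using hn3.mono hf) (hA.mono fun n hn => hn.2) hAsm
      (hA2.mono fun n hn => hn.2) hA2sm
    refine (this.trans hδ4).congr' ?_ .rfl
    filter_upwards [hAi, hA2i] with n h1 h2
    rw [h1, h2, one_mul]; rfl
  · have := inner_resolvent_sub Complex.I (hMsm.mono hf) ((hS1sm.add hS2sm).mono hf) (fun n => hSs _)
      ((hS1sm.sub hS2sm).mono hf) (hMM.mono hf) (hSM.mono hf) (hMS.mono hf) (hS'M.mono hf) (hS'Ms.mono hf)
      hGf hGbf hG'f hGbf' (.of_forall hR) hRb' (H := fun n => H (2 * n + 2)) (H2 := fun n => H (2 * n + 4))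
      (Hd := fun n => H (2 * n + 1)) (Hd2 := fun n => H (2 * n + 3))
      (hn1.mono hf) (hn3.mono hf) (hn0.mono hf)
      (hn2.mono hf) (hA.mono fun n hn => hn.2) hAsm
      (hA2.mono fun n hn => hn.2) hA2sm
    refine (this.trans hδ4).congr' ?_ .rfl
    filter_upwards [hAi, hA2i] with n h1 h2
    rw [h1, h2]; rfl

end HankelResolvent

section PhaseResolvent
open scoped ENNReal InnerProductSpace ComplexConjugate
open Asymptotics

lemma hankelType_jump1 {a : ℝ} (ha : 0 ≤ a) : HankelType 1 (fun m : ℕ => fco (jump1 a) m) where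
  bound := by
    refine ⟨1, zero_le_one, fun m hm => ?_⟩
    have hm' : (1:ℝ) ≤ m := by exact_mod_cast hm
    have h0 : 0 < a + m := by linarith
    rw [fco_jump1 _ _ (by exact_mod_cast h0.ne')]
    have e : Complex.sin (Real.pi * a) / (Real.pi * (a + ((m:ℤ):ℂ))) =
        ((Real.sin (Real.pi * a) / (Real.pi * (a + m)) : ℝ) : ℂ) := by push_cast; rfl
    rw [e, Complex.norm_real, norm_div, Real.norm_of_nonneg (by positivity : 0 ≤ Real.pi * (a + m))]
    refine div_le_div₀ zero_le_one (Real.abs_sin_le_one _) (by positivity) ?_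
    have := Real.pi_gt_three
    nlinarith
  diff := by
    obtain ⟨C, hC, h⟩ := (singularPhase_jump1 ha).diff
    exact ⟨C, hC, fun m hm => by simpa only [one_mul] using h m hm⟩

lemma jump1_neg (a : ℝ) (t : Tor) : jump1 a (-t) = conj (jump1 a t) := by
  have h : lg 1 (crd (-t)) = conj (lg 1 (crd t)) := by
    rw [crd_neg, ← conj_crd, ← lg_conj (by simp) (norm_crd t).le, map_one]
  rw [jump1, jump1, h, ← Complex.exp_conj, map_mul, Complex.conj_ofReal, map_sub]

lemma conj_fco_jump1 (a : ℝ) (m : ℤ) : conj (fco (jump1 a) m) = fco (jump1 a) m :=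
  conj_fco_of_symm (.of_forall (jump1_neg a)) m

lemma fco_jump1_ofReal {a : ℝ} {m : ℤ} (h : 0 < a + m) :
    fco (jump1 a) m = ((Real.sin (Real.pi * a) / Real.pi * (1 / (a + m)) : ℝ) : ℂ) := by
  rw [fco_jump1 _ _ (by exact_mod_cast h.ne')]
  push_cast
  rw [div_mul_div_comm, mul_one]

/-- Hankel operators of power jumps are positive, also after a rotation by `-1`. -/
lemma re_inner_jump1_nonneg {a : ℝ} (ha : a ∈ Icc (0:ℝ) 1) {ε : ℂ} (hε : ε = 1 ∨ ε = -1)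
    {S : ℕ → Ell2 →L[ℂ] Ell2} (hS : IsHankelFam (fun m : ℕ => ε ^ m * fco (jump1 a) m) S) (n : ℕ) (x : Ell2) :
    0 ≤ (inner ℂ x (S (2 * n + 2) x)).re := by
  refine re_inner_nonneg_of_matEntry (fun y p => ?_) x
  have hε2 : ε ^ 2 = 1 := by rcases hε with rfl | rfl <;> norm_num
  have hεc : conj ε = ε := by rcases hε with rfl | rfl <;> simp
  have hsin : 0 ≤ Real.sin (Real.pi * a) / Real.pi :=
    div_nonneg (Real.sin_nonneg_of_nonneg_of_le_pi (mul_nonneg Real.pi_pos.le ha.1)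
      (mul_le_of_le_one_right Real.pi_pos.le ha.2)) Real.pi_pos.le
  have key := hankel_form_nonneg (s := a + (2 * n + 1)) (by
    have := ha.1
    have : 0 ≤ a + (2 * n + 1) := by positivity
    linarith) (fun j => ε ^ j * y j) p
  have h2 := mul_nonneg hsin key
  rw [← Complex.re_ofReal_mul, Finset.mul_sum] at h2
  refine h2.trans_eq (congrArg Complex.re (Finset.sum_congr rfl fun j _ => ?_))
  rw [Finset.mul_sum]
  refine Finset.sum_congr rfl fun k _ => ?_
  have h0 : 0 < a + ((2 * n + 2 + j + k : ℕ) : ℤ) := by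
    have := ha.1; push_cast; positivity
  rw [hS]
  beta_reduce
  rw [fco_jump1_ofReal h0, map_mul, map_pow, hεc,
    show ε ^ (2 * n + 2 + j + k) = (ε ^ 2) ^ (n + 1) * (ε ^ j * ε ^ k) by ring, hε2, one_pow, one_mul]
  push_cast
  rw [show (a + (2 * n + 1) + j + k + 1 : ℂ) = a + (2 * n + 2 + j + k) by ring]
  ring

/-- The leading oscillating term. -/
noncomputable def oscTerm (l : ℝ) (ξ : ℂ) (n : ℕ) : ℂ :=
  (l / (2 * n)) * (-1) ^ n * Complex.exp (Complex.I * (2 * l * Real.log (4 * n) : ℝ)) * ξ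

/-- The phase constant attached to the Szegő function with parameters `a`, `a'`, `l`, `g`. -/
noncomputable def phaseConst (a a' l : ℝ) (g : ℂ → ℂ) : ℂ :=
  -Complex.exp (Complex.I * ((a' - a) * Real.pi / 2 + 2 * (g Complex.I).im : ℝ)) *
    (Complex.Gamma (1 - Complex.I * l) / Complex.Gamma (1 + Complex.I * l))

lemma model_eq_conj_oscTerm (a a' l : ℝ) (g : ℂ → ℂ) {m : ℕ} (hm : 1 ≤ m) :
    Complex.exp (Complex.I * ((a - a') * Real.pi / 2 - 2 * l * Real.log 2 - 2 * (g Complex.I).im : ℝ)) *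
      (-Complex.I) ^ (2 * m) * ((-(Complex.I * l)) / (2 * m : ℕ) *
        Complex.exp (-(2 * (Complex.I * l) * Real.log (2 * m : ℕ))) *
          (Complex.Gamma (1 + Complex.I * l) / Complex.Gamma (1 - Complex.I * l))) =
      Complex.I * conj (oscTerm l (phaseConst a a' l g) m) := by
  have hm' : (0:ℝ) < m := by exact_mod_cast hm
  have hl : Real.log (4 * m) = Real.log 2 + Real.log (2 * m) := by
    rw [← Real.log_mul (by norm_num) (by positivity)]; congr 1; ring
  have hI : (-Complex.I) ^ (2 * m) = (-1) ^ m := by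
    rw [pow_mul, neg_sq, Complex.I_sq]
  have hG : conj (Complex.Gamma (1 - Complex.I * l) / Complex.Gamma (1 + Complex.I * l)) =
      Complex.Gamma (1 + Complex.I * l) / Complex.Gamma (1 - Complex.I * l) := by
    rw [map_div₀, ← Complex.Gamma_conj, ← Complex.Gamma_conj]
    congr 2 <;> simp [sub_eq_add_neg]
  unfold oscTerm phaseConst
  rw [map_mul, map_mul, map_mul, map_mul, hG, hI, ← Complex.exp_conj]
  simp only [map_div₀, map_neg, map_mul, map_pow, map_one, map_ofNat, Complex.conj_ofReal, Complex.conj_I,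
    map_natCast, ← Complex.exp_conj]
  have e : Complex.exp (Complex.I * ((a - a') * Real.pi / 2 - 2 * l * Real.log 2 - 2 * (g Complex.I).im : ℝ)) *
      Complex.exp (-(2 * (Complex.I * l) * Real.log (2 * m : ℕ))) =
      Complex.exp (-Complex.I * (2 * l * Real.log (4 * m) : ℝ)) *
        Complex.exp (-Complex.I * ((a' - a) * Real.pi / 2 + 2 * (g Complex.I).im : ℝ)) := by
    rw [← Complex.exp_add, ← Complex.exp_add, hl]
    congr 1
    push_cast
    ring
  have e' := congrArg (fun z => z * ((-1) ^ m * (-(Complex.I * l) / (2 * m)) *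
    (Complex.Gamma (1 + Complex.I * l) / Complex.Gamma (1 - Complex.I * l)))) e
  push_cast at e' ⊢
  refine Eq.trans (by ring) (e'.trans (by ring))

theorem phase_resolvent_asymptotics {a a' : ℝ} (ha : a ∈ Icc (0:ℝ) 1) (ha' : a' ∈ Icc (0:ℝ) 1) (l : ℝ)
    {g : ℂ → ℂ} (hg : DiscLog g) (hb : MemLp (szegoPhase a a' l g) ∞ torMeasure) :
    let H := hankelOp (szegoPhase a a' l g) hb
    let E := oscTerm l (phaseConst a a' l g)
    (∀ᶠ n in atTop, IsUnit (1 + H (2 * n + 2))) ∧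
    (fun n : ℕ => inner ℂ (unitVec 0) ((H (2 * n + 2) * Ring.inverse (1 + H (2 * n + 2))) (unitVec 0)))
      =O[atTop] (fun n => 1 / (n:ℝ)) ∧
    (fun n : ℕ =>
      inner ℂ (unitVec 0) ((H (2 * n + 2) * Ring.inverse (1 + H (2 * n + 2))) (unitVec 0)) -
      inner ℂ (unitVec 0) ((H (2 * n + 4) * Ring.inverse (1 + H (2 * n + 4))) (unitVec 0)) -
      4 * ((E (n + 1)).im : ℂ))
      =O[atTop] (fun n => 1 / (n:ℝ) ^ 2) ∧
    (fun n : ℕ =>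
      inner ℂ (unitVec 0) ((H (2 * n + 1) * Ring.inverse (1 + H (2 * n + 2))) (unitVec 0)) -
      inner ℂ (unitVec 0) ((H (2 * n + 3) * Ring.inverse (1 + H (2 * n + 4))) (unitVec 0)) +
      4 * ((E (n + 1)).re : ℂ))
      =O[atTop] (fun n => 1 / (n:ℝ) ^ 2) := by
  intro H E
  set κ : ℂ := Complex.exp (Complex.I * ((a - a') * Real.pi / 2 - 2 * l * Real.log 2 -
    2 * (g Complex.I).im : ℝ)) with hκd
  have hκ : ‖κ‖ = 1 := by rw [hκd, mul_comm, Complex.norm_exp_ofReal_mul_I]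
  have hI : ‖-Complex.I‖ = 1 := by simp
  obtain ⟨M, G, G', hM, hMb, hG, hGb, hG', hGb', hF⟩ := exists_model_resolvent l κ (-Complex.I) hκ hI
  have hsj := singularPhase_jump1 ha.1
  have hsj' := singularPhase_jump1 ha'.1
  set ψ : Tor → ℂ := fun t => jump1 a' (t - ((Real.pi : ℝ) : Tor)) with hψ
  have hψm : MemLp ψ ∞ torMeasure := memLp_top_of_bound
    ((measurable_jump1 a').comp (measurable_id.sub_const _)).aestronglyMeasurable 1
    (.of_forall fun t => hsj'.norm_le _)
  have hS₁ := isHankelFam_hankelOp hsj.mem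
  have hS₂ : IsHankelFam (fun m : ℕ => (-1) ^ m * fco (jump1 a') m) (hankelOp ψ hψm) := by
    have h := isHankelFam_hankelOp hψm
    simpa only [hψ, fco_sub_right, crd_pi, zpow_natCast] using h
  have h₂ : HankelType (-1) (fun m : ℕ => (-1) ^ m * fco (jump1 a') m) := by
    simpa using (hankelType_jump1 ha'.1).twist (κ := 1) (z := -1) (by simp) (by simp)
  have hμ : HankelType (-Complex.I) (fun m => κ * (-Complex.I) ^ m * fco (quot1 l) m) := by
    simpa using (hankelType_quot1 l).twist hκ hI
  have hbdd : ∀ {φ : Tor → ℂ} (hφ : MemLp φ ∞ torMeasure), (∀ t, ‖φ t‖ ≤ 1) →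
      (hankelOp φ hφ) =O[atTop] (fun _ => (1:ℝ)) := fun hφ h =>
    IsBigO.of_bound 1 (.of_forall fun N => by
      simpa using norm_hankelOp_le hφ zero_le_one (.of_forall h) N)
  have hR : ∀ n, ∃ R : Ell2 →L[ℂ] Ell2, R * (1 + (hankelOp (jump1 a) hsj.mem (2 * n + 2) +
      hankelOp ψ hψm (2 * n + 2))) = 1 ∧ (1 + (hankelOp (jump1 a) hsj.mem (2 * n + 2) +
      hankelOp ψ hψm (2 * n + 2))) * R = 1 ∧ ‖R‖ ≤ 1 := by
    intro n
    refine exists_inverse_one_add fun x => ?_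
    rw [_root_.add_apply, inner_add_right, Complex.add_re]
    refine add_nonneg (re_inner_jump1_nonneg ha (.inl rfl) ?_ n x)
      (re_inner_jump1_nonneg ha' (.inr rfl) hS₂ n x)
    simpa only [one_pow, one_mul] using hS₁
  choose R hR1 hR2 hR3 using hR
  have hrβ : ∀ m : ℕ, conj (fco (szegoPhase a a' l g) m) = fco (szegoPhase a a' l g) m := fun m =>
    conj_fco_of_symm (.of_forall fun t => by
      rw [szegoPhase, szegoPhase, szegoFun_neg _ _ _ hg, map_div₀]) m
  obtain ⟨c1, c2, c3, c4⟩ := hankel_resolvent_asymptotics (hankelType_jump1 ha.1) h₂ hμ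
    (exists_fco_szegoPhase ha.1 ha'.1 l hg) (fun m => conj_fco_jump1 a m)
    (fun m => by rw [map_mul, conj_fco_jump1, map_pow, map_neg, map_one]) hrβ hS₁ hS₂ hM
    (isHankelFam_hankelOp hb) (hbdd _ hsj.norm_le) (hbdd _ fun t => hsj'.norm_le _) hMb hG hGb hG' hGb'
    (fun n => ⟨hR1 n, hR2 n⟩) hR3
  have hf2 : Tendsto (fun n : ℕ => 2 * n + 2) atTop atTop :=
    tendsto_atTop_mono (fun n => by simp only [id]; omega) tendsto_id
  have hF' : (fun n : ℕ => inner ℂ (unitVec 0) ((G (2 * n + 2) * M (2 * n + 2)) (unitVec 0)) -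
      Complex.I * conj (E (n + 1))) =O[atTop] (fun n : ℕ => 1 / (n:ℝ) ^ 2) := by
    refine ((hF.comp_tendsto hf2).congr_left fun n => ?_).trans ?_
    · rw [← model_eq_conj_oscTerm a a' l g (show 1 ≤ n + 1 by omega)]
      rfl
    · refine IsBigO.of_bound 1 ?_
      filter_upwards [eventually_ge_atTop 1] with n hn
      have : (0:ℝ) < n := by exact_mod_cast hn
      rw [Function.comp_apply, one_mul, Real.norm_of_nonneg (by positivity),
        Real.norm_of_nonneg (by positivity)]
      push_cast
      gcongr
      linarith
  have hre : ∀ w : ℂ, (fun n : ℕ => 4 * ((w * (inner ℂ (unitVec 0) ((G (2 * n + 2) * M (2 * n + 2))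
      (unitVec 0)) - Complex.I * conj (E (n + 1)))).re : ℂ)) =O[atTop] (fun n : ℕ => 1 / (n:ℝ) ^ 2) := by
    intro w
    refine IsBigO.const_mul_left ?_ _
    refine IsBigO.trans (IsBigO.of_bound 1 (.of_forall fun n => ?_)) (hF'.const_mul_left w)
    rw [one_mul, Complex.norm_real]
    exact Complex.abs_re_le_norm _
  refine ⟨c1, c2, ?_, ?_⟩
  · refine (c3.add (hre 1)).congr_left fun n => ?_
    rw [one_mul, Complex.sub_re]
    simp only [Complex.mul_re, Complex.I_re, Complex.I_im, Complex.conj_re, Complex.conj_im]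
    push_cast
    ring
  · refine (c4.add (hre Complex.I)).congr_left fun n => ?_
    rw [mul_sub, ← mul_assoc, Complex.I_mul_I, Complex.sub_re]
    simp only [neg_mul, one_mul, Complex.neg_re, Complex.conj_re]
    push_cast
    ring

end PhaseResolvent

section RecurrenceAsymptotics
open scoped ENNReal InnerProductSpace ComplexConjugate
open Asymptotics

lemma isBigO_inv_sq_of_add {E : Type*} [NormedAddCommGroup E] {f : ℕ → E} (d : ℕ)
    (h : (fun n => f (n + d)) =O[atTop] (fun n : ℕ => 1 / (n:ℝ) ^ 2)) :
    f =O[atTop] (fun n : ℕ => 1 / (n:ℝ) ^ 2) := by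
  have h1 := h.comp_tendsto (tendsto_sub_atTop_nat d)
  have h2 : f =O[atTop] ((fun n : ℕ => 1 / (n:ℝ) ^ 2) ∘ fun n => n - d) := by
    refine h1.congr' ?_ .rfl
    filter_upwards [eventually_ge_atTop d] with n hn
    rw [Function.comp_apply, Nat.sub_add_cancel hn]
  refine h2.trans (IsBigO.of_bound 4 ?_)
  filter_upwards [eventually_ge_atTop (2 * d + 1)] with n hn
  have hn' : (2 * d + 1 : ℝ) ≤ n := by exact_mod_cast hn
  have hd : (0:ℝ) ≤ d := by positivity
  rw [Function.comp_apply, Nat.cast_sub (by omega), Real.norm_of_nonneg (by positivity),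
    Real.norm_of_nonneg (by positivity), mul_one_div, div_le_div_iff₀ (by nlinarith) (by nlinarith)]
  nlinarith

lemma isBigO_add_inv_sq {E : Type*} [NormedAddCommGroup E] {f : ℕ → E}
    (h : f =O[atTop] (fun n : ℕ => 1 / (n:ℝ) ^ 2)) (d : ℕ) :
    (fun n => f (n + d)) =O[atTop] (fun n : ℕ => 1 / (n:ℝ) ^ 2) := by
  refine (h.comp_tendsto (tendsto_add_atTop_nat d)).trans (IsBigO.of_bound 1 ?_)
  filter_upwards [eventually_ge_atTop 1] with n hn
  have : (0:ℝ) < n := by exact_mod_cast hn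
  rw [Function.comp_apply, one_mul, Real.norm_of_nonneg (by positivity), Real.norm_of_nonneg (by positivity)]
  push_cast
  gcongr
  linarith

lemma norm_oscTerm (l : ℝ) (ξ : ℂ) (n : ℕ) : ‖oscTerm l ξ n‖ = |l| / 2 * ‖ξ‖ * (1 / n) := by
  unfold oscTerm
  rw [norm_mul, norm_mul, norm_mul, mul_comm Complex.I, Complex.norm_exp_ofReal_mul_I]
  simp
  ring

lemma oscTerm_isBigO (l : ℝ) (ξ : ℂ) : oscTerm l ξ =O[atTop] (fun n : ℕ => 1 / (n:ℝ)) :=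
  IsBigO.of_bound (|l| / 2 * ‖ξ‖) (.of_forall fun n => by
    rw [norm_oscTerm, Real.norm_of_nonneg (by positivity)])

lemma oscTerm_succ_add (l : ℝ) (ξ : ℂ) :
    (fun n => oscTerm l ξ (n + 1) + oscTerm l ξ n) =O[atTop] (fun n : ℕ => 1 / (n:ℝ) ^ 2) := by
  refine IsBigO.of_bound (|l| / 2 * ‖ξ‖ * (1 + 2 * |l|)) ?_
  filter_upwards [eventually_ge_atTop 1] with n hn
  have hn' : (0:ℝ) < n := by exact_mod_cast hn
  set f : ℕ → ℂ := fun n => Complex.exp (Complex.I * (2 * l * Real.log (4 * n) : ℝ)) with hf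
  have hfn : ∀ n, ‖f n‖ = 1 := fun n => by
    simp only [hf]; rw [mul_comm Complex.I, Complex.norm_exp_ofReal_mul_I]
  have h1 : ‖f (n + 1) - f n‖ ≤ 2 * |l| * (1 / n) := by
    have e : f (n + 1) = f n * Complex.exp (Complex.I * (2 * l * Real.log (1 + 1 / n) : ℝ)) := by
      simp only [hf]
      rw [← Complex.exp_add, ← mul_add, ← Complex.ofReal_add, ← mul_add, ← Real.log_mul (by positivity) (by positivity)]
      congr 5
      push_cast
      field_simp
    rw [e, ← mul_sub_one, norm_mul, hfn, one_mul]
    refine Real.norm_exp_I_mul_ofReal_sub_one_le.trans ?_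
    have h2 : Real.log (1 + 1 / n) ≤ 1 / n := by
      have := Real.log_le_sub_one_of_pos (show (0:ℝ) < 1 + 1 / n by positivity)
      linarith
    have h3 : 0 ≤ Real.log (1 + 1 / n) := Real.log_nonneg (by have : (0:ℝ) < 1 / n := by positivity
                                                              linarith)
    rw [norm_mul, norm_mul, Real.norm_of_nonneg h3]
    simp only [Real.norm_eq_abs, abs_two]
    gcongr
  have e : oscTerm l ξ (n + 1) + oscTerm l ξ n =
      (l / 2) * ξ * (-1) ^ n * ((1 / (n * (n + 1))) * f (n + 1) - (1 / n) * (f (n + 1) - f n)) := by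
    have h0 : (n:ℂ) ≠ 0 := by exact_mod_cast hn'.ne'
    have h0' : (n:ℂ) + 1 ≠ 0 := by exact_mod_cast n.succ_ne_zero
    have e1 : oscTerm l ξ (n + 1) = (l / (2 * (n + 1))) * (-1) ^ (n + 1) * f (n + 1) * ξ := by
      simp only [oscTerm, hf]; push_cast; rfl
    have e2 : oscTerm l ξ n = (l / (2 * n)) * (-1) ^ n * f n * ξ := by
      simp only [oscTerm, hf]
    rw [e1, e2, pow_succ]
    field_simp
    ring
  rw [e, norm_mul, norm_mul, norm_mul, norm_pow, norm_neg, norm_one, one_pow, mul_one, mul_assoc]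
  have e3 : ‖(l:ℂ) / 2‖ = |l| / 2 := by simp
  rw [e3, Real.norm_of_nonneg (by positivity), mul_assoc (|l| / 2), mul_assoc]
  rw [show |l| / 2 * (‖ξ‖ * (1 + 2 * |l|) * (1 / (n:ℝ) ^ 2)) =
    |l| / 2 * (‖ξ‖ * (1 / n ^ 2 + 1 / n * (2 * |l| * (1 / n)))) by field_simp]
  gcongr
  refine (norm_sub_le _ _).trans (add_le_add ?_ ?_)
  · rw [norm_mul, hfn, mul_one]
    have e4 : ‖(1:ℂ) / (n * (n + 1))‖ = 1 / (n * (n + 1)) := by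
      rw [show (1:ℂ) / (n * (n + 1)) = ((1 / (n * (n + 1)) : ℝ) : ℂ) by push_cast; rfl, Complex.norm_real,
        Real.norm_of_nonneg (by positivity)]
    rw [e4]
    gcongr
    nlinarith
  · rw [norm_mul]
    refine mul_le_mul (le_of_eq ?_) h1 (norm_nonneg _) (by positivity)
    simp

/-- `A` and `b` are the coefficients of the three-term recurrence of `P`. -/
def IsRec (P : ℕ → ℝ[X]) (A b : ℕ → ℝ) : Prop :=
  ∀ n, 1 ≤ n → P (n + 1) = (X - C (b n)) * P n - C (A n) * P (n - 1)

/-- The asymptotic behaviour of recurrence coefficients with leading term `oscTerm l ξ`. -/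
structure RecAsym (l : ℝ) (ξ : ℂ) (A b : ℕ → ℝ) : Prop where
  sq : (fun n => A n - 1 / 4 + (oscTerm l ξ n).im) =O[atTop] (fun n : ℕ => 1 / (n:ℝ) ^ 2)
  mid : (fun n => b n + 2 * (oscTerm l ξ n).re) =O[atTop] (fun n : ℕ => 1 / (n:ℝ) ^ 2)

lemma IsOPS.functional_succ {L : ℝ[X] →ₗ[ℝ] ℝ} {P : ℕ → ℝ[X]} (hP : IsOPS L P) {A b : ℕ → ℝ}
    (hr : IsRec P A b) {n : ℕ} (hn : 1 ≤ n) :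
    L (P n * X ^ n) = A n * L (P (n - 1) * X ^ (n - 1)) := by
  have h1 := hP.orth (n + 1) (n - 1) (by omega)
  have e : P (n + 1) * X ^ (n - 1) = P n * X ^ n - b n • (P n * X ^ (n - 1)) -
      A n • (P (n - 1) * X ^ (n - 1)) := by
    rw [hr n hn, smul_eq_C_mul, smul_eq_C_mul]
    obtain ⟨k, rfl⟩ : ∃ k, n = k + 1 := ⟨n - 1, by omega⟩
    rw [Nat.add_sub_cancel]
    ring
  rw [e, map_sub, map_sub, map_smul, map_smul, hP.orth n (n - 1) (by omega), smul_zero, sub_zero,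
    smul_eq_mul, sub_eq_zero] at h1
  exact h1

lemma IsOPS.coeff_succ {L : ℝ[X] →ₗ[ℝ] ℝ} {P : ℕ → ℝ[X]} (hP : IsOPS L P) {A b : ℕ → ℝ}
    (hr : IsRec P A b) {n : ℕ} (hn : 1 ≤ n) :
    b n = (P n).coeff (n - 1) - (P (n + 1)).coeff n := by
  have h1 : (P n).coeff n = 1 := by
    have := (hP.monic n).coeff_natDegree
    rwa [hP.deg] at this
  have h2 : (P (n - 1)).coeff n = 0 := coeff_eq_zero_of_natDegree_lt (by rw [hP.deg]; omega)
  obtain ⟨k, rfl⟩ : ∃ k, n = k + 1 := ⟨n - 1, by omega⟩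
  rw [hr _ hn, sub_mul, coeff_sub, coeff_sub, coeff_C_mul, coeff_C_mul, h1, h2, coeff_X_mul,
    Nat.add_sub_cancel]
  ring

lemma exists_real_solution {φ : Tor → ℂ} (hφ : MemLp φ ∞ torMeasure)
    (hr : ∀ m : ℤ, conj (fco φ m) = fco φ m) (N : ℕ) (hu : IsUnit (1 + hankelOp φ hφ N)) :
    ∀ k, conj (Ring.inverse (1 + hankelOp φ hφ N) (unitVec 0) k) =
      Ring.inverse (1 + hankelOp φ hφ N) (unitVec 0) k := by
  set H := hankelOp φ hφ N with hH
  set v := Ring.inverse (1 + H) (unitVec 0) with hv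
  have hsH : star H = H := clm_ext_matEntry fun j k => by
    rw [matEntry_star, hH, isHankelFam_hankelOp hφ, isHankelFam_hankelOp hφ, hr, add_right_comm]
  have h1 : v + H v = unitVec 0 := by
    have := congrArg (fun T : Ell2 →L[ℂ] Ell2 => T (unitVec 0)) (Ring.mul_inverse_cancel _ hu)
    simpa using this
  have h2 : star v + H (star v) = unitVec 0 := by
    refine lp.ext (funext fun j => ?_)
    have e1 := star_hankelOp_apply hφ N v j
    rw [← hH, hsH] at e1
    have e2 : H (star v) j = conj (H v j) := by rw [e1, Complex.conj_conj]
    have e3 := congrArg (fun x : Ell2 => conj (x j)) h1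
    simp only [lp.coeFn_add, Pi.add_apply, map_add] at e3
    rw [lp.coeFn_add, Pi.add_apply, e2, lp.star_apply]
    refine e3.trans ?_
    rw [unitVec_apply]; split_ifs <;> simp
  have h3 : star v = v := by
    have e1 : ∀ x : Ell2, x + H x = unitVec 0 → x = v := by
      intro x hx
      have := congrArg (fun T : Ell2 →L[ℂ] Ell2 => T x) (Ring.inverse_mul_cancel _ hu)
      simp only [mul_apply_eq_comp, one_apply_eq_self, _root_.add_apply, hx] at this
      exact this.symm
    exact e1 _ h2
  intro k
  have := congrArg (fun x : Ell2 => x k) h3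
  simpa using this

theorem recAsym_of_szegoData {a a' : ℝ} (ha : a ∈ Icc (0:ℝ) 1) (ha' : a' ∈ Icc (0:ℝ) 1) (l : ℝ)
    {g : ℂ → ℂ} (hg : DiscLog g) {D V : Tor → ℂ} (S : SzegoData D V (szegoPhase a a' l g))
    {L : ℝ[X] →ₗ[ℝ] ℝ}
    (hL : ∀ q : ℝ[X], ((L q : ℝ) : ℂ) =
      Real.pi * fco (fun t => ((q.eval (crd t).re : ℝ) : ℂ) * (D t * conj (D t))) 0)
    (hpos : PosFun L) {P : ℕ → ℝ[X]} (hP : IsOPS L P) {A b : ℕ → ℝ} (hrec : IsRec P A b) :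
    RecAsym l (phaseConst a a' l g) A b := by
  obtain ⟨hu, hρ, hA, hB⟩ := phase_resolvent_asymptotics ha ha' l hg S.memb
  set H := hankelOp (szegoPhase a a' l g) S.memb with hH
  set E := oscTerm l (phaseConst a a' l g) with hE
  set v : ℕ → Ell2 := fun n => Ring.inverse (1 + H (2 * n + 2)) (unitVec 0) with hv
  set ρ : ℕ → ℂ := fun n => inner ℂ (unitVec 0) (H (2 * n + 2) (v n)) with hρd
  have hsz : ∀ᶠ n in atTop, ((L (P (n + 1) * X ^ (n + 1)) : ℝ) : ℂ) =
      2 * Real.pi * (1 / 4) ^ (n + 1) * fco D 0 ^ 2 * (1 - ρ n) ∧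
      (((P (n + 1)).coeff n : ℝ) : ℂ) = (inner ℂ (unitVec 0) (H (2 * n + 1) (v n)) + fco V (-1) * fco D 0) / 2 := by
    filter_upwards [hu] with n hn
    have h1 : v n + H (2 * n + 2) (v n) = unitVec 0 := by
      have := congrArg (fun T : Ell2 →L[ℂ] Ell2 => T (unitVec 0)) (Ring.mul_inverse_cancel _ hn)
      simpa using this
    have h2 := szego_identity S hL hpos hP (n := n + 1) (by omega) (v := v n) h1
      (exists_real_solution S.memb S.realb _ hn)
    have h3 : v n 0 = 1 - ρ n := by
      have h4 := congrArg (fun x : Ell2 => x 0) h1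
      simp only [lp.coeFn_add, Pi.add_apply, unitVec_apply, if_true] at h4
      rw [hρd]; simp only [inner_unitVec]; exact eq_sub_of_add_eq h4
    rw [h3, Nat.add_sub_cancel, show 2 * (n + 1) - 1 = 2 * n + 1 by omega] at h2
    rwa [inner_unitVec]
  have hρ' : ρ =O[atTop] (fun n : ℕ => 1 / (n:ℝ)) := hρ
  have hinv0 : Tendsto (fun n : ℕ => 1 / (n:ℝ)) atTop (nhds 0) := tendsto_one_div_atTop_nhds_zero_nat
  have hρ0 : Tendsto ρ atTop (nhds 0) := hρ'.trans_tendsto hinv0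
  have hD0 : fco D 0 ≠ 0 := left_ne_zero_of_mul (by rw [S.value_mul]; exact one_ne_zero)
  have hne : ∀ᶠ n in atTop, 1 - ρ n ≠ 0 := by
    have : Tendsto (fun n => 1 - ρ n) atTop (nhds (1 - 0)) := tendsto_const_nhds.sub hρ0
    rw [sub_zero] at this
    exact this.eventually_ne one_ne_zero
  have hAeq : ∀ᶠ n in atTop, ((A (n + 2) : ℝ) : ℂ) - 1 / 4 = (ρ n - ρ (n + 1)) / 4 * (1 - ρ n)⁻¹ := by
    filter_upwards [hsz, (tendsto_add_atTop_nat 1).eventually hsz, hne] with n h1 h2 h3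
    have h4 := congrArg (fun x : ℝ => (x : ℂ)) (hP.functional_succ hrec (n := n + 2) (by omega))
    simp only [Complex.ofReal_mul] at h4
    rw [show n + 2 - 1 = n + 1 by omega, h1.1, h2.1] at h4
    have h5 : (1 - ρ (n + 1)) / 4 = A (n + 2) * (1 - ρ n) := by
      have h6 : (2 * Real.pi * (1 / 4) ^ (n + 1) * fco D 0 ^ 2 : ℂ) ≠ 0 := by
        have : (Real.pi : ℂ) ≠ 0 := by exact_mod_cast Real.pi_ne_zero
        exact mul_ne_zero (mul_ne_zero (mul_ne_zero two_ne_zero this) (pow_ne_zero _ (by norm_num)))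
          (pow_ne_zero _ hD0)
      refine mul_left_cancel₀ h6 ?_
      rw [show n + 1 + 1 = n + 2 by rfl, pow_succ _ (n + 1)] at h4
      linear_combination h4
    field_simp
    linear_combination (-4) * h5
  have hB1 : (fun n => (1 - ρ n)⁻¹) =O[atTop] (fun _ => (1:ℝ)) := by
    have : Tendsto (fun n => (1 - ρ n)⁻¹) atTop (nhds (1 - 0)⁻¹) :=
      (tendsto_const_nhds.sub hρ0).inv₀ (by norm_num)
    exact this.isBigO_one ℝ
  have hEb := oscTerm_isBigO l (phaseConst a a' l g)
  have hE1 : (fun n => E (n + 1)) =O[atTop] (fun n : ℕ => 1 / (n:ℝ)) := by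
    refine (hEb.comp_tendsto (tendsto_add_atTop_nat 1)).trans (IsBigO.of_bound 1 ?_)
    filter_upwards [eventually_ge_atTop 1] with n hn
    have : (0:ℝ) < n := by exact_mod_cast hn
    rw [Function.comp_apply, one_mul, Real.norm_of_nonneg (by positivity), Real.norm_of_nonneg (by positivity)]
    push_cast
    gcongr
    linarith
  have him : ∀ {f : ℕ → ℂ} {k : ℕ → ℝ}, f =O[atTop] k → (fun n => ((f n).im : ℂ)) =O[atTop] k := fun h =>
    (IsBigO.of_bound 1 (.of_forall fun n => by
      rw [one_mul, Complex.norm_real]; exact Complex.abs_im_le_norm _)).trans h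
  have hre : ∀ {f : ℕ → ℂ} {k : ℕ → ℝ}, f =O[atTop] k → (fun n => ((f n).re : ℂ)) =O[atTop] k := fun h =>
    (IsBigO.of_bound 1 (.of_forall fun n => by
      rw [one_mul, Complex.norm_real]; exact Complex.abs_re_le_norm _)).trans h
  have hEs := oscTerm_succ_add l (phaseConst a a' l g)
  constructor
  · refine isBigO_inv_sq_of_add 2 ?_
    rw [← Complex.isBigO_ofReal_left]
    have h1 : (fun n => ρ n - ρ (n + 1) - 4 * ((E (n + 1)).im : ℂ)) =O[atTop] (fun n : ℕ => 1 / (n:ℝ) ^ 2) := hA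
    have h2 := (h1.const_mul_left (1 / 4)).mul hB1
    have h3 := ((him hE1).mul hρ').mul hB1
    have h4 := him (isBigO_add_inv_sq hEs 1)
    have h5 := ((h2.congr_right fun n => mul_one _).add (h3.congr_right fun n => by ring)).add h4
    refine h5.congr' ?_ .rfl
    filter_upwards [hAeq, hne] with n e1 e2
    have e3 : ((E (n + 2) + E (n + 1)).im : ℂ) = (E (n + 2)).im + (E (n + 1)).im := by
      rw [Complex.add_im]; push_cast; rfl
    simp only [Complex.ofReal_add, Complex.ofReal_sub, Complex.ofReal_div, Complex.ofReal_one, Complex.ofReal_ofNat]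
    rw [e1]
    refine Eq.trans (congrArg₂ (· + ·) rfl e3) ?_
    simp only [hE]
    field_simp
    ring
  · refine isBigO_inv_sq_of_add 1 ?_
    rw [← Complex.isBigO_ofReal_left]
    refine (hB.const_mul_left (1 / 2)).congr' ?_ .rfl
    filter_upwards [hsz, (tendsto_add_atTop_nat 1).eventually hsz] with n h1 h2
    have h4 := congrArg (fun x : ℝ => (x : ℂ)) (hP.coeff_succ hrec (n := n + 1) (by omega))
    simp only [Complex.ofReal_sub] at h4
    rw [Nat.add_sub_cancel, h1.2, h2.2] at h4
    simp only [Complex.ofReal_add, Complex.ofReal_mul, Complex.ofReal_ofNat]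
    rw [h4]
    simp only [mul_apply_eq_comp, hv, hE, show 2 * (n + 1) + 1 = 2 * n + 3 by ring,
      show 2 * (n + 1) + 2 = 2 * n + 4 by ring]
    ring

end RecurrenceAsymptotics

section Riccati
open Asymptotics

lemma le_neg_sq_of_riccati {σ s p w e u m Δ : ℝ} (h : Δ * m = -2 * s ^ 2 + p * s + w - e * m)
    (hs : |s - σ| ≤ 3 * u) (hp : |p| ≤ 8 * u) (hw : |w| ≤ 6 * u ^ 2) (he : |e| ≤ u ^ 2)
    (hm : 0 < m) (hm1 : m ≤ 1) (hu : 100 * u ≤ |σ|) : Δ ≤ -σ ^ 2 := by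
  have hu0 : 0 ≤ u := by have := (abs_nonneg _).trans hs; linarith
  have h1 : |σ| ≤ |s| + 3 * u := by
    have := abs_sub_abs_le_abs_sub σ s; rw [abs_sub_comm] at this; linarith
  have h2 : |s| ≤ |σ| + 3 * u := by
    have := abs_sub_abs_le_abs_sub s σ; linarith
  have h3 : p * s ≤ 8 * u * |s| := (le_abs_self _).trans (by rw [abs_mul]; gcongr)
  have h4 : w ≤ 6 * u ^ 2 := (le_abs_self _).trans hw
  have h5 : -(e * m) ≤ u ^ 2 := by
    refine (neg_le_abs _).trans ?_
    rw [abs_mul, abs_of_pos hm]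
    nlinarith [abs_nonneg e]
  have hkey : Δ * m ≤ -σ ^ 2 := by
    rw [h, ← sq_abs s, ← sq_abs σ]
    nlinarith [abs_nonneg s, abs_nonneg σ, mul_nonneg hu0 (abs_nonneg σ)]
  have hneg : Δ ≤ 0 := by
    by_contra hc
    push Not at hc
    have := mul_pos hc hm
    nlinarith [sq_nonneg σ]
  nlinarith

set_option maxHeartbeats 1000000 in
/-- Positive solutions of a discrete Riccati equation at the double root stay close to it. -/
lemma riccati_bound {r q α β : ℕ → ℝ} {C : ℝ} (hC : 1 ≤ C) {n₀ : ℕ} (hn₀ : 1 ≤ n₀)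
    (hr : ∀ n, 0 < r n) (hq : ∀ n, 0 < q n)
    (h1 : ∀ n, n₀ ≤ n → r n + q n = 1 - β n)
    (h2 : ∀ n, n₀ ≤ n → q (n + 1) * r n = 1 / 4 + α (n + 1))
    (hβ : ∀ n, n₀ ≤ n → |β n| ≤ C / n) (hα : ∀ n, n₀ ≤ n → |α n| ≤ C / n)
    (hx : ∀ n, n₀ ≤ n → |(β (n + 1) + 2 * α (n + 1)) + (β n + 2 * α n)| ≤ C / ((n + 1 : ℕ) : ℝ) ^ 2) :
    ∃ K : ℝ, ∀ n, n₀ ≤ n → |r n - 1 / 2| ≤ K / n := by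
  set x : ℕ → ℝ := fun n => -(β n + 2 * α n) with hxd
  set σ : ℕ → ℝ := fun n => r n - 1 / 2 - x n / 2 with hσ
  set K : ℝ := 100 * C * n₀ with hK
  have hn₀' : (1:ℝ) ≤ n₀ := by exact_mod_cast hn₀
  have hKC : 100 * C ≤ K := by rw [hK]; nlinarith
  have hxb : ∀ n, n₀ ≤ n → |x n| ≤ 3 * (C / n) := by
    intro n hn
    rw [hxd, abs_neg]
    refine (abs_add_le _ _).trans ?_
    rw [abs_mul, abs_two]
    linarith [hβ n hn, hα n hn]
  have hpos : ∀ n, n₀ ≤ n → (0:ℝ) < n := fun n hn => by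
    have : (n₀:ℝ) ≤ n := by exact_mod_cast hn
    linarith
  have hdiv : ∀ n, n₀ ≤ n → C / n ≤ C := fun n hn => div_le_self (by linarith) (by
    have : (n₀:ℝ) ≤ n := by exact_mod_cast hn
    linarith)
  have hrel : ∀ n, n₀ ≤ n → (r (n + 1) - r n) = x (n + 1) - 2 * (r (n + 1) - 1 / 2) * (r n - 1 / 2) -
      2 * β (n + 1) * (r n - 1 / 2) := by
    intro n hn
    have e1 := h1 (n + 1) (by omega)
    have e2 := h2 n hn
    simp only [hxd]
    have e3 : q (n + 1) = 1 - β (n + 1) - r (n + 1) := by linarith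
    rw [e3] at e2
    linarith
  have hupper : ∀ n, n₀ ≤ n → σ n < K / n := by
    intro n hn
    induction n, hn using Nat.le_induction with
    | base =>
      have e1 := h1 n₀ le_rfl
      have e2 := hq n₀
      have e3 := (abs_le.mp ((hβ n₀ le_rfl).trans (hdiv n₀ le_rfl))).1
      have e4 := (abs_le.mp ((hxb n₀ le_rfl).trans (mul_le_mul_of_nonneg_left (hdiv n₀ le_rfl) (by norm_num)))).1
      rw [hK, mul_div_assoc, div_self (by linarith)]
      simp only [hσ]
      linarith
    | succ n hn ih =>
      by_contra hc
      push Not at hc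
      refine absurd ih (not_lt.mpr ?_)
      have hN := hpos n hn
      have hN1 := hpos (n + 1) (by omega)
      have hN' : (1:ℝ) ≤ n := by
        have : (n₀:ℝ) ≤ n := by exact_mod_cast hn
        linarith
      set u : ℝ := C / ((n + 1 : ℕ) : ℝ) with hu
      have hu0 : 0 ≤ u := by rw [hu]; positivity
      have e1 := hxb (n + 1) (by omega)
      have e2 := hβ (n + 1) (by omega)
      rw [← hu] at e1 e2
      have hKu : 100 * u ≤ K / ((n + 1 : ℕ) : ℝ) := by
        rw [hu, ← mul_div_assoc]; gcongr
      have hσ0 : 100 * u ≤ σ (n + 1) := hKu.trans hc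
      have e1' := abs_le.mp e1
      have e2' := abs_le.mp e2
      have hq2 : 2 * q (n + 1) = 1 - 2 * (r (n + 1) - 1 / 2) - 2 * β (n + 1) := by
        have := h1 (n + 1) (by omega); linarith
      have hss : r (n + 1) - 1 / 2 = σ (n + 1) + x (n + 1) / 2 := by simp only [hσ]; ring
      have key := le_neg_sq_of_riccati (σ := σ (n + 1)) (s := r (n + 1) - 1 / 2)
        (p := -2 * β (n + 1) + 2 * x (n + 1)) (w := 2 * β (n + 1) * x (n + 1))
        (e := -(x (n + 1) + x n) / 2) (u := u) (m := 2 * q (n + 1)) (Δ := σ (n + 1) - σ n)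
        (by
          rw [hq2]
          have e5 := hrel n hn
          simp only [hσ]
          linear_combination (1) * e5)
        (by rw [hss, add_sub_cancel_left, abs_div, abs_two]; linarith)
        (by
          refine (abs_add_le _ _).trans ?_
          rw [abs_mul, abs_mul, abs_neg, abs_two]; linarith)
        (by
          rw [abs_mul, abs_mul, abs_two]
          nlinarith [abs_nonneg (β (n + 1)), abs_nonneg (x (n + 1))])
        (by
          have e6 := hx n hn
          have e7 : C / ((n + 1 : ℕ) : ℝ) ^ 2 ≤ u ^ 2 := by
            rw [hu, div_pow]; gcongr; nlinarith
          have e8 : -(x (n + 1) + x n) / 2 = ((β (n + 1) + 2 * α (n + 1)) + (β n + 2 * α n)) / 2 := by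
            simp only [hxd]; ring
          rw [e8, abs_div, abs_two]
          have := abs_nonneg ((β (n + 1) + 2 * α (n + 1)) + (β n + 2 * α n))
          linarith)
        (by have := hq (n + 1); linarith)
        (by rw [hq2, hss]; linarith)
        (by rw [abs_of_nonneg (by linarith)]; exact hσ0)
      have h9 : K / ((n + 1 : ℕ) : ℝ) + (K / ((n + 1 : ℕ) : ℝ)) ^ 2 ≤ σ n := by
        have : 0 ≤ K / ((n + 1 : ℕ) : ℝ) := by linarith
        nlinarith
      refine le_trans ?_ h9
      push_cast
      rw [div_pow, div_add_div _ _ (by positivity) (by positivity), div_le_div_iff₀ (by positivity) (by positivity)]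
      have hK2 : 2 ≤ K := by linarith
      have : 0 ≤ K * ((n:ℝ) + 1) * (K * n - (n + 1)) := by
        refine mul_nonneg (by positivity) ?_
        nlinarith
      nlinarith
  have hlower : ∀ n, n₀ ≤ n → -(K / ((n + 1 : ℕ) : ℝ)) < σ n := by
    intro n hn
    by_contra hc
    push Not at hc
    have hstep : ∀ k, σ (n + k) ≤ -(K / ((n + k + 1 : ℕ) : ℝ)) ∧ σ (n + k) ≤ σ n - k * (σ n) ^ 2 := by
      intro k
      induction k with
      | zero => simpa using hc
      | succ k ih =>
        obtain ⟨ih1, ih2⟩ := ih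
        set j := n + k with hj
        have hjn : n₀ ≤ j := by omega
        have hN := hpos j hjn
        set u : ℝ := C / ((j + 1 : ℕ) : ℝ) with hu
        have hu0 : 0 ≤ u := by rw [hu]; positivity
        have e0 := hxb j hjn
        have e0' : |x j| ≤ 6 * u := by
          refine e0.trans ?_
          rw [hu, ← mul_div_assoc, ← mul_div_assoc, div_le_div_iff₀ hN (by positivity)]
          push_cast
          have : (1:ℝ) ≤ j := by
            have : (n₀:ℝ) ≤ j := by exact_mod_cast hjn
            linarith
          nlinarith
        have e1 := hxb (j + 1) (by omega)
        have e2 := hβ (j + 1) (by omega)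
        rw [← hu] at e1 e2
        have hKu : 100 * u ≤ K / ((j + 1 : ℕ) : ℝ) := by
          rw [hu, ← mul_div_assoc]; gcongr
        have hσ0 : 100 * u ≤ -σ j := by linarith
        have hss : r j - 1 / 2 = σ j + x j / 2 := by simp only [hσ]; ring
        have e0'' := abs_le.mp e0'
        have key := le_neg_sq_of_riccati (σ := σ j) (s := r j - 1 / 2)
          (p := -2 * (β (j + 1) + x (j + 1))) (w := 0)
          (e := -(x (j + 1) + x j) / 2) (u := u) (m := 2 * r j) (Δ := σ (j + 1) - σ j)
          (by
            have e5 := hrel j hjn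
            simp only [hσ]
            linear_combination (1) * e5)
          (by rw [hss, add_sub_cancel_left, abs_div, abs_two]; linarith)
          (by
            rw [abs_mul, abs_neg, abs_two]
            have := abs_add_le (β (j + 1)) (x (j + 1))
            linarith)
          (by rw [abs_zero]; positivity)
          (by
            have e6 := hx j hjn
            have e7 : C / ((j + 1 : ℕ) : ℝ) ^ 2 ≤ u ^ 2 := by
              rw [hu, div_pow]; gcongr; nlinarith
            have e8 : -(x (j + 1) + x j) / 2 = ((β (j + 1) + 2 * α (j + 1)) + (β j + 2 * α j)) / 2 := by
              simp only [hxd]; ring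
            rw [e8, abs_div, abs_two]
            have := abs_nonneg ((β (j + 1) + 2 * α (j + 1)) + (β j + 2 * α j))
            linarith)
          (by have := hr j; linarith)
          (by linarith)
          (by rw [abs_of_nonpos (by linarith)]; exact hσ0)
        have hmono : σ j ≤ σ n := by
          have : 0 ≤ (k:ℝ) * (σ n) ^ 2 := by positivity
          linarith
        have hσn : σ n ≤ 0 := by
          have : 0 ≤ K / ((n + 1 : ℕ) : ℝ) := by
            have : 0 ≤ K := by linarith
            positivity
          linarith
        constructor
        · show σ (j + 1) ≤ -(K / ((j + 1 + 1 : ℕ) : ℝ))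
          have h9 : K / ((j + 1 + 1 : ℕ) : ℝ) ≤ K / ((j + 1 : ℕ) : ℝ) := by
            have : 0 ≤ K := by linarith
            gcongr
            omega
          nlinarith [sq_nonneg (σ j)]
        · show σ (j + 1) ≤ _
          push_cast
          nlinarith
    have hσn : σ n < 0 := by
      have : 0 < K / ((n + 1 : ℕ) : ℝ) := by
        have : 0 < K := by linarith
        positivity
      linarith
    obtain ⟨k, hk⟩ := exists_nat_gt (2 * C / (σ n) ^ 2)
    have h3 := (hstep k).2
    rw [div_lt_iff₀ (by nlinarith)] at hk
    have e4 := (abs_le.mp ((hxb (n + k) (by omega)).trans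
      (mul_le_mul_of_nonneg_left (hdiv (n + k) (by omega)) (by norm_num)))).2
    have h5 : -(1 / 2) - 3 / 2 * C < σ (n + k) := by
      simp only [hσ]; linarith [hr (n + k)]
    linarith
  refine ⟨K + 3 / 2 * C, fun n hn => ?_⟩
  have hN := hpos n hn
  have e1 := abs_le.mp (hxb n hn)
  have e2 := hupper n hn
  have e3 := hlower n hn
  have e4 : K / ((n + 1 : ℕ) : ℝ) ≤ K / n := by
    have : 0 ≤ K := by linarith
    gcongr
    omega
  have e5 : r n - 1 / 2 = σ n + x n / 2 := by simp only [hσ]; ring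
  rw [e5, add_div K, mul_div_assoc (3 / 2), abs_le]
  constructor <;> linarith

lemma oscTerm_mul (l : ℝ) (w ξ : ℂ) (n : ℕ) : oscTerm l (w * ξ) n = w * oscTerm l ξ n := by
  unfold oscTerm; ring

/-- Transformation of recurrence asymptotics under a factorisation of the Jacobi matrix. -/
theorem RecAsym.riccati {l : ℝ} {ξ : ℂ} {A b r q : ℕ → ℝ} {ε : ℝ} (hε : ε = 1 ∨ ε = -1)
    (hr : ∀ n, 0 < r n) (hq : ∀ n, 0 < q n)
    (h1 : ∀ n, 1 ≤ n → r n + q n = 1 - ε * b n) (h2 : ∀ n, 1 ≤ n → q (n + 1) * r n = A (n + 1))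
    (H : RecAsym l ξ A b) :
    RecAsym l (-(Complex.I * ε) * ξ) (fun n => q n * r n) (fun n => ε * (1 - (r n + q (n + 1)))) := by
  have hε2 : ε * ε = 1 := by rcases hε with rfl | rfl <;> norm_num
  have hεa : |ε| = 1 := by rcases hε with rfl | rfl <;> norm_num
  have hEim : (fun n => (oscTerm l ξ n).im) =O[atTop] (fun n : ℕ => 1 / (n:ℝ)) :=
    (IsBigO.of_norm_le fun n => Complex.abs_im_le_norm _).trans (oscTerm_isBigO l ξ).norm_left
  have hEre : (fun n => (oscTerm l ξ n).re) =O[atTop] (fun n : ℕ => 1 / (n:ℝ)) :=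
    (IsBigO.of_norm_le fun n => Complex.abs_re_le_norm _).trans (oscTerm_isBigO l ξ).norm_left
  have hEim' : (fun n => (oscTerm l ξ (n + 1) + oscTerm l ξ n).im) =O[atTop] (fun n : ℕ => 1 / (n:ℝ) ^ 2) :=
    (IsBigO.of_norm_le fun n => Complex.abs_im_le_norm _).trans (oscTerm_succ_add l ξ).norm_left
  have hEre' : (fun n => (oscTerm l ξ (n + 1) + oscTerm l ξ n).re) =O[atTop] (fun n : ℕ => 1 / (n:ℝ) ^ 2) :=
    (IsBigO.of_norm_le fun n => Complex.abs_re_le_norm _).trans (oscTerm_succ_add l ξ).norm_left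
  have hsq1 : (fun n : ℕ => 1 / (n:ℝ) ^ 2) =O[atTop] (fun n : ℕ => 1 / (n:ℝ)) := by
    refine IsBigO.of_bound 1 ?_
    filter_upwards [eventually_ge_atTop 1] with n hn
    have hn' : (1:ℝ) ≤ n := by exact_mod_cast hn
    rw [one_mul, Real.norm_of_nonneg (by positivity), Real.norm_of_nonneg (by positivity)]
    exact one_div_le_one_div_of_le (by linarith) (by nlinarith)
  have hA : (fun n => A n - 1 / 4) =O[atTop] (fun n : ℕ => 1 / (n:ℝ)) :=
    ((H.sq.trans hsq1).sub hEim).congr_left fun n => by ring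
  have hB : (fun n => ε * b n) =O[atTop] (fun n : ℕ => 1 / (n:ℝ)) :=
    (((H.mid.trans hsq1).sub (hEre.const_mul_left 2)).const_mul_left ε).congr_left fun n => by ring
  have hX : (fun n => (ε * b (n + 1) + 2 * (A (n + 1) - 1 / 4)) + (ε * b n + 2 * (A n - 1 / 4)))
      =O[atTop] (fun n : ℕ => 1 / (n:ℝ) ^ 2) := by
    have h3 := isBigO_add_inv_sq H.sq 1
    have h4 := isBigO_add_inv_sq H.mid 1
    refine ((((h4.add H.mid).const_mul_left ε).add ((h3.add H.sq).const_mul_left 2)).sub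
      ((hEim'.const_mul_left 2).add (hEre'.const_mul_left (2 * ε)))).congr_left fun n => ?_
    simp only [Complex.add_im, Complex.add_re]
    ring
  have hX' : (fun n => (ε * b (n + 1) + 2 * (A (n + 1) - 1 / 4)) + (ε * b n + 2 * (A n - 1 / 4)))
      =O[atTop] (fun n : ℕ => 1 / ((n + 1 : ℕ) : ℝ) ^ 2) := by
    refine hX.trans (IsBigO.of_bound 4 ?_)
    filter_upwards [eventually_ge_atTop 1] with n hn
    have hn' : (1:ℝ) ≤ n := by exact_mod_cast hn
    rw [Real.norm_of_nonneg (by positivity), Real.norm_of_nonneg (by positivity), mul_one_div,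
      div_le_div_iff₀ (by positivity) (by positivity)]
    push_cast
    nlinarith
  obtain ⟨C₁, hC₁⟩ := hA.bound
  obtain ⟨C₂, hC₂⟩ := hB.bound
  obtain ⟨C₃, hC₃⟩ := hX'.bound
  obtain ⟨N, hN⟩ := eventually_atTop.mp (hC₁.and (hC₂.and hC₃))
  set C : ℝ := max 1 (max C₁ (max C₂ C₃)) with hCd
  have c1 : C₁ ≤ C := (le_max_left _ _).trans (le_max_right _ _)
  have c2 : C₂ ≤ C := (le_max_left _ _).trans ((le_max_right _ _).trans (le_max_right _ _))
  have c3 : C₃ ≤ C := (le_max_right _ _).trans ((le_max_right _ _).trans (le_max_right _ _))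
  have hbd : ∀ {y x c : ℝ}, 0 ≤ x → c ≤ C → ‖y‖ ≤ c * ‖1 / x‖ → |y| ≤ C / x := by
    intro y x c hx hc hy
    rw [Real.norm_eq_abs, Real.norm_of_nonneg (by positivity), mul_one_div] at hy
    exact hy.trans (by gcongr)
  obtain ⟨K, hK⟩ := riccati_bound (r := r) (q := q) (α := fun n => A n - 1 / 4) (β := fun n => ε * b n)
    (C := C) (le_max_left _ _) (n₀ := max 1 N) (le_max_left _ _) hr hq
    (fun n hn => h1 n (le_trans (le_max_left _ _) hn))
    (fun n hn => by rw [h2 n (le_trans (le_max_left _ _) hn)]; ring)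
    (fun n hn => hbd (by positivity) c2 (hN n (le_trans (le_max_right _ _) hn)).2.1)
    (fun n hn => hbd (by positivity) c1 (hN n (le_trans (le_max_right _ _) hn)).1)
    (fun n hn => hbd (by positivity) c3 (hN n (le_trans (le_max_right _ _) hn)).2.2)
  have hs : (fun n => r n - 1 / 2) =O[atTop] (fun n : ℕ => 1 / (n:ℝ)) := by
    refine IsBigO.of_bound K ?_
    filter_upwards [eventually_ge_atTop (max 1 N)] with n hn
    rw [Real.norm_eq_abs, Real.norm_of_nonneg (by positivity), mul_one_div]
    exact hK n hn
  have hinv1 : (fun n : ℕ => 1 / ((n + 1 : ℕ):ℝ)) =O[atTop] (fun n : ℕ => 1 / (n:ℝ)) := by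
    refine IsBigO.of_bound 1 ?_
    filter_upwards [eventually_ge_atTop 1] with n hn
    have hn' : (1:ℝ) ≤ n := by exact_mod_cast hn
    rw [one_mul, Real.norm_of_nonneg (by positivity), Real.norm_of_nonneg (by positivity)]
    exact one_div_le_one_div_of_le (by linarith) (by push_cast; linarith)
  have hs' : (fun n => r (n + 1) - 1 / 2) =O[atTop] (fun n : ℕ => 1 / (n:ℝ)) :=
    (hs.comp_tendsto (tendsto_add_atTop_nat 1)).trans hinv1
  have hB' : (fun n => ε * b (n + 1)) =O[atTop] (fun n : ℕ => 1 / (n:ℝ)) :=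
    (hB.comp_tendsto (tendsto_add_atTop_nat 1)).trans hinv1
  have hmul : ∀ {f g : ℕ → ℝ}, f =O[atTop] (fun n : ℕ => 1 / (n:ℝ)) → g =O[atTop] (fun n : ℕ => 1 / (n:ℝ)) →
      (fun n => f n * g n) =O[atTop] (fun n : ℕ => 1 / (n:ℝ) ^ 2) := fun hf hg =>
    (hf.mul hg).congr_right fun n => by ring
  constructor
  · refine (((H.mid.const_mul_left (-ε / 2)).sub (hmul hB hs)).sub (hmul hs hs)).congr' ?_ .rfl
    filter_upwards [eventually_ge_atTop 1] with n hn
    have e1 : q n = 1 - ε * b n - r n := by linarith [h1 n hn]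
    have e2 : (oscTerm l (-(Complex.I * ε) * ξ) n).im = -ε * (oscTerm l ξ n).re := by
      rw [oscTerm_mul]; simp
    rw [e1, e2]
    ring
  · refine (((((isBigO_add_inv_sq H.sq 1).const_mul_left (-2)).add (hEim'.const_mul_left 2)).sub
      ((hmul hs' hs).const_mul_left 2)).sub ((hmul hB' hs).const_mul_left 2)).const_mul_left ε |>.congr' ?_ .rfl
    filter_upwards [eventually_ge_atTop 1] with n hn
    have e1 : q (n + 1) = 1 - ε * b (n + 1) - r (n + 1) := by linarith [h1 (n + 1) (by omega)]
    have e2 : (oscTerm l (-(Complex.I * ε) * ξ) n).re = ε * (oscTerm l ξ n).im := by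
      rw [oscTerm_mul]; simp
    have e3 := h2 n hn
    rw [← e3, e1, e2]
    simp only [Complex.add_im]
    ring

end Riccati

section Christoffel
open Asymptotics

lemma IsOPS.coeff_self {L : ℝ[X] →ₗ[ℝ] ℝ} {P : ℕ → ℝ[X]} (hP : IsOPS L P) (n : ℕ) : (P n).coeff n = 1 := by
  have := (hP.monic n).coeff_natDegree
  rwa [hP.deg] at this

lemma IsOPS.coeff_gt {L : ℝ[X] →ₗ[ℝ] ℝ} {P : ℕ → ℝ[X]} (hP : IsOPS L P) {n m : ℕ} (h : n < m) :
    (P n).coeff m = 0 := coeff_eq_zero_of_natDegree_lt (by rw [hP.deg]; omega)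

lemma IsOPS.functional_pos {L : ℝ[X] →ₗ[ℝ] ℝ} (hL : PosFun L) {P : ℕ → ℝ[X]} (hP : IsOPS L P) (n : ℕ) :
    0 < L (P n * X ^ n) := by
  have h1 := hL (P n) (hP.monic n).ne_zero
  have h2 : L (P n * (P n - X ^ n)) = 0 := by
    refine functional_mul_eq_zero (hP.orth n) ?_
    rw [degree_lt_iff_coeff_zero]
    intro m hm
    rcases hm.eq_or_lt with rfl | hm
    · simp [hP.coeff_self]
    · simp [hP.coeff_gt hm, coeff_X_pow, hm.ne']
  rw [mul_sub, map_sub] at h2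
  linarith

/-- The factorisation of Jacobi matrices behind a linear modification of the functional. -/
lemma christoffel_factor {L L' : ℝ[X] →ₗ[ℝ] ℝ} (hL : PosFun L) (hL' : PosFun L') {ε : ℝ}
    (hε : ε = 1 ∨ ε = -1) (hLL : ∀ p, L' p = L ((1 - C ε * X) * p)) {P P' : ℕ → ℝ[X]}
    (hP : IsOPS L P) (hP' : IsOPS L' P') {A b A' b' : ℕ → ℝ} (hr : IsRec P A b) (hr' : IsRec P' A' b') :
    ∃ r q : ℕ → ℝ, (∀ n, 0 < r n) ∧ (∀ n, 0 < q n) ∧ (∀ n, 1 ≤ n → r n + q n = 1 - ε * b n) ∧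
      (∀ n, 1 ≤ n → q (n + 1) * r n = A (n + 1)) ∧ (∀ n, 1 ≤ n → q n * r n = A' n) ∧
      (∀ n, 1 ≤ n → r n + q (n + 1) = 1 - ε * b' n) := by
  have hε2 : ε * ε = 1 := by rcases hε with rfl | rfl <;> norm_num
  set H : ℕ → ℝ := fun n => L (P n * X ^ n) with hH
  set H' : ℕ → ℝ := fun n => L' (P' n * X ^ n) with hH'
  have hHp : ∀ n, 0 < H n := hP.functional_pos hL
  have hHp' : ∀ n, 0 < H' n := hP'.functional_pos hL'
  have e1 : ∀ n, 1 ≤ n → H' n / H n = 1 - ε * (P' n).coeff (n - 1) + ε * (P (n + 1)).coeff n := by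
    intro n hn
    set Q : ℝ[X] := (1 - C ε * X) * P' n + C ε * P (n + 1) with hQ
    have hQL : ∀ k, L (Q * X ^ k) = L' (P' n * X ^ k) + ε * L (P (n + 1) * X ^ k) := by
      intro k
      rw [hQ, add_mul, map_add, mul_assoc, ← hLL, mul_assoc, ← smul_eq_C_mul, map_smul, smul_eq_mul]
    have hc : ∀ m, Q.coeff (m + 1) = (P' n).coeff (m + 1) - ε * (P' n).coeff m + ε * (P (n + 1)).coeff (m + 1) := by
      intro m
      rw [hQ, sub_mul, one_mul, mul_assoc]
      simp [coeff_X_mul]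
    have hdeg : Q.natDegree ≤ n := by
      rw [natDegree_le_iff_coeff_eq_zero]
      intro m hm
      obtain ⟨m, rfl⟩ : ∃ j, m = j + 1 := ⟨m - 1, by omega⟩
      rw [hc, hP'.coeff_gt (by omega)]
      rcases (show n ≤ m by omega).eq_or_lt with rfl | h
      · rw [hP'.coeff_self, hP.coeff_self]; ring
      · rw [hP'.coeff_gt h, hP.coeff_gt (by omega)]; ring
    have h1 := hP.eq_smul hL (Q := Q) (n := n) (fun k hk => by
      rw [hQL, hP'.orth n k hk, hP.orth (n + 1) k (by omega)]; simp) hdeg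
    have h2 := hQL n
    rw [hP.orth (n + 1) n (by omega), h1, mul_assoc, ← smul_eq_C_mul, map_smul, smul_eq_mul] at h2
    obtain ⟨m, rfl⟩ : ∃ j, n = j + 1 := ⟨n - 1, by omega⟩
    have h3 := hc m
    rw [hP'.coeff_self] at h3
    rw [div_eq_iff (hHp _).ne', Nat.add_sub_cancel, ← h3]
    simp only [hH, hH']
    linarith
  have e2 : ∀ n, 1 ≤ n → H n / H' (n - 1) = ε * ((P' n).coeff (n - 1) - (P n).coeff (n - 1)) := by
    intro n hn
    obtain ⟨m, rfl⟩ : ∃ j, n = j + 1 := ⟨n - 1, by omega⟩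
    rw [Nat.add_sub_cancel]
    set Q : ℝ[X] := P (m + 1) - P' (m + 1) with hQ
    have hQL : ∀ k, L' (Q * X ^ k) = L (P (m + 1) * X ^ k) - ε * L (P (m + 1) * X ^ (k + 1)) -
        L' (P' (m + 1) * X ^ k) := by
      intro k
      have : (1 - C ε * X) * (P (m + 1) * X ^ k) = P (m + 1) * X ^ k - ε • (P (m + 1) * X ^ (k + 1)) := by
        rw [smul_eq_C_mul]; ring
      rw [hQ, sub_mul, map_sub, hLL, this, map_sub, map_smul, smul_eq_mul]
    have hdeg : Q.natDegree ≤ m := by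
      rw [natDegree_le_iff_coeff_eq_zero]
      intro j hj
      rw [hQ, coeff_sub]
      rcases (show m + 1 ≤ j by omega).eq_or_lt with rfl | h
      · rw [hP'.coeff_self, hP.coeff_self]; ring
      · rw [hP'.coeff_gt h, hP.coeff_gt h]; ring
    have h1 := hP'.eq_smul hL' (Q := Q) (n := m) (fun k hk => by
      rw [hQL, hP.orth _ k (by omega), hP.orth _ (k + 1) (by omega), hP'.orth _ k (by omega)]; simp) hdeg
    have h2 := hQL m
    rw [hP.orth _ m (by omega), hP'.orth _ m (by omega), h1, mul_assoc, ← smul_eq_C_mul, map_smul,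
      smul_eq_mul] at h2
    have h3 : Q.coeff m = (P (m + 1)).coeff m - (P' (m + 1)).coeff m := by rw [hQ, coeff_sub]
    rw [h3] at h2
    rw [div_eq_iff (hHp' _).ne']
    simp only [hH, hH']
    linear_combination ε * h2 - (L (P (m + 1) * X ^ (m + 1))) * hε2
  refine ⟨fun n => H' n / H n, fun n => if n = 0 then 1 else H n / H' (n - 1),
    fun n => div_pos (hHp' n) (hHp n), fun n => ?_, fun n hn => ?_, fun n hn => ?_, fun n hn => ?_, fun n hn => ?_⟩
  · beta_reduce
    split_ifs
    · exact one_pos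
    · exact div_pos (hHp _) (hHp' _)
  · beta_reduce
    rw [if_neg (by omega), e1 n hn, e2 n hn, hP.coeff_succ hr hn]
    ring
  · beta_reduce
    have h1 := hP.functional_succ hr (n := n + 1) (by omega)
    rw [if_neg (by omega), Nat.add_sub_cancel, div_mul_div_cancel₀ (hHp' n).ne', div_eq_iff (hHp n).ne']
    exact h1
  · beta_reduce
    have h1 := hP'.functional_succ hr' hn
    rw [if_neg (by omega), mul_comm, div_mul_div_cancel₀ (hHp n).ne', div_eq_iff (hHp' _).ne']
    exact h1
  · beta_reduce
    have h1 := e2 (n + 1) (by omega)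
    rw [if_neg (by omega), e1 n hn, h1, hP'.coeff_succ hr' hn, Nat.add_sub_cancel]
    ring

theorem RecAsym.christoffel {L L' : ℝ[X] →ₗ[ℝ] ℝ} (hL : PosFun L) (hL' : PosFun L') {ε : ℝ}
    (hε : ε = 1 ∨ ε = -1) (hLL : ∀ p, L' p = L ((1 - C ε * X) * p)) {P P' : ℕ → ℝ[X]}
    (hP : IsOPS L P) (hP' : IsOPS L' P') {A b A' b' : ℕ → ℝ} (hr : IsRec P A b) (hr' : IsRec P' A' b')
    {l : ℝ} {ξ : ℂ} (H : RecAsym l ξ A b) : RecAsym l (-(Complex.I * ε) * ξ) A' b' := by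
  obtain ⟨r, q, hr0, hq0, h1, h2, h3, h4⟩ := christoffel_factor hL hL' hε hLL hP hP' hr hr'
  have hε2 : ε * ε = 1 := by rcases hε with rfl | rfl <;> norm_num
  have h := H.riccati hε hr0 hq0 h1 h2
  constructor
  · refine h.sq.congr' ?_ .rfl
    filter_upwards [eventually_ge_atTop 1] with n hn
    rw [h3 n hn]
  · refine h.mid.congr' ?_ .rfl
    filter_upwards [eventually_ge_atTop 1] with n hn
    rw [h4 n hn]
    linear_combination (b' n) * hε2

theorem RecAsym.of_christoffel {L L' : ℝ[X] →ₗ[ℝ] ℝ} (hL : PosFun L) (hL' : PosFun L') {ε : ℝ}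
    (hε : ε = 1 ∨ ε = -1) (hLL : ∀ p, L' p = L ((1 - C ε * X) * p)) {P P' : ℕ → ℝ[X]}
    (hP : IsOPS L P) (hP' : IsOPS L' P') {A b A' b' : ℕ → ℝ} (hr : IsRec P A b) (hr' : IsRec P' A' b')
    {l : ℝ} {ξ : ℂ} (H : RecAsym l ξ A' b') : RecAsym l ((Complex.I * ε) * ξ) A b := by
  obtain ⟨r, q, hr0, hq0, h1, h2, h3, h4⟩ := christoffel_factor hL hL' hε hLL hP hP' hr hr'
  have hε2 : ε * ε = 1 := by rcases hε with rfl | rfl <;> norm_num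
  have h := H.riccati (r := fun n => q (n + 1)) (q := r) hε (fun n => hq0 _) hr0
    (fun n hn => by rw [← h4 n hn]; ring) (fun n hn => by rw [← h3 (n + 1) (by omega)]; ring)
  have h5 := oscTerm_succ_add l (Complex.I * ε * ξ)
  have h5' : (fun n => (oscTerm l (Complex.I * ε * ξ) (n + 1) + oscTerm l (Complex.I * ε * ξ) n).im)
      =O[atTop] (fun n : ℕ => 1 / (n:ℝ) ^ 2) :=
    (IsBigO.of_norm_le fun n => Complex.abs_im_le_norm _).trans h5.norm_left
  have h5'' : (fun n => (oscTerm l (Complex.I * ε * ξ) (n + 1) + oscTerm l (Complex.I * ε * ξ) n).re)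
      =O[atTop] (fun n : ℕ => 1 / (n:ℝ) ^ 2) :=
    (IsBigO.of_norm_le fun n => Complex.abs_re_le_norm _).trans h5.norm_left
  have h6 : ∀ n, oscTerm l (-(Complex.I * ε) * ξ) n = -oscTerm l (Complex.I * ε * ξ) n := fun n => by
    rw [neg_mul, neg_eq_neg_one_mul, oscTerm_mul]; ring
  constructor
  · refine isBigO_inv_sq_of_add 1 ((h.sq.add h5').congr' ?_ .rfl)
    filter_upwards [eventually_ge_atTop 1] with n hn
    rw [← h2 n hn, h6]
    simp only [Complex.add_im, Complex.neg_im]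
    ring
  · refine isBigO_inv_sq_of_add 1 ((h.mid.add (h5''.const_mul_left 2)).congr' ?_ .rfl)
    filter_upwards [eventually_ge_atTop 1] with n hn
    rw [show q (n + 1) + r (n + 1) = 1 - ε * b (n + 1) by rw [← h1 (n + 1) (by omega)]; ring, h6]
    simp only [Complex.add_re, Complex.neg_re]
    linear_combination (b (n + 1)) * hε2

end Christoffel

section Existence

lemma PosFun.exists_isOPS {L : ℝ[X] →ₗ[ℝ] ℝ} (hL : PosFun L) : ∃ P, IsOPS L P := by
  have key : ∀ n : ℕ, ∃ Q : ℝ[X], Q.degree < n ∧ ∀ k < n, L (Q * X ^ k) = -L (X ^ n * X ^ k) := by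
    intro n
    let T : degreeLT ℝ n →ₗ[ℝ] (Fin n → ℝ) := LinearMap.pi fun k =>
      L ∘ₗ (LinearMap.mulRight ℝ ((X : ℝ[X]) ^ (k : ℕ))) ∘ₗ (degreeLT ℝ n).subtype
    have hT : ∀ (Q : degreeLT ℝ n) (k : Fin n), T Q k = L ((Q : ℝ[X]) * X ^ (k : ℕ)) := fun Q k => rfl
    have hinj : Function.Injective T := by
      rw [injective_iff_map_eq_zero]
      intro Q hQ
      refine Subtype.ext (hL.eq_zero (n := n) (fun k hk => ?_) (mem_degreeLT.mp Q.2))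
      have := congrFun hQ ⟨k, hk⟩
      rwa [hT] at this
    have : FiniteDimensional ℝ (degreeLT ℝ n) := (degreeLTEquiv ℝ n).symm.finiteDimensional
    have hsurj : Function.Surjective T :=
      (LinearMap.injective_iff_surjective_of_finrank_eq_finrank
        (LinearEquiv.finrank_eq (degreeLTEquiv ℝ n))).mp hinj
    obtain ⟨Q, hQ⟩ := hsurj fun k => -L (X ^ n * X ^ (k : ℕ))
    refine ⟨Q, mem_degreeLT.mp Q.2, fun k hk => ?_⟩
    have := congrFun hQ ⟨k, hk⟩
    rwa [hT] at this
  choose Q hQ hQL using key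
  refine ⟨fun n => X ^ n + Q n, fun n => monic_X_pow_add (hQ n), fun n => ?_, fun n k hk => ?_⟩
  · rw [natDegree_eq_of_degree_eq_some]
    rw [degree_add_eq_left_of_degree_lt (by rw [degree_X_pow]; exact hQ n), degree_X_pow]
  · rw [add_mul, map_add, hQL n k hk, add_neg_cancel]

lemma IsOPS.exists_isRec {L : ℝ[X] →ₗ[ℝ] ℝ} (hL : PosFun L) {P : ℕ → ℝ[X]} (hP : IsOPS L P) :
    ∃ A b, IsRec P A b := by
  have key : ∀ n : ℕ, ∃ A b : ℝ, 1 ≤ n → P (n + 1) = (X - C b) * P n - C A * P (n - 1) := by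
    intro n
    rcases Nat.eq_zero_or_pos n with rfl | hn
    · exact ⟨0, 0, fun h => by omega⟩
    obtain ⟨m, rfl⟩ : ∃ j, n = j + 1 := ⟨n - 1, by omega⟩
    set b : ℝ := (P (m + 1)).coeff m - (P (m + 2)).coeff (m + 1) with hb
    set Q : ℝ[X] := X * P (m + 1) - C b * P (m + 1) - P (m + 2) with hQ
    have hdeg : Q.natDegree ≤ m := by
      rw [natDegree_le_iff_coeff_eq_zero]
      intro j hj
      obtain ⟨j, rfl⟩ : ∃ i, j = i + 1 := ⟨j - 1, by omega⟩
      simp only [hQ, coeff_sub, coeff_X_mul, coeff_C_mul]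
      rcases (show m ≤ j by omega).eq_or_lt with rfl | h
      · rw [hP.coeff_self, hb]; ring
      rcases (show m + 1 ≤ j by omega).eq_or_lt with rfl | h
      · rw [hP.coeff_self, hP.coeff_self, hP.coeff_gt (by omega)]; ring
      · rw [hP.coeff_gt h, hP.coeff_gt (by omega), hP.coeff_gt (by omega)]; ring
    have h1 := hP.eq_smul hL (Q := Q) (n := m) (fun k hk => by
      have : Q * X ^ k = P (m + 1) * X ^ (k + 1) - b • (P (m + 1) * X ^ k) - P (m + 2) * X ^ k := by
        rw [hQ, smul_eq_C_mul]; ring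
      rw [this, map_sub, map_sub, map_smul, hP.orth _ k (by omega), hP.orth _ k (by omega),
        hP.orth _ (k + 1) (by omega)]
      simp) hdeg
    refine ⟨Q.coeff m, b, fun _ => ?_⟩
    rw [Nat.add_sub_cancel, ← h1, hQ]
    ring
  choose A b h using key
  exact ⟨A, b, h⟩

end Existence

section Weights
open scoped ComplexConjugate

/-- Integration against a weight on `[-1, 1]` as a functional on polynomials. -/
noncomputable def weightFun (w : ℝ → ℝ) (hw : IntervalIntegrable w volume (-1) 1) : ℝ[X] →ₗ[ℝ] ℝ where
  toFun q := ∫ x in (-1:ℝ)..1, q.eval x * w x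
  map_add' p q := by
    rw [← intervalIntegral.integral_add (hw.continuousOn_mul p.continuous.continuousOn)
      (hw.continuousOn_mul q.continuous.continuousOn)]
    simp only [eval_add, add_mul]
  map_smul' r q := by
    rw [RingHom.id_apply, smul_eq_mul, ← intervalIntegral.integral_const_mul]
    simp only [eval_smul, smul_eq_mul, mul_assoc]

lemma posFun_weightFun {w : ℝ → ℝ} (hw : IntervalIntegrable w volume (-1) 1)
    (hpos : ∀ x ∈ Ioo (-1:ℝ) 1, 0 < w x) : PosFun (weightFun w hw) := by
  intro q hq
  show 0 < ∫ x in (-1:ℝ)..1, (q * q).eval x * w x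
  rw [intervalIntegral.integral_pos_iff_support_of_nonneg_ae' ?_
    (hw.continuousOn_mul (q * q).continuous.continuousOn)]
  · refine ⟨by norm_num, ?_⟩
    have hsub : Ioo (-1:ℝ) 1 \ (q.roots.toFinset : Set ℝ) ⊆
        Function.support (fun x => (q * q).eval x * w x) ∩ Ioc (-1) 1 := by
      rintro x ⟨hx, hx'⟩
      refine ⟨?_, hx.1, hx.2.le⟩
      have h1 : q.eval x ≠ 0 := by
        intro h
        exact hx' (by simpa [hq] using h)
      simp [h1, (hpos x hx).ne']
    refine lt_of_lt_of_le ?_ (measure_mono hsub)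
    rw [measure_sdiff_null (Finset.measure_zero _ _), Real.volume_Ioo]
    norm_num
  · rw [uIoc_of_le (by norm_num), ← restrict_Ioo_eq_restrict_Ioc]
    refine (ae_restrict_mem measurableSet_Ioo).mono fun x hx => ?_
    simp only [Pi.zero_apply, eval_mul]
    exact mul_nonneg (mul_self_nonneg _) (hpos x hx).le

/-- Orthogonal polynomials for the weight `w` have recurrence coefficients with the given asymptotics. -/
def HasAsym (w : ℝ → ℝ) (l : ℝ) (ξ : ℂ) : Prop :=
  ∀ (hw : IntervalIntegrable w volume (-1) 1) (P : ℕ → ℝ[X]) (A b : ℕ → ℝ),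
    IsOPS (weightFun w hw) P → IsRec P A b → RecAsym l ξ A b

lemma weightFun_eq {w w' : ℝ → ℝ} (hw : IntervalIntegrable w volume (-1) 1)
    (hw' : IntervalIntegrable w' volume (-1) 1) {ε : ℝ}
    (h : ∀ x ∈ Ioo (-1:ℝ) 1, w' x = (1 - ε * x) * w x) (p : ℝ[X]) :
    weightFun w' hw' p = weightFun w hw ((1 - C ε * X) * p) := by
  show ∫ x in (-1:ℝ)..1, p.eval x * w' x = ∫ x in (-1:ℝ)..1, ((1 - C ε * X) * p).eval x * w x
  refine intervalIntegral.integral_congr_Ioo_of_le (by norm_num) fun x hx => ?_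
  simp only [h x hx, eval_mul, eval_sub, eval_one, eval_C, eval_X]
  ring

lemma HasAsym.christoffel {w w' : ℝ → ℝ} (hw : IntervalIntegrable w volume (-1) 1)
    (hpos : ∀ x ∈ Ioo (-1:ℝ) 1, 0 < w x) (hpos' : ∀ x ∈ Ioo (-1:ℝ) 1, 0 < w' x) {ε : ℝ}
    (hε : ε = 1 ∨ ε = -1) (h : ∀ x ∈ Ioo (-1:ℝ) 1, w' x = (1 - ε * x) * w x) {l : ℝ} {ξ : ℂ}
    (H : HasAsym w l ξ) : HasAsym w' l (-(Complex.I * ε) * ξ) := by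
  intro hw' P' A' b' hP' hr'
  have hL := posFun_weightFun hw hpos
  obtain ⟨P, hP⟩ := hL.exists_isOPS
  obtain ⟨A, b, hr⟩ := hP.exists_isRec hL
  exact (H hw P A b hP hr).christoffel hL (posFun_weightFun hw' hpos') hε (weightFun_eq hw hw' h)
    hP hP' hr hr'

lemma HasAsym.of_christoffel {w w' : ℝ → ℝ} (hw' : IntervalIntegrable w' volume (-1) 1)
    (hpos : ∀ x ∈ Ioo (-1:ℝ) 1, 0 < w x) (hpos' : ∀ x ∈ Ioo (-1:ℝ) 1, 0 < w' x) {ε : ℝ}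
    (hε : ε = 1 ∨ ε = -1) (h : ∀ x ∈ Ioo (-1:ℝ) 1, w' x = (1 - ε * x) * w x) {l : ℝ} {ξ : ℂ}
    (H : HasAsym w' l ξ) : HasAsym w l ((Complex.I * ε) * ξ) := by
  intro hw P A b hP hr
  have hL' := posFun_weightFun hw' hpos'
  obtain ⟨P', hP'⟩ := hL'.exists_isOPS
  obtain ⟨A', b', hr'⟩ := hP'.exists_isRec hL'
  exact (H hw' P' A' b' hP' hr').of_christoffel (posFun_weightFun hw hpos) hL' hε (weightFun_eq hw hw' h)
    hP hP' hr hr'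

/-- The Jacobi-type weight with a jump at the origin. -/
noncomputable def jacWeight (c : ℝ) (h : ℝ → ℝ) (α β x : ℝ) : ℝ :=
  h x * (1 - x) ^ α * (1 + x) ^ β * (if x < 0 then 1 else c ^ 2)

variable {c : ℝ} {h : ℝ → ℝ}

lemma jacWeight_pos (hc : 0 < c) (h_pos : ∀ x ∈ Icc (-1 : ℝ) 1, 0 < h x) (α β : ℝ) :
    ∀ x ∈ Ioo (-1:ℝ) 1, 0 < jacWeight c h α β x := by
  intro x hx
  have h1 := h_pos x ⟨hx.1.le, hx.2.le⟩
  have h2 : 0 < 1 - x := by linarith [hx.2]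
  have h3 : 0 < 1 + x := by linarith [hx.1]
  unfold jacWeight
  split_ifs <;> positivity

lemma jacWeight_add_one_left (α β : ℝ) :
    ∀ x ∈ Ioo (-1:ℝ) 1, jacWeight c h (α + 1) β x = (1 - (1:ℝ) * x) * jacWeight c h α β x := by
  intro x hx
  unfold jacWeight
  rw [Real.rpow_add_one (by linarith [hx.2])]
  ring

lemma jacWeight_add_one_right (α β : ℝ) :
    ∀ x ∈ Ioo (-1:ℝ) 1, jacWeight c h α (β + 1) x = (1 - (-1:ℝ) * x) * jacWeight c h α β x := by
  intro x hx
  unfold jacWeight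
  rw [Real.rpow_add_one (by linarith [hx.1])]
  ring

lemma intervalIntegrable_jacWeight (hcont : ContinuousOn h (Icc (-1) 1)) {α β : ℝ} (hα : -1 < α)
    (hβ : -1 < β) : IntervalIntegrable (jacWeight c h α β) volume (-1) 1 := by
  have hα' : IntervalIntegrable (fun x : ℝ => (1 - x) ^ α) volume 0 1 := by
    have := (intervalIntegral.intervalIntegrable_rpow' (a := 1) (b := 0) hα).comp_sub_left 1
    simpa using this
  have hβ' : IntervalIntegrable (fun x : ℝ => (1 + x) ^ β) volume (-1) 0 := by
    have := (intervalIntegral.intervalIntegrable_rpow' (a := 0) (b := 1) hβ).comp_add_left 1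
    simpa using this
  refine IntervalIntegrable.trans (b := 0) ?_ ?_
  · have hc1 : ContinuousOn (fun x : ℝ => h x * (1 - x) ^ α) (uIcc (-1) 0) := by
      rw [uIcc_of_le (by norm_num)]
      refine (hcont.mono (Icc_subset_Icc le_rfl zero_le_one)).mul
        (ContinuousOn.rpow_const (by fun_prop) fun x hx => Or.inl ?_)
      linarith [hx.2]
    refine (hβ'.continuousOn_mul hc1).congr_uIoo fun x hx => ?_
    rw [uIoo_of_le (by norm_num)] at hx
    simp only [jacWeight, if_pos hx.2]
    ring
  · have hc1 : ContinuousOn (fun x : ℝ => h x * (1 + x) ^ β * c ^ 2) (uIcc 0 1) := by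
      rw [uIcc_of_le (by norm_num)]
      refine ((hcont.mono (Icc_subset_Icc (by norm_num) le_rfl)).mul
        (ContinuousOn.rpow_const (by fun_prop) fun x hx => Or.inl ?_)).mul continuousOn_const
      linarith [hx.1]
    refine (hα'.continuousOn_mul hc1).congr_uIoo fun x hx => ?_
    rw [uIoo_of_le (by norm_num)] at hx
    simp only [jacWeight, if_neg hx.1.le.not_gt]
    ring

lemma phaseConst_add_one_left (a a' l : ℝ) (g : ℂ → ℂ) :
    phaseConst (a + 1) a' l g = -(Complex.I * (1:ℝ)) * phaseConst a a' l g := by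
  have : (Complex.I * ((a' - (a + 1)) * Real.pi / 2 + 2 * (g Complex.I).im : ℝ) : ℂ) =
      Complex.I * ((a' - a) * Real.pi / 2 + 2 * (g Complex.I).im : ℝ) + -(Real.pi / 2 * Complex.I) := by
    push_cast; ring
  unfold phaseConst
  rw [this, Complex.exp_add, Complex.exp_neg, Complex.exp_pi_div_two_mul_I, Complex.inv_I]
  push_cast
  ring

lemma phaseConst_add_one_right (a a' l : ℝ) (g : ℂ → ℂ) :
    phaseConst a (a' + 1) l g = -(Complex.I * (-1:ℝ)) * phaseConst a a' l g := by
  have : (Complex.I * ((a' + 1 - a) * Real.pi / 2 + 2 * (g Complex.I).im : ℝ) : ℂ) =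
      Complex.I * ((a' - a) * Real.pi / 2 + 2 * (g Complex.I).im : ℝ) + Real.pi / 2 * Complex.I := by
    push_cast; ring
  unfold phaseConst
  rw [this, Complex.exp_add, Complex.exp_pi_div_two_mul_I]
  push_cast
  ring

lemma forall_of_shift {p : ℝ → Prop} (base : ∀ x ∈ Icc (-(1 / 2):ℝ) (1 / 2), p x)
    (up : ∀ x, -1 < x → p x → p (x + 1)) (down : ∀ x, -1 < x → p (x + 1) → p x) {x : ℝ} (hx : -1 < x) :
    p x := by
  have h1 : ∀ k : ℕ, ∀ y ∈ Icc (-(1 / 2):ℝ) (1 / 2), p (y + k) := by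
    intro k
    induction k with
    | zero => intro y hy; simpa using base y hy
    | succ k ih =>
      intro y hy
      have h2 : (0:ℝ) ≤ k := k.cast_nonneg
      have := up (y + k) (by linarith [hy.1]) (ih y hy)
      rwa [show y + ((k + 1 : ℕ) : ℝ) = y + k + 1 by push_cast; ring]
  rcases le_or_gt (-(1 / 2)) x with h | h
  · have h2 := Nat.floor_le (show 0 ≤ x + 1 / 2 by linarith)
    have h3 := Nat.lt_floor_add_one (x + 1 / 2)
    have := h1 ⌊x + 1 / 2⌋₊ (x - ⌊x + 1 / 2⌋₊) ⟨by linarith, by linarith⟩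
    rwa [sub_add_cancel] at this
  · exact down x hx (base _ ⟨by linarith, by linarith⟩)

/-- Asymptotics of the recurrence coefficients for Jacobi-type weights with a jump. -/
theorem hasAsym_jacWeight (hc : 0 < c) (hcont : ContinuousOn h (Icc (-1) 1))
    (h_pos : ∀ x ∈ Icc (-1 : ℝ) 1, 0 < h x) {g : ℂ → ℂ} (hg : DiscLog g)
    (hgh : ∀ t, g (crd t) + conj (g (crd t)) = (Real.log (h (crd t).re) : ℝ))
    {α β : ℝ} (hα : -1 < α) (hβ : -1 < β) :
    HasAsym (jacWeight c h α β) (Real.log c / Real.pi)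
      (phaseConst (α + 1 / 2) (β + 1 / 2) (Real.log c / Real.pi) g) := by
  have base : ∀ β ∈ Icc (-(1 / 2):ℝ) (1 / 2), ∀ α ∈ Icc (-(1 / 2):ℝ) (1 / 2),
      HasAsym (jacWeight c h α β) (Real.log c / Real.pi)
        (phaseConst (α + 1 / 2) (β + 1 / 2) (Real.log c / Real.pi) g) := by
    intro β hβ α hα hw P A b hP hr
    set g' : ℂ → ℂ := fun z => g z + ((Real.log c - (α + β + 1) * Real.log 2) / 2 : ℝ) with hg'
    have hg1 : DiscLog g' := hg.add_real _
    have ha : α + 1 / 2 ∈ Icc (0:ℝ) 1 := ⟨by linarith [hα.1], by linarith [hα.2]⟩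
    have ha' : β + 1 / 2 ∈ Icc (0:ℝ) 1 := ⟨by linarith [hβ.1], by linarith [hβ.2]⟩
    have := recAsym_of_szegoData ha ha' (Real.log c / Real.pi) hg1
      (szegoData_szegoFun ha ha' (Real.log c / Real.pi) hg1)
      (fun q => integral_weight_eq_fco (w := jacWeight c h α β) (szegoFun_neg _ _ _ hg1)
        (fun x hx hx0 => normSq_szegoFun hc h_pos hgh hx hx0) (fun x => q.eval x))
      (posFun_weightFun hw (jacWeight_pos hc h_pos α β)) hP hr
    have e : (g' Complex.I).im = (g Complex.I).im := by
      rw [hg', Complex.add_im, Complex.ofReal_im, add_zero]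
    rwa [phaseConst, e] at this
  have left : ∀ β ∈ Icc (-(1 / 2):ℝ) (1 / 2), ∀ α, -1 < α →
      HasAsym (jacWeight c h α β) (Real.log c / Real.pi)
        (phaseConst (α + 1 / 2) (β + 1 / 2) (Real.log c / Real.pi) g) := by
    intro β hβ α hα
    have hβ' : -1 < β := by linarith [hβ.1]
    refine forall_of_shift (p := fun α => HasAsym (jacWeight c h α β) (Real.log c / Real.pi)
        (phaseConst (α + 1 / 2) (β + 1 / 2) (Real.log c / Real.pi) g)) (base β hβ) ?_ ?_ hα
    · intro x hx H
      have := H.christoffel (intervalIntegrable_jacWeight hcont hx hβ') (jacWeight_pos hc h_pos x β)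
        (jacWeight_pos hc h_pos (x + 1) β) (.inl rfl) (jacWeight_add_one_left x β)
      rwa [← phaseConst_add_one_left, show x + 1 / 2 + 1 = x + 1 + 1 / 2 by ring] at this
    · intro x hx H
      have := H.of_christoffel (intervalIntegrable_jacWeight hcont (by linarith) hβ')
        (jacWeight_pos hc h_pos x β)
        (jacWeight_pos hc h_pos (x + 1) β) (.inl rfl) (jacWeight_add_one_left x β)
      rw [show x + 1 + 1 / 2 = x + 1 / 2 + 1 by ring, phaseConst_add_one_left] at this
      convert this using 1
      push_cast
      linear_combination (phaseConst (x + 1 / 2) (β + 1 / 2) (Real.log c / Real.pi) g) * Complex.I_sq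
  refine forall_of_shift (p := fun β => HasAsym (jacWeight c h α β) (Real.log c / Real.pi)
        (phaseConst (α + 1 / 2) (β + 1 / 2) (Real.log c / Real.pi) g)) (fun β hβ => left β hβ α hα) ?_ ?_ hβ
  · intro x hx H
    have := H.christoffel (intervalIntegrable_jacWeight hcont hα hx) (jacWeight_pos hc h_pos α x)
      (jacWeight_pos hc h_pos α (x + 1)) (.inr rfl) (jacWeight_add_one_right α x)
    rwa [← phaseConst_add_one_right, show x + 1 / 2 + 1 = x + 1 + 1 / 2 by ring] at this
  · intro x hx H
    have := H.of_christoffel (intervalIntegrable_jacWeight hcont hα (by linarith))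
      (jacWeight_pos hc h_pos α x)
      (jacWeight_pos hc h_pos α (x + 1)) (.inr rfl) (jacWeight_add_one_right α x)
    rw [show x + 1 + 1 / 2 = x + 1 / 2 + 1 by ring, phaseConst_add_one_right] at this
    convert this using 1
    push_cast
    linear_combination (phaseConst (α + 1 / 2) (x + 1 / 2) (Real.log c / Real.pi) g) * Complex.I_sq

end Weights

section Final
open Asymptotics
open scoped ComplexConjugate

lemma neg_Gamma_div_Gamma {l γ : ℝ} (hl : l ≠ 0) {k : ℤ}
    (hk : Complex.arg (Complex.Gamma (Complex.I * (l : ℂ))) = γ + k * Real.pi) :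
    -(Complex.Gamma (1 - Complex.I * l) / Complex.Gamma (1 + Complex.I * l)) =
      Complex.exp (Complex.I * (-(2 * γ) : ℝ)) := by
  have hl' : (l : ℂ) ≠ 0 := by exact_mod_cast hl
  have hIl : Complex.I * (l : ℂ) ≠ 0 := mul_ne_zero Complex.I_ne_zero hl'
  have e1 : Complex.Gamma (1 + Complex.I * l) = Complex.I * l * Complex.Gamma (Complex.I * l) := by
    rw [add_comm, Complex.Gamma_add_one _ hIl]
  have e2 : Complex.Gamma (1 - Complex.I * l) = -(Complex.I * l) * conj (Complex.Gamma (Complex.I * l)) := by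
    rw [← Complex.Gamma_conj, map_mul, Complex.conj_I, Complex.conj_ofReal, neg_mul Complex.I,
      ← Complex.Gamma_add_one _ (neg_ne_zero.mpr hIl)]
    congr 1; ring
  set z := Complex.Gamma (Complex.I * l) with hz
  have hz0 : z ≠ 0 := by
    refine Complex.Gamma_ne_zero fun m h => ?_
    have := congrArg Complex.im h
    simp at this
    exact hl this
  have hzn : ((‖z‖ : ℝ) : ℂ) ≠ 0 := by exact_mod_cast norm_ne_zero_iff.mpr hz0
  have e3 : z = ‖z‖ * Complex.exp (Complex.arg z * Complex.I) := (Complex.norm_mul_exp_arg_mul_I z).symm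
  have e4 : conj z = ‖z‖ * Complex.exp (-(Complex.arg z * Complex.I)) := by
    conv_lhs => rw [e3]
    rw [map_mul, Complex.conj_ofReal, ← Complex.exp_conj, map_mul, Complex.conj_I, Complex.conj_ofReal, mul_neg]
  have e5 : Complex.exp (Complex.I * (-(2 * γ) : ℝ)) = Complex.exp (-(Complex.arg z * Complex.I)) /
      Complex.exp (Complex.arg z * Complex.I) := by
    rw [← Complex.exp_sub, hk, Complex.exp_eq_exp_iff_exists_int]
    exact ⟨k, by push_cast; ring⟩
  rw [e1, e2, e5, neg_mul, neg_div, neg_neg, mul_div_mul_left _ _ hIl, e4]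
  rw [div_eq_div_iff hz0 (Complex.exp_ne_zero _)]
  linear_combination (-Complex.exp (-(Complex.arg z * Complex.I))) * e3

lemma oscTerm_phaseConst {a a' l γ : ℝ} (hl : l ≠ 0) {g : ℂ → ℂ} {k : ℤ}
    (hk : Complex.arg (Complex.Gamma (Complex.I * (l : ℂ))) = γ + k * Real.pi) (n : ℕ) :
    oscTerm l (phaseConst a a' l g) n = ((l / (2 * n) : ℝ) : ℂ) * Complex.exp
      (((2 * (l * Real.log (4 * n) + n * Real.pi / 2 + (a' - a) / 4 * Real.pi + (g Complex.I).im - γ) : ℝ) : ℂ)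
        * Complex.I) := by
  have h1 : ((-1 : ℂ)) ^ n = Complex.exp (n * (Real.pi * Complex.I)) := by
    rw [Complex.exp_nat_mul, Complex.exp_pi_mul_I]
  have h2 := neg_Gamma_div_Gamma hl hk
  have h3 : phaseConst a a' l g = Complex.exp (Complex.I * ((a' - a) * Real.pi / 2 + 2 * (g Complex.I).im : ℝ)) *
      Complex.exp (Complex.I * (-(2 * γ) : ℝ)) := by
    rw [← h2, phaseConst]; ring
  rw [oscTerm, h1, h3, mul_assoc, mul_assoc, ← Complex.exp_add, ← Complex.exp_add, ← Complex.exp_add]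
  push_cast
  congr 2
  ring

lemma RecAsym.sqrt {l : ℝ} {ξ : ℂ} {a b : ℕ → ℝ} (ha : ∀ n, 0 < a n) (H : RecAsym l ξ (fun n => a n ^ 2) b) :
    (fun n => a n - 1 / 2 + (oscTerm l ξ n).im) =O[atTop] (fun n : ℕ => 1 / (n:ℝ) ^ 2) := by
  have hEim : (fun n => (oscTerm l ξ n).im) =O[atTop] (fun n : ℕ => 1 / (n:ℝ)) :=
    (IsBigO.of_norm_le fun n => Complex.abs_im_le_norm _).trans (oscTerm_isBigO l ξ).norm_left
  have hsq1 : (fun n : ℕ => 1 / (n:ℝ) ^ 2) =O[atTop] (fun n : ℕ => 1 / (n:ℝ)) := by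
    refine IsBigO.of_bound 1 ?_
    filter_upwards [eventually_ge_atTop 1] with n hn
    have hn' : (1:ℝ) ≤ n := by exact_mod_cast hn
    rw [one_mul, Real.norm_of_nonneg (by positivity), Real.norm_of_nonneg (by positivity)]
    exact one_div_le_one_div_of_le (by linarith) (by nlinarith)
  have hA : (fun n => a n ^ 2 - 1 / 4) =O[atTop] (fun n : ℕ => 1 / (n:ℝ)) :=
    ((H.sq.trans hsq1).sub hEim).congr_left fun n => by ring
  have hy : (fun n => a n - 1 / 2) =O[atTop] (fun n : ℕ => 1 / (n:ℝ)) := by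
    refine IsBigO.trans (IsBigO.of_bound 2 (.of_forall fun n => ?_)) hA
    have : a n ^ 2 - 1 / 4 = (a n - 1 / 2) * (a n + 1 / 2) := by ring
    rw [this, norm_mul, Real.norm_of_nonneg (show 0 ≤ a n + 1 / 2 by linarith [ha n])]
    nlinarith [norm_nonneg (a n - 1 / 2), ha n]
  refine (H.sq.sub ((hy.mul hy).congr_right (g₂ := fun n : ℕ => 1 / (n:ℝ) ^ 2) fun n => by ring)).congr_left
    fun n => by ring

end Final

theorem stmt1
    (α β c : ℝ) (hα : -1 < α) (hβ : -1 < β) (hc : 0 < c)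
    (h : ℝ → ℝ)
    (h_an : AnalyticOnNhd ℝ h (Icc (-1) 1))
    (h_pos : ∀ x ∈ Icc (-1 : ℝ) 1, 0 < h x)
    -- the weight w_c(x) = h(x)(1-x)^α(1+x)^β Ξ_c(x)
    (w : ℝ → ℝ)
    (hw : ∀ x : ℝ, w x = h x * (1 - x) ^ α * (1 + x) ^ β * (if x < 0 then 1 else c ^ 2))
    -- the monic orthogonal polynomials with respect to w_c
    (P : ℕ → Polynomial ℝ)
    (hP_monic : ∀ n, (P n).Monic)
    (hP_deg : ∀ n, (P n).natDegree = n)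
    (hP_orth : ∀ n, ∀ k < n, ∫ x in (-1 : ℝ)..1, (P n).eval x * x ^ k * w x = 0)
    -- the recurrence coefficients: P_{n+1}(z) = (z - bₙ)Pₙ(z) - aₙ²P_{n-1}(z), aₙ > 0
    (a b : ℕ → ℝ)
    (ha_pos : ∀ n, 0 < a n)
    (hrec0 : P 1 = (Polynomial.X - Polynomial.C (b 0)) * P 0)
    (hrec : ∀ n : ℕ, 1 ≤ n →
      P (n + 1) = (Polynomial.X - Polynomial.C (b n)) * P n - Polynomial.C (a n ^ 2) * P (n - 1))
    -- ħ, defined by the principal value integral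
    (hbar : ℝ → ℝ)
    (hhbar : ∀ x ∈ Ioo (-1 : ℝ) 1,
      Tendsto (fun ε : ℝ =>
          ∫ t in (Ioo (-1 : ℝ) 1 \ Ioo (x - ε) (x + ε)),
            Real.log (h t) / Real.sqrt (1 - t ^ 2) / (t - x))
        (nhdsWithin 0 (Ioi 0)) (nhds (2 * Real.pi * hbar x / Real.sqrt (1 - x ^ 2))))
    -- γ = arg Γ(i·log(c)/π), the determination lying in (-π/2, π/2)
    (γ : ℝ)
    (hγ : c ≠ 1 → γ ∈ Ioo (-(Real.pi / 2)) (Real.pi / 2) ∧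
      ∃ k : ℤ, Complex.arg (Complex.Gamma (Complex.I * ((Real.log c / Real.pi : ℝ) : ℂ))) =
        γ + k * Real.pi)
    -- the phase θₙ
    (θ : ℕ → ℝ)
    (hθ : ∀ n : ℕ, θ n =
      if c = 1 then
        2 * ((Real.log c / Real.pi) * Real.log (4 * n) + n * Real.pi / 2 +
          (β - α) / 4 * Real.pi + hbar 0 + Real.pi / 2)
      else
        2 * ((Real.log c / Real.pi) * Real.log (4 * n) + n * Real.pi / 2 +
          (β - α) / 4 * Real.pi + hbar 0 - γ)) :
    -- aₙ = 1/2 − (log c/(2πn))·sin(θₙ) + O(1/n²)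
    ∃ C : ℝ, ∃ N : ℕ, ∀ n : ℕ, N ≤ n →
      |a n - (1 / 2 - Real.log c / (2 * Real.pi * n) * Real.sin (θ n))| ≤ C / (n : ℝ) ^ 2 := by
  have hv := hhbar 0 ⟨by norm_num, by norm_num⟩
  rw [zero_pow two_ne_zero, sub_zero, Real.sqrt_one, div_one] at hv
  obtain ⟨g, g1, g2, g3, g4, g5, g6⟩ := exists_outer_log h_an h_pos hv
  have hcont : ContinuousOn h (Icc (-1) 1) := h_an.continuousOn
  obtain rfl : w = jacWeight c h α β := funext hw
  have hP : IsOPS (weightFun (jacWeight c h α β) (intervalIntegrable_jacWeight hcont hα hβ)) P :=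
    ⟨hP_monic, hP_deg, fun n k hk => by
      refine Eq.trans ?_ (hP_orth n k hk)
      refine intervalIntegral.integral_congr fun x _ => ?_
      simp only [eval_mul, eval_pow, eval_X]⟩
  have H := (hasAsym_jacWeight hc hcont h_pos ⟨g1, g2, g3, g4⟩ g5 hα hβ _ P (fun n => a n ^ 2) b hP hrec).sqrt
    ha_pos
  have hE : ∀ n : ℕ, (oscTerm (Real.log c / Real.pi)
      (phaseConst (α + 1 / 2) (β + 1 / 2) (Real.log c / Real.pi) g) n).im =
      Real.log c / (2 * Real.pi * n) * Real.sin (θ n) := by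
    intro n
    rcases eq_or_ne c 1 with rfl | hc1
    · simp [oscTerm]
    · obtain ⟨-, k, hk⟩ := hγ hc1
      have hl : Real.log c / Real.pi ≠ 0 :=
        div_ne_zero (Real.log_ne_zero_of_pos_of_ne_one hc hc1) Real.pi_ne_zero
      rw [oscTerm_phaseConst hl hk, Complex.im_ofReal_mul, Complex.exp_ofReal_mul_I_im, g6, hθ, if_neg hc1]
      congr 1
      · rw [div_div]; ring
      · congr 2; ring
  obtain ⟨K, hK⟩ := H.bound
  obtain ⟨N, hN⟩ := eventually_atTop.mp hK
  refine ⟨K, N, fun n hn => ?_⟩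
  have := hN n hn
  rw [Real.norm_of_nonneg (show (0:ℝ) ≤ 1 / (n:ℝ) ^ 2 by positivity), mul_one_div, hE, Real.norm_eq_abs] at this
  convert this using 2
  ring
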